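/- Characterization of the achievable region for causal encoding and noncausal decoding with channel feedback (Theorem 3): A pair of Witsenhausen costs (P,S) ∈ ℝ² is achievable by control designs with causal encoder having strictly causal channel feedback and noncausal decoder if and only if there exists a joint probability distribution of (X_0, W_1, U_1, X_1, Y_1, U_2) that decomposes as P_{X_0} P_{W_1} P_{U_1|X_0,W_1} P_{X_1,Y_1|X_0,U_1} P_{U_2|X_0,W_1,Y_1} (i.e., X_0 ~ N(0,Q) is independent of the auxiliary variable W_1, the conditional law of (X_1,Y_1) given (X_0,U_1,W_1) is the Witsenhausen channel depending only on (X_0,U_1), and U_2 is conditionally independent of (U_1,X_1) given (X_0,Y_1,W_1)), such that the information constraint I(W_1; Y_1) − I(U_2; X_0 | W_1, Y_1) ≥ 0 holds and P = E[U_1²], S = E[(X_1 − U_2)²]. -/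

import Mathlib

/-!
Formalization of results from "Causal Vector-valued Witsenhausen Counterexamples with
Feedback" (Zhao, Le Treust, Oechtering).

Stochastic encoders/decoders (stochastic kernels) are realized as measurable functions of
independent i.i.d. randomization seeds, which is equivalent to the kernel formulation on
standard Borel spaces.
-/

open MeasureTheory ProbabilityTheory
open scoped ENNReal NNReal

namespace Witsenhausen

noncomputable section

/-- A path (block of length `n`) of real values. -/
abbrev Path (n : ℕ) : Type := Fin n → ℝ

/-- i.i.d. centered Gaussian vector of length `n` and variance `v`. -/
def iidGaussian (n : ℕ) (v : ℝ≥0) : Measure (Path n) :=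
  Measure.pi fun _ => gaussianReal 0 v

instance (n : ℕ) (v : ℝ≥0) : IsProbabilityMeasure (iidGaussian n v) := by
  unfold iidGaussian; infer_instance

/-- Canonical sample space: source `X₀ⁿ`, channel noise `Z₁ⁿ`, and the randomization seeds of
the (stochastic) encoder and decoder. -/
abbrev Sample (n : ℕ) : Type := Path n × Path n × Path n × Path n

/-- The base randomness: the i.i.d. `N(0,Q)` source `X₀ⁿ`, the independent i.i.d. `N(0,N)`
channel noise `Z₁ⁿ`, and independent i.i.d. randomization seeds for the stochastic encoder
and decoder. -/
def base (n : ℕ) (Q N : ℝ≥0) : Measure (Sample n) :=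
  (iidGaussian n Q).prod ((iidGaussian n N).prod
    ((iidGaussian n 1).prod (iidGaussian n 1)))

instance (n : ℕ) (Q N : ℝ≥0) : IsProbabilityMeasure (base n Q N) := by
  unfold base; infer_instance

/-- The source sequence `X₀ⁿ`. -/
def srcX0 {n : ℕ} (ω : Sample n) : Path n := ω.1
/-- The channel noise sequence `Z₁ⁿ`. -/
def noiseZ {n : ℕ} (ω : Sample n) : Path n := ω.2.1
/-- The encoder randomization seeds. -/
def seedV {n : ℕ} (ω : Sample n) : Path n := ω.2.2.1
/-- The decoder randomization seeds. -/
def seedW {n : ℕ} (ω : Sample n) : Path n := ω.2.2.2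

/-- The long-run input cost `c_P(u₁ⁿ) = (1/n) ∑_t u_{1,t}²`. -/
def costP {n : ℕ} (u : Path n) : ℝ := (1 / (n : ℝ)) * ∑ t, (u t) ^ 2

/-- The long-run estimation cost `c_S(x₁ⁿ, u₂ⁿ) = (1/n) ∑_t (x_{1,t} - u_{2,t})²`. -/
def costS {n : ℕ} (x u : Path n) : ℝ := (1 / (n : ℝ)) * ∑ t, (x t - u t) ^ 2

/-- The control sequence generated recursively by a feedback encoder: at each time `t < n`,
`U_{1,t}` is produced from the source `x`, the past channel outputs
`Y_{1,s} = X_{0,s} + U_{1,s} + Z_{1,s}` for `s < t` (the strict prefix, padded by `0`), and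
the seed `v t`. -/
def fbCtrl {n : ℕ} (enc : Fin n → Path n → Path n → ℝ → ℝ)
    (x z v : Path n) (t : ℕ) : ℝ :=
  if ht : t < n then
    enc ⟨t, ht⟩ x
      (fun s : Fin n => if hs : (s : ℕ) < t then x s + fbCtrl enc x z v s + z s else 0)
      (v ⟨t, ht⟩)
  else 0
termination_by t
decreasing_by exact hs

/-- A control design with causal encoder with (strictly causal) channel feedback and
noncausal decoder: at time `t` the stochastic encoder `f^{f,t}` observes `(X₀^t, Y₁^{t-1})`,
while the stochastic decoder `g` observes the whole output block `Y₁ⁿ`. -/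
structure FBNCDesign (n : ℕ) where
  enc : Fin n → Path n → Path n → ℝ → ℝ
  dec : Path n → Path n → Path n
  enc_meas : ∀ t, Measurable fun p : (Path n × Path n) × ℝ => enc t p.1.1 p.1.2 p.2
  dec_meas : Measurable fun p : Path n × Path n => dec p.1 p.2
  /-- the encoder observes the source causally and the channel output strictly causally -/
  enc_causal : ∀ (t : Fin n) (x x' y y' : Path n) (v : ℝ),
    (∀ s, s ≤ t → x s = x' s) → (∀ s, s < t → y s = y' s) →
      enc t x y v = enc t x' y' v

namespace FBNCDesign

variable {n : ℕ} (c : FBNCDesign n)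

/-- The control sequence `U₁ⁿ` (defined recursively through the feedback loop). -/
def U1 (ω : Sample n) : Path n := fun t => fbCtrl c.enc (srcX0 ω) (noiseZ ω) (seedV ω) t
/-- The interim state `X₁ⁿ = X₀ⁿ + U₁ⁿ`. -/
def X1 (ω : Sample n) : Path n := fun t => srcX0 ω t + c.U1 ω t
/-- The channel output `Y₁ⁿ = X₁ⁿ + Z₁ⁿ`. -/
def Y1 (ω : Sample n) : Path n := fun t => c.X1 ω t + noiseZ ω t
/-- The estimate block `U₂ⁿ = g(Y₁ⁿ)`. -/
def U2 (ω : Sample n) : Path n := c.dec (c.Y1 ω) (seedW ω)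

end FBNCDesign

/-- The region `R_{e,f}`: achievable pairs of costs for causal encoding with channel feedback
and noncausal decoding. -/
def achievableFBNC (Q N : ℝ≥0) (P S : ℝ) : Prop :=
  ∀ ε > (0 : ℝ), ∃ n₀ : ℕ, ∀ n ≥ n₀, ∃ c : FBNCDesign n,
    (∫⁻ ω, ENNReal.ofReal
        (|P - costP (c.U1 ω)| + |S - costS (c.X1 ω) (c.U2 ω)|) ∂(base n Q N))
      ≤ ENNReal.ofReal ε

/-- A single-letter joint distribution of `(X₀, W₁, U₁, X₁, Y₁, U₂)` decomposing according to
`P_{X₀} P_{W₁} P_{U₁|X₀,W₁} P_{X₁,Y₁|X₀,U₁} P_{U₂|X₀,W₁,Y₁}`: it is described by the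
distribution of the auxiliary variable `W₁` (independent of `X₀ ~ N(0,Q)`), the conditional
kernel `P_{U₁|X₀,W₁}`, and the conditional kernel `P_{U₂|X₀,W₁,Y₁}`; the Witsenhausen
channel `P_{X₁,Y₁|X₀,U₁}` is fixed. -/
structure SLDecompFB (Q N : ℝ≥0) (W : Type) [MeasurableSpace W] where
  /-- the distribution `P_{W₁}` of the auxiliary variable -/
  μW : Measure W
  probW : IsProbabilityMeasure μW
  /-- the conditional distribution `P_{U₁|X₀,W₁}` -/
  κ1 : Kernel (ℝ × W) ℝ
  markov1 : IsMarkovKernel κ1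
  /-- the conditional distribution `P_{U₂|X₀,W₁,Y₁}` -/
  κ2 : Kernel ((ℝ × W) × ℝ) ℝ
  markov2 : IsMarkovKernel κ2

attribute [instance] SLDecompFB.probW SLDecompFB.markov1 SLDecompFB.markov2

namespace SLDecompFB

/-- canonical coordinates `((((X₀, W₁), U₁), Z₁), U₂)` -/
abbrev Space (W : Type) : Type := (((ℝ × W) × ℝ) × ℝ) × ℝ

variable {Q N : ℝ≥0} {W : Type} [MeasurableSpace W]

def sX0 (q : Space W) : ℝ := q.1.1.1.1
def sW (q : Space W) : W := q.1.1.1.2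
def sU1 (q : Space W) : ℝ := q.1.1.2
def sZ (q : Space W) : ℝ := q.1.2
def sU2 (q : Space W) : ℝ := q.2
def sX1 (q : Space W) : ℝ := sX0 q + sU1 q
def sY1 (q : Space W) : ℝ := sX1 q + sZ q

/-- The joint law `P_{X₀} P_{W₁} P_{U₁|X₀,W₁} P_{X₁,Y₁|X₀,U₁} P_{U₂|X₀,W₁,Y₁}` on the
canonical space: `(X₀, W₁) ~ N(0,Q) ⊗ P_{W₁}`, then `U₁ ~ P_{U₁|X₀,W₁}`, then the memoryless
Witsenhausen channel is realized by an independent noise `Z₁ ~ N(0,N)` through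
`X₁ = X₀ + U₁` and `Y₁ = X₁ + Z₁`, and finally `U₂ ~ P_{U₂|X₀,W₁,Y₁}`. -/
def measure (d : SLDecompFB Q N W) : Measure (Space W) :=
  ((((gaussianReal 0 Q).prod d.μW) ⊗ₘ d.κ1).prod (gaussianReal 0 N)) ⊗ₘ
    (d.κ2.comap
      (fun q : ((ℝ × W) × ℝ) × ℝ => ((q.1.1.1, q.1.1.2), q.1.1.1 + q.1.2 + q.2))
      (by fun_prop))

instance (d : SLDecompFB Q N W) : IsProbabilityMeasure d.measure := by
  unfold measure; infer_instance

/-- The pair `(P, S)` consists of the expected single-letter Witsenhausen costs of the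
decomposed distribution: `P = E[U₁²]` and `S = E[(X₁ - U₂)²]` (both finite). -/
def realizes (d : SLDecompFB Q N W) (P S : ℝ) : Prop :=
  Integrable (fun q => (sU1 q) ^ 2) d.measure ∧
  Integrable (fun q => (sX1 q - sU2 q) ^ 2) d.measure ∧
  P = ∫ q, (sU1 q) ^ 2 ∂d.measure ∧
  S = ∫ q, (sX1 q - sU2 q) ^ 2 ∂d.measure

end SLDecompFB

open scoped Classical in
/-- The Kullback–Leibler divergence `D_KL(μ ‖ ν) ∈ [0, ∞]`. -/
def klDiv {α : Type*} [MeasurableSpace α] (μ ν : Measure α) : ℝ≥0∞ :=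
  if μ ≪ ν ∧ Integrable (llr μ ν) μ then ENNReal.ofReal (∫ x, llr μ ν x ∂μ) else ∞

/-- The mutual information `I(A; B) = D_KL(P_{A,B} ‖ P_A ⊗ P_B)`. -/
def mutualInfo {Ω α β : Type*} [MeasurableSpace Ω] [MeasurableSpace α] [MeasurableSpace β]
    (μ : Measure Ω) (A : Ω → α) (B : Ω → β) : ℝ≥0∞ :=
  klDiv (μ.map fun ω => (A ω, B ω)) ((μ.map A).prod (μ.map B))

/-- The conditional mutual information
`I(A; B | C) = E_{c ~ P_C}[D_KL(P_{A,B|C=c} ‖ P_{A|C=c} ⊗ P_{B|C=c})]`. -/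
def condMutualInfo {Ω α β γ : Type*} [MeasurableSpace Ω]
    [MeasurableSpace α] [StandardBorelSpace α] [Nonempty α]
    [MeasurableSpace β] [StandardBorelSpace β] [Nonempty β]
    [MeasurableSpace γ]
    (μ : Measure Ω) [IsFiniteMeasure μ] (A : Ω → α) (B : Ω → β) (C : Ω → γ) : ℝ≥0∞ :=
  ∫⁻ c, klDiv ((condDistrib (fun ω => (A ω, B ω)) C μ) c)
      (((condDistrib A C μ) c).prod ((condDistrib B C μ) c)) ∂(μ.map C)

section ProductMeasures

variable {ι : Type*} [Fintype ι] {X : ι → Type*} [∀ i, MeasurableSpace (X i)]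

/-- Gluing two independent copies of a product vector along a set of coordinates. -/
lemma measurePreserving_glue (μ : ∀ i, Measure (X i)) [∀ i, IsProbabilityMeasure (μ i)]
    (p : ι → Prop) [DecidablePred p] :
    MeasurePreserving (fun q : (∀ i, X i) × (∀ i, X i) => fun i => if p i then q.1 i else q.2 i)
      ((Measure.pi μ).prod (Measure.pi μ)) (Measure.pi μ) := by
  have hm : Measurable
      (fun q : (∀ i, X i) × (∀ i, X i) => fun i => if p i then q.1 i else q.2 i) := by
    refine measurable_pi_lambda _ fun i => ?_
    by_cases h : p i <;> simp only [h, if_true, if_false] <;> fun_prop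
  refine ⟨hm, (Measure.pi_eq fun s hs => ?_).symm⟩
  rw [Measure.map_apply hm (MeasurableSet.univ_pi hs)]
  have : (fun q : (∀ i, X i) × (∀ i, X i) => fun i => if p i then q.1 i else q.2 i) ⁻¹'
      (Set.univ.pi s) = (Set.univ.pi fun i => if p i then s i else Set.univ) ×ˢ
        (Set.univ.pi fun i => if p i then Set.univ else s i) := by
    ext q
    simp only [Set.mem_preimage, Set.mem_univ_pi, Set.mem_prod]
    rw [← forall_and]
    refine forall_congr' fun i => ?_
    by_cases h : p i <;> simp [h]
  rw [this, Measure.prod_prod, Measure.pi_pi, Measure.pi_pi, ← Finset.prod_mul_distrib]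
  refine Finset.prod_congr rfl fun i _ => ?_
  by_cases h : p i <;> simp [h]

/-- Resampling one coordinate of a product vector. -/
lemma measurePreserving_update [DecidableEq ι] (μ : ∀ i, Measure (X i))
    [∀ i, IsProbabilityMeasure (μ i)] (j : ι) :
    MeasurePreserving (fun q : (∀ i, X i) × X j => Function.update q.1 j q.2)
      ((Measure.pi μ).prod (μ j)) (Measure.pi μ) := by
  have h1 := measurePreserving_glue μ (fun i => i ≠ j)
  have h2 : MeasurePreserving (Prod.map id (Function.eval j))
      ((Measure.pi μ).prod (Measure.pi μ)) ((Measure.pi μ).prod (μ j)) :=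
    (MeasurePreserving.id _).prod (measurePreserving_eval μ j)
  have hm : Measurable (fun q : (∀ i, X i) × X j => Function.update q.1 j q.2) := by
    refine measurable_pi_lambda _ fun i => ?_
    by_cases h : i = j
    · subst h; simp only [Function.update_self]; fun_prop
    · simp only [Function.update_of_ne h]; fun_prop
  refine ⟨hm, ?_⟩
  rw [← h2.map_eq, Measure.map_map hm h2.measurable]
  refine Eq.trans ?_ h1.map_eq
  congr 1
  ext q i
  by_cases h : i = j
  · subst h; simp
  · simp [h]

lemma lintegral_pi_prod (μ : ∀ i, Measure (X i)) [∀ i, SigmaFinite (μ i)]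
    (f : ∀ i, X i → ℝ≥0∞) (hf : ∀ i, Measurable (f i)) :
    ∫⁻ x, ∏ i, f i (x i) ∂(Measure.pi μ) = ∏ i, ∫⁻ x, f i x ∂(μ i) := by
  classical
  rcases isEmpty_or_nonempty (∀ i, X i) with h | ⟨⟨x⟩⟩
  · obtain ⟨i, hi⟩ := isEmpty_pi.1 h
    rw [lintegral_of_isEmpty, Finset.prod_eq_zero (Finset.mem_univ i) (lintegral_of_isEmpty _ _)]
  have key : ∀ (s : Finset ι) (x : ∀ i, X i),
      (∫⋯∫⁻_s, (fun x => ∏ i ∈ s, f i (x i)) ∂μ) x = ∏ i ∈ s, ∫⁻ x, f i x ∂(μ i) := by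
    intro s
    induction s using Finset.induction with
    | empty => intro x; simp
    | insert i s hi ih =>
      intro x
      rw [lmarginal_insert' _ (by fun_prop) hi, Finset.prod_insert hi]
      have e : (fun x : ∀ i, X i => ∫⁻ xᵢ, (∏ j ∈ insert i s, f j (Function.update x i xᵢ j)) ∂μ i)
          = fun x => (∫⁻ xᵢ, f i xᵢ ∂μ i) * ∏ j ∈ s, f j (x j) := by
        funext x
        have h2 : ∀ xᵢ, (∏ j ∈ insert i s, f j (Function.update x i xᵢ j))
            = f i xᵢ * ∏ j ∈ s, f j (x j) := fun xᵢ => by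
          rw [Finset.prod_insert hi, Function.update_self]
          congr 1
          refine Finset.prod_congr rfl fun j hj => ?_
          have hne : j ≠ i := fun h => hi (h ▸ hj)
          rw [Function.update_of_ne hne]
        simp_rw [h2]
        rw [lintegral_mul_const _ (hf i)]
      rw [e, lmarginal]
      rw [lintegral_const_mul _ (by fun_prop)]
      congr 1
      exact ih x
  rw [lintegral_eq_lmarginal_univ x]
  exact key Finset.univ x

lemma pi_withDensity (μ : ∀ i, Measure (X i)) [∀ i, SigmaFinite (μ i)]
    (f : ∀ i, X i → ℝ≥0∞) (hf : ∀ i, Measurable (f i))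
    [∀ i, IsProbabilityMeasure ((μ i).withDensity (f i))] :
    Measure.pi (fun i => (μ i).withDensity (f i))
      = (Measure.pi μ).withDensity (fun x => ∏ i, f i (x i)) := by
  classical
  refine Measure.pi_eq fun s hs => ?_
  rw [withDensity_apply _ (MeasurableSet.univ_pi hs),
    ← lintegral_indicator (MeasurableSet.univ_pi hs)]
  have : ∀ x : ∀ i, X i, (Set.univ.pi s).indicator (fun x => ∏ i, f i (x i)) x
      = ∏ i, (s i).indicator (f i) (x i) := by
    intro x
    by_cases h : x ∈ Set.univ.pi s
    · rw [Set.indicator_of_mem h]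
      exact Finset.prod_congr rfl fun i _ => (Set.indicator_of_mem (h i (Set.mem_univ i)) _).symm
    · rw [Set.indicator_of_notMem h]
      simp only [Set.mem_univ_pi, not_forall] at h
      obtain ⟨i, hi⟩ := h
      exact (Finset.prod_eq_zero (Finset.mem_univ i) (Set.indicator_of_notMem hi _)).symm
  simp_rw [this]
  rw [lintegral_pi_prod μ _ fun i => (hf i).indicator (hs i)]
  refine Finset.prod_congr rfl fun i _ => ?_
  rw [lintegral_indicator (hs i), withDensity_apply _ (hs i)]

end ProductMeasures

/-- Injective reindexing of an i.i.d. family. -/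
lemma map_infinitePi_reindex {ι κ E : Type*} [MeasurableSpace E] (μ : Measure E)
    [IsProbabilityMeasure μ] (e : κ → ι) (he : Function.Injective e) :
    (Measure.infinitePi fun _ : ι => μ).map (fun ω k => ω (e k))
      = Measure.infinitePi fun _ : κ => μ := by
  classical
  refine Measure.eq_infinitePi _ fun s t ht => ?_
  have hm : Measurable (fun (ω : ι → E) k => ω (e k)) := by fun_prop
  rw [Measure.map_apply hm (MeasurableSet.pi s.countable_toSet fun i _ => ht i)]
  rcases isEmpty_or_nonempty κ with hκ | hκ
  · have : s = ∅ := Finset.eq_empty_of_isEmpty s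
    simp [this]
  have : (fun (ω : ι → E) k => ω (e k)) ⁻¹' (Set.pi (s : Set κ) t)
      = Set.pi ((s.map ⟨e, he⟩ : Finset ι) : Set ι) (fun i => t (Function.invFun e i)) := by
    ext ω
    simp [Set.mem_pi, Function.leftInverse_invFun he _]
  rw [this, Measure.infinitePi_pi _ fun i _ => ht _, Finset.prod_map]
  simp [Function.leftInverse_invFun he _]

/-- The law of large numbers in `L¹` for product measures. -/
lemma lln_pi {E : Type*} [MeasurableSpace E] (μ : Measure E) [IsProbabilityMeasure μ]
    (f : E → ℝ) (hf : Measurable f) (hfi : Integrable f μ) (ε : ℝ≥0∞) (hε : 0 < ε) :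
    ∃ L₀ : ℕ, ∀ L ≥ L₀,
      ∫⁻ e, ENNReal.ofReal |(1 / (L : ℝ)) * ∑ t, f (e t) - ∫ x, f x ∂μ|
        ∂(Measure.pi fun _ : Fin L => μ) ≤ ε := by
  set ν := Measure.infinitePi fun _ : ℕ => μ
  have hmap : ∀ i : ℕ, ν.map (fun ω => ω i) = μ := fun i =>
    Measure.infinitePi_map_eval (fun _ : ℕ => μ) i
  have hid : ∀ i : ℕ, IdentDistrib (fun ω : ℕ → E => f (ω i)) (fun ω : ℕ → E => f (ω 0)) ν ν := by
    intro i
    have : IdentDistrib (fun ω : ℕ → E => ω i) (fun ω : ℕ → E => ω 0) ν ν :=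
      ⟨(measurable_pi_apply i).aemeasurable, (measurable_pi_apply 0).aemeasurable,
        by rw [hmap, hmap]⟩
    exact this.comp hf
  have hinteg : Integrable (fun ω : ℕ → E => f (ω 0)) ν := by
    have : Integrable f (ν.map (fun ω => ω 0)) := by rw [hmap]; exact hfi
    exact this.comp_measurable (by fun_prop)
  have hE : ∫ ω, f (ω 0) ∂ν = ∫ x, f x ∂μ := by
    rw [← hmap 0, integral_map (measurable_pi_apply 0).aemeasurable hf.aestronglyMeasurable]
  have hind : Pairwise (Function.onFun (fun f g => IndepFun f g ν)
      (fun (i : ℕ) (ω : ℕ → E) => f (ω i))) := fun i j hij =>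
    (iIndepFun_infinitePi (P := fun _ : ℕ => μ) (X := fun _ => f) (fun _ => hf)).indepFun hij
  have key := strong_law_Lp (μ := ν) (le_refl 1) ENNReal.one_ne_top
    (fun (i : ℕ) (ω : ℕ → E) => f (ω i)) (memLp_one_iff_integrable.2 hinteg) hind hid
  rw [ENNReal.tendsto_atTop_zero] at key
  obtain ⟨L₀, hL₀⟩ := key ε hε
  refine ⟨L₀, fun L hL => le_trans (le_of_eq ?_) (hL₀ L hL)⟩
  have hre := map_infinitePi_reindex μ (fun k : Fin L => (k : ℕ)) Fin.val_injective
  rw [← Measure.infinitePi_eq_pi, ← hre, lintegral_map (by fun_prop) (by fun_prop),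
    eLpNorm_one_eq_lintegral_enorm]
  refine lintegral_congr fun ω => ?_
  rw [hE, Finset.sum_range, Real.enorm_eq_ofReal_abs]
  simp

section Selection

open scoped Classical in
/-- An index satisfying the predicate, if there is one. -/
def sel {M : ℕ} [NeZero M] (s : Fin M → Prop) : Fin M :=
  if h : ∃ j, s j then h.choose else 0

lemma sel_spec {M : ℕ} [NeZero M] {s : Fin M → Prop} (h : ∃ j, s j) : s (sel s) := by
  unfold sel; rw [dif_pos h]; exact h.choose_spec

lemma measurable_sel {A : Type*} [MeasurableSpace A] {M : ℕ} [NeZero M] {p : A → Fin M → Prop}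
    (hp : ∀ j, MeasurableSet {a | p a j}) : Measurable (fun a => sel (p a)) := by
  have h1 : Measurable p := measurable_pi_lambda _ fun j => measurableSet_setOfPred.1 (hp j)
  have h2 : Measurable (sel : (Fin M → Prop) → Fin M) := Measurable.of_discrete
  exact h2.comp h1

end Selection

/-- The randomness attached to one block: source, noise, codebook and seeds. -/
abbrev Blk (W T : Type*) (L M : ℕ) : Type _ :=
  (Fin L → ℝ) × (Fin L → ℝ) × (Fin M → Fin L → W) × (Fin M → Fin L → T)

/-- The ingredients of a block code. -/
structure BlockCode (W T : Type*) [MeasurableSpace W] [MeasurableSpace T] (L : ℕ) where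
  F : ℝ × W → ℝ
  uhat : W × ℝ × T → ℝ
  covering : Set ((Fin L → ℝ) × (Fin L → W) × (Fin L → ℝ) × (Fin L → T))
  packing : Set ((Fin L → W) × (Fin L → ℝ))
  measF : Measurable F
  meas_uhat : Measurable uhat
  meas_covering : MeasurableSet covering
  meas_packing : MeasurableSet packing

namespace BlockCode

variable {W T : Type*} [MeasurableSpace W] [MeasurableSpace T] {L M : ℕ} [NeZero M]
  (k : BlockCode W T L)

/-- The channel output of a block when message `m` is sent. -/
def out (m : Fin M) (θ : Blk W T L M) : Fin L → ℝ :=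
  fun i => θ.1 i + k.F (θ.1 i, θ.2.2.1 m i) + θ.2.1 i

/-- The message to be sent in the next block. -/
def next (m : Fin M) (θ : Blk W T L M) : Fin M :=
  sel fun j => (θ.1, θ.2.2.1 m, θ.2.1, θ.2.2.2 j) ∈ k.covering

/-- The decoded message. -/
def decode (C : Fin M → Fin L → W) (y : Fin L → ℝ) : Fin M :=
  sel fun m => (C m, y) ∈ k.packing

def encBad (m : Fin M) : Set (Blk W T L M) :=
  {θ | ∀ j, (θ.1, θ.2.2.1 m, θ.2.1, θ.2.2.2 j) ∉ k.covering}

def decBad (m : Fin M) : Set (Blk W T L M) :=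
  {θ | (θ.2.2.1 m, k.out m θ) ∉ k.packing ∨
    ∃ m', m' ≠ m ∧ (θ.2.2.1 m', k.out m θ) ∈ k.packing}

lemma decode_eq {m : Fin M} {θ : Blk W T L M} (h : θ ∉ k.decBad m) :
    k.decode θ.2.2.1 (k.out m θ) = m := by
  simp only [decBad, Set.mem_ofPred_eq, not_or, not_not, not_exists, not_and] at h
  by_contra hne
  exact h.2 _ hne (sel_spec (s := fun m' => (θ.2.2.1 m', k.out m θ) ∈ k.packing) ⟨m, h.1⟩)

lemma next_mem {m : Fin M} {θ : Blk W T L M} (h : θ ∉ k.encBad m) :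
    (θ.1, θ.2.2.1 m, θ.2.1, θ.2.2.2 (k.next m θ)) ∈ k.covering := by
  simp only [encBad, Set.mem_ofPred_eq, not_forall, not_not] at h
  exact sel_spec (s := fun j => (θ.1, θ.2.2.1 m, θ.2.1, θ.2.2.2 j) ∈ k.covering) h

@[fun_prop]
lemma measurable_out (m : Fin M) : Measurable (k.out m : Blk W T L M → Fin L → ℝ) := by
  have := k.measF
  unfold out; fun_prop

lemma measurableSet_covering_preimage (m j : Fin M) :
    MeasurableSet {θ : Blk W T L M | (θ.1, θ.2.2.1 m, θ.2.1, θ.2.2.2 j) ∈ k.covering} := by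
  have h : Measurable fun θ : Blk W T L M => (θ.1, θ.2.2.1 m, θ.2.1, θ.2.2.2 j) := by fun_prop
  exact h k.meas_covering

lemma measurableSet_packing_preimage (m m' : Fin M) :
    MeasurableSet {θ : Blk W T L M | (θ.2.2.1 m', k.out m θ) ∈ k.packing} := by
  have h : Measurable fun θ : Blk W T L M => (θ.2.2.1 m', k.out m θ) := by fun_prop
  exact h k.meas_packing

lemma measurable_next (m : Fin M) : Measurable (k.next m : Blk W T L M → Fin M) :=
  measurable_sel fun j => k.measurableSet_covering_preimage m j

lemma measurableSet_encBad (m : Fin M) : MeasurableSet (k.encBad m : Set (Blk W T L M)) := by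
  unfold encBad
  rw [Set.ofPred_forall]
  exact MeasurableSet.iInter fun j => (k.measurableSet_covering_preimage m j).compl

lemma measurableSet_decBad (m : Fin M) : MeasurableSet (k.decBad m : Set (Blk W T L M)) := by
  unfold decBad
  refine (k.measurableSet_packing_preimage m m).compl.union ?_
  exact measurableSet_setOfPred.2 (Measurable.exists fun m' => measurableSet_setOfPred.1
    ((MeasurableSet.const _).inter (k.measurableSet_packing_preimage m m')))

section Messages

variable {B : ℕ}

/-- The message sent in each block. -/
def msg (θ : Fin B → Blk W T L M) : ℕ → Fin M
  | 0 => 0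
  | b + 1 => if h : b < B then k.next (msg θ b) (θ ⟨b, h⟩) else 0

lemma measurable_msg (b : ℕ) : Measurable fun θ : Fin B → Blk W T L M => k.msg θ b := by
  induction b with
  | zero => exact measurable_const
  | succ b ih =>
    by_cases h : b < B
    · simp only [msg, h, dif_pos]
      have h1 : Measurable fun p : Fin M × Blk W T L M => k.next p.1 p.2 :=
        measurable_from_prod_countable_right fun m => k.measurable_next m
      exact h1.comp (ih.prodMk (measurable_pi_apply _))
    · simp only [msg, h, dif_neg, not_false_eq_true]; exact measurable_const

lemma msg_congr {θ θ' : Fin B → Blk W T L M} (b : ℕ) (h : ∀ c : Fin B, (c : ℕ) < b → θ c = θ' c) :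
    k.msg θ b = k.msg θ' b := by
  induction b with
  | zero => rfl
  | succ b ih =>
    by_cases hb : b < B
    · simp only [msg, hb, dif_pos]
      rw [ih fun c hc => h c (hc.trans (Nat.lt_succ_self b)), h ⟨b, hb⟩ (Nat.lt_succ_self b)]
    · simp [msg, hb]

/-- A message is independent of the randomness of the block in which it is sent. -/
lemma lintegral_msg_le (β : Measure (Blk W T L M)) [IsProbabilityMeasure β] (b : Fin B)
    (f : Fin M → Blk W T L M → ℝ≥0∞) (hf : ∀ m, Measurable (f m)) (c : ℝ≥0∞)
    (hc : ∀ m, ∫⁻ θ, f m θ ∂β ≤ c) :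
    ∫⁻ θ, f (k.msg θ b) (θ b) ∂(Measure.pi fun _ : Fin B => β) ≤ c := by
  have hF : Measurable fun p : Fin M × Blk W T L M => f p.1 p.2 :=
    measurable_from_prod_countable_right fun m => hf m
  have hG : Measurable fun θ : Fin B → Blk W T L M => f (k.msg θ b) (θ b) :=
    hF.comp ((k.measurable_msg b).prodMk (measurable_pi_apply b))
  have hu := measurePreserving_update (fun _ : Fin B => β) b
  rw [← hu.lintegral_comp hG]
  refine (lintegral_prod _ (hG.comp hu.measurable).aemeasurable).trans_le ?_
  simp only [Function.comp_apply]
  calc _ ≤ ∫⁻ θ, c ∂(Measure.pi fun _ : Fin B => β) := by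
        refine lintegral_mono fun θ => ?_
        have : ∀ θ' : Blk W T L M, k.msg (Function.update θ b θ') b = k.msg θ b := fun θ' =>
          k.msg_congr b fun c hc => Function.update_of_ne (fun h => by simp [h] at hc) _ _
        simp only [this, Function.update_self]
        exact hc _
    _ = c := by simp

end Messages

section Design

variable {B r : ℕ}

/-- The time index of position `i` in block `b`. -/
def time (b : Fin B) (i : Fin L) : Fin (B * L + r) := Fin.castAdd r (finProdFinEquiv (b, i))

lemma time_val (b : Fin B) (i : Fin L) : ((time b i : Fin (B * L + r)) : ℕ) = i + L * b := rfl

/-- The block randomness recovered from the source, the outputs and the codebooks, given the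
message sent. -/
def recover (cb : Fin B → (Fin M → Fin L → W) × (Fin M → Fin L → T))
    (x y : Path (B * L + r)) (b : Fin B) (m : Fin M) : Blk W T L M :=
  (fun i => x (time b i), fun i => y (time b i) - x (time b i)
    - k.F (x (time b i), (cb b).1 m i), (cb b).1, (cb b).2)

/-- The messages as computed by the encoder from source and outputs. -/
def msgY (cb : Fin B → (Fin M → Fin L → W) × (Fin M → Fin L → T))
    (x y : Path (B * L + r)) : ℕ → Fin M
  | 0 => 0
  | b + 1 => if h : b < B then
      k.next (msgY cb x y b) (k.recover cb x y ⟨b, h⟩ (msgY cb x y b)) else 0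

variable (cb : Fin B → (Fin M → Fin L → W) × (Fin M → Fin L → T))

lemma msgY_congr {x x' y y' : Path (B * L + r)} (b : ℕ)
    (hx : ∀ s : Fin (B * L + r), (s : ℕ) < L * b → x s = x' s)
    (hy : ∀ s : Fin (B * L + r), (s : ℕ) < L * b → y s = y' s) :
    k.msgY cb x y b = k.msgY cb x' y' b := by
  induction b with
  | zero => rfl
  | succ b ih =>
    by_cases hb : b < B
    · have hle : L * b ≤ L * (b + 1) := Nat.mul_le_mul_left _ (Nat.le_succ b)
      have hlt : ∀ i : Fin L, ((time ⟨b, hb⟩ i : Fin (B * L + r)) : ℕ) < L * (b + 1) := fun i => by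
        have := i.2
        rw [time_val, Nat.mul_succ]; simp only; omega
      simp only [msgY, hb, dif_pos]
      rw [ih (fun s hs => hx s (hs.trans_le hle)) (fun s hs => hy s (hs.trans_le hle))]
      unfold recover
      simp only [hx _ (hlt _), hy _ (hlt _)]
    · simp [msgY, hb]

lemma measurable_msgY (b : ℕ) :
    Measurable fun p : Path (B * L + r) × Path (B * L + r) => k.msgY cb p.1 p.2 b := by
  induction b with
  | zero => exact measurable_const
  | succ b ih =>
    by_cases h : b < B
    · simp only [msgY, h, dif_pos]
      have h1 : Measurable fun p : Fin M × (Path (B * L + r) × Path (B * L + r)) =>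
          k.next p.1 (k.recover cb p.2.1 p.2.2 ⟨b, h⟩ p.1) := by
        refine measurable_from_prod_countable_right fun m => (k.measurable_next m).comp ?_
        have := k.measF
        unfold recover; fun_prop
      exact h1.comp (ih.prodMk measurable_id)
    · simp only [msgY, h, dif_neg, not_false_eq_true]; exact measurable_const

/-- The encoder of the block scheme. -/
def encFun (t : Fin (B * L + r)) (x y : Path (B * L + r)) : ℝ :=
  Fin.addCases (motive := fun _ => ℝ)
    (fun q => k.F (x t, (cb (finProdFinEquiv.symm q).1).1
      (k.msgY cb x y (finProdFinEquiv.symm q).1) (finProdFinEquiv.symm q).2)) (fun _ => 0) t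

/-- The decoder of the block scheme. -/
def decFun (y : Path (B * L + r)) (t : Fin (B * L + r)) : ℝ :=
  Fin.addCases (motive := fun _ => ℝ)
    (fun q => if h : ((finProdFinEquiv.symm q).1 : ℕ) + 1 < B then
      k.uhat ((cb (finProdFinEquiv.symm q).1).1
        (k.decode (cb (finProdFinEquiv.symm q).1).1
          fun i => y (time (finProdFinEquiv.symm q).1 i)) (finProdFinEquiv.symm q).2, y t,
        (cb (finProdFinEquiv.symm q).1).2
        (k.decode (cb ⟨_, h⟩).1 fun i => y (time ⟨_, h⟩ i)) (finProdFinEquiv.symm q).2)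
      else 0) (fun _ => 0) t

lemma encFun_time (x y : Path (B * L + r)) (b : Fin B) (i : Fin L) :
    k.encFun cb (time b i) x y = k.F (x (time b i), (cb b).1 (k.msgY cb x y b) i) := by
  unfold encFun
  nth_rewrite 2 [time]
  rw [Fin.addCases_left]; simp

lemma encFun_rem (x y : Path (B * L + r)) (j : Fin r) :
    k.encFun cb (Fin.natAdd (B * L) j) x y = 0 := by
  unfold encFun; rw [Fin.addCases_right]

lemma decFun_time (y : Path (B * L + r)) (b : Fin B) (h : (b : ℕ) + 1 < B) (i : Fin L) :
    k.decFun cb y (time b i) = k.uhat ((cb b).1 (k.decode (cb b).1 fun i => y (time b i)) i,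
      y (time b i), (cb b).2 (k.decode (cb ⟨b + 1, h⟩).1 fun i => y (time ⟨b + 1, h⟩ i)) i) := by
  refine (Fin.addCases_left (motive := fun _ => ℝ) (finProdFinEquiv (b, i))).trans ?_
  simp only [Equiv.symm_apply_apply, h, dif_pos]

lemma decFun_time_last (y : Path (B * L + r)) (b : Fin B) (h : ¬ (b : ℕ) + 1 < B) (i : Fin L) :
    k.decFun cb y (time b i) = 0 := by
  refine (Fin.addCases_left (motive := fun _ => ℝ) (finProdFinEquiv (b, i))).trans ?_
  simp only [Equiv.symm_apply_apply, h, dif_neg, not_false_eq_true]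

lemma decFun_rem (y : Path (B * L + r)) (j : Fin r) :
    k.decFun cb y (Fin.natAdd (B * L) j) = 0 := by
  unfold decFun; rw [Fin.addCases_right]

lemma time_cases (t : Fin (B * L + r)) :
    (∃ b i, t = time b i) ∨ ∃ j, t = Fin.natAdd (B * L) j := by
  refine Fin.addCases (fun q => Or.inl ?_) (fun j => Or.inr ⟨j, rfl⟩) t
  exact ⟨(finProdFinEquiv.symm q).1, (finProdFinEquiv.symm q).2, by
    simp only [time, Prod.mk.eta, Equiv.apply_symm_apply]⟩

lemma measurable_decode (C : Fin M → Fin L → W) :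
    Measurable fun y : Fin L → ℝ => k.decode C y := by
  refine measurable_sel fun j => ?_
  have h : Measurable fun y : Fin L → ℝ => (C j, y) := by fun_prop
  exact h k.meas_packing

/-- The control design of the block scheme with given codebooks. -/
def design : FBNCDesign (B * L + r) where
  enc t x y _ := k.encFun cb t x y
  dec y _ := k.decFun cb y
  enc_meas t := by
    rcases time_cases t with ⟨b, i, rfl⟩ | ⟨j, rfl⟩
    · simp only [encFun_time]
      have h1 : Measurable fun p : (Path (B * L + r) × Path (B * L + r)) × ℝ =>
          k.msgY cb p.1.1 p.1.2 b := (k.measurable_msgY cb b).comp measurable_fst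
      have h2 : Measurable fun m : Fin M => (cb b).1 m i := Measurable.of_discrete
      refine k.measF.comp (Measurable.prodMk (by fun_prop) (h2.comp h1))
    · simp only [encFun_rem]; exact measurable_const
  dec_meas := by
    refine measurable_pi_lambda _ fun t => ?_
    rcases time_cases t with ⟨b, i, rfl⟩ | ⟨j, rfl⟩
    · by_cases h : (b : ℕ) + 1 < B
      · simp only [decFun_time _ _ _ _ h]
        have hd : ∀ b : Fin B, Measurable fun p : Path (B * L + r) × Path (B * L + r) =>
            k.decode (cb b).1 fun i => p.1 (time b i) := fun b =>
          (k.measurable_decode (cb b).1).comp (by fun_prop)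
        have h2 : Measurable fun m : Fin M => (cb b).1 m i := Measurable.of_discrete
        have h3 : Measurable fun m : Fin M => (cb b).2 m i := Measurable.of_discrete
        exact k.meas_uhat.comp ((h2.comp (hd b)).prodMk
          (Measurable.prodMk (by fun_prop) (h3.comp (hd _))))
      · simp only [decFun_time_last _ _ _ _ h]; exact measurable_const
    · simp only [decFun_rem]; exact measurable_const
  enc_causal t x x' y y' v hx hy := by
    rcases time_cases t with ⟨b, i, rfl⟩ | ⟨j, rfl⟩
    · rw [encFun_time, encFun_time, hx _ le_rfl]
      have : k.msgY cb x y b = k.msgY cb x' y' b := by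
        refine k.msgY_congr cb b (fun s hs => hx s ?_) (fun s hs => hy s ?_)
        · rw [Fin.le_def, time_val]; omega
        · rw [Fin.lt_def, time_val]; omega
      rw [this]
    · simp only [encFun_rem]

end Design

end BlockCode

/-- The control at time `t` is the encoder applied to the whole output path. -/
lemma FBNCDesign.U1_eq {n : ℕ} (c : FBNCDesign n) (ω : Sample n) (t : Fin n) :
    c.U1 ω t = c.enc t (srcX0 ω) (c.Y1 ω) (seedV ω t) := by
  change fbCtrl c.enc (srcX0 ω) (noiseZ ω) (seedV ω) t = _
  rw [fbCtrl, dif_pos t.2]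
  refine c.enc_causal t _ _ _ _ _ (fun s _ => rfl) fun s hs => ?_
  rw [dif_pos (Fin.lt_def.1 hs)]
  rfl

/-- A nonnegative measurable function whose expectation is at most `a`. -/
structure ExpBound {Ω : Type*} [MeasurableSpace Ω] (μ : Measure Ω) (f : Ω → ℝ) (a : ℝ) : Prop where
  meas : Measurable f
  nonneg : ∀ ω, 0 ≤ f ω
  bound_nonneg : 0 ≤ a
  le : ∫⁻ ω, ENNReal.ofReal (f ω) ∂μ ≤ ENNReal.ofReal a

namespace ExpBound

variable {Ω : Type*} [MeasurableSpace Ω] {μ : Measure Ω} {f g : Ω → ℝ} {a b : ℝ}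

lemma add (hf : ExpBound μ f a) (hg : ExpBound μ g b) :
    ExpBound μ (fun ω => f ω + g ω) (a + b) where
  meas := hf.meas.add hg.meas
  nonneg ω := add_nonneg (hf.nonneg ω) (hg.nonneg ω)
  bound_nonneg := add_nonneg hf.bound_nonneg hg.bound_nonneg
  le := by
    simp_rw [ENNReal.ofReal_add (hf.nonneg _) (hg.nonneg _)]
    rw [lintegral_add_left hf.meas.ennreal_ofReal,
      ENNReal.ofReal_add hf.bound_nonneg hg.bound_nonneg]
    exact add_le_add hf.le hg.le

lemma const_mul (hf : ExpBound μ f a) {c : ℝ} (hc : 0 ≤ c) :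
    ExpBound μ (fun ω => c * f ω) (c * a) where
  meas := hf.meas.const_mul c
  nonneg ω := mul_nonneg hc (hf.nonneg ω)
  bound_nonneg := mul_nonneg hc hf.bound_nonneg
  le := by
    simp_rw [ENNReal.ofReal_mul hc]
    rw [lintegral_const_mul _ hf.meas.ennreal_ofReal]
    gcongr
    exact hf.le

lemma const [IsProbabilityMeasure μ] {c : ℝ} (hc : 0 ≤ c) : ExpBound μ (fun _ => c) c where
  meas := measurable_const
  nonneg _ := hc
  bound_nonneg := hc
  le := by simp

lemma sum {ι : Type*} (s : Finset ι) {f : ι → Ω → ℝ} {a : ι → ℝ}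
    (h : ∀ i ∈ s, ExpBound μ (f i) (a i)) :
    ExpBound μ (fun ω => ∑ i ∈ s, f i ω) (∑ i ∈ s, a i) := by
  classical
  induction s using Finset.induction_on with
  | empty => exact ⟨by simp, by simp, by simp, by simp⟩
  | insert i s hi ih =>
    simp only [Finset.sum_insert hi]
    exact (h i (Finset.mem_insert_self i s)).add
      (ih fun j hj => h j (Finset.mem_insert_of_mem hj))

lemma comp {Ω' : Type*} [MeasurableSpace Ω'] {ν : Measure Ω'} {φ : Ω' → Ω}
    (hf : ExpBound μ f a) (hφ : MeasurePreserving φ ν μ) : ExpBound ν (fun ω => f (φ ω)) a :=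
  ⟨hf.meas.comp hφ.measurable, fun ω => hf.nonneg _, hf.bound_nonneg, by
    have := hφ.lintegral_comp hf.meas.ennreal_ofReal
    rw [this]; exact hf.le⟩

end ExpBound

section Zip

lemma measurePreserving_zip {ι α β : Type*} [Fintype ι] [MeasurableSpace α] [MeasurableSpace β]
    (μ : ι → Measure α) (ν : ι → Measure β) [∀ i, SigmaFinite (μ i)] [∀ i, SigmaFinite (ν i)] :
    MeasurePreserving (fun (p : (ι → α) × (ι → β)) i => (p.1 i, p.2 i))
      ((Measure.pi μ).prod (Measure.pi ν)) (Measure.pi fun i => (μ i).prod (ν i)) :=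
  (measurePreserving_arrowProdEquivProdArrow α β ι μ ν).symm

lemma measurePreserving_blocks {E : Type*} [MeasurableSpace E] (μ : Measure E)
    [IsProbabilityMeasure μ] (B L r : ℕ) :
    MeasurePreserving (fun (x : Fin (B * L + r) → E) (b : Fin B) (i : Fin L) =>
      x (BlockCode.time b i)) (Measure.pi fun _ => μ)
      (Measure.pi fun _ : Fin B => Measure.pi fun _ : Fin L => μ) := by
  have h1 := map_infinitePi_reindex μ
    (fun p : Fin B × Fin L => (BlockCode.time p.1 p.2 : Fin (B * L + r)))
    (fun p q h => finProdFinEquiv.injective (Fin.castAdd_injective _ _ h))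
  have h2 := Measure.infinitePi_map_curry (fun (_ : Fin B) (_ : Fin L) => μ)
  have hm : Measurable (fun (x : Fin (B * L + r) → E) (b : Fin B) (i : Fin L) =>
      x (BlockCode.time b i)) := by fun_prop
  refine ⟨hm, ?_⟩
  simp_rw [← Measure.infinitePi_eq_pi]
  rw [← h2, ← h1, Measure.map_map (by fun_prop) (by fun_prop)]
  rfl

end Zip

section BlkMeasure

variable {W T : Type*} [MeasurableSpace W] [MeasurableSpace T]

/-- The law of codebook and seeds of one block. -/
def bookMeasure (μW : Measure W) (μT : Measure T) (L M : ℕ) :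
    Measure ((Fin M → Fin L → W) × (Fin M → Fin L → T)) :=
  (Measure.pi fun _ => Measure.pi fun _ => μW).prod (Measure.pi fun _ => Measure.pi fun _ => μT)

instance (μW : Measure W) (μT : Measure T) [IsProbabilityMeasure μW] [IsProbabilityMeasure μT]
    (L M : ℕ) : IsProbabilityMeasure (bookMeasure μW μT L M) := by
  unfold bookMeasure; infer_instance

/-- The law of the randomness of one block. -/
def blkMeasure (Q N : ℝ≥0) (μW : Measure W) (μT : Measure T) (L M : ℕ) : Measure (Blk W T L M) :=
  (iidGaussian L Q).prod ((iidGaussian L N).prod (bookMeasure μW μT L M))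

instance (Q N : ℝ≥0) (μW : Measure W) (μT : Measure T) [IsProbabilityMeasure μW]
    [IsProbabilityMeasure μT] (L M : ℕ) : IsProbabilityMeasure (blkMeasure Q N μW μT L M) := by
  unfold blkMeasure; infer_instance

/-- The randomness of all blocks. -/
def blocks {L M B r : ℕ} (p : (Fin B → (Fin M → Fin L → W) × (Fin M → Fin L → T)) ×
    Sample (B * L + r)) : Fin B → Blk W T L M :=
  fun b => (fun i => p.2.1 (BlockCode.time b i), fun i => p.2.2.1 (BlockCode.time b i), p.1 b)

lemma measurePreserving_allBlocks (Q N : ℝ≥0) (μW : Measure W) (μT : Measure T)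
    [IsProbabilityMeasure μW] [IsProbabilityMeasure μT] (L M B r : ℕ) :
    MeasurePreserving (blocks (L := L) (M := M) (B := B) (r := r) (W := W) (T := T))
      ((Measure.pi fun _ : Fin B => bookMeasure μW μT L M).prod (base (B * L + r) Q N))
      (Measure.pi fun _ : Fin B => blkMeasure Q N μW μT L M) := by
  set n := B * L + r
  have hx := measurePreserving_blocks (gaussianReal 0 Q) B L r
  have hz := measurePreserving_blocks (gaussianReal 0 N) B L r
  have z1 := measurePreserving_zip (fun _ : Fin B => iidGaussian L N)
    (fun _ : Fin B => bookMeasure μW μT L M)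
  have z2 := measurePreserving_zip (fun _ : Fin B => iidGaussian L Q)
    (fun _ : Fin B => (iidGaussian L N).prod (bookMeasure μW μT L M))
  have e1 : MeasurePreserving
      (fun p : (Fin B → (Fin M → Fin L → W) × (Fin M → Fin L → T)) × Sample n => (p.2.1, p.2.2.1, p.1))
      ((Measure.pi fun _ : Fin B => bookMeasure μW μT L M).prod (base n Q N))
      ((iidGaussian n Q).prod ((iidGaussian n N).prod
        (Measure.pi fun _ : Fin B => bookMeasure μW μT L M))) := by
    have s1 : MeasurePreserving Prod.swap
      ((Measure.pi fun _ : Fin B => bookMeasure μW μT L M).prod (base n Q N))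
      ((base n Q N).prod (Measure.pi fun _ : Fin B => bookMeasure μW μT L M)) :=
      Measure.measurePreserving_swap
    have s2 : MeasurePreserving (fun ω : Sample n => (ω.1, ω.2.1)) (base n Q N)
        ((iidGaussian n Q).prod (iidGaussian n N)) :=
      (MeasurePreserving.id _).prod measurePreserving_fst
    have s3 := s2.prod (MeasurePreserving.id (Measure.pi fun _ : Fin B => bookMeasure μW μT L M))
    exact ((measurePreserving_prodAssoc _ _ _).comp s3).comp s1
  have h := z2.comp ((hx.prod (z1.comp (hz.prod (MeasurePreserving.id _)))).comp e1)
  exact h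

end BlkMeasure

namespace BlockCode

variable {W T : Type*} [MeasurableSpace W] [MeasurableSpace T] {L M : ℕ} [NeZero M]
  (k : BlockCode W T L)

section Run

variable {B r : ℕ} (cb : Fin B → (Fin M → Fin L → W) × (Fin M → Fin L → T))
  (ω : Sample (B * L + r))

lemma U1_design_time (b : Fin B) (i : Fin L) :
    (k.design cb).U1 ω (time b i)
      = k.F (ω.1 (time b i), (cb b).1 (k.msgY cb ω.1 ((k.design cb).Y1 ω) b) i) := by
  rw [FBNCDesign.U1_eq]
  exact k.encFun_time cb _ _ b i

lemma msgY_eq (b : ℕ) :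
    k.msgY cb ω.1 ((k.design cb).Y1 ω) b = k.msg (blocks (cb, ω)) b := by
  induction b with
  | zero => rfl
  | succ b ih =>
    by_cases hb : b < B
    · simp only [msgY, msg, hb, dif_pos, ← ih]
      congr 1
      unfold recover blocks
      have : ∀ i, (k.design cb).Y1 ω (time ⟨b, hb⟩ i) - ω.1 (time ⟨b, hb⟩ i)
          - k.F (ω.1 (time ⟨b, hb⟩ i), (cb ⟨b, hb⟩).1 (k.msgY cb ω.1 ((k.design cb).Y1 ω) b) i)
          = ω.2.1 (time ⟨b, hb⟩ i) := by
        intro i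
        rw [← k.U1_design_time cb ω ⟨b, hb⟩ i]
        unfold FBNCDesign.Y1 FBNCDesign.X1 srcX0 noiseZ
        ring
      simp only [this]
    · simp [msgY, msg, hb]

lemma U1_time (b : Fin B) (i : Fin L) :
    (k.design cb).U1 ω (time b i)
      = k.F ((blocks (cb, ω) b).1 i, (blocks (cb, ω) b).2.2.1 (k.msg (blocks (cb, ω)) b) i) := by
  rw [U1_design_time, msgY_eq]; rfl

lemma U1_rem (j : Fin r) : (k.design cb).U1 ω (Fin.natAdd (B * L) j) = 0 := by
  rw [FBNCDesign.U1_eq]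
  exact k.encFun_rem cb _ _ j

lemma Y1_time (b : Fin B) :
    (fun i => (k.design cb).Y1 ω (time b i))
      = k.out (k.msg (blocks (cb, ω)) b) (blocks (cb, ω) b) := by
  ext i
  unfold FBNCDesign.Y1 FBNCDesign.X1
  rw [U1_time]; rfl

lemma U2_rem (j : Fin r) : (k.design cb).U2 ω (Fin.natAdd (B * L) j) = 0 :=
  k.decFun_rem cb _ j

lemma U2_time_last (b : Fin B) (h : ¬ (b : ℕ) + 1 < B) (i : Fin L) :
    (k.design cb).U2 ω (time b i) = 0 := k.decFun_time_last cb _ b h i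

lemma U2_time (b : Fin B) (h : (b : ℕ) + 1 < B) (i : Fin L) :
    (k.design cb).U2 ω (time b i)
      = k.uhat ((cb b).1 (k.decode (cb b).1 (k.out (k.msg (blocks (cb, ω)) b) (blocks (cb, ω) b))) i,
          k.out (k.msg (blocks (cb, ω)) b) (blocks (cb, ω) b) i,
          (cb b).2 (k.decode (cb ⟨b + 1, h⟩).1 (k.out (k.msg (blocks (cb, ω)) (b + 1))
            (blocks (cb, ω) ⟨b + 1, h⟩))) i) := by
  have h1 := k.Y1_time cb ω b
  have h2 := k.Y1_time cb ω ⟨b + 1, h⟩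
  refine (k.decFun_time cb _ b h i).trans ?_
  rw [h1, h2, ← h1]

end Run

/-- Deviation of the empirical power from `P`. -/
def devP (P : ℝ) (m : Fin M) (θ : Blk W T L M) : ℝ :=
  |(1 / (L : ℝ)) * ∑ i, k.F (θ.1 i, θ.2.2.1 m i) ^ 2 - P|

/-- Deviation of the empirical power of the interim state. -/
def devX (E : ℝ) (m : Fin M) (θ : Blk W T L M) : ℝ :=
  |(1 / (L : ℝ)) * ∑ i, (θ.1 i + k.F (θ.1 i, θ.2.2.1 m i)) ^ 2 - E|

/-- Bound on the estimation cost deviation of a non-final block. -/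
lemma estimation_block_bound {S E K ε : ℝ} {B r : ℕ} (hL : 0 < L) (hS : 0 ≤ S) (hE : 0 ≤ E)
    (hε : 0 ≤ ε) (hK : ∀ q, |k.uhat q| ≤ K)
    (hcov : ∀ q ∈ k.covering, |(1 / (L : ℝ)) * ∑ i, (q.1 i + k.F (q.1 i, q.2.1 i)
      - k.uhat (q.2.1 i, q.1 i + k.F (q.1 i, q.2.1 i) + q.2.2.1 i, q.2.2.2 i)) ^ 2 - S| ≤ ε)
    (cb : Fin B → (Fin M → Fin L → W) × (Fin M → Fin L → T))
    (ω : Sample (B * L + r)) (b : Fin B) (h : (b : ℕ) + 1 < B) :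
    |(1 / (L : ℝ)) * ∑ i, ((k.design cb).X1 ω (time b i) - (k.design cb).U2 ω (time b i)) ^ 2 - S|
      ≤ ε + 2 * k.devX E (k.msg (blocks (cb, ω)) b) (blocks (cb, ω) b)
        + (S + 2 * E + 2 * K ^ 2) *
          ((k.encBad (k.msg (blocks (cb, ω)) b)).indicator (fun _ => (1 : ℝ)) (blocks (cb, ω) b)
          + (k.decBad (k.msg (blocks (cb, ω)) b)).indicator (fun _ => (1 : ℝ)) (blocks (cb, ω) b)
          + (k.decBad (k.msg (blocks (cb, ω)) (b + 1))).indicator (fun _ => (1 : ℝ))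
            (blocks (cb, ω) ⟨b + 1, h⟩)) := by
  set θ := blocks (cb, ω) with hθ
  set m := k.msg θ b with hm
  set m' := k.msg θ (b + 1) with hm'
  have hLpos : (0 : ℝ) < L := Nat.cast_pos.2 hL
  have hX1 : ∀ i, (k.design cb).X1 ω (time b i)
      = (θ b).1 i + k.F ((θ b).1 i, (θ b).2.2.1 m i) := by
    intro i
    unfold FBNCDesign.X1
    rw [U1_time]; rfl
  have hdev : 0 ≤ k.devX E m (θ b) := abs_nonneg _
  have hC : 0 ≤ S + 2 * E + 2 * K ^ 2 := by positivity
  have i1 : 0 ≤ (k.encBad m).indicator (fun _ => (1 : ℝ)) (θ b) :=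
    Set.indicator_nonneg (fun _ _ => zero_le_one) _
  have i2 : 0 ≤ (k.decBad m).indicator (fun _ => (1 : ℝ)) (θ b) :=
    Set.indicator_nonneg (fun _ _ => zero_le_one) _
  have i3 : 0 ≤ (k.decBad m').indicator (fun _ => (1 : ℝ)) (θ ⟨b + 1, h⟩) :=
    Set.indicator_nonneg (fun _ _ => zero_le_one) _
  by_cases hbad : θ b ∈ k.encBad m ∨ θ b ∈ k.decBad m ∨ θ ⟨b + 1, h⟩ ∈ k.decBad m'
  · have hone : 1 ≤ (k.encBad m).indicator (fun _ => (1 : ℝ)) (θ b)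
        + (k.decBad m).indicator (fun _ => (1 : ℝ)) (θ b)
        + (k.decBad m').indicator (fun _ => (1 : ℝ)) (θ ⟨b + 1, h⟩) := by
      rcases hbad with hb | hb | hb
      · rw [Set.indicator_of_mem hb]; linarith
      · rw [Set.indicator_of_mem (s := k.decBad m) hb]; linarith
      · rw [Set.indicator_of_mem (s := k.decBad m') hb]; linarith
    have hsum : (1 / (L : ℝ)) * ∑ i, ((k.design cb).X1 ω (time b i)
        - (k.design cb).U2 ω (time b i)) ^ 2
        ≤ 2 * ((1 / (L : ℝ)) * ∑ i, ((θ b).1 i + k.F ((θ b).1 i, (θ b).2.2.1 m i)) ^ 2)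
          + 2 * K ^ 2 := by
      have h1 : ∑ i, ((k.design cb).X1 ω (time b i) - (k.design cb).U2 ω (time b i)) ^ 2
          ≤ ∑ i : Fin L, (2 * ((θ b).1 i + k.F ((θ b).1 i, (θ b).2.2.1 m i)) ^ 2 + 2 * K ^ 2) := by
        refine Finset.sum_le_sum fun i _ => ?_
        rw [hX1 i]
        have hu : (k.design cb).U2 ω (time b i) ^ 2 ≤ K ^ 2 := by
          rw [k.U2_time cb ω b h i, ← sq_abs]
          exact pow_le_pow_left₀ (abs_nonneg _) (hK _) 2
        nlinarith [sq_nonneg ((θ b).1 i + k.F ((θ b).1 i, (θ b).2.2.1 m i)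
          + (k.design cb).U2 ω (time b i))]
      rw [Finset.sum_add_distrib, ← Finset.mul_sum] at h1
      simp only [Finset.sum_const, Finset.card_univ, Fintype.card_fin, nsmul_eq_mul] at h1
      calc _ ≤ (1 / (L : ℝ)) * _ := mul_le_mul_of_nonneg_left h1 (by positivity)
        _ = _ := by field_simp
    have hnn : 0 ≤ (1 / (L : ℝ)) * ∑ i, ((k.design cb).X1 ω (time b i)
        - (k.design cb).U2 ω (time b i)) ^ 2 := by positivity
    have hdx : (1 / (L : ℝ)) * ∑ i, ((θ b).1 i + k.F ((θ b).1 i, (θ b).2.2.1 m i)) ^ 2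
        ≤ E + k.devX E m (θ b) := by
      have := le_abs_self ((1 / (L : ℝ)) *
        ∑ i, ((θ b).1 i + k.F ((θ b).1 i, (θ b).2.2.1 m i)) ^ 2 - E)
      unfold devX; linarith
    have hmul := mul_le_mul_of_nonneg_left hone hC
    rw [abs_le]
    constructor <;> nlinarith
  · push Not at hbad
    obtain ⟨hb1, hb2, hb3⟩ := hbad
    have hd1 := k.decode_eq hb2
    have hd2 := k.decode_eq hb3
    have hnext : m' = k.next m (θ b) := by
      rw [hm', hm]; simp [msg]
    have hmem := k.next_mem hb1
    have hgood := hcov _ hmem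
    have : ∀ i, (k.design cb).U2 ω (time b i) = k.uhat ((θ b).2.2.1 m i,
        (θ b).1 i + k.F ((θ b).1 i, (θ b).2.2.1 m i) + (θ b).2.1 i,
        (θ b).2.2.2 (k.next m (θ b)) i) := by
      intro i
      rw [k.U2_time cb ω b h i]
      have e1 : (cb b).1 = (θ b).2.2.1 := rfl
      have e2 : (cb ⟨b + 1, h⟩).1 = (θ ⟨b + 1, h⟩).2.2.1 := rfl
      have e3 : (cb b).2 = (θ b).2.2.2 := rfl
      rw [e1, e2, e3, hd1, hd2, hnext]; rfl
    simp only [hX1, this]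
    refine hgood.trans ?_
    have := mul_nonneg hC (add_nonneg (add_nonneg i1 i2) i3)
    linarith

/-- Bound on the estimation cost deviation of the final block. -/
lemma estimation_last_block_bound {S E : ℝ} {B r : ℕ} (hS : 0 ≤ S)
    (cb : Fin B → (Fin M → Fin L → W) × (Fin M → Fin L → T))
    (ω : Sample (B * L + r)) (b : Fin B) (h : ¬ (b : ℕ) + 1 < B) :
    |(1 / (L : ℝ)) * ∑ i, ((k.design cb).X1 ω (time b i) - (k.design cb).U2 ω (time b i)) ^ 2 - S|
      ≤ (S + E) + k.devX E (k.msg (blocks (cb, ω)) b) (blocks (cb, ω) b) := by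
  have hX1 : ∀ i, (k.design cb).X1 ω (time b i) - (k.design cb).U2 ω (time b i)
      = (blocks (cb, ω) b).1 i + k.F ((blocks (cb, ω) b).1 i,
        (blocks (cb, ω) b).2.2.1 (k.msg (blocks (cb, ω)) b) i) := by
    intro i
    rw [U2_time_last _ _ _ _ h]
    unfold FBNCDesign.X1
    rw [U1_time, sub_zero]; rfl
  simp only [hX1, devX]
  set A := (1 / (L : ℝ)) * ∑ i, ((blocks (cb, ω) b).1 i + k.F ((blocks (cb, ω) b).1 i,
        (blocks (cb, ω) b).2.2.1 (k.msg (blocks (cb, ω)) b) i)) ^ 2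
  have hA : 0 ≤ A := by positivity
  have := le_abs_self (A - E)
  rw [abs_le]; constructor <;> linarith [abs_nonneg (A - E)]

end BlockCode

/-- Splitting an average over time into blocks. -/
lemma abs_average_sub_le {B L r : ℕ} (hL : 0 < L) (hn : 0 < B * L + r) (g : Fin (B * L + r) → ℝ) (a : ℝ) :
    |(1 / ((B * L + r : ℕ) : ℝ)) * ∑ t, g t - a|
      ≤ (1 / ((B * L + r : ℕ) : ℝ)) * ((L : ℝ) * ∑ b : Fin B,
          |(1 / (L : ℝ)) * ∑ i : Fin L, g (BlockCode.time b i) - a|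
        + ∑ j : Fin r, |g (Fin.natAdd (B * L) j) - a|) := by
  have hLpos : (0 : ℝ) < L := Nat.cast_pos.2 hL
  have hnpos : (0 : ℝ) < ((B * L + r : ℕ) : ℝ) := Nat.cast_pos.2 hn
  have h1 : (1 / ((B * L + r : ℕ) : ℝ)) * ∑ t, g t - a
      = (1 / ((B * L + r : ℕ) : ℝ)) * ∑ t, (g t - a) := by
    rw [Finset.sum_sub_distrib]
    simp only [Finset.sum_const, Finset.card_univ, Fintype.card_fin, nsmul_eq_mul]
    field_simp
  have h2 : ∑ t, (g t - a) = (∑ b : Fin B, ∑ i : Fin L, (g (BlockCode.time b i) - a))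
      + ∑ j : Fin r, (g (Fin.natAdd (B * L) j) - a) := by
    rw [Fin.sum_univ_add, ← finProdFinEquiv.sum_comp, Fintype.sum_prod_type]; rfl
  rw [h1, abs_mul, abs_of_pos (by positivity : (0:ℝ) < 1 / ((B * L + r : ℕ) : ℝ)), h2]
  refine mul_le_mul_of_nonneg_left ?_ (by positivity)
  refine (abs_add_le _ _).trans (add_le_add ?_ (Finset.abs_sum_le_sum_abs _ _))
  refine (Finset.abs_sum_le_sum_abs _ _).trans ?_
  rw [Finset.mul_sum]
  refine Finset.sum_le_sum fun b _ => le_of_eq ?_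
  rw [Finset.sum_sub_distrib, ← abs_of_pos hLpos, ← abs_mul, abs_of_pos hLpos]
  simp only [Finset.sum_const, Finset.card_univ, Fintype.card_fin, nsmul_eq_mul]
  congr 1
  field_simp

namespace BlockCode

variable {W T : Type*} [MeasurableSpace W] [MeasurableSpace T] {L M : ℕ} [NeZero M]
  (k : BlockCode W T L)

lemma expBound_msg (Q N : ℝ≥0) (μW : Measure W) (μT : Measure T)
    [IsProbabilityMeasure μW] [IsProbabilityMeasure μT] {B r : ℕ} (b : Fin B)
    {f : Fin M → Blk W T L M → ℝ} {a : ℝ}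
    (hf : ∀ m, ExpBound (blkMeasure Q N μW μT L M) (f m) a) :
    ExpBound ((Measure.pi fun _ : Fin B => bookMeasure μW μT L M).prod (base (B * L + r) Q N))
      (fun p => f (k.msg (blocks p) b) (blocks p b)) a := by
  have hF : Measurable fun p : Fin M × Blk W T L M => f p.1 p.2 :=
    measurable_from_prod_countable_right fun m => (hf m).meas
  have h : ExpBound (Measure.pi fun _ : Fin B => blkMeasure Q N μW μT L M)
      (fun θ => f (k.msg θ b) (θ b)) a :=
    ⟨hF.comp ((k.measurable_msg b).prodMk (measurable_pi_apply b)), fun θ => (hf _).nonneg _,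
      (hf 0).bound_nonneg,
      k.lintegral_msg_le _ b (fun m θ => ENNReal.ofReal (f m θ))
        (fun m => (hf m).meas.ennreal_ofReal) _ fun m => (hf m).le⟩
  exact h.comp (measurePreserving_allBlocks Q N μW μT L M B r)

lemma expBound_indicator {Ω : Type*} [MeasurableSpace Ω] {μ : Measure Ω} {s : Set Ω}
    (hs : MeasurableSet s) {ε : ℝ} (hε : 0 ≤ ε) (h : μ s ≤ ENNReal.ofReal ε) :
    ExpBound μ (s.indicator fun _ => (1 : ℝ)) ε where
  meas := measurable_const.indicator hs
  nonneg ω := Set.indicator_nonneg (fun _ _ => zero_le_one) ω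
  bound_nonneg := hε
  le := by
    have : ∀ ω, ENNReal.ofReal (s.indicator (fun _ => (1 : ℝ)) ω) = s.indicator 1 ω := by
      intro ω; by_cases hω : ω ∈ s <;> simp [hω]
    simp_rw [this]
    rwa [lintegral_indicator_one hs]

lemma lintegral_sq_gaussianReal (v : ℝ≥0) :
    ∫⁻ x, ENNReal.ofReal (x ^ 2) ∂(gaussianReal 0 v) = ENNReal.ofReal v := by
  rw [← ofReal_integral_eq_lintegral_ofReal]
  · congr 1
    have h := variance_fun_id_gaussianReal (μ := 0) (v := v)
    rw [variance_eq_integral aemeasurable_id'] at h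
    simpa using h
  · exact (memLp_id_gaussianReal (μ := 0) (v := v) 2).integrable_sq
  · exact Filter.Eventually.of_forall fun x => sq_nonneg x

/-- Performance of the block scheme. -/
theorem exists_design_bound (Q N : ℝ≥0) (μW : Measure W) (μT : Measure T)
    [IsProbabilityMeasure μW] [IsProbabilityMeasure μT] (B r : ℕ) {P S E K ε : ℝ} (hL : 0 < L)
    (hP0 : 0 ≤ P) (hS : 0 ≤ S) (hE : 0 ≤ E) (hε : 0 ≤ ε) (hK : ∀ q, |k.uhat q| ≤ K)
    (hcov : ∀ q ∈ k.covering, |(1 / (L : ℝ)) * ∑ i, (q.1 i + k.F (q.1 i, q.2.1 i)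
      - k.uhat (q.2.1 i, q.1 i + k.F (q.1 i, q.2.1 i) + q.2.2.1 i, q.2.2.2 i)) ^ 2 - S| ≤ ε)
    (hdP : ∀ m : Fin M, ∫⁻ θ, ENNReal.ofReal (k.devP P m θ) ∂(blkMeasure Q N μW μT L M)
      ≤ ENNReal.ofReal ε)
    (hdX : ∀ m : Fin M, ∫⁻ θ, ENNReal.ofReal (k.devX E m θ) ∂(blkMeasure Q N μW μT L M)
      ≤ ENNReal.ofReal ε)
    (henc : ∀ m : Fin M, blkMeasure Q N μW μT L M (k.encBad m) ≤ ENNReal.ofReal ε)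
    (hdec : ∀ m : Fin M, blkMeasure Q N μW μT L M (k.decBad m) ≤ ENNReal.ofReal ε) :
    ∃ c : FBNCDesign ((B + 1) * L + r),
      ∫⁻ ω, ENNReal.ofReal (|P - costP (c.U1 ω)| + |S - costS (c.X1 ω) (c.U2 ω)|)
        ∂(base ((B + 1) * L + r) Q N) ≤ ENNReal.ofReal ((1 / (((B + 1) * L + r : ℕ) : ℝ)) *
          ((L : ℝ) * ((B + 1) * ((4 + 3 * (S + 2 * E + 2 * K ^ 2)) * ε) + (S + E))
            + r * (P + S + Q))) := by
  have hn : 0 < (B + 1) * L + r := by positivity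
  set n := (B + 1) * L + r with hndef
  set D := S + 2 * E + 2 * K ^ 2 with hD
  have hD0 : 0 ≤ D := by positivity
  set Pm := (Measure.pi fun _ : Fin (B + 1) => bookMeasure μW μT L M).prod (base n Q N) with hPm
  have mF := k.measF
  have eP : ∀ m : Fin M, ExpBound (blkMeasure Q N μW μT L M) (k.devP P m) ε := fun m =>
    ⟨by unfold devP; fun_prop, fun _ => abs_nonneg _, hε, hdP m⟩
  have eX : ∀ m : Fin M, ExpBound (blkMeasure Q N μW μT L M) (k.devX E m) ε := fun m =>
    ⟨by unfold devX; fun_prop, fun _ => abs_nonneg _, hε, hdX m⟩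
  have eE : ∀ m : Fin M, ExpBound (blkMeasure Q N μW μT L M)
      ((k.encBad m).indicator fun _ => (1 : ℝ)) ε := fun m =>
    expBound_indicator (k.measurableSet_encBad m) hε (henc m)
  have eD : ∀ m : Fin M, ExpBound (blkMeasure Q N μW μT L M)
      ((k.decBad m).indicator fun _ => (1 : ℝ)) ε := fun m =>
    expBound_indicator (k.measurableSet_decBad m) hε (hdec m)
  have tP := fun b => k.expBound_msg Q N μW μT (B := B + 1) (r := r) b eP
  have tX := fun b => k.expBound_msg Q N μW μT (B := B + 1) (r := r) b eX
  have tE := fun b => k.expBound_msg Q N μW μT (B := B + 1) (r := r) b eE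
  have tD := fun b => k.expBound_msg Q N μW μT (B := B + 1) (r := r) b eD
  have tx : ∀ j : Fin r, ExpBound Pm (fun p => p.2.1 (Fin.natAdd ((B + 1) * L) j) ^ 2) Q := by
    intro j
    have hev : MeasurePreserving (fun p : (Fin (B + 1) → (Fin M → Fin L → W) × (Fin M → Fin L → T)) ×
        Sample n => p.2.1 (Fin.natAdd ((B + 1) * L) j)) Pm (gaussianReal 0 Q) :=
      ((measurePreserving_eval (fun _ : Fin n => gaussianReal 0 Q)
        (Fin.natAdd ((B + 1) * L) j)).comp measurePreserving_fst).comp measurePreserving_snd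
    exact (⟨by fun_prop, fun x => sq_nonneg x, Q.2, (lintegral_sq_gaussianReal Q).le⟩ :
      ExpBound (gaussianReal 0 Q) (fun x => x ^ 2) Q).comp hev
  have nonlast := fun b : Fin B =>
    ((ExpBound.const (μ := Pm) hε).add ((tX b.castSucc).const_mul zero_le_two)).add
      ((((tE b.castSucc).add (tD b.castSucc)).add (tD ⟨b + 1, Nat.succ_lt_succ b.2⟩)).const_mul hD0)
  have last := (ExpBound.const (μ := Pm) (add_nonneg hS hE)).add (tX (Fin.last B))
  have total := ((((ExpBound.sum Finset.univ fun b _ => tP b).const_mul (Nat.cast_nonneg L)).add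
      (ExpBound.sum (Finset.univ : Finset (Fin r)) fun _ _ => ExpBound.const (μ := Pm) hP0)).add
    ((((ExpBound.sum Finset.univ fun b _ => nonlast b).add last).const_mul (Nat.cast_nonneg L)).add
      (ExpBound.sum Finset.univ fun j _ => (tx j).add (ExpBound.const (μ := Pm) hS)))).const_mul
    (by positivity : (0 : ℝ) ≤ 1 / (n : ℝ))
  have hmeas := total.meas.ennreal_ofReal
  obtain ⟨cb, hcb⟩ := exists_le_lintegral
    (hmeas.lintegral_prod_right' (ν := base n Q N)).aemeasurable
    (μ := Measure.pi fun _ : Fin (B + 1) => bookMeasure μW μT L M)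
  rw [← lintegral_prod _ hmeas.aemeasurable] at hcb
  refine ⟨k.design cb, (lintegral_mono fun ω => ENNReal.ofReal_le_ofReal ?_).trans
    ((hcb.trans total.le).trans (ENNReal.ofReal_le_ofReal ?_))⟩
  swap
  · simp only [Finset.sum_const, Finset.card_univ, Fintype.card_fin, nsmul_eq_mul]
    refine mul_le_mul_of_nonneg_left ?_ (by positivity)
    push_cast
    have h1 : 0 ≤ (L : ℝ) * (2 + 3 * D) * ε := by positivity
    linarith
  · have hP1 := abs_average_sub_le (B := B + 1) (r := r) hL hn
      (fun t => (k.design cb).U1 ω t ^ 2) P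
    have hS1 := abs_average_sub_le (B := B + 1) (r := r) hL hn
      (fun t => ((k.design cb).X1 ω t - (k.design cb).U2 ω t) ^ 2) S
    rw [abs_sub_comm P, abs_sub_comm S, mul_add]
    refine add_le_add (hP1.trans ?_) (hS1.trans ?_)
    · refine mul_le_mul_of_nonneg_left (add_le_add ?_ ?_) (by positivity)
      · refine mul_le_mul_of_nonneg_left (Finset.sum_le_sum fun b _ => le_of_eq ?_) (by positivity)
        simp only [U1_time, devP]
      · refine Finset.sum_le_sum fun j _ => le_of_eq ?_
        simp only [U1_rem]
        simp [abs_of_nonneg hP0]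
    · refine mul_le_mul_of_nonneg_left (add_le_add ?_ ?_) (by positivity)
      · refine mul_le_mul_of_nonneg_left ?_ (by positivity)
        rw [Fin.sum_univ_castSucc]
        refine add_le_add (Finset.sum_le_sum fun b _ => ?_) ?_
        · exact k.estimation_block_bound hL hS hE hε hK hcov cb ω b.castSucc
            (Nat.succ_lt_succ b.2)
        · exact k.estimation_last_block_bound hS cb ω (Fin.last B) (by simp)
      · refine Finset.sum_le_sum fun j _ => ?_
        have h0 : (k.design cb).X1 ω (Fin.natAdd ((B + 1) * L) j)
            = ω.1 (Fin.natAdd ((B + 1) * L) j) := by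
          unfold FBNCDesign.X1; rw [U1_rem, add_zero]; rfl
        simp only [U2_rem, sub_zero, h0]
        rw [abs_le]; constructor <;> nlinarith [sq_nonneg (ω.1 (Fin.natAdd ((B + 1) * L) j))]

end BlockCode

section Abstract

variable {A S : Type*} [MeasurableSpace A] [MeasurableSpace S]

lemma one_sub_pow_le {c p : ℝ} (hc1 : c ≤ 1) (hp0 : 0 ≤ p) (hp1 : p ≤ 1) (M : ℕ) :
    (1 - c * p) ^ M ≤ (1 - p) + (1 - c) ^ M := by
  have h := (convexOn_pow (𝕜 := ℝ) M).2 (Set.mem_Ici.2 zero_le_one)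
    (Set.mem_Ici.2 (sub_nonneg.2 hc1)) (sub_nonneg.2 hp1) hp0 (sub_add_cancel 1 p)
  simp only [smul_eq_mul, one_pow, mul_one] at h
  have h2 : (1 - p) + p * (1 - c) = 1 - c * p := by ring
  rw [h2] at h
  refine h.trans ?_
  have : p * (1 - c) ^ M ≤ 1 * (1 - c) ^ M :=
    mul_le_mul_of_nonneg_right hp1 (pow_nonneg (by linarith) _)
  linarith

/-- Random covering: the probability that none of `M` independent draws is acceptable. -/
lemma covering_bound (ν : Measure A) (τ : Measure S) [IsProbabilityMeasure ν]
    [IsProbabilityMeasure τ] {M : ℕ} {cov : Set (A × S)} (hcov : MeasurableSet cov)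
    {f : A × S → ℝ≥0∞} (hf : Measurable f) (hf1 : ∀ a, ∫⁻ s, f (a, s) ∂τ = 1) {c : ℝ}
    (hc0 : 0 ≤ c) (hc1 : c ≤ 1) (hfc : ∀ p ∈ cov, ENNReal.ofReal c * f p ≤ 1) :
    (ν.prod (Measure.pi fun _ : Fin M => τ)) {q | ∀ j, (q.1, q.2 j) ∉ cov}
      ≤ (ν.prod τ).withDensity f covᶜ + ENNReal.ofReal ((1 - c) ^ M) := by
  have hms : MeasurableSet {q : A × (Fin M → S) | ∀ j, (q.1, q.2 j) ∉ cov} := by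
    have : {q : A × (Fin M → S) | ∀ j, (q.1, q.2 j) ∉ cov}
        = ⋂ j, (fun q : A × (Fin M → S) => (q.1, q.2 j)) ⁻¹' covᶜ := by ext; simp
    rw [this]
    exact MeasurableSet.iInter fun j => hcov.compl.preimage (by fun_prop)
  rw [Measure.prod_apply hms, withDensity_apply _ hcov.compl,
    ← lintegral_indicator hcov.compl, lintegral_prod _ (hf.indicator hcov.compl).aemeasurable]
  have hconst : ENNReal.ofReal ((1 - c) ^ M) = ∫⁻ _, ENNReal.ofReal ((1 - c) ^ M) ∂ν := by simp
  rw [hconst, ← lintegral_add_right _ measurable_const]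
  refine lintegral_mono fun a => ?_
  have ha : MeasurableSet {s : S | (a, s) ∈ cov} := hcov.preimage (by fun_prop)
  have h1 : (Prod.mk a ⁻¹' {q : A × (Fin M → S) | ∀ j, (q.1, q.2 j) ∉ cov})
      = Set.univ.pi fun _ : Fin M => {s : S | (a, s) ∈ cov}ᶜ := by ext; simp
  rw [h1, Measure.pi_pi, Finset.prod_const, Finset.card_univ, Fintype.card_fin]
  set q := τ {s : S | (a, s) ∈ cov} with hq
  set p := ∫⁻ s in {s : S | (a, s) ∈ cov}, f (a, s) ∂τ with hp
  have hfa : Measurable fun s => f (a, s) := by fun_prop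
  have hp' : ∫⁻ s, covᶜ.indicator f (a, s) ∂τ = ∫⁻ s in {s : S | (a, s) ∈ cov}ᶜ, f (a, s) ∂τ := by
    rw [← lintegral_indicator ha.compl]; rfl
  have hsum : p + ∫⁻ s, covᶜ.indicator f (a, s) ∂τ = 1 := by
    rw [hp', hp, lintegral_add_compl _ ha, hf1]
  have hpq : ENNReal.ofReal c * p ≤ q := by
    rw [hp, ← lintegral_const_mul _ hfa]
    calc _ ≤ ∫⁻ s in {s : S | (a, s) ∈ cov}, 1 ∂τ :=
          setLIntegral_mono measurable_const fun s hs => hfc _ hs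
      _ = q := by simp [hq]
  have hp1 : p ≤ 1 := hsum ▸ le_self_add
  have hptop : p ≠ ∞ := ne_top_of_le_ne_top ENNReal.one_ne_top hp1
  have hqc : τ {s : S | (a, s) ∈ cov}ᶜ ≤ ENNReal.ofReal (1 - c * p.toReal) := by
    rw [prob_compl_eq_one_sub ha, ENNReal.ofReal_sub _ (by positivity), ENNReal.ofReal_one,
      ENNReal.ofReal_mul hc0, ENNReal.ofReal_toReal hptop]
    exact tsub_le_tsub_left hpq _
  have hpr : p.toReal ≤ 1 := by
    simpa using ENNReal.toReal_mono ENNReal.one_ne_top hp1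
  have hrest : ∫⁻ s, covᶜ.indicator f (a, s) ∂τ = ENNReal.ofReal (1 - p.toReal) := by
    rw [ENNReal.ofReal_sub _ ENNReal.toReal_nonneg, ENNReal.ofReal_one, ENNReal.ofReal_toReal hptop]
    exact ENNReal.eq_sub_of_add_eq hptop (by rw [add_comm]; exact hsum)
  have h0 : 0 ≤ 1 - c * p.toReal := by nlinarith [ENNReal.toReal_nonneg (a := p)]
  calc _ ≤ ENNReal.ofReal (1 - c * p.toReal) ^ M := by gcongr
    _ = ENNReal.ofReal ((1 - c * p.toReal) ^ M) := (ENNReal.ofReal_pow h0 M).symm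
    _ ≤ ENNReal.ofReal ((1 - p.toReal) + (1 - c) ^ M) :=
        ENNReal.ofReal_le_ofReal (one_sub_pow_le hc1 ENNReal.toReal_nonneg hpr M)
    _ = _ := by
        rw [hrest, ENNReal.ofReal_add (by linarith) (pow_nonneg (by linarith) _)]

/-- Random packing: the probability that a wrong codeword looks like the right one. -/
lemma packing_bound {Y : Type*} [MeasurableSpace Y] (ν : Measure A) (τ : Measure S)
    [IsProbabilityMeasure ν] [IsProbabilityMeasure τ] {M : ℕ} {out : A × S → Y}
    (hout : Measurable out) {D : S × Y → ℝ≥0∞} (hD : Measurable D)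
    (hD1 : ∫⁻ y, ∫⁻ s, D (s, y) ∂τ ∂((ν.prod τ).map out) ≤ 1) {t : ℝ≥0∞} (ht0 : t ≠ 0)
    (ht : t ≠ ∞) {m m' : Fin M} (hm : m' ≠ m) :
    (ν.prod (Measure.pi fun _ : Fin M => τ)) {q | t ≤ D (q.2 m', out (q.1, q.2 m))} ≤ t⁻¹ := by
  have hind : IndepFun (fun C : Fin M → S => C m) (fun C => C m')
      (Measure.pi fun _ : Fin M => τ) :=
    (iIndepFun_pi (μ := fun _ : Fin M => τ) (X := fun _ (s : S) => s)
      fun _ => aemeasurable_id').indepFun hm.symm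
  have hmap : MeasurePreserving (fun C : Fin M → S => (C m, C m'))
      (Measure.pi fun _ : Fin M => τ) (τ.prod τ) := by
    refine ⟨by fun_prop, ?_⟩
    rw [(indepFun_iff_map_prod_eq_prod_map_map (measurable_pi_apply m).aemeasurable
      (measurable_pi_apply m').aemeasurable).1 hind]
    congr 1
    · exact (measurePreserving_eval (fun _ : Fin M => τ) m).map_eq
    · exact (measurePreserving_eval (fun _ : Fin M => τ) m').map_eq
  have hmp := (MeasurePreserving.id ν).prod hmap
  have hDm : Measurable fun q : A × S × S => D (q.2.2, out (q.1, q.2.1)) := by fun_prop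
  have hms : MeasurableSet {q : A × S × S | t ≤ D (q.2.2, out (q.1, q.2.1))} :=
    measurableSet_le measurable_const hDm
  have hEq : (ν.prod (Measure.pi fun _ : Fin M => τ)) {q | t ≤ D (q.2 m', out (q.1, q.2 m))}
      = (ν.prod (τ.prod τ)) {q | t ≤ D (q.2.2, out (q.1, q.2.1))} := by
    rw [← hmp.measure_preimage hms.nullMeasurableSet]; rfl
  rw [hEq]
  refine (meas_ge_le_lintegral_div hDm.aemeasurable ht0 ht).trans ?_
  rw [← one_div]
  refine ENNReal.div_le_div_right ?_ _
  refine le_of_eq_of_le ?_ hD1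
  rw [lintegral_map (Measurable.lintegral_prod_left (by fun_prop)) hout,
    lintegral_prod _ (Measurable.lintegral_prod_left (by fun_prop)).aemeasurable,
    lintegral_prod _ hDm.aemeasurable]
  refine lintegral_congr fun a => ?_
  rw [lintegral_prod _ (by fun_prop)]

end Abstract

section Letters

variable {W T : Type*} [MeasurableSpace W] [MeasurableSpace T]

/-- The law of a letter `(x, w, z)` of source, codeword and noise. -/
def triLaw (Q N : ℝ≥0) (μW : Measure W) : Measure (ℝ × W × ℝ) :=
  (gaussianReal 0 Q).prod (μW.prod (gaussianReal 0 N))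

instance (Q N : ℝ≥0) (μW : Measure W) [IsProbabilityMeasure μW] :
    IsProbabilityMeasure (triLaw Q N μW) := by
  unfold triLaw; infer_instance

variable (Q N : ℝ≥0) (μW : Measure W) (μT : Measure T) [IsProbabilityMeasure μW]
  [IsProbabilityMeasure μT] (L M : ℕ)

lemma measurePreserving_tri_seeds (m : Fin M) :
    MeasurePreserving (fun θ : Blk W T L M =>
      ((fun i => (θ.1 i, θ.2.2.1 m i, θ.2.1 i) : Fin L → ℝ × W × ℝ), θ.2.2.2))
      (blkMeasure Q N μW μT L M)
      ((Measure.pi fun _ : Fin L => triLaw Q N μW).prod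
        (Measure.pi fun _ : Fin M => Measure.pi fun _ : Fin L => μT)) := by
  have z1 := measurePreserving_zip (fun _ : Fin L => μW) (fun _ : Fin L => gaussianReal 0 N)
  have z2 := measurePreserving_zip (fun _ : Fin L => gaussianReal 0 Q)
    (fun _ : Fin L => μW.prod (gaussianReal 0 N))
  have e := measurePreserving_eval (fun _ : Fin M => Measure.pi fun _ : Fin L => μW) m
  have a1 := (MeasurePreserving.id (iidGaussian L Q)).prod
    (measurePreserving_prodAssoc (iidGaussian L N)
      (Measure.pi fun _ : Fin M => Measure.pi fun _ : Fin L => μW)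
      (Measure.pi fun _ : Fin M => Measure.pi fun _ : Fin L => μT)).symm
  have a2 := (measurePreserving_prodAssoc (iidGaussian L Q)
    ((iidGaussian L N).prod (Measure.pi fun _ : Fin M => Measure.pi fun _ : Fin L => μW))
      (Measure.pi fun _ : Fin M => Measure.pi fun _ : Fin L => μT)).symm
  have s := (z1.comp Measure.measurePreserving_swap).comp
    ((MeasurePreserving.id (iidGaussian L N)).prod e)
  have s' := (z2.comp ((MeasurePreserving.id (iidGaussian L Q)).prod s)).prod
    (MeasurePreserving.id (Measure.pi fun _ : Fin M => Measure.pi fun _ : Fin L => μT))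
  exact (s'.comp a2).comp a1

lemma measurePreserving_tri (m : Fin M) :
    MeasurePreserving (fun (θ : Blk W T L M) i => (θ.1 i, θ.2.2.1 m i, θ.2.1 i))
      (blkMeasure Q N μW μT L M) (Measure.pi fun _ : Fin L => triLaw Q N μW) :=
  measurePreserving_fst.comp (measurePreserving_tri_seeds Q N μW μT L M m)

lemma measurePreserving_book :
    MeasurePreserving (fun θ : Blk W T L M => ((θ.1, θ.2.1), θ.2.2.1))
      (blkMeasure Q N μW μT L M)
      (((iidGaussian L Q).prod (iidGaussian L N)).prod
        (Measure.pi fun _ : Fin M => Measure.pi fun _ : Fin L => μW)) := by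
  have a1 := (MeasurePreserving.id (iidGaussian L Q)).prod
    ((MeasurePreserving.id (iidGaussian L N)).prod (measurePreserving_fst
      (μ := (Measure.pi fun _ : Fin M => Measure.pi fun _ : Fin L => μW))
      (ν := (Measure.pi fun _ : Fin M => Measure.pi fun _ : Fin L => μT))))
  exact (measurePreserving_prodAssoc _ _ _).symm.comp a1

lemma measurePreserving_tri_of_pair :
    MeasurePreserving (fun (q : ((Fin L → ℝ) × (Fin L → ℝ)) × (Fin L → W)) i =>
      (q.1.1 i, q.2 i, q.1.2 i))
      (((iidGaussian L Q).prod (iidGaussian L N)).prod (Measure.pi fun _ : Fin L => μW))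
      (Measure.pi fun _ : Fin L => triLaw Q N μW) := by
  have z1 := measurePreserving_zip (fun _ : Fin L => μW) (fun _ : Fin L => gaussianReal 0 N)
  have z2 := measurePreserving_zip (fun _ : Fin L => gaussianReal 0 Q)
    (fun _ : Fin L => μW.prod (gaussianReal 0 N))
  exact (z2.comp ((MeasurePreserving.id (iidGaussian L Q)).prod
    (z1.comp Measure.measurePreserving_swap))).comp
    (measurePreserving_prodAssoc (iidGaussian L Q) (iidGaussian L N)
      (Measure.pi fun _ : Fin L => μW))

end Letters

section LLN

variable {E : Type*} [MeasurableSpace E]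

lemma lln_prob (μ : Measure E) [IsProbabilityMeasure μ] {f : E → ℝ} (hf : Measurable f)
    (hfi : Integrable f μ) {δ ε : ℝ} (hδ : 0 < δ) (hε : 0 < ε) :
    ∃ L₀ : ℕ, ∀ L ≥ L₀, (Measure.pi fun _ : Fin L => μ)
      {e | δ ≤ |(1 / (L : ℝ)) * ∑ t, f (e t) - ∫ x, f x ∂μ|} ≤ ENNReal.ofReal ε := by
  obtain ⟨L₀, h⟩ := lln_pi μ f hf hfi (ENNReal.ofReal (δ * ε))
    (ENNReal.ofReal_pos.2 (by positivity))
  refine ⟨L₀, fun L hL => ?_⟩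
  have hm : Measurable fun e : Fin L → E =>
      ENNReal.ofReal |(1 / (L : ℝ)) * ∑ t, f (e t) - ∫ x, f x ∂μ| := by fun_prop
  have h1 := meas_ge_le_lintegral_div hm.aemeasurable (ENNReal.ofReal_pos.2 hδ).ne'
    ENNReal.ofReal_ne_top (μ := Measure.pi fun _ : Fin L => μ)
  have h2 : {e : Fin L → E | δ ≤ |(1 / (L : ℝ)) * ∑ t, f (e t) - ∫ x, f x ∂μ|}
      ⊆ {e | ENNReal.ofReal δ
        ≤ ENNReal.ofReal |(1 / (L : ℝ)) * ∑ t, f (e t) - ∫ x, f x ∂μ|} :=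
    fun e he => ENNReal.ofReal_le_ofReal he
  refine (measure_mono h2).trans (h1.trans ?_)
  refine (ENNReal.div_le_div_right (h L hL) _).trans ?_
  rw [ENNReal.ofReal_mul hδ.le, mul_comm, ENNReal.mul_div_cancel_right
    (ENNReal.ofReal_pos.2 hδ).ne' ENNReal.ofReal_ne_top]

lemma prod_eq_ofReal_exp {L : ℕ} {a : Fin L → ℝ≥0∞} (h : ∀ i, a i ≠ 0 ∧ a i ≠ ∞) :
    ∏ i, a i = ENNReal.ofReal (Real.exp (∑ i, Real.log (a i).toReal)) := by
  rw [Real.exp_sum, ENNReal.ofReal_prod_of_nonneg fun i _ => (Real.exp_pos _).le]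
  refine Finset.prod_congr rfl fun i _ => ?_
  rw [Real.exp_log (ENNReal.toReal_pos (h i).1 (h i).2), ENNReal.ofReal_toReal (h i).2]

lemma ae_pi_forall (μ : Measure E) [IsProbabilityMeasure μ] {p : E → Prop} (h : ∀ᵐ e ∂μ, p e)
    (L : ℕ) : ∀ᵐ e ∂(Measure.pi fun _ : Fin L => μ), ∀ i, p (e i) :=
  ae_all_iff.2 fun i => (measurePreserving_eval (fun _ : Fin L => μ) i).quasiMeasurePreserving.ae h

/-- The product of the densities is eventually below any exponential of rate exceeding the mean. -/
lemma prod_gt_small (μ : Measure E) [IsProbabilityMeasure μ] {ρ : E → ℝ≥0∞} (hρ : Measurable ρ)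
    (h0 : ∀ᵐ e ∂μ, ρ e ≠ 0 ∧ ρ e ≠ ∞) (hi : Integrable (fun e => Real.log (ρ e).toReal) μ)
    {τ ε : ℝ} (hτ : ∫ e, Real.log (ρ e).toReal ∂μ < τ) (hε : 0 < ε) :
    ∃ L₀ : ℕ, ∀ L ≥ L₀, (Measure.pi fun _ : Fin L => μ)
      {e | ENNReal.ofReal (Real.exp (L * τ)) < ∏ i, ρ (e i)} ≤ ENNReal.ofReal ε := by
  obtain ⟨L₀, h⟩ := lln_prob μ (by fun_prop) hi (sub_pos.2 hτ) hε
  refine ⟨L₀ + 1, fun L hL => (measure_mono_ae ?_).trans (h L (by omega))⟩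
  filter_upwards [ae_pi_forall μ h0 L] with e he hlt
  have hlt' : ENNReal.ofReal (Real.exp (L * τ)) < ∏ i, ρ (e i) := hlt
  rw [prod_eq_ofReal_exp he, ENNReal.ofReal_lt_ofReal_iff (Real.exp_pos _), Real.exp_lt_exp] at hlt'
  have hL0 : (0 : ℝ) < L := by exact_mod_cast (by omega : 0 < L)
  have h2 : τ ≤ (1 / (L : ℝ)) * ∑ t, Real.log (ρ (e t)).toReal := by
    rw [one_div, inv_mul_eq_div, le_div_iff₀ hL0]; linarith
  exact (sub_le_sub_right h2 _).trans (le_abs_self _)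

lemma prod_lt_small (μ : Measure E) [IsProbabilityMeasure μ] {ρ : E → ℝ≥0∞} (hρ : Measurable ρ)
    (h0 : ∀ᵐ e ∂μ, ρ e ≠ 0 ∧ ρ e ≠ ∞) (hi : Integrable (fun e => Real.log (ρ e).toReal) μ)
    {τ ε : ℝ} (hτ : τ < ∫ e, Real.log (ρ e).toReal ∂μ) (hε : 0 < ε) :
    ∃ L₀ : ℕ, ∀ L ≥ L₀, (Measure.pi fun _ : Fin L => μ)
      {e | ∏ i, ρ (e i) < ENNReal.ofReal (Real.exp (L * τ))} ≤ ENNReal.ofReal ε := by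
  obtain ⟨L₀, h⟩ := lln_prob μ (by fun_prop) hi (sub_pos.2 hτ) hε
  refine ⟨L₀ + 1, fun L hL => (measure_mono_ae ?_).trans (h L (by omega))⟩
  filter_upwards [ae_pi_forall μ h0 L] with e he hlt
  have hlt' : ∏ i, ρ (e i) < ENNReal.ofReal (Real.exp (L * τ)) := hlt
  rw [prod_eq_ofReal_exp he, ENNReal.ofReal_lt_ofReal_iff (Real.exp_pos _), Real.exp_lt_exp] at hlt'
  have hL0 : (0 : ℝ) < L := by exact_mod_cast (by omega : 0 < L)
  have h2 : (1 / (L : ℝ)) * ∑ t, Real.log (ρ (e t)).toReal ≤ τ := by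
    rw [one_div, inv_mul_eq_div, div_le_iff₀ hL0]; linarith
  refine (sub_le_sub_left h2 _).trans ?_
  rw [← neg_sub]
  exact neg_le_abs _

end LLN

/-- Single-letter data from which block codes are drawn: a deterministic encoder `F`, a bounded
estimator `uhat` fed with quantization letters, the density `ρ` of the quantization channel and
the decoding density `D`. -/
structure CodeData (Q N : ℝ≥0) (W T : Type*) [MeasurableSpace W] [MeasurableSpace T] where
  μW : Measure W
  probW : IsProbabilityMeasure μW
  μT : Measure T
  probT : IsProbabilityMeasure μT
  F : ℝ × W → ℝ
  measF : Measurable F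
  uhat : W × ℝ × T → ℝ
  meas_uhat : Measurable uhat
  K : ℝ
  uhat_le : ∀ q, |uhat q| ≤ K
  ρ : (ℝ × W × ℝ) × T → ℝ≥0∞
  measρ : Measurable ρ
  lintegral_ρ : ∀ a, ∫⁻ σ, ρ (a, σ) ∂μT = 1
  D : W × ℝ → ℝ≥0∞
  measD : Measurable D
  integrable_sq : Integrable (fun a : ℝ × W × ℝ => F (a.1, a.2.1) ^ 2) (triLaw Q N μW)

namespace CodeData

attribute [instance] probW probT

variable {Q N : ℝ≥0} {W T : Type*} [MeasurableSpace W] [MeasurableSpace T] (k : CodeData Q N W T)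

/-- The channel output of a letter. -/
def out (a : ℝ × W × ℝ) : ℝ := a.1 + k.F (a.1, a.2.1) + a.2.2

/-- The joint law of source, codeword, noise and quantization letters. -/
def J : Measure ((ℝ × W × ℝ) × T) := ((triLaw Q N k.μW).prod k.μT).withDensity k.ρ

def costInput : ℝ := ∫ a, k.F (a.1, a.2.1) ^ 2 ∂(triLaw Q N k.μW)

def costState : ℝ := ∫ a, (a.1 + k.F (a.1, a.2.1)) ^ 2 ∂(triLaw Q N k.μW)

/-- The squared estimation error of a letter. -/
def err (e : (ℝ × W × ℝ) × T) : ℝ :=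
  (e.1.1 + k.F (e.1.1, e.1.2.1) - k.uhat (e.1.2.1, k.out e.1, e.2)) ^ 2

def costEst : ℝ := ∫ e, k.err e ∂k.J

@[fun_prop] lemma measurable_out : Measurable k.out := by
  have := k.measF; unfold out; fun_prop

@[fun_prop] lemma measurable_err : Measurable k.err := by
  have := k.measF; have := k.meas_uhat; unfold err; fun_prop

lemma map_fst_J : k.J.map Prod.fst = triLaw Q N k.μW := by
  ext s hs
  rw [Measure.map_apply measurable_fst hs, J, withDensity_apply _ (measurable_fst hs),
    ← lintegral_indicator (measurable_fst hs),
    lintegral_prod _ (k.measρ.indicator (measurable_fst hs)).aemeasurable, ← lintegral_indicator_one hs]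
  refine lintegral_congr fun a => ?_
  by_cases ha : a ∈ s
  · have : ∀ σ, (Prod.fst ⁻¹' s).indicator k.ρ (a, σ) = k.ρ (a, σ) := fun σ =>
      Set.indicator_of_mem (by simpa using ha) _
    simp only [this, k.lintegral_ρ, Set.indicator_of_mem ha, Pi.one_apply]
  · have : ∀ σ, (Prod.fst ⁻¹' s).indicator k.ρ (a, σ) = 0 := fun σ =>
      Set.indicator_of_notMem (by simpa using ha) _
    simp only [this, lintegral_zero, Set.indicator_of_notMem ha]

instance : IsProbabilityMeasure k.J := by
  have h : k.J.map Prod.fst Set.univ = 1 := by rw [map_fst_J]; exact measure_univ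
  rw [Measure.map_apply measurable_fst MeasurableSet.univ] at h
  exact ⟨h⟩

lemma integrable_x_sq : Integrable (fun a : ℝ × W × ℝ => a.1 ^ 2) (triLaw Q N k.μW) := by
  have h := (memLp_id_gaussianReal (μ := 0) (v := Q) 2).integrable_sq
  exact h.comp_fst (ν := k.μW.prod (gaussianReal 0 N))

lemma integrable_state : Integrable (fun a : ℝ × W × ℝ => (a.1 + k.F (a.1, a.2.1)) ^ 2)
    (triLaw Q N k.μW) := by
  have := k.measF
  refine ((k.integrable_x_sq.const_mul 2).add (k.integrable_sq.const_mul 2)).mono'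
    (by fun_prop) (Filter.Eventually.of_forall fun a => ?_)
  rw [Real.norm_of_nonneg (sq_nonneg _)]
  simp only [Pi.add_apply]
  nlinarith [sq_nonneg (a.1 - k.F (a.1, a.2.1))]

lemma integrable_err : Integrable k.err k.J := by
  have h : Integrable (fun e : (ℝ × W × ℝ) × T => (e.1.1 + k.F (e.1.1, e.1.2.1)) ^ 2) k.J := by
    have := k.integrable_state
    rw [← k.map_fst_J] at this
    exact this.comp_measurable measurable_fst
  refine ((h.const_mul 2).add (integrable_const (2 * k.K ^ 2))).mono'
    (by fun_prop) (Filter.Eventually.of_forall fun e => ?_)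
  have h2 := sq_le_sq' (abs_le.1 (k.uhat_le (e.1.2.1, k.out e.1, e.2))).1
    (abs_le.1 (k.uhat_le (e.1.2.1, k.out e.1, e.2))).2
  unfold err
  rw [Real.norm_of_nonneg (sq_nonneg _)]
  simp only [Pi.add_apply]
  nlinarith [sq_nonneg (e.1.1 + k.F (e.1.1, e.1.2.1) + k.uhat (e.1.2.1, k.out e.1, e.2))]

/-- The quantities used by the block coding argument: a threshold pair and a codebook size. -/
structure Thresholds (L : ℕ) (ε : ℝ) where
  M : ℕ
  M_ne : NeZero M
  good : Set ((Fin L → (ℝ × W × ℝ) × T))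
  meas_good : MeasurableSet good
  good_prob : (Measure.pi fun _ : Fin L => k.J) goodᶜ ≤ ENNReal.ofReal ε
  c : ℝ
  c_nonneg : 0 ≤ c
  c_le_one : c ≤ 1
  dens_le : ∀ e ∈ good, ENNReal.ofReal c * ∏ i, k.ρ (e i) ≤ 1
  pow_le : (1 - c) ^ M ≤ ε
  t : ℝ≥0∞
  t_ne_top : t ≠ ∞
  wrong_le : ((M - 1 : ℕ) : ℝ≥0∞) * t⁻¹ ≤ ENNReal.ofReal ε
  t_zero : t = 0 → M = 1
  right_le : (Measure.pi fun _ : Fin L => triLaw Q N k.μW)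
    {a | ∏ i, k.D ((a i).2.1, k.out (a i)) < t} ≤ ENNReal.ofReal ε

/-- The code attached to the thresholds. -/
def Thresholds.code {k : CodeData Q N W T} {L : ℕ} {ε : ℝ} (h : k.Thresholds L ε) (δ : ℝ) :
    BlockCode W T L where
  F := k.F
  uhat := k.uhat
  measF := k.measF
  meas_uhat := k.meas_uhat
  covering := (fun q i => ((q.1 i, q.2.1 i, q.2.2.1 i), q.2.2.2 i)) ⁻¹'
    (h.good ∩ {e | |(1 / (L : ℝ)) * ∑ i, k.err (e i) - k.costEst| ≤ δ})
  meas_covering := by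
    refine (h.meas_good.inter (measurableSet_le (by fun_prop) (by fun_prop))).preimage ?_
    fun_prop
  packing := {q | h.t ≤ ∏ i, k.D (q.1 i, q.2 i)}
  meas_packing := by
    have := k.measD
    exact measurableSet_le (by fun_prop) (by fun_prop)

lemma lintegral_D_block (hD1 : ∫⁻ a, ∫⁻ w, k.D (w, k.out a) ∂k.μW ∂(triLaw Q N k.μW) ≤ 1) (L : ℕ) :
    ∫⁻ y, ∫⁻ w, ∏ i, k.D (w i, y i) ∂(Measure.pi fun _ : Fin L => k.μW)
      ∂((((iidGaussian L Q).prod (iidGaussian L N)).prod (Measure.pi fun _ : Fin L => k.μW)).map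
        fun q i => k.out (q.1.1 i, q.2 i, q.1.2 i)) ≤ 1 := by
  have := k.measD
  have hmp := measurePreserving_tri_of_pair Q N k.μW L
  have h1 : ∀ y : Fin L → ℝ, ∫⁻ w, ∏ i, k.D (w i, y i) ∂(Measure.pi fun _ : Fin L => k.μW)
      = ∏ i, ∫⁻ w, k.D (w, y i) ∂k.μW := fun y =>
    lintegral_pi_prod (fun _ : Fin L => k.μW) (fun i w => k.D (w, y i)) fun i => by fun_prop
  have hg : Measurable fun y => ∫⁻ w, k.D (w, y) ∂k.μW :=
    Measurable.lintegral_prod_left k.measD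
  simp_rw [h1]
  have ho : Measurable fun (q : ((Fin L → ℝ) × (Fin L → ℝ)) × (Fin L → W)) i =>
    k.out (q.1.1 i, q.2 i, q.1.2 i) := by fun_prop
  rw [lintegral_map (by fun_prop) ho]
  have h2 := hmp.lintegral_comp (f := fun a => ∏ i, ∫⁻ w, k.D (w, k.out (a i)) ∂k.μW) (by fun_prop)
  rw [h2, lintegral_pi_prod (fun _ : Fin L => triLaw Q N k.μW)
    (fun i a => ∫⁻ w, k.D (w, k.out a) ∂k.μW) fun i => hg.comp k.measurable_out]
  exact Finset.prod_le_one' fun i _ => hD1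

variable {L : ℕ} {ε : ℝ}

lemma Thresholds.encBad_le {k : CodeData Q N W T} (h : k.Thresholds L ε) {δ : ℝ}
    (hε : 0 ≤ ε)
    (hdev : (Measure.pi fun _ : Fin L => k.J)
      {e | δ ≤ |(1 / (L : ℝ)) * ∑ i, k.err (e i) - k.costEst|} ≤ ENNReal.ofReal ε)
    (m : Fin h.M) :
    blkMeasure Q N k.μW k.μT L h.M ((h.code δ).encBad m) ≤ ENNReal.ofReal (3 * ε) := by
  have := k.measρ
  set G : Set (Fin L → (ℝ × W × ℝ) × T) :=
    h.good ∩ {e | |(1 / (L : ℝ)) * ∑ i, k.err (e i) - k.costEst| ≤ δ} with hG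
  have hGm : MeasurableSet G :=
    h.meas_good.inter (measurableSet_le (by fun_prop) (by fun_prop))
  have hz := measurePreserving_zip (fun _ : Fin L => triLaw Q N k.μW) (fun _ : Fin L => k.μT)
  set cov : Set ((Fin L → ℝ × W × ℝ) × (Fin L → T)) := (fun p i => (p.1 i, p.2 i)) ⁻¹' G with hcov
  have hcm : MeasurableSet cov := hGm.preimage hz.measurable
  have hb := covering_bound (Measure.pi fun _ : Fin L => triLaw Q N k.μW)
    (Measure.pi fun _ : Fin L => k.μT) (M := h.M) hcm
    (f := fun p => ∏ i, k.ρ (p.1 i, p.2 i)) (by fun_prop)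
    (fun a => by
      rw [lintegral_pi_prod (fun _ : Fin L => k.μT) (fun i σ => k.ρ (a i, σ)) fun i => by fun_prop]
      simp [k.lintegral_ρ]) h.c_nonneg h.c_le_one (fun p hp => h.dens_le _ hp.1)
  have hms : MeasurableSet {q : (Fin L → ℝ × W × ℝ) × (Fin h.M → Fin L → T) |
      ∀ j, (q.1, q.2 j) ∉ cov} := by
    have : {q : (Fin L → ℝ × W × ℝ) × (Fin h.M → Fin L → T) | ∀ j, (q.1, q.2 j) ∉ cov}
        = ⋂ j, (fun q : (Fin L → ℝ × W × ℝ) × (Fin h.M → Fin L → T) => (q.1, q.2 j)) ⁻¹' covᶜ := by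
      ext; simp
    rw [this]
    exact MeasurableSet.iInter fun j => hcm.compl.preimage (by fun_prop)
  rw [← (measurePreserving_tri_seeds Q N k.μW k.μT L h.M m).measure_preimage
    hms.nullMeasurableSet] at hb
  have hJ : ((Measure.pi fun _ : Fin L => triLaw Q N k.μW).prod
      (Measure.pi fun _ : Fin L => k.μT)).withDensity (fun p => ∏ i, k.ρ (p.1 i, p.2 i)) covᶜ
      = (Measure.pi fun _ : Fin L => k.J) Gᶜ := by
    have : IsProbabilityMeasure (((triLaw Q N k.μW).prod k.μT).withDensity k.ρ) :=
      inferInstanceAs (IsProbabilityMeasure k.J)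
    have := pi_withDensity (fun _ : Fin L => (triLaw Q N k.μW).prod k.μT) (fun _ => k.ρ)
      (fun _ => k.measρ)
    unfold J
    rw [this, withDensity_apply _ hcm.compl, withDensity_apply _ hGm.compl]
    exact hz.setLIntegral_comp_preimage hGm.compl (f := fun e => ∏ i, k.ρ (e i)) (by fun_prop)
  rw [hJ] at hb
  refine (le_of_eq ?_).trans (hb.trans ?_)
  · congr 1
  · have hsub : Gᶜ ⊆ h.goodᶜ ∪ {e | δ ≤ |(1 / (L : ℝ)) * ∑ i, k.err (e i) - k.costEst|} := by
      intro e he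
      by_cases h1 : e ∈ h.good
      · right
        rw [Set.mem_ofPred_eq]
        by_contra h2
        exact he ⟨h1, (not_le.1 h2).le⟩
      · exact Or.inl h1
    have h3 : (Measure.pi fun _ : Fin L => k.J) Gᶜ ≤ ENNReal.ofReal ε + ENNReal.ofReal ε :=
      (measure_mono hsub).trans ((measure_union_le _ _).trans (add_le_add h.good_prob hdev))
    have h4 := ENNReal.ofReal_le_ofReal h.pow_le
    refine (add_le_add h3 h4).trans (le_of_eq ?_)
    rw [← ENNReal.ofReal_add hε hε, ← ENNReal.ofReal_add (by linarith) hε]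
    congr 1; ring

lemma Thresholds.decBad_le {k : CodeData Q N W T} (h : k.Thresholds L ε) {δ : ℝ}
    (hε : 0 ≤ ε) (hD1 : ∫⁻ a, ∫⁻ w, k.D (w, k.out a) ∂k.μW ∂(triLaw Q N k.μW) ≤ 1)
    (m : Fin h.M) :
    blkMeasure Q N k.μW k.μT L h.M ((h.code δ).decBad m) ≤ ENNReal.ofReal (2 * ε) := by
  have := k.measD
  have hsub : ((h.code δ).decBad m : Set (Blk W T L h.M)) ⊆
      {θ | ∏ i, k.D (θ.2.2.1 m i, k.out (θ.1 i, θ.2.2.1 m i, θ.2.1 i)) < h.t} ∪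
      ⋃ m' ∈ Finset.univ.erase m, {θ | h.t ≤
        ∏ i, k.D (θ.2.2.1 m' i, k.out (θ.1 i, θ.2.2.1 m i, θ.2.1 i))} := by
    rintro θ (h1 | ⟨m', hm', h1⟩)
    · left
      rw [Set.mem_ofPred_eq]
      by_contra h2
      exact h1 (not_lt.1 h2)
    · exact Or.inr (Set.mem_biUnion (Finset.mem_erase.2 ⟨hm', Finset.mem_univ _⟩) h1)
  refine (measure_mono hsub).trans ((measure_union_le _ _).trans ?_)
  rw [two_mul, ENNReal.ofReal_add hε hε]
  refine add_le_add ?_ ?_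
  · have hms : MeasurableSet {a : Fin L → ℝ × W × ℝ |
        ∏ i, k.D ((a i).2.1, k.out (a i)) < h.t} :=
      measurableSet_lt (by fun_prop) (by fun_prop)
    have h1 := h.right_le
    rwa [← (measurePreserving_tri Q N k.μW k.μT L h.M m).measure_preimage
      hms.nullMeasurableSet] at h1
  · by_cases ht : h.t = 0
    · have hM := h.t_zero ht
      have : Finset.univ.erase m = (∅ : Finset (Fin h.M)) := by
        ext j
        simp only [Finset.mem_erase, Finset.mem_univ, and_true, Finset.notMem_empty, iff_false,
          not_not]
        exact Fin.ext (by omega)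
      simp [this]
    · refine (measure_biUnion_finset_le _ _).trans (le_trans ?_ h.wrong_le)
      rw [← nsmul_eq_mul]
      refine (Finset.sum_le_card_nsmul _ _ (h.t⁻¹) fun m' hm' => ?_).trans (le_of_eq ?_)
      · have hb := packing_bound ((iidGaussian L Q).prod (iidGaussian L N))
          (Measure.pi fun _ : Fin L => k.μW) (M := h.M)
          (out := fun q i => k.out (q.1.1 i, q.2 i, q.1.2 i)) (by fun_prop)
          (D := fun p => ∏ i, k.D (p.1 i, p.2 i)) (by fun_prop) (k.lintegral_D_block hD1 L) ht
          h.t_ne_top (Finset.ne_of_mem_erase hm')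
        rw [← (measurePreserving_book Q N k.μW k.μT L h.M).measure_preimage
          (measurableSet_le (by fun_prop) (by fun_prop)).nullMeasurableSet] at hb
        exact hb
      · rw [Finset.card_erase_of_mem (Finset.mem_univ _), Finset.card_univ, Fintype.card_fin]

end CodeData

namespace CodeData

variable {Q N : ℝ≥0} {W T : Type*} [MeasurableSpace W] [MeasurableSpace T] (k : CodeData Q N W T)

lemma nonempty_thresholds_of_one (h : ∀ e, k.ρ e = 1) (L : ℕ) {ε : ℝ} (hε : 0 ≤ ε) :
    Nonempty (k.Thresholds L ε) :=
  ⟨{ M := 1, M_ne := ⟨one_ne_zero⟩, good := Set.univ, meas_good := MeasurableSet.univ,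
     good_prob := by simp, c := 1, c_nonneg := zero_le_one, c_le_one := le_rfl,
     dens_le := by simp [h], pow_le := by simpa using hε, t := 0, t_ne_top := ENNReal.zero_ne_top,
     wrong_le := by simp, t_zero := fun _ => rfl, right_le := by simp }⟩

lemma exists_nat_exp_lt {a ε : ℝ} (ha : 0 < a) (hε : 0 < ε) :
    ∃ L₀ : ℕ, ∀ L ≥ L₀, Real.exp (-(L * a)) ≤ ε := by
  have h : Filter.Tendsto (fun L : ℕ => Real.exp (-(L * a))) Filter.atTop (nhds 0) :=
    Real.tendsto_exp_neg_atTop_nhds_zero.comp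
      (tendsto_natCast_atTop_atTop.atTop_mul_const ha)
  obtain ⟨L₀, hL⟩ := Filter.eventually_atTop.1 (h.eventually_le_const hε)
  exact ⟨L₀, hL⟩

lemma exists_thresholds (hρi : Integrable (fun e => Real.log (k.ρ e).toReal) k.J)
    (hρ0 : 0 ≤ ∫ e, Real.log (k.ρ e).toReal ∂k.J)
    (hD0 : ∀ᵐ a ∂(triLaw Q N k.μW), k.D (a.2.1, k.out a) ≠ 0 ∧ k.D (a.2.1, k.out a) ≠ ∞)
    (hDi : Integrable (fun a => Real.log (k.D (a.2.1, k.out a)).toReal) (triLaw Q N k.μW))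
    (hlt : ∫ e, Real.log (k.ρ e).toReal ∂k.J
      < ∫ a, Real.log (k.D (a.2.1, k.out a)).toReal ∂(triLaw Q N k.μW))
    {ε : ℝ} (hε : 0 < ε) : ∃ L₀ : ℕ, ∀ L ≥ L₀, Nonempty (k.Thresholds L ε) := by
  have mρ := k.measρ
  have mD := k.measD
  set A := ∫ e, Real.log (k.ρ e).toReal ∂k.J with hA
  set B := ∫ a, Real.log (k.D (a.2.1, k.out a)).toReal ∂(triLaw Q N k.μW) with hB
  obtain ⟨R, hAR, hRB⟩ := exists_between hlt
  obtain ⟨τ, hAτ, hτR⟩ := exists_between hAR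
  obtain ⟨τ', hRτ', hτ'B⟩ := exists_between hRB
  have hρ : ∀ᵐ e ∂k.J, k.ρ e ≠ 0 ∧ k.ρ e ≠ ∞ := by
    have h1 : ∀ᵐ e ∂k.J, k.ρ e ≠ 0 := by
      unfold J
      rw [ae_withDensity_iff mρ]
      exact Filter.Eventually.of_forall fun e he => he
    have h2 : ∀ᵐ e ∂k.J, k.ρ e ≠ ∞ := by
      refine (withDensity_absolutelyContinuous _ _).ae_le ?_
      have : ∫⁻ e, k.ρ e ∂((triLaw Q N k.μW).prod k.μT) ≠ ∞ := by
        rw [lintegral_prod _ mρ.aemeasurable]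
        simp [k.lintegral_ρ]
      filter_upwards [ae_lt_top mρ this] with e he using he.ne
    filter_upwards [h1, h2] with e a b using ⟨a, b⟩
  obtain ⟨L₁, h1⟩ := prod_gt_small k.J mρ hρ hρi hAτ hε
  obtain ⟨L₂, h2⟩ := prod_lt_small (triLaw Q N k.μW) (ρ := fun a => k.D (a.2.1, k.out a))
    (by fun_prop) hD0 hDi hτ'B hε
  obtain ⟨L₃, h3⟩ := exists_nat_exp_lt (sub_pos.2 hRτ') hε
  obtain ⟨L₄, h4⟩ := exists_nat_exp_lt (sub_pos.2 hτR) hε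
  refine ⟨max (max L₁ L₂) (max L₃ L₄), fun L hL => ?_⟩
  have hL1 : L₁ ≤ L := (le_max_left _ _).trans ((le_max_left _ _).trans hL)
  have hL2 : L₂ ≤ L := (le_max_right _ _).trans ((le_max_left _ _).trans hL)
  have hL3 : L₃ ≤ L := (le_max_left _ _).trans ((le_max_right _ _).trans hL)
  have hL4 : L₄ ≤ L := (le_max_right _ _).trans ((le_max_right _ _).trans hL)
  have hM0 : 0 < ⌈Real.exp (L * R)⌉₊ := Nat.ceil_pos.2 (Real.exp_pos _)
  have hτ0 : 0 ≤ τ := hρ0.trans hAτ.le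
  have hc1 : Real.exp (-(L * τ)) ≤ 1 := by
    rw [Real.exp_le_one_iff]; have : 0 ≤ (L : ℝ) * τ := by positivity
    linarith
  refine ⟨{ M := ⌈Real.exp (L * R)⌉₊
            M_ne := ⟨hM0.ne'⟩
            good := {e | ∏ i, k.ρ (e i) ≤ ENNReal.ofReal (Real.exp (L * τ))}
            meas_good := measurableSet_le (by fun_prop) (by fun_prop)
            good_prob := ?_
            c := Real.exp (-(L * τ))
            c_nonneg := (Real.exp_pos _).le
            c_le_one := hc1
            dens_le := ?_
            pow_le := ?_
            t := ENNReal.ofReal (Real.exp (L * τ'))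
            t_ne_top := ENNReal.ofReal_ne_top
            wrong_le := ?_
            t_zero := fun h => absurd h (ENNReal.ofReal_pos.2 (Real.exp_pos _)).ne'
            right_le := h2 L hL2 }⟩
  · refine le_of_eq_of_le ?_ (h1 L hL1)
    congr 1; ext e; simp
  · intro e he
    calc _ ≤ ENNReal.ofReal (Real.exp (-(L * τ))) * ENNReal.ofReal (Real.exp (L * τ)) := by
          gcongr; exact he
      _ = 1 := by
          rw [← ENNReal.ofReal_mul (Real.exp_pos _).le, ← Real.exp_add]; simp
  · have hle : 1 - Real.exp (-(L * τ)) ≤ Real.exp (-Real.exp (-(L * τ))) := by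
      have := Real.add_one_le_exp (-Real.exp (-(L * τ))); linarith
    refine (pow_le_pow_left₀ (by linarith) hle _).trans ?_
    rw [← Real.exp_nat_mul]
    refine (Real.exp_le_exp.2 ?_).trans (h4 L hL4)
    have hceil := Nat.le_ceil (Real.exp (L * R))
    have h5 : (L : ℝ) * (R - τ) ≤ Real.exp (L * (R - τ)) := by
      have := Real.add_one_le_exp ((L : ℝ) * (R - τ)); linarith
    have h6 : Real.exp (L * (R - τ)) = Real.exp (L * R) * Real.exp (-(L * τ)) := by
      rw [← Real.exp_add]; congr 1; ring
    have h7 := mul_le_mul_of_nonneg_right hceil (Real.exp_pos (-(L * τ))).le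
    linarith
  · rw [← ENNReal.ofReal_inv_of_pos (Real.exp_pos _), ← Real.exp_neg, ← ENNReal.ofReal_natCast,
      ← ENNReal.ofReal_mul (Nat.cast_nonneg _)]
    refine ENNReal.ofReal_le_ofReal (le_trans ?_ (h3 L hL3))
    have hceil := Nat.ceil_lt_add_one (Real.exp_pos (L * R)).le
    have h5 : ((⌈Real.exp (L * R)⌉₊ - 1 : ℕ) : ℝ) ≤ Real.exp (L * R) := by
      rw [Nat.cast_sub hM0]; push_cast; linarith
    have h6 : Real.exp (-(L * (τ' - R))) = Real.exp (L * R) * Real.exp (-(L * τ')) := by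
      rw [← Real.exp_add]; congr 1; ring
    rw [h6]
    exact mul_le_mul_of_nonneg_right h5 (Real.exp_pos _).le

/-- Block codes drawn from single-letter data achieve its costs. -/
theorem achievable
    (hth : ∀ ε > 0, ∃ L₀ : ℕ, ∀ L ≥ L₀, Nonempty (k.Thresholds L ε))
    (hD1 : ∫⁻ a, ∫⁻ w, k.D (w, k.out a) ∂k.μW ∂(triLaw Q N k.μW) ≤ 1) :
    achievableFBNC Q N k.costInput k.costEst := by
  have mF := k.measF
  intro η hη
  set P := k.costInput with hP
  set S := k.costEst with hS
  set E := k.costState with hE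
  have hP0 : 0 ≤ P := integral_nonneg fun _ => sq_nonneg _
  have hS0 : 0 ≤ S := integral_nonneg fun _ => sq_nonneg _
  have hE0 : 0 ≤ E := integral_nonneg fun _ => sq_nonneg _
  have hQ0 : (0 : ℝ) ≤ Q := Q.2
  set C := 4 + 3 * (S + 2 * E + 2 * k.K ^ 2) with hC
  have hC0 : 0 < C := by positivity
  obtain ⟨B, hB⟩ := exists_nat_gt (3 * (S + E) / η)
  obtain ⟨R, hR⟩ := exists_nat_gt (3 * (B * (P + S + Q)) / η)
  set ε := η / (3 * C) with hε
  have hε0 : 0 < ε := by positivity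
  obtain ⟨L₁, h1⟩ := hth (ε / 3) (by positivity)
  obtain ⟨L₂, h2⟩ := lln_prob k.J k.measurable_err k.integrable_err hε0
    (show 0 < ε / 3 by positivity)
  obtain ⟨L₃, h3⟩ := lln_pi (triLaw Q N k.μW) (fun a => k.F (a.1, a.2.1) ^ 2) (by fun_prop)
    k.integrable_sq (ENNReal.ofReal ε) (ENNReal.ofReal_pos.2 hε0)
  obtain ⟨L₄, h4⟩ := lln_pi (triLaw Q N k.μW) (fun a => (a.1 + k.F (a.1, a.2.1)) ^ 2)
    (by fun_prop) k.integrable_state (ENNReal.ofReal ε) (ENNReal.ofReal_pos.2 hε0)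
  refine ⟨(B + 1) * (L₁ + L₂ + L₃ + L₄ + 1) + R + 1, fun n hn => ?_⟩
  have hdm := Nat.div_add_mod n (B + 1)
  have hrB : n % (B + 1) ≤ B := Nat.lt_succ_iff.1 (Nat.mod_lt _ (Nat.succ_pos _))
  have hLge : L₁ + L₂ + L₃ + L₄ + 1 ≤ n / (B + 1) := by
    rw [Nat.le_div_iff_mul_le (Nat.succ_pos _)]
    nlinarith
  have hnR : R ≤ n := by
    have : 0 ≤ (B + 1) * (L₁ + L₂ + L₃ + L₄ + 1) := Nat.zero_le _
    omega
  generalize n / (B + 1) = L at hdm hLge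
  generalize n % (B + 1) = r at hdm hrB
  subst hdm
  have hL : 0 < L := by omega
  obtain ⟨t⟩ := h1 L (by omega)
  have := t.M_ne
  obtain ⟨c, hc⟩ := (t.code ε).exists_design_bound (M := t.M) Q N k.μW k.μT B r
    (P := P) (S := S) (E := E) (K := k.K) (ε := ε) hL hP0 hS0 hE0 hε0.le k.uhat_le
    (fun q hq => hq.2)
    (fun m => by
      have := (measurePreserving_tri Q N k.μW k.μT L t.M m).lintegral_comp
        (f := fun a : Fin L → ℝ × W × ℝ => ENNReal.ofReal
          |(1 / (L : ℝ)) * ∑ i, k.F ((a i).1, (a i).2.1) ^ 2 - P|) (by fun_prop)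
      exact le_of_eq_of_le this (h3 L (by omega)))
    (fun m => by
      have := (measurePreserving_tri Q N k.μW k.μT L t.M m).lintegral_comp
        (f := fun a : Fin L → ℝ × W × ℝ => ENNReal.ofReal
          |(1 / (L : ℝ)) * ∑ i, ((a i).1 + k.F ((a i).1, (a i).2.1)) ^ 2 - E|) (by fun_prop)
      exact le_of_eq_of_le this (h4 L (by omega)))
    (fun m => (t.encBad_le (by positivity) (h2 L (by omega)) m).trans
      (ENNReal.ofReal_le_ofReal (by linarith)))
    (fun m => (t.decBad_le (by positivity) hD1 m).trans
      (ENNReal.ofReal_le_ofReal (by linarith)))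
  refine ⟨c, hc.trans (ENNReal.ofReal_le_ofReal ?_)⟩
  set n := (B + 1) * L + r with hndef
  have hn0 : (0 : ℝ) < n := by
    have : 0 < n := by positivity
    exact_mod_cast this
  rw [one_div, inv_mul_eq_div, div_le_iff₀ hn0]
  have hncast : (n : ℝ) = (B + 1) * L + r := by rw [hndef]; push_cast; ring
  have hCε : C * ε = η / 3 := by rw [hε]; field_simp
  rw [← hC, hCε]
  have hr : (r : ℝ) ≤ B := by exact_mod_cast hrB
  have hnR' : (R : ℝ) ≤ n := by exact_mod_cast hnR
  rw [div_lt_iff₀ hη] at hB hR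
  have hL0 : (0 : ℝ) ≤ L := Nat.cast_nonneg L
  have hB0 : (0 : ℝ) ≤ B := Nat.cast_nonneg B
  have hr0 : (0 : ℝ) ≤ r := Nat.cast_nonneg r
  have e1 : (L : ℝ) * (S + E) ≤ (L * B) * η / 3 := by nlinarith
  have e2 : (r : ℝ) * (P + S + Q) ≤ n * η / 3 := by
    have : (r : ℝ) * (P + S + Q) ≤ B * (P + S + Q) :=
      mul_le_mul_of_nonneg_right hr (by positivity)
    nlinarith
  have e3 : (L : ℝ) * B * η ≤ n * η := by
    refine mul_le_mul_of_nonneg_right ?_ hη.le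
    rw [hncast]; nlinarith
  have e4 : (L : ℝ) * (B + 1) * η ≤ n * η := by
    refine mul_le_mul_of_nonneg_right ?_ hη.le
    rw [hncast]; nlinarith
  linarith

end CodeData

/-- The achievable region is closed. -/
lemma achievable_of_tendsto {Q N : ℝ≥0} {P S : ℝ} {p s : ℕ → ℝ}
    (hp : Filter.Tendsto p Filter.atTop (nhds P)) (hs : Filter.Tendsto s Filter.atTop (nhds S))
    (h : ∀ᶠ i in Filter.atTop, achievableFBNC Q N (p i) (s i)) : achievableFBNC Q N P S := by
  intro ε hε
  have h1 := (Metric.tendsto_nhds.1 hp (ε / 4) (by positivity))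
  have h2 := (Metric.tendsto_nhds.1 hs (ε / 4) (by positivity))
  obtain ⟨i, hi, hi1, hi2⟩ := (h.and (h1.and h2)).exists
  obtain ⟨n₀, hn⟩ := hi (ε / 2) (by positivity)
  refine ⟨n₀, fun n hnn => ?_⟩
  obtain ⟨c, hc⟩ := hn n hnn
  refine ⟨c, ?_⟩
  rw [Real.dist_eq] at hi1 hi2
  calc _ ≤ ∫⁻ ω, (ENNReal.ofReal (|p i - costP (c.U1 ω)| + |s i - costS (c.X1 ω) (c.U2 ω)|)
        + ENNReal.ofReal (ε / 2)) ∂(base n Q N) := by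
        refine lintegral_mono fun ω => ?_
        rw [← ENNReal.ofReal_add (by positivity) (by positivity)]
        refine ENNReal.ofReal_le_ofReal ?_
        have a1 := abs_sub_le P (p i) (costP (c.U1 ω))
        have a2 := abs_sub_le S (s i) (costS (c.X1 ω) (c.U2 ω))
        rw [abs_sub_comm P (p i)] at a1
        rw [abs_sub_comm S (s i)] at a2
        linarith
    _ ≤ ENNReal.ofReal (ε / 2) + ENNReal.ofReal (ε / 2) := by
        rw [lintegral_add_right _ measurable_const]
        refine add_le_add hc ?_
        simp
    _ = ENNReal.ofReal ε := by
        rw [← ENNReal.ofReal_add (by positivity) (by positivity)]; congr 1; ring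

lemma klDiv_eq_klDiv {α : Type*} [MeasurableSpace α] (μ ν : Measure α)
    [IsProbabilityMeasure μ] [IsProbabilityMeasure ν] :
    klDiv μ ν = InformationTheory.klDiv μ ν := by
  simp [klDiv, InformationTheory.klDiv]

lemma klDiv_map_measurableEquiv {α β : Type*} [MeasurableSpace α] [MeasurableSpace β]
    (μ ν : Measure α) [IsFiniteMeasure μ] [IsFiniteMeasure ν] (e : α ≃ᵐ β) :
    InformationTheory.klDiv (μ.map e) (ν.map e) = InformationTheory.klDiv μ ν := by
  refine le_antisymm (InformationTheory.klDiv_map_le _ _ e.measurable) ?_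
  have := InformationTheory.klDiv_map_le (μ.map e) (ν.map e) e.symm.measurable
  rw [Measure.map_map e.symm.measurable e.measurable,
    Measure.map_map e.symm.measurable e.measurable] at this
  simpa using this

section Kernel

variable {α γ : Type*} [MeasurableSpace α] [MeasurableSpace γ]
  [MeasurableSpace.CountableOrCountablyGenerated α γ]
  (μ : Measure α) [IsFiniteMeasure μ] (κ η : Kernel α γ) [IsMarkovKernel κ] [IsMarkovKernel η]

lemma compProd_eq_withDensity_rnDeriv (h : ∀ᵐ a ∂μ, κ a ≪ η a) :
    μ ⊗ₘ κ = (μ ⊗ₘ η).withDensity (fun p => Kernel.rnDeriv κ η p.1 p.2) := by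
  have hm := Kernel.measurable_rnDeriv κ η
  ext s hs
  rw [Measure.compProd_apply hs, withDensity_apply _ hs, ← lintegral_indicator hs,
    Measure.lintegral_compProd (hm.indicator hs)]
  refine lintegral_congr_ae ?_
  filter_upwards [h] with a ha
  rw [← Kernel.setLIntegral_rnDeriv ha (hs.preimage measurable_prodMk_left),
    ← lintegral_indicator (hs.preimage measurable_prodMk_left)]
  rfl

lemma lintegral_klDiv_kernel :
    ∫⁻ a, InformationTheory.klDiv (κ a) (η a) ∂μ
      = InformationTheory.klDiv (μ ⊗ₘ κ) (μ ⊗ₘ η) := by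
  have hm := Kernel.measurable_rnDeriv κ η
  by_cases h : ∀ᵐ a ∂μ, κ a ≪ η a
  · rw [InformationTheory.klDiv_eq_lintegral_klFun_of_ac
      ((Measure.absolutelyContinuous_compProd_right_iff).2 h)]
    have h1 : (μ ⊗ₘ κ).rnDeriv (μ ⊗ₘ η) =ᵐ[μ ⊗ₘ η] fun p => Kernel.rnDeriv κ η p.1 p.2 := by
      rw [compProd_eq_withDensity_rnDeriv μ κ η h]
      exact Measure.rnDeriv_withDensity _ hm
    rw [lintegral_congr_ae (g := fun p : α × γ => ENNReal.ofReal
      (InformationTheory.klFun (Kernel.rnDeriv κ η p.1 p.2).toReal))]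
    · rw [Measure.lintegral_compProd (by
        exact (InformationTheory.measurable_klFun.comp hm.ennreal_toReal).ennreal_ofReal)]
      refine lintegral_congr_ae ?_
      filter_upwards [h] with a ha
      rw [InformationTheory.klDiv_eq_lintegral_klFun_of_ac ha]
      refine lintegral_congr_ae ?_
      filter_upwards [Kernel.rnDeriv_eq_rnDeriv_measure (κ := κ) (η := η) (a := a)] with x hx
      rw [hx]
    · filter_upwards [h1] with p hp
      rw [hp]
  · rw [InformationTheory.klDiv_of_not_ac
      (fun h' => h ((Measure.absolutelyContinuous_compProd_right_iff).1 h'))]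
    have hms := Kernel.measurableSet_absolutelyContinuous κ η
    rw [ae_iff] at h
    refine top_le_iff.1 ?_
    calc ⊤ = ⊤ * μ {a | ¬ κ a ≪ η a} := (ENNReal.top_mul h).symm
      _ = ∫⁻ a in {a | ¬ κ a ≪ η a}, ⊤ ∂μ := by simp
      _ ≤ ∫⁻ a in {a | ¬ κ a ≪ η a}, InformationTheory.klDiv (κ a) (η a) ∂μ := by
          refine lintegral_mono_ae ?_
          filter_upwards [ae_restrict_mem hms.compl] with a ha
          rw [InformationTheory.klDiv_of_not_ac ha]
      _ ≤ _ := setLIntegral_le_lintegral _ _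

end Kernel

section CondMutualInfo

variable {Ω α β γ : Type*} [MeasurableSpace Ω]
    [MeasurableSpace α] [StandardBorelSpace α] [Nonempty α]
    [MeasurableSpace β] [StandardBorelSpace β] [Nonempty β] [MeasurableSpace γ]
    (μ : Measure Ω) [IsProbabilityMeasure μ] {A : Ω → α} {B : Ω → β} {C : Ω → γ}

lemma compProd_comap_map_swap {α β γ : Type*} [MeasurableSpace α] [MeasurableSpace β]
    [MeasurableSpace γ] (ν : Measure γ) [SFinite ν] (κ : Kernel γ α) [IsSFiniteKernel κ]
    (η : Kernel γ β) [IsSFiniteKernel η] :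
    (ν ⊗ₘ (κ ×ₖ η)).map (fun p => ((p.1, p.2.2), p.2.1))
      = (ν ⊗ₘ η) ⊗ₘ κ.comap Prod.fst measurable_fst := by
  refine Measure.ext_of_lintegral _ fun f hf => ?_
  rw [lintegral_map hf (by fun_prop), Measure.lintegral_compProd (by fun_prop),
    Measure.lintegral_compProd (by fun_prop), Measure.lintegral_compProd (by fun_prop)]
  refine lintegral_congr fun c => ?_
  rw [Kernel.lintegral_prod _ _ _ (by fun_prop)]
  simp only [Kernel.comap_apply]
  rw [lintegral_lintegral_swap (by fun_prop)]

/-- Conditional mutual information as a single divergence. -/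
lemma condMutualInfo_eq (hA : Measurable A) (hB : Measurable B) (hC : Measurable C) :
    condMutualInfo μ A B C = InformationTheory.klDiv
      (μ.map fun ω => ((C ω, B ω), A ω))
      ((μ.map fun ω => (C ω, B ω)) ⊗ₘ (condDistrib A C μ).comap Prod.fst measurable_fst) := by
  have : IsProbabilityMeasure (μ.map C) := Measure.isProbabilityMeasure_map hC.aemeasurable
  unfold condMutualInfo
  have e : ∀ c, klDiv ((condDistrib (fun ω => (A ω, B ω)) C μ) c)
      (((condDistrib A C μ) c).prod ((condDistrib B C μ) c))
      = InformationTheory.klDiv ((condDistrib (fun ω => (A ω, B ω)) C μ) c)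
        ((condDistrib A C μ ×ₖ condDistrib B C μ) c) := fun c => by
    rw [klDiv_eq_klDiv, Kernel.prod_apply]
  simp_rw [e]
  rw [lintegral_klDiv_kernel, compProd_map_condDistrib (hA.prodMk hB).aemeasurable]
  let s : γ × (α × β) ≃ᵐ (γ × β) × α :=
    { toFun := fun p => ((p.1, p.2.2), p.2.1)
      invFun := fun p => (p.1.1, (p.2, p.1.2))
      left_inv := fun p => rfl
      right_inv := fun p => rfl
      measurable_toFun := by simp only [Equiv.coe_fn_mk]; fun_prop
      measurable_invFun := by simp only [Equiv.coe_fn_symm_mk]; fun_prop }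
  have : IsProbabilityMeasure (μ.map fun ω => (C ω, (A ω, B ω))) :=
    Measure.isProbabilityMeasure_map (by fun_prop)
  rw [← klDiv_map_measurableEquiv _ _ s]
  have h1 := compProd_comap_map_swap (μ.map C) (condDistrib A C μ) (condDistrib B C μ)
  rw [compProd_map_condDistrib hB.aemeasurable] at h1
  rw [← h1, Measure.map_map s.measurable (by fun_prop)]
  rfl

end CondMutualInfo

lemma klDiv_withDensity_ofReal {α : Type*} [MeasurableSpace α] {μ ν : Measure α}
    [IsProbabilityMeasure μ] [IsProbabilityMeasure ν] {f : α → ℝ} (hf : Measurable f)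
    (hf0 : ∀ a, 0 ≤ f a) (h : μ = ν.withDensity fun a => ENNReal.ofReal (f a))
    (hi : Integrable (fun a => Real.log (f a)) μ) :
    InformationTheory.klDiv μ ν = ENNReal.ofReal (∫ a, Real.log (f a) ∂μ) := by
  have hac : μ ≪ ν := h ▸ withDensity_absolutelyContinuous _ _
  have e : llr μ ν =ᵐ[μ] fun a => Real.log (f a) := by
    refine hac.ae_eq ?_
    have := Measure.rnDeriv_withDensity ν hf.ennreal_ofReal
    rw [← h] at this
    filter_upwards [this] with a ha
    rw [llr, ha, ENNReal.toReal_ofReal (hf0 a)]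
  rw [InformationTheory.klDiv_of_ac_of_integrable hac (hi.congr e.symm), integral_congr_ae e]
  simp

/-- The density of the channel output when the channel input has law `ν`. -/
def outDens (N : ℝ≥0) (ν : Measure ℝ) (y : ℝ) : ℝ := ∫ x, gaussianPDFReal x N y ∂ν

lemma gaussianPDFReal_le (N : ℝ≥0) (x y : ℝ) :
    gaussianPDFReal x N y ≤ (√(2 * Real.pi * N))⁻¹ := by
  rw [gaussianPDFReal]
  refine mul_le_of_le_one_right (by positivity) ?_
  rw [Real.exp_le_one_iff, neg_div]
  exact neg_nonpos.2 (by positivity)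

lemma continuous_gaussianPDFReal_uncurry (N : ℝ≥0) :
    Continuous fun p : ℝ × ℝ => gaussianPDFReal p.1 N p.2 := by
  unfold gaussianPDFReal
  fun_prop

lemma integrable_gaussianPDFReal_mean (N : ℝ≥0) (ν : Measure ℝ) [IsProbabilityMeasure ν] (y : ℝ) :
    Integrable (fun x => gaussianPDFReal x N y) ν := by
  refine Integrable.of_bound
    ((continuous_gaussianPDFReal_uncurry N).comp (by fun_prop : Continuous fun x : ℝ => (x, y))
      ).aestronglyMeasurable (√(2 * Real.pi * N))⁻¹ (ae_of_all _ fun x => ?_)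
  rw [Real.norm_of_nonneg (gaussianPDFReal_nonneg _ _ _)]
  exact gaussianPDFReal_le N x y

lemma continuous_outDens (N : ℝ≥0) (ν : Measure ℝ) [IsProbabilityMeasure ν] :
    Continuous (outDens N ν) := by
  refine continuous_of_dominated (bound := fun _ => (√(2 * Real.pi * N))⁻¹) (fun y =>
    (integrable_gaussianPDFReal_mean N ν y).1) (fun y => ae_of_all _ fun x => ?_)
    (integrable_const _) (ae_of_all _ fun x => ?_)
  · rw [Real.norm_of_nonneg (gaussianPDFReal_nonneg _ _ _)]
    exact gaussianPDFReal_le N x y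
  · exact (continuous_gaussianPDFReal_uncurry N).comp (by fun_prop : Continuous fun y : ℝ => (x, y))

lemma outDens_le (N : ℝ≥0) (ν : Measure ℝ) [IsProbabilityMeasure ν] (y : ℝ) :
    outDens N ν y ≤ (√(2 * Real.pi * N))⁻¹ := by
  calc outDens N ν y ≤ ∫ _, (√(2 * Real.pi * N))⁻¹ ∂ν :=
        integral_mono (integrable_gaussianPDFReal_mean N ν y) (integrable_const _)
          fun x => gaussianPDFReal_le N x y
    _ = _ := by simp

lemma outDens_pos {N : ℝ≥0} (hN : N ≠ 0) (ν : Measure ℝ) [IsProbabilityMeasure ν] (y : ℝ) :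
    0 < outDens N ν y := by
  refine (integral_pos_iff_support_of_nonneg (fun x => gaussianPDFReal_nonneg _ _ _)
    (integrable_gaussianPDFReal_mean N ν y)).2 ?_
  have : Function.support (fun x => gaussianPDFReal x N y) = Set.univ := by
    ext x; simp [(gaussianPDFReal_pos x N y hN).ne']
  rw [this]; simp

/-- Jensen's lower bound for the output density. -/
lemma le_log_outDens {N : ℝ≥0} (hN : N ≠ 0) (ν : Measure ℝ) [IsProbabilityMeasure ν]
    (hν : Integrable (fun x => x ^ 2) ν) (y : ℝ) :
    - Real.log √(2 * Real.pi * N) - (y ^ 2 + ∫ x, x ^ 2 ∂ν) / N ≤ Real.log (outDens N ν y) := by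
  have hN' : (0 : ℝ) < N := by positivity
  have hs : 0 < √(2 * Real.pi * N) := by positivity
  have e : outDens N ν y = (√(2 * Real.pi * N))⁻¹ * ∫ x, Real.exp (-(y - x) ^ 2 / (2 * N)) ∂ν := by
    rw [outDens, ← integral_const_mul]; rfl
  have hi : Integrable (fun x => Real.exp (-(y - x) ^ 2 / (2 * N))) ν := by
    have := (integrable_gaussianPDFReal_mean N ν y).const_mul (√(2 * Real.pi * N))
    refine this.congr (ae_of_all _ fun x => ?_)
    simp only [gaussianPDFReal]
    field_simp
  have hx : Integrable (fun x : ℝ => x) ν := by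
    refine ((integrable_const (1 : ℝ)).add hν).mono' (by fun_prop) (ae_of_all _ fun x => ?_)
    simp only [Pi.add_apply, Real.norm_eq_abs]
    nlinarith [sq_nonneg (|x| - 1), sq_abs x]
  have hg : Integrable (fun x => -(y - x) ^ 2 / (2 * N)) ν := by
    have : (fun x => -(y - x) ^ 2 / (2 * N))
        = fun x : ℝ => (-(1 / (2 * (N : ℝ)))) * (y ^ 2 - 2 * y * x + x ^ 2) := by
      funext x; field_simp; ring
    rw [this]
    exact (((integrable_const _).sub (hx.const_mul _)).add hν).const_mul _
  have hj : Real.exp (∫ x, -(y - x) ^ 2 / (2 * N) ∂ν)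
      ≤ ∫ x, Real.exp (-(y - x) ^ 2 / (2 * N)) ∂ν :=
    convexOn_exp.map_integral_le Real.continuous_exp.continuousOn isClosed_univ (by simp) hg hi
  have hb : - (y ^ 2 + ∫ x, x ^ 2 ∂ν) / N ≤ ∫ x, -(y - x) ^ 2 / (2 * N) ∂ν := by
    calc - (y ^ 2 + ∫ x, x ^ 2 ∂ν) / N = ∫ x, - (y ^ 2 + x ^ 2) / N ∂ν := by
          rw [integral_div, integral_neg, integral_add (integrable_const _) hν]; simp
      _ ≤ _ := by
          refine integral_mono (((integrable_const _).add hν).neg.div_const _) hg fun x => ?_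
          rw [div_le_div_iff₀ hN' (by positivity)]
          nlinarith [mul_nonneg hN'.le (sq_nonneg (y + x))]
  have hE : 0 < ∫ x, Real.exp (-(y - x) ^ 2 / (2 * N)) ∂ν := lt_of_lt_of_le (Real.exp_pos _) hj
  rw [e, Real.log_mul (by positivity) hE.ne', Real.log_inv]
  have := (Real.le_log_iff_exp_le hE).2 hj
  have h3 : - (y ^ 2 + ∫ x, x ^ 2 ∂ν) / N = -((y ^ 2 + ∫ x, x ^ 2 ∂ν) / N) := neg_div _ _
  linarith

lemma log_gaussianPDFReal {N : ℝ≥0} (hN : N ≠ 0) (x y : ℝ) :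
    Real.log (gaussianPDFReal x N y) = - Real.log √(2 * Real.pi * N) - (y - x) ^ 2 / (2 * N) := by
  have hN' : (0 : ℝ) < N := by positivity
  rw [gaussianPDFReal, Real.log_mul (by positivity) (Real.exp_pos _).ne', Real.log_inv,
    Real.log_exp]
  ring

lemma integrable_sq_gaussianReal (v : ℝ≥0) : Integrable (fun x : ℝ => x ^ 2) (gaussianReal 0 v) :=
  (memLp_id_gaussianReal' 2 (by simp)).integrable_sq

section Channel

variable {α : Type*} [MeasurableSpace α] (μA : Measure α) [IsProbabilityMeasure μA]
  {m : α → ℝ} {N : ℝ≥0}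

lemma lintegral_channel (hm : Measurable m) (hN : N ≠ 0) {f : α × ℝ → ℝ≥0∞} (hf : Measurable f) :
    ∫⁻ p, f p ∂((μA.prod (gaussianReal 0 N)).map fun p => (p.1, m p.1 + p.2))
      = ∫⁻ a, ∫⁻ y, ENNReal.ofReal (gaussianPDFReal (m a) N y) * f (a, y) ∂volume ∂μA := by
  rw [lintegral_map hf (by fun_prop), lintegral_prod _ (by fun_prop)]
  refine lintegral_congr fun a => ?_
  have : gaussianReal (m a) N = (gaussianReal 0 N).map (fun z => m a + z) := by
    rw [gaussianReal_map_const_add]; simp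
  rw [← lintegral_map (f := fun y => f (a, y)) (g := fun z => m a + z) (by fun_prop)
    (by fun_prop), ← this, gaussianReal_of_var_ne_zero _ hN,
    lintegral_withDensity_eq_lintegral_mul _ (measurable_gaussianPDF _ _) (by fun_prop)]
  rfl

lemma map_add_noise_eq_withDensity (hm : Measurable m) (hN : N ≠ 0) :
    (μA.prod (gaussianReal 0 N)).map (fun p => m p.1 + p.2)
      = volume.withDensity fun y => ENNReal.ofReal (outDens N (μA.map m) y) := by
  have : IsProbabilityMeasure (μA.map m) := Measure.isProbabilityMeasure_map hm.aemeasurable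
  refine Measure.ext_of_lintegral _ fun f hf => ?_
  have h1 := lintegral_channel μA hm hN (f := fun p => f p.2) (by fun_prop)
  rw [lintegral_map (by fun_prop) (by fun_prop)] at h1
  have hc := continuous_gaussianPDFReal_uncurry N
  rw [lintegral_map hf (by fun_prop), h1, lintegral_lintegral_swap,
    lintegral_withDensity_eq_lintegral_mul _ (continuous_outDens N _).measurable.ennreal_ofReal hf]
  · refine lintegral_congr fun y => ?_
    have hcy : Measurable fun a => ENNReal.ofReal (gaussianPDFReal (m a) N y) := by
      exact (hc.measurable.comp (hm.prodMk measurable_const)).ennreal_ofReal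
    dsimp only
    rw [lintegral_mul_const _ hcy, Pi.mul_apply, outDens, ofReal_integral_eq_lintegral_ofReal
      (integrable_gaussianPDFReal_mean N _ y) (ae_of_all _ fun x => gaussianPDFReal_nonneg _ _ _),
      lintegral_map _ hm]
    exact (hc.measurable.comp (by fun_prop : Measurable fun x : ℝ => (x, y))).ennreal_ofReal
  · exact ((hc.measurable.comp (by fun_prop : Measurable fun p : α × ℝ =>
      (m p.1, p.2))).ennreal_ofReal.mul (hf.comp measurable_snd)).aemeasurable

lemma map_channel_eq_withDensity (hm : Measurable m) (hN : N ≠ 0) :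
    (μA.prod (gaussianReal 0 N)).map (fun p => (p.1, m p.1 + p.2))
      = (μA.prod ((μA.prod (gaussianReal 0 N)).map fun p => m p.1 + p.2)).withDensity
        fun p => ENNReal.ofReal (gaussianPDFReal (m p.1) N p.2 / outDens N (μA.map m) p.2) := by
  have : IsProbabilityMeasure (μA.map m) := Measure.isProbabilityMeasure_map hm.aemeasurable
  have hc := continuous_gaussianPDFReal_uncurry N
  have hd := (continuous_outDens N (μA.map m)).measurable
  have hr : Measurable fun p : α × ℝ =>
      ENNReal.ofReal (gaussianPDFReal (m p.1) N p.2 / outDens N (μA.map m) p.2) :=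
    ((hc.measurable.comp (by fun_prop : Measurable fun p : α × ℝ =>
      (m p.1, p.2))).div (hd.comp measurable_snd)).ennreal_ofReal
  refine Measure.ext_of_lintegral _ fun f hf => ?_
  rw [lintegral_channel μA hm hN hf, lintegral_withDensity_eq_lintegral_mul _ hr hf,
    lintegral_prod _ (hr.mul hf).aemeasurable, map_add_noise_eq_withDensity μA hm hN]
  refine lintegral_congr fun a => ?_
  rw [lintegral_withDensity_eq_lintegral_mul _ hd.ennreal_ofReal
    (g := fun y => ((fun p : α × ℝ => ENNReal.ofReal
      (gaussianPDFReal (m p.1) N p.2 / outDens N (μA.map m) p.2)) * f) (a, y))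
    ((hr.mul hf).comp measurable_prodMk_left)]
  refine lintegral_congr fun y => ?_
  simp only [Pi.mul_apply]
  rw [← mul_assoc, ← ENNReal.ofReal_mul (outDens_pos hN _ y).le,
    mul_div_cancel₀ _ (outDens_pos hN _ y).ne']

lemma integrable_log_gaussianPDFReal (hN : N ≠ 0) :
    Integrable (fun z => Real.log (gaussianPDFReal 0 N z)) (gaussianReal 0 N) := by
  simp_rw [log_gaussianPDFReal hN, sub_zero]
  exact (integrable_const _).sub ((integrable_sq_gaussianReal N).div_const _)

lemma integrable_log_outDens (hm : Measurable m) (hN : N ≠ 0)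
    (hm2 : Integrable (fun a => m a ^ 2) μA) :
    Integrable (fun p : α × ℝ => Real.log (outDens N (μA.map m) (m p.1 + p.2)))
      (μA.prod (gaussianReal 0 N)) := by
  have : IsProbabilityMeasure (μA.map m) := Measure.isProbabilityMeasure_map hm.aemeasurable
  have hν : Integrable (fun x => x ^ 2) (μA.map m) := by
    rw [integrable_map_measure (by fun_prop) hm.aemeasurable]; exact hm2
  have h1 : Integrable (fun p : α × ℝ => m p.1 ^ 2) (μA.prod (gaussianReal 0 N)) := hm2.comp_fst _
  have h2 : Integrable (fun p : α × ℝ => p.2 ^ 2) (μA.prod (gaussianReal 0 N)) :=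
    (integrable_sq_gaussianReal N).comp_snd _
  have hN' : (0 : ℝ) < N := by positivity
  have hd := (continuous_outDens N (μA.map m)).measurable
  refine ((integrable_const (|Real.log √(2 * Real.pi * N)| + (∫ x, x ^ 2 ∂(μA.map m)) / N)).add
    ((h1.add h2).const_mul (2 / N))).mono' (hd.comp (by fun_prop)).log.aestronglyMeasurable
      (ae_of_all _ fun p => ?_)
  have hM : 0 ≤ ∫ x, x ^ 2 ∂(μA.map m) := integral_nonneg fun x => sq_nonneg x
  have hl := le_log_outDens hN (μA.map m) hν (m p.1 + p.2)
  have hu : Real.log (outDens N (μA.map m) (m p.1 + p.2)) ≤ - Real.log √(2 * Real.pi * N) := by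
    rw [← Real.log_inv]
    exact Real.log_le_log (outDens_pos hN _ _) (outDens_le N _ _)
  have hq : ((m p.1 + p.2) ^ 2 + ∫ x, x ^ 2 ∂(μA.map m)) / N
      ≤ (∫ x, x ^ 2 ∂(μA.map m)) / N + 2 / N * (m p.1 ^ 2 + p.2 ^ 2) := by
    rw [add_div, add_comm, div_mul_eq_mul_div]
    gcongr
    nlinarith [sq_nonneg (m p.1 - p.2)]
  have hq0 : 0 ≤ ((m p.1 + p.2) ^ 2 + ∫ x, x ^ 2 ∂(μA.map m)) / N := by positivity
  simp only [Pi.add_apply, Real.norm_eq_abs]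
  have h3 := neg_abs_le (Real.log √(2 * Real.pi * N))
  have h4 := le_abs_self (Real.log √(2 * Real.pi * N))
  rw [abs_le]
  constructor <;> linarith

/-- Mutual information across the additive Gaussian channel. -/
lemma klDiv_channel (hm : Measurable m) (hN : N ≠ 0) (hm2 : Integrable (fun a => m a ^ 2) μA) :
    InformationTheory.klDiv ((μA.prod (gaussianReal 0 N)).map fun p => (p.1, m p.1 + p.2))
      (μA.prod ((μA.prod (gaussianReal 0 N)).map fun p => m p.1 + p.2))
    = ENNReal.ofReal ((∫ z, Real.log (gaussianPDFReal 0 N z) ∂(gaussianReal 0 N))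
      - ∫ p, Real.log (outDens N (μA.map m) (m p.1 + p.2)) ∂(μA.prod (gaussianReal 0 N))) := by
  have : IsProbabilityMeasure (μA.map m) := Measure.isProbabilityMeasure_map hm.aemeasurable
  have : IsProbabilityMeasure ((μA.prod (gaussianReal 0 N)).map fun p => m p.1 + p.2) :=
    Measure.isProbabilityMeasure_map (by fun_prop)
  have : IsProbabilityMeasure ((μA.prod (gaussianReal 0 N)).map fun p => (p.1, m p.1 + p.2)) :=
    Measure.isProbabilityMeasure_map (by fun_prop)
  have hc := continuous_gaussianPDFReal_uncurry N
  have hd := (continuous_outDens N (μA.map m)).measurable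
  have hr : Measurable fun p : α × ℝ =>
      gaussianPDFReal (m p.1) N p.2 / outDens N (μA.map m) p.2 :=
    (hc.measurable.comp (by fun_prop : Measurable fun p : α × ℝ =>
      (m p.1, p.2))).div (hd.comp measurable_snd)
  have hZ : Integrable (fun p : α × ℝ => Real.log (gaussianPDFReal 0 N p.2))
      (μA.prod (gaussianReal 0 N)) := (integrable_log_gaussianPDFReal hN).comp_snd _
  have e : ∀ p : α × ℝ, Real.log (gaussianPDFReal (m p.1) N (m p.1 + p.2)
      / outDens N (μA.map m) (m p.1 + p.2))
      = Real.log (gaussianPDFReal 0 N p.2)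
        - Real.log (outDens N (μA.map m) (m p.1 + p.2)) := fun p => by
    rw [Real.log_div (gaussianPDFReal_pos _ _ _ hN).ne' (outDens_pos hN _ _).ne',
      log_gaussianPDFReal hN, log_gaussianPDFReal hN]
    congr 3; ring
  have hi := integrable_log_outDens μA hm hN hm2
  rw [klDiv_withDensity_ofReal hr (fun p => div_nonneg (gaussianPDFReal_nonneg _ _ _)
    (outDens_pos hN _ _).le) (map_channel_eq_withDensity μA hm hN)]
  · rw [integral_map (by fun_prop) hr.log.aestronglyMeasurable]
    simp_rw [e]
    rw [integral_sub hZ hi, integral_fun_snd (fun z => Real.log (gaussianPDFReal 0 N z))]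
    simp
  · rw [integrable_map_measure hr.log.aestronglyMeasurable (by fun_prop)]
    refine (hZ.sub hi).congr (ae_of_all _ fun p => ?_)
    simp only [Function.comp, e, Pi.sub_apply]

end Channel

namespace SLDecompFB

variable {Q N : ℝ≥0} {W : Type} [MeasurableSpace W] (d : SLDecompFB Q N W)

@[fun_prop] lemma measurable_sX0 : Measurable (sX0 : Space W → ℝ) := by unfold sX0; fun_prop
@[fun_prop] lemma measurable_sW : Measurable (sW : Space W → W) := by unfold sW; fun_prop
@[fun_prop] lemma measurable_sU1 : Measurable (sU1 : Space W → ℝ) := by unfold sU1; fun_prop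
@[fun_prop] lemma measurable_sZ : Measurable (sZ : Space W → ℝ) := by unfold sZ; fun_prop
@[fun_prop] lemma measurable_sU2 : Measurable (sU2 : Space W → ℝ) := by unfold sU2; fun_prop
@[fun_prop] lemma measurable_sX1 : Measurable (sX1 : Space W → ℝ) := by unfold sX1; fun_prop
@[fun_prop] lemma measurable_sY1 : Measurable (sY1 : Space W → ℝ) := by unfold sY1; fun_prop

/-- The joint law of source, auxiliary variable and control input. -/
def inputLaw : Measure ((ℝ × W) × ℝ) := ((gaussianReal 0 Q).prod d.μW) ⊗ₘ d.κ1

instance : IsProbabilityMeasure d.inputLaw := by unfold inputLaw; infer_instance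

/-- The joint law of source, auxiliary variable, control input and noise. -/
def preLaw : Measure (((ℝ × W) × ℝ) × ℝ) := d.inputLaw.prod (gaussianReal 0 N)

instance : IsProbabilityMeasure d.preLaw := by unfold preLaw; infer_instance

/-- Source, auxiliary variable and channel output. -/
def obsMap (q : ((ℝ × W) × ℝ) × ℝ) : (ℝ × W) × ℝ := ((q.1.1.1, q.1.1.2), q.1.1.1 + q.1.2 + q.2)

@[fun_prop] lemma measurable_obsMap : Measurable (obsMap : ((ℝ × W) × ℝ) × ℝ → (ℝ × W) × ℝ) := by
  unfold obsMap; fun_prop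

/-- The joint law of source, auxiliary variable and channel output. -/
def obsLaw : Measure ((ℝ × W) × ℝ) := d.preLaw.map obsMap

instance : IsProbabilityMeasure d.obsLaw := Measure.isProbabilityMeasure_map (by fun_prop)

lemma measure_eq : d.measure = d.preLaw ⊗ₘ d.κ2.comap obsMap measurable_obsMap := rfl

lemma map_fst_measure : d.measure.map Prod.fst = d.preLaw := by
  rw [measure_eq]; exact Measure.fst_compProd _ _

lemma map_obs_measure :
    d.measure.map (fun s => (obsMap s.1, s.2)) = d.obsLaw ⊗ₘ d.κ2 := by
  refine Measure.ext_of_lintegral _ fun f hf => ?_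
  rw [lintegral_map hf (by fun_prop), measure_eq, Measure.lintegral_compProd (by fun_prop),
    Measure.lintegral_compProd hf, obsLaw, lintegral_map (by fun_prop) (by fun_prop)]
  rfl

lemma integrable_x_sq_inputLaw : Integrable (fun q : (ℝ × W) × ℝ => q.1.1 ^ 2) d.inputLaw := by
  have h : d.inputLaw.map (fun q => q.1.1) = gaussianReal 0 Q := by
    have h1 : d.inputLaw.map Prod.fst = (gaussianReal 0 Q).prod d.μW := Measure.fst_compProd _ _
    have h2 : ((gaussianReal 0 Q).prod d.μW).map Prod.fst = gaussianReal 0 Q :=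
      Measure.fst_prod
    rw [← h2, ← h1, Measure.map_map measurable_fst measurable_fst]; rfl
  have := integrable_sq_gaussianReal Q
  rw [← h, integrable_map_measure (by fun_prop) (by fun_prop)] at this
  exact this

lemma integrable_input_sq (h : Integrable (fun q => (sU1 q) ^ 2) d.measure) :
    Integrable (fun q : (ℝ × W) × ℝ => (q.1.1 + q.2) ^ 2) d.inputLaw := by
  have hu : Integrable (fun q : (ℝ × W) × ℝ => q.2 ^ 2) d.inputLaw := by
    have e : d.inputLaw = d.measure.map (fun q => q.1.1) := by
      have : d.preLaw.map Prod.fst = d.inputLaw := Measure.fst_prod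
      rw [← this, ← d.map_fst_measure, Measure.map_map measurable_fst measurable_fst]; rfl
    rw [e, integrable_map_measure (by fun_prop) (by fun_prop)]
    exact h
  refine ((d.integrable_x_sq_inputLaw.const_mul 2).add (hu.const_mul 2)).mono'
    (by fun_prop) (ae_of_all _ fun q => ?_)
  rw [Real.norm_of_nonneg (sq_nonneg _)]
  simp only [Pi.add_apply]
  nlinarith [sq_nonneg (q.1.1 - q.2)]

/-- The joint law of the auxiliary variable and the channel output. -/
def auxLaw : Measure (W × ℝ) := d.obsLaw.map fun q => (q.1.2, q.2)

/-- The law of the channel output. -/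
def outLaw : Measure ℝ := d.obsLaw.map Prod.snd

instance : IsProbabilityMeasure d.auxLaw := Measure.isProbabilityMeasure_map (by fun_prop)

instance : IsProbabilityMeasure d.outLaw := Measure.isProbabilityMeasure_map (by fun_prop)

lemma map_sW : d.measure.map sW = d.μW := by
  have h1 : d.measure.map (fun q => q.1.1) = d.inputLaw := by
    have : d.preLaw.map Prod.fst = d.inputLaw := Measure.fst_prod
    rw [← this, ← d.map_fst_measure, Measure.map_map measurable_fst measurable_fst]; rfl
  have h2 : d.inputLaw.map Prod.fst = (gaussianReal 0 Q).prod d.μW := Measure.fst_compProd _ _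
  have h3 : ((gaussianReal 0 Q).prod d.μW).map Prod.snd = d.μW := Measure.snd_prod
  rw [← h3, ← h2, ← h1, Measure.map_map (by fun_prop) (by fun_prop),
    Measure.map_map (by fun_prop) (by fun_prop)]
  rfl

lemma map_obs : d.measure.map (fun s => obsMap s.1) = d.obsLaw := by
  rw [obsLaw, ← d.map_fst_measure, Measure.map_map (by fun_prop) (by fun_prop)]; rfl

lemma map_sY1 : d.measure.map sY1 = d.outLaw := by
  rw [outLaw, ← d.map_obs, Measure.map_map (by fun_prop) (by fun_prop)]; rfl

lemma map_sW_sY1 : d.measure.map (fun q => (sW q, sY1 q)) = d.auxLaw := by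
  rw [auxLaw, ← d.map_obs, Measure.map_map (by fun_prop) (by fun_prop)]; rfl

lemma mutualInfo_eq : mutualInfo d.measure sW sY1
    = InformationTheory.klDiv d.auxLaw (d.μW.prod d.outLaw) := by
  rw [mutualInfo, map_sW_sY1, map_sW, map_sY1, klDiv_eq_klDiv]

lemma map_inputLaw_aux : d.inputLaw.map (fun q => q.1.2) = d.μW := by
  have h2 : d.inputLaw.map Prod.fst = (gaussianReal 0 Q).prod d.μW := Measure.fst_compProd _ _
  have h3 : ((gaussianReal 0 Q).prod d.μW).map Prod.snd = d.μW := Measure.snd_prod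
  rw [← h3, ← h2, Measure.map_map (by fun_prop) (by fun_prop)]
  rfl

lemma outLaw_eq : d.outLaw = (d.inputLaw.prod (gaussianReal 0 N)).map
    (fun p => (p.1.1.1 + p.1.2) + p.2) := by
  rw [outLaw, obsLaw, Measure.map_map (by fun_prop) (by fun_prop)]; rfl

lemma mutualInfo_ne_top (hN : N ≠ 0) (h : Integrable (fun q => (sU1 q) ^ 2) d.measure) :
    mutualInfo d.measure sW sY1 ≠ ∞ := by
  have hk := klDiv_channel d.inputLaw (m := fun q => q.1.1 + q.2) (by fun_prop) hN
    (d.integrable_input_sq h)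
  rw [← d.outLaw_eq] at hk
  have : IsProbabilityMeasure ((d.inputLaw.prod (gaussianReal 0 N)).map
    fun p => (p.1, p.1.1.1 + p.1.2 + p.2)) := Measure.isProbabilityMeasure_map (by fun_prop)
  have hle := InformationTheory.klDiv_map_le
    ((d.inputLaw.prod (gaussianReal 0 N)).map fun p => (p.1, p.1.1.1 + p.1.2 + p.2))
    (d.inputLaw.prod d.outLaw) (g := Prod.map (fun q : (ℝ × W) × ℝ => q.1.2) id) (by fun_prop)
  rw [← Measure.map_prod_map _ _ (by fun_prop) (by fun_prop), map_inputLaw_aux, Measure.map_id,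
    Measure.map_map (by fun_prop) (by fun_prop)] at hle
  have e : d.auxLaw = (d.inputLaw.prod (gaussianReal 0 N)).map
      (Prod.map (fun q : (ℝ × W) × ℝ => q.1.2) id ∘ fun p => (p.1, p.1.1.1 + p.1.2 + p.2)) := by
    rw [auxLaw, obsLaw, Measure.map_map (by fun_prop) (by fun_prop)]; rfl
  rw [← e, hk, ← mutualInfo_eq] at hle
  exact ne_top_of_le_ne_top ENNReal.ofReal_ne_top hle

/-- The law of the estimate given auxiliary variable and channel output. -/
def estKernel : Kernel (W × ℝ) ℝ := condDistrib sU2 (fun q => (sW q, sY1 q)) d.measure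

instance : IsMarkovKernel d.estKernel := by unfold estKernel; infer_instance

/-- The projection forgetting the source. -/
def forget (q : (ℝ × W) × ℝ) : W × ℝ := (q.1.2, q.2)

@[fun_prop] lemma measurable_forget : Measurable (forget : (ℝ × W) × ℝ → W × ℝ) := by
  unfold forget; fun_prop

lemma condMutualInfo_eq_klDiv :
    condMutualInfo d.measure sU2 sX0 (fun q => (sW q, sY1 q))
      = InformationTheory.klDiv (d.obsLaw ⊗ₘ d.κ2)
        (d.obsLaw ⊗ₘ d.estKernel.comap forget measurable_forget) := by
  rw [condMutualInfo_eq _ (by fun_prop) (by fun_prop) (by fun_prop)]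
  let s : ((ℝ × W) × ℝ) × ℝ ≃ᵐ ((W × ℝ) × ℝ) × ℝ :=
    { toFun := fun p => (((p.1.1.2, p.1.2), p.1.1.1), p.2)
      invFun := fun p => (((p.1.2, p.1.1.1), p.1.1.2), p.2)
      left_inv := fun p => rfl
      right_inv := fun p => rfl
      measurable_toFun := by simp only [Equiv.coe_fn_mk]; fun_prop
      measurable_invFun := by simp only [Equiv.coe_fn_symm_mk]; fun_prop }
  rw [← klDiv_map_measurableEquiv (d.obsLaw ⊗ₘ d.κ2) _ s]
  congr 1
  · rw [← d.map_obs_measure, Measure.map_map s.measurable (by fun_prop)]; rfl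
  · refine Measure.ext_of_lintegral _ fun f hf => ?_
    rw [Measure.lintegral_compProd hf, lintegral_map (by fun_prop) (by fun_prop),
      lintegral_map hf s.measurable, Measure.lintegral_compProd (by fun_prop), ← d.map_obs,
      lintegral_map (by fun_prop) (by fun_prop)]
    rfl

end SLDecompFB

section UnitInterval

open scoped unitInterval

/-- A biased coin. -/
def coin (δ : I) : Measure Bool :=
  ENNReal.ofReal (1 - δ) • Measure.dirac true + ENNReal.ofReal δ • Measure.dirac false

instance (δ : I) : IsProbabilityMeasure (coin δ) := by
  constructor
  simp only [coin, Measure.coe_add, Measure.coe_smul, Pi.add_apply, Pi.smul_apply, measure_univ,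
    smul_eq_mul, mul_one]
  rw [← ENNReal.ofReal_add (by linarith [δ.2.2]) δ.2.1]; simp

namespace SLDecompFB

variable {Q N : ℝ≥0} {W : Type} [MeasurableSpace W]

/-- Functional representation of the kernels of a single-letter decomposition; `r` is the density
of `P_{U₂|X₀,W₁,Y₁}` with respect to `P_{U₂|W₁,Y₁}`. -/
structure Rep (d : SLDecompFB Q N W) where
  F : ℝ × W → I → ℝ
  measF : Measurable (Function.uncurry F)
  mapF : ∀ a, (volume : Measure I).map (F a) = d.κ1 a
  φ : W × ℝ → I → ℝ
  measφ : Measurable (Function.uncurry φ)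
  mapφ : ∀ a, (volume : Measure I).map (φ a) = d.estKernel a
  r : ((ℝ × W) × ℝ) × ℝ → ℝ≥0∞
  measr : Measurable r
  lintegral_r : ∀ q, ∫⁻ u, r (q, u) ∂(d.estKernel (forget q)) = 1
  r_ae : ∀ᵐ q ∂d.obsLaw, d.κ2 q = (d.estKernel (forget q)).withDensity fun u => r (q, u)

lemma exists_rep_one (d : SLDecompFB Q N W)
    (h : ∀ᵐ q ∂d.obsLaw, d.κ2 q = d.estKernel (forget q)) : ∃ R : d.Rep, ∀ q, R.r q = 1 := by
  obtain ⟨F, hF, hF'⟩ := d.κ1.exists_measurable_map_eq_unitInterval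
  obtain ⟨φ, hφ, hφ'⟩ := d.estKernel.exists_measurable_map_eq_unitInterval
  exact ⟨⟨F, hF, hF', φ, hφ, hφ', fun _ => 1, measurable_const, by simp, by
    filter_upwards [h] with q hq
    rw [hq]; exact withDensity_one.symm⟩, fun _ => rfl⟩

lemma exists_rep (d : SLDecompFB Q N W)
    (h : ∀ᵐ q ∂d.obsLaw, d.κ2 q ≪ d.estKernel (forget q)) : Nonempty d.Rep := by
  classical
  obtain ⟨F, hF, hF'⟩ := d.κ1.exists_measurable_map_eq_unitInterval
  obtain ⟨φ, hφ, hφ'⟩ := d.estKernel.exists_measurable_map_eq_unitInterval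
  set β := d.estKernel.comap forget measurable_forget with hβ
  set B : Set ((ℝ × W) × ℝ) := {q | d.κ2 q ≪ β q} with hB
  have hBm : MeasurableSet B := Kernel.measurableSet_absolutelyContinuous d.κ2 β
  refine ⟨⟨F, hF, hF', φ, hφ, hφ',
    fun p => if p.1 ∈ B then Kernel.rnDeriv d.κ2 β p.1 p.2 else 1,
    Measurable.ite (measurable_fst hBm) (Kernel.measurable_rnDeriv _ _) measurable_const, ?_, ?_⟩⟩
  · intro q
    by_cases hq : q ∈ B
    · simp only [hq, if_true]
      have := Kernel.lintegral_rnDeriv (κ := d.κ2) (η := β) (a := q) hq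
      rw [measure_univ] at this
      exact this
    · simp [hq]
  · filter_upwards [h] with q hq
    have hq' : q ∈ B := hq
    simp only [hq', if_true]
    have := Kernel.withDensity_rnDeriv_eq (κ := d.κ2) (η := β) (a := q) hq
    rw [Kernel.withDensity_apply _ (Kernel.measurable_rnDeriv _ _)] at this
    exact this.symm

namespace Rep

variable {d : SLDecompFB Q N W} (R : d.Rep)

lemma compProd_eq : d.obsLaw ⊗ₘ d.κ2
    = (d.obsLaw ⊗ₘ d.estKernel.comap forget measurable_forget).withDensity R.r := by
  have := R.measr
  refine Measure.ext_of_lintegral _ fun f hf => ?_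
  rw [lintegral_withDensity_eq_lintegral_mul _ R.measr hf, Measure.lintegral_compProd hf,
    Measure.lintegral_compProd (R.measr.mul hf)]
  refine lintegral_congr_ae ?_
  filter_upwards [R.r_ae] with q hq
  rw [hq, lintegral_withDensity_eq_lintegral_mul _ (by fun_prop) (by fun_prop)]
  rfl

/-- The density `r` as a function on the canonical space. -/
def dens (s : Space W) : ℝ≥0∞ := R.r (obsMap s.1, s.2)

@[fun_prop] lemma measurable_dens : Measurable R.dens := by
  have := R.measr; unfold dens; fun_prop

lemma integrable_log_dens
    (h : condMutualInfo d.measure sU2 sX0 (fun q => (sW q, sY1 q)) ≠ ∞) :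
    Integrable (fun s => Real.log (R.dens s).toReal) d.measure ∧
    (condMutualInfo d.measure sU2 sX0 (fun q => (sW q, sY1 q))).toReal
      = ∫ s, Real.log (R.dens s).toReal ∂d.measure := by
  have mr := R.measr
  rw [condMutualInfo_eq_klDiv] at h ⊢
  obtain ⟨hac, hi⟩ := InformationTheory.klDiv_ne_top_iff.1 h
  have e : llr (d.obsLaw ⊗ₘ d.κ2) (d.obsLaw ⊗ₘ d.estKernel.comap forget measurable_forget)
      =ᵐ[d.obsLaw ⊗ₘ d.κ2] fun p => Real.log (R.r p).toReal := by
    refine hac.ae_eq ?_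
    rw [R.compProd_eq]
    filter_upwards [Measure.rnDeriv_withDensity
      (d.obsLaw ⊗ₘ d.estKernel.comap forget measurable_forget) R.measr] with p hp
    rw [llr, hp]
  rw [InformationTheory.toReal_klDiv_of_measure_eq hac (by simp), integral_congr_ae e]
  replace hi := hi.congr e
  rw [← d.map_obs_measure] at hi ⊢
  rw [integrable_map_measure mr.ennreal_toReal.log.aestronglyMeasurable (by fun_prop)] at hi
  refine ⟨hi, ?_⟩
  rw [integral_map (by fun_prop) mr.ennreal_toReal.log.aestronglyMeasurable]
  rfl

/-- The density of the joint law of auxiliary variable and output. -/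
def auxDens (d : SLDecompFB Q N W) : W × ℝ → ℝ≥0∞ := d.auxLaw.rnDeriv (d.μW.prod d.outLaw)

/-- Truncation to `[-K, K]`. -/
def clip (K u : ℝ) : ℝ := max (-K) (min K u)

lemma abs_clip_le {K : ℝ} (hK : 0 ≤ K) (u : ℝ) : |clip K u| ≤ K := by
  unfold clip
  rw [abs_le]
  exact ⟨le_max_left _ _, max_le (by linarith) (min_le_left _ _)⟩

@[fun_prop] lemma measurable_clip (K : ℝ) : Measurable (clip K) := by unfold clip; fun_prop

variable (δ : I) (K : ℝ≥0)

lemma lintegral_triLaw {G : ((ℝ × W) × ℝ) × ℝ → ℝ≥0∞} (hG : Measurable G) (g : Bool → ℝ≥0∞) :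
    ∫⁻ a : ℝ × ((W × I) × Bool) × ℝ, g a.2.1.2 * G (((a.1, a.2.1.1.1),
        R.F (a.1, a.2.1.1.1) a.2.1.1.2), a.2.2)
      ∂(triLaw Q N ((d.μW.prod (volume : Measure I)).prod (coin δ)))
      = (∫⁻ b, g b ∂(coin δ)) * ∫⁻ q, G q ∂d.preLaw := by
  have mF := R.measF
  have mF' : Measurable fun a : ℝ × ((W × I) × Bool) × ℝ =>
      R.F (a.1, a.2.1.1.1) a.2.1.1.2 :=
    mF.comp (by fun_prop : Measurable fun a : ℝ × ((W × I) × Bool) × ℝ =>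
      ((a.1, a.2.1.1.1), a.2.1.1.2))
  have mg : Measurable g := by fun_prop
  have mF3 : Measurable fun a : (ℝ × W) × I => R.F (a.1.1, a.1.2) a.2 :=
    mF.comp (by fun_prop : Measurable fun a : (ℝ × W) × I => ((a.1.1, a.1.2), a.2))
  have inner : ∀ x w, ∫⁻ v, ∫⁻ z, G (((x, w), R.F (x, w) v), z) ∂gaussianReal 0 N ∂volume
      = ∫⁻ u, ∫⁻ z, G (((x, w), u), z) ∂gaussianReal 0 N ∂(d.κ1 (x, w)) := fun x w => by
    have mx : Measurable (R.F (x, w)) := mF.comp measurable_prodMk_left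
    rw [← R.mapF, lintegral_map (by fun_prop) mx]
  have m0 : Measurable fun a : ℝ × W =>
      ∫⁻ u, ∫⁻ z, G ((a, u), z) ∂gaussianReal 0 N ∂(d.κ1 a) :=
    Measurable.lintegral_kernel_prod_right' (f := fun p : (ℝ × W) × ℝ =>
      ∫⁻ z, G ((p.1, p.2), z) ∂gaussianReal 0 N) (by fun_prop)
  rw [preLaw, inputLaw, lintegral_prod _ hG.aemeasurable, Measure.lintegral_compProd (by fun_prop),
    lintegral_prod _ m0.aemeasurable]
  rw [triLaw, lintegral_prod _ (by fun_prop), ← lintegral_const_mul _ (m0.lintegral_prod_right')]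
  refine lintegral_congr fun x => ?_
  have mFx : Measurable fun a : ((W × I) × Bool) × ℝ => R.F (x, a.1.1.1) a.1.1.2 :=
    mF.comp (by fun_prop : Measurable fun a : ((W × I) × Bool) × ℝ => ((x, a.1.1.1), a.1.1.2))
  have mFx2 : Measurable fun a : (W × I) × ℝ => R.F (x, a.1.1) a.1.2 :=
    mF.comp (by fun_prop : Measurable fun a : (W × I) × ℝ => ((x, a.1.1), a.1.2))
  dsimp only
  have e1 : ∀ a : (W × I) × Bool, ∫⁻ z, g a.2 * G (((x, a.1.1), R.F (x, a.1.1) a.1.2), z)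
      ∂gaussianReal 0 N
      = g a.2 * ∫⁻ z, G (((x, a.1.1), R.F (x, a.1.1) a.1.2), z) ∂gaussianReal 0 N := fun a =>
    lintegral_const_mul _ (by fun_prop)
  have m1 : Measurable fun a : W × I =>
      ∫⁻ z, G (((x, a.1), R.F (x, a.1) a.2), z) ∂gaussianReal 0 N :=
    Measurable.lintegral_prod_right' (f := fun p : (W × I) × ℝ =>
      G (((x, p.1.1), R.F (x, p.1.1) p.1.2), p.2)) (by fun_prop)
  rw [lintegral_prod _ (by fun_prop)]
  simp only [e1]
  rw [lintegral_prod _ (by fun_prop)]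
  have e2 : ∀ a : W × I, ∫⁻ b, g b * ∫⁻ z, G (((x, a.1), R.F (x, a.1) a.2), z) ∂gaussianReal 0 N
      ∂(coin δ) = (∫⁻ b, g b ∂(coin δ)) *
        ∫⁻ z, G (((x, a.1), R.F (x, a.1) a.2), z) ∂gaussianReal 0 N := fun a =>
    lintegral_mul_const _ mg
  simp only [e2]
  rw [lintegral_const_mul _ m1, lintegral_prod _ m1.aemeasurable]
  simp only [inner]

end Rep

end SLDecompFB

namespace SLDecompFB.Rep

variable {Q N : ℝ≥0} {W : Type} [MeasurableSpace W] {d : SLDecompFB Q N W} (R : d.Rep)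
  (δ : I) (K : ℝ≥0)

/-- The law of the enriched auxiliary variable: the auxiliary variable, the seed of the control
kernel and a coin deciding whether the letter is quantized. -/
def auxMeasure (d : SLDecompFB Q N W) (δ : I) : Measure ((W × I) × Bool) :=
  (d.μW.prod (volume : Measure I)).prod (coin δ)

instance : IsProbabilityMeasure (auxMeasure d δ) := by unfold auxMeasure; infer_instance

/-- The canonical coordinates of a letter. -/
def letter (a : ℝ × ((W × I) × Bool) × ℝ) : ((ℝ × W) × ℝ) × ℝ :=
  (((a.1, a.2.1.1.1), R.F (a.1, a.2.1.1.1) a.2.1.1.2), a.2.2)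

@[fun_prop] lemma measurable_letter : Measurable R.letter := by
  have mF' : Measurable fun a : ℝ × ((W × I) × Bool) × ℝ =>
      R.F (a.1, a.2.1.1.1) a.2.1.1.2 :=
    R.measF.comp (by fun_prop : Measurable fun a : ℝ × ((W × I) × Bool) × ℝ =>
      ((a.1, a.2.1.1.1), a.2.1.1.2))
  unfold letter
  fun_prop

/-- The canonical coordinates of a letter together with its quantization letter. -/
def fullLetter (e : (ℝ × ((W × I) × Bool) × ℝ) × I) : Space W :=
  (R.letter e.1, R.φ (forget (obsMap (R.letter e.1))) e.2)

@[fun_prop] lemma measurable_fullLetter : Measurable R.fullLetter := by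
  have : Measurable fun e : (ℝ × ((W × I) × Bool) × ℝ) × I =>
      R.φ (forget (obsMap (R.letter e.1))) e.2 :=
    R.measφ.comp (by fun_prop : Measurable fun e : (ℝ × ((W × I) × Bool) × ℝ) × I =>
      (forget (obsMap (R.letter e.1)), e.2))
  unfold fullLetter
  fun_prop

/-- The set of letters whose coin shows `b`. -/
def coinSet (W : Type) (b : Bool) : Set (ℝ × ((W × I) × Bool) × ℝ) := {a | a.2.1.2 = b}

lemma measurableSet_coinSet (b : Bool) : MeasurableSet (coinSet W b) :=
  measurableSet_eq_fun (by fun_prop) measurable_const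

lemma map_restrict_letter (b : Bool) :
    ((triLaw Q N (auxMeasure d δ)).restrict (coinSet W b)).map R.letter
      = (coin δ {b}) • d.preLaw := by
  refine Measure.ext_of_lintegral _ fun f hf => ?_
  rw [lintegral_map hf (by fun_prop), lintegral_smul_measure,
    ← lintegral_indicator (measurableSet_coinSet b), smul_eq_mul]
  have := R.lintegral_triLaw δ hf (Set.indicator {b} 1)
  rw [lintegral_indicator_one (MeasurableSet.singleton b)] at this
  rw [← this]
  refine lintegral_congr fun a => ?_
  by_cases h : a.2.1.2 = b
  · rw [Set.indicator_of_mem (show a ∈ coinSet W b from h),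
      Set.indicator_of_mem (show a.2.1.2 ∈ ({b} : Set Bool) from h)]
    simp [letter]
  · rw [Set.indicator_of_notMem (show a ∉ coinSet W b from h),
      Set.indicator_of_notMem (show a.2.1.2 ∉ ({b} : Set Bool) from h)]
    simp

lemma map_letter : (triLaw Q N (auxMeasure d δ)).map R.letter = d.preLaw := by
  refine Measure.ext_of_lintegral _ fun f hf => ?_
  rw [lintegral_map hf (by fun_prop)]
  have := R.lintegral_triLaw δ hf (fun _ => 1)
  simp only [one_mul, lintegral_const, measure_univ] at this
  exact this

lemma coin_true : coin δ {true} = ENNReal.ofReal (1 - δ) := by simp [coin]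

lemma coin_false : coin δ {false} = ENNReal.ofReal δ := by simp [coin]

lemma measurable_ctrl_sq : Measurable fun q : ((ℝ × W) × ℝ) × ℝ => q.1.2 ^ 2 := by fun_prop

lemma sq_integrable (h : Integrable (fun q => (sU1 q) ^ 2) d.measure) :
    Integrable (fun q : ((ℝ × W) × ℝ) × ℝ => q.1.2 ^ 2) d.preLaw := by
  rw [← d.map_fst_measure, integrable_map_measure measurable_ctrl_sq.aestronglyMeasurable
    (by fun_prop)]
  exact h

/-- The code data extracted from a single-letter decomposition. -/
def code (h : Integrable (fun q => (sU1 q) ^ 2) d.measure) :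
    CodeData Q N ((W × I) × Bool) I where
  μW := auxMeasure d δ
  probW := inferInstance
  μT := volume
  probT := inferInstance
  F q := R.F (q.1, q.2.1.1) q.2.1.2
  measF := R.measF.comp (by fun_prop : Measurable fun q : ℝ × (W × I) × Bool =>
      ((q.1, q.2.1.1), q.2.1.2))
  uhat q := if q.1.2 = true then clip K (R.φ (q.1.1.1, q.2.1) q.2.2) else 0
  meas_uhat := by
    have := R.measφ.comp (by fun_prop : Measurable fun q : ((W × I) × Bool) × ℝ × I =>
      ((q.1.1.1, q.2.1), q.2.2))
    exact Measurable.ite (measurableSet_eq_fun (by fun_prop) measurable_const)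
      ((measurable_clip K).comp this) measurable_const
  K := K
  uhat_le q := by
    split_ifs
    · exact abs_clip_le K.2 _
    · simp
  ρ e := if e.1.2.1.2 = true then R.dens (R.fullLetter e) else 1
  measρ := Measurable.ite (measurableSet_eq_fun (by fun_prop) measurable_const) (by fun_prop)
    measurable_const
  lintegral_ρ a := by
    by_cases hc : a.2.1.2 = true
    · simp only [hc, if_true]
      have := R.lintegral_r (obsMap (R.letter a))
      have mr := R.measr
      have mφ : Measurable (R.φ (forget (obsMap (R.letter a)))) :=
        R.measφ.comp measurable_prodMk_left
      rw [← R.mapφ, lintegral_map (by fun_prop) mφ] at this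
      exact this
    · simp [hc]
  D q := auxDens d (q.1.1.1, q.2)
  measD := (Measure.measurable_rnDeriv _ _).comp (by fun_prop :
    Measurable fun q : ((W × I) × Bool) × ℝ => (q.1.1.1, q.2))
  integrable_sq := by
    have := sq_integrable h
    rw [← R.map_letter δ, integrable_map_measure measurable_ctrl_sq.aestronglyMeasurable
      (by fun_prop)] at this
    exact this

variable (h : Integrable (fun q => (sU1 q) ^ 2) d.measure)

lemma map_restrict_fullLetter :
    ((R.code δ K h).J.restrict (Prod.fst ⁻¹' coinSet W true)).map R.fullLetter
      = (ENNReal.ofReal (1 - δ)) • d.measure := by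
  have mr := R.measr
  have mρ := (R.code δ K h).measρ
  refine Measure.ext_of_lintegral _ fun f hf => ?_
  have ms : MeasurableSet (Prod.fst ⁻¹' coinSet W true : Set ((ℝ × ((W × I) × Bool) × ℝ) × I)) :=
    measurable_fst (measurableSet_coinSet true)
  rw [lintegral_map hf (by fun_prop), ← lintegral_indicator ms, CodeData.J,
    lintegral_withDensity_eq_lintegral_mul _ mρ ((by fun_prop : Measurable fun e =>
      f (R.fullLetter e)).indicator ms), lintegral_prod _ (mρ.mul ((by fun_prop : Measurable fun e =>
      f (R.fullLetter e)).indicator ms)).aemeasurable]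
  set G : ((ℝ × W) × ℝ) × ℝ → ℝ≥0∞ := fun q =>
    ∫⁻ u, R.r (obsMap q, u) * f (q, u) ∂(d.estKernel.comap (fun q => forget (obsMap q))
      (by fun_prop)) q with hG
  have mG : Measurable G := Measurable.lintegral_kernel_prod_right'
    (f := fun p : (((ℝ × W) × ℝ) × ℝ) × ℝ => R.r (obsMap p.1, p.2) * f (p.1, p.2)) (by fun_prop)
  have e1 : ∀ a, ∫⁻ t, ((R.code δ K h).ρ * (Prod.fst ⁻¹' coinSet W true).indicator
      fun e => f (R.fullLetter e)) (a, t) ∂(R.code δ K h).μT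
      = (coinSet W true).indicator (fun a => G (R.letter a)) a := fun a => by
    by_cases hc : a.2.1.2 = true
    · rw [Set.indicator_of_mem (show a ∈ coinSet W true from hc), hG]
      have mφ : Measurable (R.φ (forget (obsMap (R.letter a)))) :=
        R.measφ.comp measurable_prodMk_left
      simp only [Kernel.comap_apply]
      rw [← R.mapφ, lintegral_map (by fun_prop) mφ]
      refine lintegral_congr fun t => ?_
      rw [Pi.mul_apply, Set.indicator_of_mem
        (show (a, t) ∈ Prod.fst ⁻¹' coinSet W true from hc)]
      simp [code, hc, dens, fullLetter]
    · rw [Set.indicator_of_notMem (show a ∉ coinSet W true from hc)]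
      have : ∀ t, ((R.code δ K h).ρ * (Prod.fst ⁻¹' coinSet W true).indicator
          fun e => f (R.fullLetter e)) (a, t) = 0 := fun t => by
        rw [Pi.mul_apply, Set.indicator_of_notMem
          (show (a, t) ∉ Prod.fst ⁻¹' coinSet W true from hc), mul_zero]
      simp only [this, lintegral_zero]
  simp only [e1]
  rw [lintegral_indicator (measurableSet_coinSet true), ← lintegral_map mG (by fun_prop)]
  change ∫⁻ q, G q ∂((triLaw Q N (auxMeasure d δ)).restrict (coinSet W true)).map R.letter = _
  rw [map_restrict_letter, coin_true, lintegral_smul_measure, lintegral_smul_measure, measure_eq,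
    Measure.lintegral_compProd hf]
  congr 1
  have := ae_of_ae_map (by fun_prop) R.r_ae
  refine lintegral_congr_ae ?_
  filter_upwards [this] with q hq
  rw [hG, Kernel.comap_apply, hq]
  simp only [Kernel.comap_apply]
  rw [lintegral_withDensity_eq_lintegral_mul _ (by fun_prop) (by fun_prop)]
  rfl

lemma costInput_code : (R.code δ K h).costInput = ∫ q, (sU1 q) ^ 2 ∂d.measure := by
  have e : ∫ q, (sU1 q) ^ 2 ∂d.measure = ∫ q : ((ℝ × W) × ℝ) × ℝ, q.1.2 ^ 2 ∂d.preLaw := by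
    rw [← d.map_fst_measure, integral_map (by fun_prop) measurable_ctrl_sq.aestronglyMeasurable]; rfl
  rw [e, ← R.map_letter δ, integral_map (by fun_prop) measurable_ctrl_sq.aestronglyMeasurable]; rfl

lemma costEst_code : (R.code δ K h).costEst
    = (1 - δ) * ∫ q, (sX1 q - clip K (sU2 q)) ^ 2 ∂d.measure
      + δ * ∫ q, (sX1 q) ^ 2 ∂d.measure := by
  set s : Set ((ℝ × ((W × I) × Bool) × ℝ) × I) := Prod.fst ⁻¹' coinSet W true with hs
  have ms : MeasurableSet s := measurable_fst (measurableSet_coinSet true)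
  have hsc : sᶜ = Prod.fst ⁻¹' coinSet W false := by
    ext e
    show ¬ (e.1.2.1.2 = true) ↔ e.1.2.1.2 = false
    simp
  have hi := (R.code δ K h).integrable_err
  rw [CodeData.costEst, ← integral_add_compl ms hi]
  congr 1
  · have e1 : ∀ e ∈ s, (R.code δ K h).err e
        = (sX1 (R.fullLetter e) - clip K (sU2 (R.fullLetter e))) ^ 2 := fun e he => by
      have he' : e.1.2.1.2 = true := he
      simp only [CodeData.err, code, he', if_true]
      rfl
    rw [setIntegral_congr_fun ms e1, ← integral_map (φ := R.fullLetter)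
      (f := fun q => (sX1 q - clip K (sU2 q)) ^ 2) (by fun_prop) (by fun_prop),
      map_restrict_fullLetter, integral_smul_measure, ENNReal.toReal_ofReal (by linarith [δ.2.2])]
    rfl
  · have e1 : ∀ e ∈ sᶜ, (R.code δ K h).err e
        = (fun q : ((ℝ × W) × ℝ) × ℝ => (q.1.1.1 + q.1.2) ^ 2) (R.letter e.1) := fun e he => by
      rw [hsc] at he
      have he' : e.1.2.1.2 = false := he
      simp only [CodeData.err, code, he', Bool.false_eq_true, if_false, sub_zero]
      rfl
    rw [setIntegral_congr_fun ms.compl e1, hsc, ← setIntegral_map (g := Prod.fst)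
      (f := fun a => (fun q : ((ℝ × W) × ℝ) × ℝ => (q.1.1.1 + q.1.2) ^ 2) (R.letter a))
      (measurableSet_coinSet false)
      ((by fun_prop : Measurable fun q : ((ℝ × W) × ℝ) × ℝ => (q.1.1.1 + q.1.2) ^ 2).comp
        R.measurable_letter).aestronglyMeasurable (by fun_prop), CodeData.map_fst_J]
    change ∫ a in coinSet W false, (fun q : ((ℝ × W) × ℝ) × ℝ => (q.1.1.1 + q.1.2) ^ 2)
      (R.letter a) ∂(triLaw Q N (auxMeasure d δ)) = _
    rw [← integral_map (φ := R.letter)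
      (f := fun q : ((ℝ × W) × ℝ) × ℝ => (q.1.1.1 + q.1.2) ^ 2) (by fun_prop) (by fun_prop),
      map_restrict_letter, coin_false, integral_smul_measure, ENNReal.toReal_ofReal δ.2.1,
      ← d.map_fst_measure, integral_map (by fun_prop) (by fun_prop)]
    rfl

lemma log_ρ_code (hc : Integrable (fun s => Real.log (R.dens s).toReal) d.measure) :
    Integrable (fun e => Real.log ((R.code δ K h).ρ e).toReal) (R.code δ K h).J ∧
    ∫ e, Real.log ((R.code δ K h).ρ e).toReal ∂(R.code δ K h).J
      = (1 - δ) * ∫ s, Real.log (R.dens s).toReal ∂d.measure := by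
  set s : Set ((ℝ × ((W × I) × Bool) × ℝ) × I) := Prod.fst ⁻¹' coinSet W true with hs
  have ms : MeasurableSet s := measurable_fst (measurableSet_coinSet true)
  have e : (fun e => Real.log ((R.code δ K h).ρ e).toReal)
      = s.indicator fun e => Real.log (R.dens (R.fullLetter e)).toReal := by
    funext e
    by_cases he : e ∈ s
    · have he' : e.1.2.1.2 = true := he
      rw [Set.indicator_of_mem he]
      simp only [code, he', if_true]
    · have he' : ¬ e.1.2.1.2 = true := he
      rw [Set.indicator_of_notMem he]
      simp only [code, he']
      simp
  have ml : Measurable fun q => Real.log (R.dens q).toReal :=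
    R.measurable_dens.ennreal_toReal.log
  rw [e]
  constructor
  · rw [integrable_indicator_iff ms, IntegrableOn]
    have : Integrable (fun q => Real.log (R.dens q).toReal)
        (((R.code δ K h).J.restrict s).map R.fullLetter) := by
      rw [map_restrict_fullLetter]
      exact hc.smul_measure ENNReal.ofReal_ne_top
    exact this.comp_measurable R.measurable_fullLetter
  · rw [integral_indicator ms, ← integral_map (φ := R.fullLetter)
      (f := fun q => Real.log (R.dens q).toReal) (by fun_prop) ml.aestronglyMeasurable,
      map_restrict_fullLetter, integral_smul_measure, ENNReal.toReal_ofReal (by linarith [δ.2.2])]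
    rfl

lemma map_aux_code : (triLaw Q N (R.code δ K h).μW).map
    (fun a => (a.2.1.1.1, (R.code δ K h).out a)) = d.auxLaw := by
  rw [auxLaw, obsLaw, ← R.map_letter δ, Measure.map_map (by fun_prop) (by fun_prop),
    Measure.map_map (by fun_prop) (by fun_prop)]
  rfl

lemma lintegral_D_code : ∫⁻ a, ∫⁻ w, (R.code δ K h).D (w, (R.code δ K h).out a)
    ∂(R.code δ K h).μW ∂(triLaw Q N (R.code δ K h).μW) ≤ 1 := by
  have mD : Measurable (auxDens d) := Measure.measurable_rnDeriv _ _
  have e : ∀ y, ∫⁻ w, (R.code δ K h).D (w, y) ∂(R.code δ K h).μW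
      = ∫⁻ w, auxDens d (w, y) ∂d.μW := fun y => by
    have : (auxMeasure d δ).map (fun w => w.1.1) = d.μW := by
      have h1 : (auxMeasure d δ).map Prod.fst = d.μW.prod (volume : Measure I) := Measure.fst_prod
      have h2 : (d.μW.prod (volume : Measure I)).map Prod.fst = d.μW := Measure.fst_prod
      rw [← h2, ← h1, Measure.map_map measurable_fst measurable_fst]; rfl
    rw [← this, lintegral_map (by fun_prop) (by fun_prop)]
    rfl
  simp only [e]
  have m2 : Measurable fun y => ∫⁻ w, auxDens d (w, y) ∂d.μW :=
    Measurable.lintegral_prod_left' mD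
  have e2 : ∫⁻ a, (fun p : W × ℝ => ∫⁻ w, auxDens d (w, p.2) ∂d.μW)
      (a.2.1.1.1, (R.code δ K h).out a) ∂(triLaw Q N (R.code δ K h).μW)
      = ∫⁻ y, ∫⁻ w, auxDens d (w, y) ∂d.μW ∂d.outLaw := by
    have m3 : Measurable fun a : ℝ × ((W × I) × Bool) × ℝ =>
      (a.2.1.1.1, (R.code δ K h).out a) := by fun_prop
    rw [← lintegral_map (f := fun p : W × ℝ => ∫⁻ w, auxDens d (w, p.2) ∂d.μW) (g := fun a : ℝ × ((W × I) × Bool) × ℝ =>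
      (a.2.1.1.1, (R.code δ K h).out a)) (m2.comp measurable_snd) m3, map_aux_code]
    have : d.outLaw = d.auxLaw.map Prod.snd := by
      rw [auxLaw, Measure.map_map (by fun_prop) (by fun_prop)]; rfl
    rw [this, lintegral_map m2 (by fun_prop)]
  refine (le_of_eq e2).trans ?_
  rw [← lintegral_prod_symm' _ mD]
  exact (Measure.lintegral_rnDeriv_le).trans (by simp)

end SLDecompFB.Rep

namespace SLDecompFB

variable {Q N : ℝ≥0} {W : Type} [MeasurableSpace W] {d : SLDecompFB Q N W}

lemma integrable_sX1_sq (h : Integrable (fun q => (sU1 q) ^ 2) d.measure) :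
    Integrable (fun q => (sX1 q) ^ 2) d.measure := by
  have e : d.inputLaw = d.measure.map (fun q => q.1.1) := by
    have : d.preLaw.map Prod.fst = d.inputLaw := Measure.fst_prod
    rw [← this, ← d.map_fst_measure, Measure.map_map measurable_fst measurable_fst]; rfl
  have h1 := d.integrable_input_sq h
  rw [e] at h1
  exact h1.comp_measurable (by fun_prop)

namespace Rep

lemma abs_clip_le_abs {K : ℝ} (hK : 0 ≤ K) (u : ℝ) : |clip K u| ≤ |u| := by
  unfold clip
  rcases le_total 0 u with hu | hu
  · rw [abs_of_nonneg hu, abs_le]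
    exact ⟨by linarith [le_max_right (-K) (min K u), le_min hK hu],
      max_le (by linarith) (min_le_right _ _)⟩
  · rw [abs_of_nonpos hu, abs_le, min_eq_right (hu.trans hK)]
    exact ⟨by linarith [le_max_right (-K) u], max_le (by linarith) (by linarith)⟩

lemma tendsto_clip (u : ℝ) :
    Filter.Tendsto (fun n : ℕ => clip n u) Filter.atTop (nhds u) := by
  refine tendsto_const_nhds.congr' ?_
  obtain ⟨m, hm⟩ := exists_nat_ge |u|
  filter_upwards [Filter.eventually_ge_atTop m] with n hn
  have h1 : |u| ≤ n := hm.trans (by exact_mod_cast hn)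
  rw [abs_le] at h1
  unfold clip
  rw [min_eq_right h1.2, max_eq_right h1.1]

lemma tendsto_costEst {δ : ℕ → I} (hδ : Filter.Tendsto (fun n => (δ n : ℝ)) Filter.atTop (nhds 0))
    (R : d.Rep) (h : Integrable (fun q => (sU1 q) ^ 2) d.measure)
    (h2 : Integrable (fun q => (sX1 q - sU2 q) ^ 2) d.measure) :
    Filter.Tendsto (fun n : ℕ => (R.code (δ n) n h).costEst) Filter.atTop
      (nhds (∫ q, (sX1 q - sU2 q) ^ 2 ∂d.measure)) := by
  have hx := integrable_sX1_sq h
  have hlim : Filter.Tendsto (fun n : ℕ => ∫ q, (sX1 q - clip n (sU2 q)) ^ 2 ∂d.measure)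
      Filter.atTop (nhds (∫ q, (sX1 q - sU2 q) ^ 2 ∂d.measure)) := by
    refine tendsto_integral_of_dominated_convergence
      (fun q => 6 * (sX1 q) ^ 2 + 4 * (sX1 q - sU2 q) ^ 2) (fun n => ?_)
      ((hx.const_mul 6).add (h2.const_mul 4)) (fun n => ?_) ?_
    · exact (by fun_prop : Measurable fun q : Space W =>
        (sX1 q - clip n (sU2 q)) ^ 2).aestronglyMeasurable
    · refine Filter.Eventually.of_forall fun q => ?_
      rw [Real.norm_of_nonneg (sq_nonneg _)]
      have h3 : clip n (sU2 q) ^ 2 ≤ (sU2 q) ^ 2 :=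
        sq_le_sq.2 (abs_clip_le_abs (Nat.cast_nonneg n) _)
      nlinarith [sq_nonneg (sX1 q + clip n (sU2 q)), sq_nonneg (2 * sX1 q - sU2 q)]
    · refine Filter.Eventually.of_forall fun q => ?_
      exact (((tendsto_clip (sU2 q)).const_sub _).pow 2)
  have := ((hδ.const_sub 1).mul hlim).add (hδ.mul_const (∫ q, (sX1 q) ^ 2 ∂d.measure))
  simp only [sub_zero, one_mul, zero_mul, add_zero] at this
  refine this.congr fun n => ?_
  rw [costEst_code]
  simp

end Rep

/-- A vanishing sequence of coin biases. -/
def bias (n : ℕ) : I := ⟨1 / ((n : ℝ) + 1), by positivity, by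
  rw [div_le_one (by positivity)]; linarith [Nat.cast_nonneg (α := ℝ) n]⟩

lemma bias_pos (n : ℕ) : 0 < (bias n : ℝ) := by unfold bias; positivity

lemma tendsto_bias : Filter.Tendsto (fun n => (bias n : ℝ)) Filter.atTop (nhds 0) :=
  tendsto_one_div_add_atTop_nhds_zero_nat

theorem achievable_of_realizes (hN : 0 < N) {P S : ℝ} (hd : d.realizes P S)
    (hI : condMutualInfo d.measure sU2 sX0 (fun q => (sW q, sY1 q)) ≤
      mutualInfo d.measure sW sY1) : achievableFBNC Q N P S := by
  obtain ⟨h1, h2, rfl, rfl⟩ := hd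
  have hMI := d.mutualInfo_ne_top hN.ne' h1
  have hC := ne_top_of_le_ne_top hMI hI
  have key : ∀ (R : d.Rep), (∀ n : ℕ, ∀ ε > 0, ∃ L₀ : ℕ, ∀ L ≥ L₀,
      Nonempty ((R.code (bias n) n h1).Thresholds L ε)) →
      achievableFBNC Q N (∫ q, (sU1 q) ^ 2 ∂d.measure) (∫ q, (sX1 q - sU2 q) ^ 2 ∂d.measure) := by
    intro R hR
    refine achievable_of_tendsto (p := fun _ => ∫ q, (sU1 q) ^ 2 ∂d.measure) tendsto_const_nhds
      (Rep.tendsto_costEst tendsto_bias R h1 h2) (Filter.Eventually.of_forall fun n => ?_)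
    have := (R.code (bias n) n h1).achievable (hR n) (R.lintegral_D_code (bias n) n h1)
    rwa [R.costInput_code] at this
  by_cases h0 : mutualInfo d.measure sW sY1 = 0
  · rw [h0, nonpos_iff_eq_zero, condMutualInfo_eq_klDiv, InformationTheory.klDiv_eq_zero_iff] at hI
    have hae : ∀ᵐ q ∂d.obsLaw, d.κ2 q = d.estKernel (forget q) :=
      Kernel.ae_eq_of_compProd_eq hI
    obtain ⟨R, hR⟩ := exists_rep_one d hae
    refine key R fun n ε hε => ⟨0, fun L _ => CodeData.nonempty_thresholds_of_one _ (fun e => ?_) L hε.le⟩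
    simp [Rep.code, Rep.dens, hR]
  · have hac : ∀ᵐ q ∂d.obsLaw, d.κ2 q ≪ d.estKernel (forget q) := by
      rw [condMutualInfo_eq_klDiv, InformationTheory.klDiv_ne_top_iff] at hC
      exact Measure.absolutelyContinuous_compProd_right_iff.1 hC.1
    obtain ⟨R⟩ := exists_rep d hac
    obtain ⟨hi, hv⟩ := R.integrable_log_dens hC
    refine key R fun n ε hε => ?_
    obtain ⟨hρi, hρv⟩ := R.log_ρ_code (bias n) n h1 hi
    rw [← hv] at hρv
    have hkl := d.mutualInfo_eq
    have hnt := hMI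
    rw [hkl, InformationTheory.klDiv_ne_top_iff] at hnt
    obtain ⟨hac2, hinteg⟩ := hnt
    have mD : Measurable (Rep.auxDens d) := Measure.measurable_rnDeriv _ _
    have hmap := R.map_aux_code (bias n) n h1
    have mo : Measurable fun a : ℝ × ((W × I) × Bool) × ℝ =>
      (a.2.1.1.1, (R.code (bias n) n h1).out a) := by fun_prop
    have hllr : Integrable (fun q => Real.log (Rep.auxDens d q).toReal) d.auxLaw := hinteg
    have hMIv : (mutualInfo d.measure sW sY1).toReal
        = ∫ q, Real.log (Rep.auxDens d q).toReal ∂d.auxLaw := by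
      rw [hkl, InformationTheory.toReal_klDiv_of_measure_eq hac2 (by simp)]; rfl
    have hpos : 0 < (mutualInfo d.measure sW sY1).toReal := ENNReal.toReal_pos h0 hMI
    refine CodeData.exists_thresholds _ hρi ?_ ?_ ?_ ?_ hε
    · rw [hρv]
      exact mul_nonneg (by linarith [(bias n).2.2]) ENNReal.toReal_nonneg
    · have : ∀ᵐ q ∂d.auxLaw, Rep.auxDens d q ≠ 0 ∧ Rep.auxDens d q ≠ ∞ := by
        filter_upwards [Measure.rnDeriv_pos hac2, hac2.ae_le
          (Measure.rnDeriv_lt_top d.auxLaw (d.μW.prod d.outLaw))]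
          with q hq1 hq2
        exact ⟨hq1.ne', hq2.ne⟩
      rw [← hmap] at this
      exact ae_of_ae_map mo.aemeasurable this
    · rw [← hmap] at hllr
      exact hllr.comp_measurable mo
    · rw [hρv]
      have e : ∫ a, Real.log ((R.code (bias n) n h1).D (a.2.1, (R.code (bias n) n h1).out a)).toReal
          ∂(triLaw Q N (R.code (bias n) n h1).μW) = (mutualInfo d.measure sW sY1).toReal := by
        rw [hMIv, ← hmap, integral_map mo.aemeasurable
          mD.ennreal_toReal.log.aestronglyMeasurable]
        rfl
      rw [e]
      have h3 := ENNReal.toReal_mono hMI hI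
      nlinarith [bias_pos n, (bias n).2.2,
        ENNReal.toReal_nonneg (a := condMutualInfo d.measure sU2 sX0 (fun q => (sW q, sY1 q)))]

end SLDecompFB

end UnitInterval

section Shear

variable {n : ℕ}

/-- Translating one coordinate by a function of the others preserves Lebesgue measure. -/
lemma measurePreserving_shear (m : Fin n) (s : Path n → ℝ) (hs : Measurable s)
    (hind : ∀ y a, s (Function.update y m a) = s y) :
    MeasurePreserving (fun y : Path n => Function.update y m (y m + s y)) volume volume := by
  have hmeas : Measurable (fun y : Path n => Function.update y m (y m + s y)) := by
    refine measurable_pi_iff.2 fun i => ?_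
    by_cases h : i = m
    · subst h; simp only [Function.update_self]; fun_prop
    · simp only [Function.update_of_ne h]; fun_prop
  refine ⟨hmeas, Measure.ext_of_lintegral _ fun f hf => ?_⟩
  rw [lintegral_map hf hmeas]
  refine lintegral_eq_of_lmarginal_eq (μ := fun _ => volume) {m} (hf.comp hmeas) hf ?_
  rw [lmarginal_singleton, lmarginal_singleton]
  funext y
  simp only [hind, Function.update_self, Function.update_idem]
  exact lintegral_add_right_eq_self (fun a => f (Function.update y m a)) (s y)

end Shear

namespace FBNCDesign

variable {n : ℕ} (c : FBNCDesign n)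

/-- The output path after the first `m` uses of the channel; later coordinates still hold the
noise. -/
def outStage (x z v : Path n) : ℕ → Path n
  | 0 => z
  | m + 1 => if h : m < n then
      Function.update (outStage x z v m) ⟨m, h⟩ (outStage x z v m ⟨m, h⟩ +
        (x ⟨m, h⟩ + c.enc ⟨m, h⟩ x (outStage x z v m) (v ⟨m, h⟩)))
    else outStage x z v m

lemma outStage_apply (x z v w : Path n) (m : ℕ) (s : Fin n) :
    c.outStage x z v m s = if (s : ℕ) < m then c.Y1 (x, z, v, w) s else z s := by
  induction m generalizing s with
  | zero => simp [outStage]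
  | succ m ih =>
    rw [outStage]
    by_cases h : m < n
    · rw [dif_pos h]
      by_cases hs : s = ⟨m, h⟩
      · subst hs
        have he : c.enc ⟨m, h⟩ x (c.outStage x z v m) (v ⟨m, h⟩)
            = c.enc ⟨m, h⟩ x (c.Y1 (x, z, v, w)) (v ⟨m, h⟩) := by
          refine c.enc_causal _ _ _ _ _ _ (fun _ _ => rfl) fun r hr => ?_
          rw [ih, if_pos (Fin.lt_def.1 hr)]
        rw [Function.update_self, he, ih, if_neg (lt_irrefl _), if_pos (Nat.lt_succ_self m)]
        have hu := c.U1_eq (x, z, v, w) ⟨m, h⟩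
        change z _ + _ = x _ + c.U1 (x, z, v, w) _ + z _
        rw [hu]
        change _ + (_ + c.enc _ x _ (v _)) = _ + c.enc _ x _ (v _) + _
        ring
      · rw [Function.update_of_ne hs, ih]
        have : (s : ℕ) ≠ m := fun h' => hs (Fin.ext h')
        have h2 : ((s : ℕ) < m) ↔ ((s : ℕ) < m + 1) := by omega
        simp only [h2]
    · rw [dif_neg h, ih]
      have h1 : (s : ℕ) < m := by omega
      rw [if_pos h1, if_pos (by omega)]

lemma outStage_eq (x z v w : Path n) : c.outStage x z v n = c.Y1 (x, z, v, w) := by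
  funext s
  rw [c.outStage_apply x z v w, if_pos s.2]

lemma measurable_outStage (m : ℕ) :
    Measurable fun q : Path n × Path n × Path n => c.outStage q.1 q.2.1 q.2.2 m := by
  induction m with
  | zero => simp only [outStage]; fun_prop
  | succ m ih =>
    simp only [outStage]
    by_cases h : m < n
    · simp only [dif_pos h]
      refine measurable_pi_iff.2 fun i => ?_
      by_cases hi : i = ⟨m, h⟩
      · subst hi
        simp only [Function.update_self]
        have := (c.enc_meas ⟨m, h⟩).comp
          (f := fun q : Path n × Path n × Path n =>
            ((q.1, c.outStage q.1 q.2.1 q.2.2 m), q.2.2 ⟨m, h⟩)) (by fun_prop)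
        exact (measurable_pi_iff.1 ih _).add (by fun_prop)
      · simp only [Function.update_of_ne hi]
        exact measurable_pi_iff.1 ih i
    · simpa only [dif_neg h] using ih

lemma measurePreserving_outStage (x v : Path n) (m : ℕ) :
    MeasurePreserving (fun z => c.outStage x z v m) volume volume := by
  induction m with
  | zero => exact MeasurePreserving.id _
  | succ m ih =>
    by_cases h : m < n
    · have hm : Measurable fun y : Path n => c.enc ⟨m, h⟩ x y (v ⟨m, h⟩) :=
        (c.enc_meas ⟨m, h⟩).comp (f := fun y => ((x, y), v ⟨m, h⟩)) (by fun_prop)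
      have := measurePreserving_shear ⟨m, h⟩
        (fun y => x ⟨m, h⟩ + c.enc ⟨m, h⟩ x y (v ⟨m, h⟩)) (by fun_prop) (fun y a => by
          congr 1
          refine c.enc_causal _ _ _ _ _ _ (fun _ _ => rfl) fun r hr => ?_
          rw [Function.update_of_ne hr.ne])
      have e : (fun z => c.outStage x z v (m + 1)) = (fun y : Path n => Function.update y ⟨m, h⟩
          (y ⟨m, h⟩ + (x ⟨m, h⟩ + c.enc ⟨m, h⟩ x y (v ⟨m, h⟩)))) ∘
          fun z => c.outStage x z v m := by
        funext z
        simp only [outStage, dif_pos h, Function.comp]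
      rw [e]
      exact this.comp ih
    · simpa only [outStage, dif_neg h] using ih

@[fun_prop]
lemma measurable_Y1 : Measurable (c.Y1 : Sample n → Path n) := by
  have : (c.Y1 : Sample n → Path n) = fun ω => c.outStage ω.1 ω.2.1 ω.2.2.1 n := by
    funext ω; exact (c.outStage_eq ω.1 ω.2.1 ω.2.2.1 ω.2.2.2).symm
  rw [this]
  exact (c.measurable_outStage n).comp (f := fun ω : Sample n => (ω.1, ω.2.1, ω.2.2.1))
    (by fun_prop)

@[fun_prop]
lemma measurable_U1 : Measurable (c.U1 : Sample n → Path n) := by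
  refine measurable_pi_iff.2 fun t => ?_
  simp only [c.U1_eq]
  exact (c.enc_meas t).comp (f := fun ω : Sample n => ((srcX0 ω, c.Y1 ω), seedV ω t))
    (by unfold srcX0 seedV; fun_prop)

@[fun_prop]
lemma measurable_U2 : Measurable (c.U2 : Sample n → Path n) :=
  c.dec_meas.comp (f := fun ω : Sample n => (c.Y1 ω, seedW ω)) (by unfold seedW; fun_prop)

lemma measurePreserving_Y1 (x v w : Path n) :
    MeasurePreserving (fun z => c.Y1 (x, z, v, w)) volume volume := by
  simp only [← c.outStage_eq x _ v w]
  exact c.measurePreserving_outStage x v n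

end FBNCDesign

section Bound

variable {n : ℕ}

/-- Causal exponential supermartingale bound: if each `H t` depends on the first `t` coordinates
and has conditional exponential moment at most one, so does the sum. -/
lemma lintegral_exp_sum_le_one (γ : Measure ℝ) [IsProbabilityMeasure γ] (H : Fin n → Path n → ℝ)
    (hm : ∀ t, Measurable (H t))
    (hcausal : ∀ t x x', (∀ s, s ≤ t → x s = x' s) → H t x = H t x')
    (h1 : ∀ t x, ∫⁻ a, ENNReal.ofReal (Real.exp (H t (Function.update x t a))) ∂γ ≤ 1) :
    ∫⁻ x, ENNReal.ofReal (Real.exp (∑ t, H t x)) ∂(Measure.pi fun _ : Fin n => γ) ≤ 1 := by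
  have key : ∀ m ≤ n, ∫⁻ x, ∏ t with t.val < m, ENNReal.ofReal (Real.exp (H t x))
      ∂(Measure.pi fun _ : Fin n => γ) ≤ 1 := by
    intro m hmn
    induction m with
    | zero => simp
    | succ m ih =>
      have hlt : m < n := hmn
      set j : Fin n := ⟨m, hlt⟩
      have hset : (Finset.univ.filter fun t : Fin n => t.val < m + 1)
          = insert j (Finset.univ.filter fun t : Fin n => t.val < m) := by
        ext t
        simp only [Finset.mem_filter, Finset.mem_univ, true_and, Finset.mem_insert, Fin.ext_iff, j]
        omega
      have hj : j ∉ (Finset.univ.filter fun t : Fin n => t.val < m) := by simp [j]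
      have hfm : Measurable fun x : Path n =>
          ∏ t with t.val < m + 1, ENNReal.ofReal (Real.exp (H t x)) :=
        Finset.measurable_prod _ fun t _ => (Real.measurable_exp.comp (hm t)).ennreal_ofReal
      have hp := measurePreserving_update (fun _ : Fin n => γ) j
      have hfub : ∀ F : Path n → ℝ≥0∞, Measurable F →
          ∫⁻ x, F x ∂(Measure.pi fun _ : Fin n => γ)
            = ∫⁻ x, ∫⁻ a, F (Function.update x j a) ∂γ ∂(Measure.pi fun _ : Fin n => γ) := by
        intro F hF
        rw [← hp.lintegral_comp hF]
        exact lintegral_prod _ (hF.comp hp.measurable).aemeasurable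
      rw [hfub _ hfm]
      refine le_trans (lintegral_mono fun x => ?_) (ih (by omega))
      have hsp : ∀ a, (∏ t with t.val < m + 1,
          ENNReal.ofReal (Real.exp (H t (Function.update x j a))))
          = ENNReal.ofReal (Real.exp (H j (Function.update x j a)))
            * ∏ t with t.val < m, ENNReal.ofReal (Real.exp (H t x)) := by
        intro a
        rw [hset, Finset.prod_insert hj]
        congr 1
        refine Finset.prod_congr rfl fun t ht => ?_
        have ht' : t.val < m := (Finset.mem_filter.1 ht).2
        rw [hcausal t (Function.update x j a) x fun s hs => ?_]
        refine Function.update_of_ne (fun h => ?_) _ _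
        have : s.val = m := by rw [h]
        have := Fin.le_def.1 hs
        omega
      simp only [hsp]
      rw [lintegral_mul_const]
      · exact mul_le_of_le_one_left zero_le (h1 j x)
      · have : Measurable fun a => Function.update x j a := measurable_update x
        exact (Real.measurable_exp.comp ((hm j).comp this)).ennreal_ofReal
  have := key n le_rfl
  have hu : (Finset.univ.filter fun t : Fin n => t.val < n) = Finset.univ := by
    ext t; simp
  rw [hu] at this
  simpa only [Real.exp_sum, ENNReal.ofReal_prod_of_nonneg
    (fun t (_ : t ∈ Finset.univ) => (Real.exp_pos _).le)] using this

variable {Θ : Type*} [MeasurableSpace Θ]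

/-- The exponential form of the converse: a tilted exponential moment under the channel, computed
by changing variables from the noise to the output. -/
lemma converse_bound {N : ℝ≥0} (hN : N ≠ 0) (ν : Measure (Path n)) [IsProbabilityMeasure ν]
    (τ : Measure Θ) [IsProbabilityMeasure τ] {Y : Path n × Path n × Θ → Path n}
    (hY : Measurable Y) (hYp : ∀ x θ, MeasurePreserving (fun z => Y (x, z, θ)) volume volume)
    {H : Path n × Path n × Θ → ℝ} (hH : Measurable H) {C : ℝ} (hC : ∀ p, |H p| ≤ C)
    (hH1 : ∀ y θ, ∫⁻ x, ENNReal.ofReal (Real.exp (H (x, y, θ))) ∂ν ≤ 1)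
    {ψ : ℝ → ℝ} (hψ : Measurable ψ) (hψ1 : ∫⁻ y, ENNReal.ofReal (Real.exp (ψ y)) ≤ 1)
    (hψi : ∀ t, Integrable (fun p => ψ (Y p t)) (ν.prod ((iidGaussian n N).prod τ))) :
    ∫ p, H (p.1, Y p, p.2.2) ∂(ν.prod ((iidGaussian n N).prod τ))
      + ∑ t, ∫ p, ψ (Y p t) ∂(ν.prod ((iidGaussian n N).prod τ))
      ≤ n * ∫ z, Real.log (gaussianPDFReal 0 N z) ∂(gaussianReal 0 N) := by
  set Λ := ν.prod ((iidGaussian n N).prod τ) with hΛ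
  set L : ℝ → ℝ := fun z => Real.log (gaussianPDFReal 0 N z) with hL
  have hLi : ∀ t : Fin n, MeasurePreserving (fun p : Path n × Path n × Θ => p.2.1 t) Λ
      (gaussianReal 0 N) := fun t =>
    ((measurePreserving_eval (fun _ : Fin n => gaussianReal 0 N) t).comp
      measurePreserving_fst).comp measurePreserving_snd
  have hLm : Measurable L := (measurable_gaussianPDFReal 0 N).log
  have hLint : Integrable L (gaussianReal 0 N) := integrable_log_gaussianPDFReal hN
  have hLint' : ∀ t : Fin n, Integrable (fun p : Path n × Path n × Θ => L (p.2.1 t)) Λ :=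
    fun t => (hLi t).integrable_comp_of_integrable hLint
  have hHm : Measurable fun p : Path n × Path n × Θ => H (p.1, Y p, p.2.2) := by fun_prop
  have hHi : Integrable (fun p : Path n × Path n × Θ => H (p.1, Y p, p.2.2)) Λ :=
    Integrable.of_bound hHm.aestronglyMeasurable C (Filter.Eventually.of_forall fun p => hC _)
  have hψs : Integrable (fun p => ∑ t, ψ (Y p t)) Λ := integrable_finsetSum _ fun t _ => hψi t
  have hLs : Integrable (fun p : Path n × Path n × Θ => ∑ t, L (p.2.1 t)) Λ :=
    integrable_finsetSum _ fun t _ => hLint' t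
  set G : Path n × Path n × Θ → ℝ :=
    fun p => H (p.1, Y p, p.2.2) + ∑ t, ψ (Y p t) - ∑ t, L (p.2.1 t) with hG
  have hGi : Integrable G Λ := (hHi.add hψs).sub hLs
  have hLe : ∀ t : Fin n, ∫ p, L (p.2.1 t) ∂Λ = ∫ z, L z ∂(gaussianReal 0 N) := fun t => by
    rw [← (hLi t).map_eq, integral_map (hLi t).measurable.aemeasurable
      hLm.aestronglyMeasurable]
  have hval : ∫ p, G p ∂Λ = ∫ p, H (p.1, Y p, p.2.2) ∂Λ + ∑ t, ∫ p, ψ (Y p t) ∂Λ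
      - n * ∫ z, L z ∂(gaussianReal 0 N) := by
    have e1 : ∫ p, G p ∂Λ = ∫ p, (H (p.1, Y p, p.2.2) + ∑ t, ψ (Y p t)) ∂Λ
        - ∫ p, ∑ t, L (p.2.1 t) ∂Λ := integral_sub (hHi.add hψs) hLs
    rw [e1, integral_add hHi hψs, integral_finsetSum _ fun t _ => hψi t,
      integral_finsetSum _ fun t _ => hLint' t]
    simp only [hLe, Finset.sum_const, Finset.card_univ, Fintype.card_fin, nsmul_eq_mul]
  have hEm : Measurable fun q : Path n × Path n × Θ => ENNReal.ofReal
      (Real.exp (H q) * ∏ t, Real.exp (ψ (q.2.1 t))) := by fun_prop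
  have hexp : ∫⁻ p, ENNReal.ofReal (Real.exp (G p)) ∂Λ ≤ 1 := by
    have hGm : Measurable fun p => ENNReal.ofReal (Real.exp (G p)) := by
      have : Measurable G := by
        rw [hG]
        refine (hHm.add (Finset.measurable_sum _ fun t _ => ?_)).sub
          (Finset.measurable_sum _ fun t _ => ?_)
        · exact hψ.comp ((measurable_pi_apply t).comp hY)
        · exact hLm.comp (by fun_prop)
      exact (Real.measurable_exp.comp this).ennreal_ofReal
    rw [hΛ, lintegral_prod _ hGm.aemeasurable]
    have h1 : ∀ x, ∫⁻ q, ENNReal.ofReal (Real.exp (G (x, q))) ∂((iidGaussian n N).prod τ)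
        = ∫⁻ θ, (∫⁻ y : Path n,
          ENNReal.ofReal (Real.exp (H (x, y, θ)) * ∏ t, Real.exp (ψ (y t)))) ∂τ := by
      intro x
      rw [lintegral_prod_symm (fun q : Path n × Θ => ENNReal.ofReal (Real.exp (G (x, q))))
        (hGm.comp measurable_prodMk_left).aemeasurable]
      refine lintegral_congr fun θ => ?_
      have hdens : iidGaussian n N = (volume : Measure (Path n)).withDensity
          (fun z => ∏ t, gaussianPDF 0 N (z t)) := by
        rw [iidGaussian]
        have : IsProbabilityMeasure (volume.withDensity (gaussianPDF 0 N)) := by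
          rw [← gaussianReal_of_var_ne_zero 0 hN]; infer_instance
        simp only [gaussianReal_of_var_ne_zero 0 hN]
        exact pi_withDensity (fun _ : Fin n => (volume : Measure ℝ)) _
          (fun _ => measurable_gaussianPDF 0 N)
      have hpm : Measurable fun z : Path n => ∏ t, gaussianPDF 0 N (z t) :=
        Finset.measurable_prod _ fun t _ => (measurable_gaussianPDF 0 N).comp
          (measurable_pi_apply t)
      have hcomp : Measurable fun z : Path n => ENNReal.ofReal (Real.exp (G (x, z, θ))) :=
        hGm.comp (f := fun z : Path n => (x, z, θ)) (by fun_prop)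
      rw [hdens, lintegral_withDensity_eq_lintegral_mul _ hpm hcomp]
      have := (hYp x θ).lintegral_comp (f := fun y => ENNReal.ofReal
        (Real.exp (H (x, y, θ)) * ∏ t, Real.exp (ψ (y t))))
        (hEm.comp (g := fun q : Path n × Path n × Θ => ENNReal.ofReal
          (Real.exp (H q) * ∏ t, Real.exp (ψ (q.2.1 t)))) (f := fun y => (x, y, θ)) (by fun_prop))
      rw [← this]
      refine lintegral_congr fun z => ?_
      simp only [Pi.mul_apply, hG, gaussianPDF]
      rw [← ENNReal.ofReal_prod_of_nonneg (fun t _ => gaussianPDFReal_nonneg 0 N _),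
        ← ENNReal.ofReal_mul (Finset.prod_nonneg fun t _ => gaussianPDFReal_nonneg 0 N _)]
      congr 1
      rw [Real.exp_sub, Real.exp_add, Real.exp_sum, Real.exp_sum]
      have hpos : ∀ t, Real.exp (L (z t)) = gaussianPDFReal 0 N (z t) := fun t =>
        Real.exp_log (gaussianPDFReal_pos 0 N _ hN)
      simp only [hpos]
      rw [mul_div_cancel₀]
      exact (Finset.prod_pos fun t _ => gaussianPDFReal_pos 0 N _ hN).ne'
    simp only [h1]
    rw [lintegral_lintegral_swap]
    swap
    · refine Measurable.aemeasurable ?_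
      exact Measurable.lintegral_prod_left' (f := fun q : Path n × (Path n × Θ) =>
        ENNReal.ofReal (Real.exp (H (q.2.1, q.1, q.2.2)) * ∏ t, Real.exp (ψ (q.1 t))))
        (by fun_prop)
    calc ∫⁻ θ, ∫⁻ x, (∫⁻ y : Path n, ENNReal.ofReal
          (Real.exp (H (x, y, θ)) * ∏ t, Real.exp (ψ (y t)))) ∂ν ∂τ
        ≤ ∫⁻ _, 1 ∂τ := lintegral_mono fun θ => ?_
      _ = 1 := by simp
    rw [lintegral_lintegral_swap (Measurable.aemeasurable (by fun_prop))]
    calc ∫⁻ y : Path n, (∫⁻ x, ENNReal.ofReal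
          (Real.exp (H (x, y, θ)) * ∏ t, Real.exp (ψ (y t))) ∂ν)
        ≤ ∫⁻ y : Path n, ∏ t, ENNReal.ofReal (Real.exp (ψ (y t))) := by
          refine lintegral_mono fun y => ?_
          simp only [ENNReal.ofReal_mul (Real.exp_pos _).le]
          rw [lintegral_mul_const _ (by fun_prop),
            ENNReal.ofReal_prod_of_nonneg fun t _ => (Real.exp_pos _).le]
          exact mul_le_of_le_one_left zero_le (hH1 y θ)
      _ = ∏ _t : Fin n, ∫⁻ y, ENNReal.ofReal (Real.exp (ψ y)) :=
          lintegral_pi_prod (fun _ : Fin n => (volume : Measure ℝ))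
            (fun _ y => ENNReal.ofReal (Real.exp (ψ y))) fun _ => by fun_prop
      _ ≤ 1 := Finset.prod_le_one (fun _ _ => zero_le) fun _ _ => hψ1
  have hfin : Integrable (fun p => Real.exp (G p)) Λ := by
    refine ⟨(Real.continuous_exp.comp_aestronglyMeasurable hGi.1), ?_⟩
    rw [hasFiniteIntegral_iff_ofReal (Filter.Eventually.of_forall fun p => (Real.exp_pos _).le)]
    exact hexp.trans_lt ENNReal.one_lt_top
  have hle1 : ∫ p, Real.exp (G p) ∂Λ ≤ 1 := by
    rw [integral_eq_lintegral_of_nonneg_ae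
      (Filter.Eventually.of_forall fun p => (Real.exp_pos _).le) hfin.1]
    exact ENNReal.toReal_le_of_le_ofReal zero_le_one (by simpa using hexp)
  have : ∫ p, (G p + 1) ∂Λ ≤ ∫ p, Real.exp (G p) ∂Λ :=
    integral_mono (hGi.add (integrable_const _)) hfin fun p => Real.add_one_le_exp _
  rw [integral_add hGi (integrable_const _)] at this
  simp only [integral_const, probReal_univ, smul_eq_mul, one_mul] at this
  linarith

end Bound

section Preserving

variable {A B C E : Type*} [MeasurableSpace A] [MeasurableSpace B] [MeasurableSpace C]
  [MeasurableSpace E]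

/-- Prepend a letter to a sequence. -/
def seqCons (a : E) (f : ℕ → E) : ℕ → E
  | 0 => a
  | i + 1 => f i

/-- Drop the first letter of a sequence. -/
def seqTail (f : ℕ → E) : ℕ → E := fun i => f (i + 1)

@[simp] lemma seqCons_seqTail (f : ℕ → E) : seqCons (f 0) (seqTail f) = f := by
  funext i; cases i <;> rfl

@[fun_prop]
lemma measurable_seqTail : Measurable (seqTail : (ℕ → E) → ℕ → E) := by
  unfold seqTail; fun_prop

@[fun_prop]
lemma measurable_seqCons {f : A → E} {g : A → ℕ → E} (hf : Measurable f) (hg : Measurable g) :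
    Measurable fun a => seqCons (f a) (g a) := by
  refine measurable_pi_iff.2 fun i => ?_
  cases i with
  | zero => exact hf
  | succ i => exact measurable_pi_iff.1 hg i

lemma measurePreserving_seqCons (μ : Measure E) [IsProbabilityMeasure μ] :
    MeasurePreserving (fun q : E × (ℕ → E) => seqCons q.1 q.2)
      (μ.prod (Measure.infinitePi fun _ : ℕ => μ)) (Measure.infinitePi fun _ : ℕ => μ) := by
  classical
  have hm : Measurable (fun q : E × (ℕ → E) => seqCons q.1 q.2) := by fun_prop
  refine ⟨hm, Measure.eq_infinitePi _ fun s t ht => ?_⟩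
  -- enlarge the index set to an initial segment
  obtain ⟨k, hk⟩ := s.exists_nat_subset_range
  set t' : ℕ → Set E := fun i => if i ∈ s then t i else Set.univ with ht'
  have ht'm : ∀ i, MeasurableSet (t' i) := fun i => by
    by_cases h : i ∈ s
    · simp only [ht', if_pos h]; exact ht i
    · simp only [ht', if_neg h]; exact MeasurableSet.univ
  have hsets : (s : Set ℕ).pi t = ((Finset.range (k + 1) : Finset ℕ) : Set ℕ).pi t' := by
    ext f
    simp only [Set.mem_pi, Finset.mem_coe, ht']
    constructor
    · intro h i _
      by_cases hi : i ∈ s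
      · rw [if_pos hi]; exact h i hi
      · rw [if_neg hi]; trivial
    · intro h i hi
      have := h i (Finset.mem_range.2 (by have := Finset.mem_range.1 (hk hi); omega))
      rwa [if_pos hi] at this
  have hprod : ∏ i ∈ s, μ (t i) = ∏ i ∈ Finset.range (k + 1), μ (t' i) := by
    rw [← Finset.prod_subset (s₁ := s) (s₂ := Finset.range (k + 1))
      (fun i hi => Finset.mem_range.2 (by have := Finset.mem_range.1 (hk hi); omega))]
    · exact Finset.prod_congr rfl fun i hi => by simp only [ht', if_pos hi]
    · intro i _ hi
      simp only [ht', if_neg hi, measure_univ]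
  rw [hsets, hprod, Measure.map_apply hm (MeasurableSet.pi (Finset.countable_toSet _)
    fun i _ => ht'm i)]
  have hpre : (fun q : E × (ℕ → E) => seqCons q.1 q.2) ⁻¹'
      (((Finset.range (k + 1) : Finset ℕ) : Set ℕ).pi t')
      = t' 0 ×ˢ (((Finset.range k : Finset ℕ) : Set ℕ).pi fun i => t' (i + 1)) := by
    ext q
    simp only [Set.mem_preimage, Set.mem_pi, Finset.mem_coe, Finset.mem_range, Set.mem_prod]
    constructor
    · intro h
      exact ⟨h 0 (by omega), fun i hi => h (i + 1) (by omega)⟩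
    · rintro ⟨h0, h1⟩ i hi
      cases i with
      | zero => exact h0
      | succ i => exact h1 i (by omega)
  rw [hpre, Measure.prod_prod, Measure.infinitePi_pi _ (fun i _ => ht'm (i + 1)),
    Finset.prod_range_succ', mul_comm]

lemma measurePreserving_seqUncons (μ : Measure E) [IsProbabilityMeasure μ] :
    MeasurePreserving (fun f : ℕ → E => (f 0, seqTail f))
      (Measure.infinitePi fun _ : ℕ => μ) (μ.prod (Measure.infinitePi fun _ : ℕ => μ)) := by
  have hm : Measurable (fun f : ℕ → E => (f 0, seqTail f)) := by fun_prop
  refine ⟨hm, ?_⟩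
  have h := measurePreserving_seqCons μ
  conv_lhs => rw [← h.map_eq]
  rw [Measure.map_map hm h.measurable]
  exact Measure.map_id

variable {α : Measure A} {β : Measure B} {γ : Measure C}
  [IsProbabilityMeasure α] [IsProbabilityMeasure β] [IsProbabilityMeasure γ]

lemma measurePreserving_liftLeft {R : A × C → A} (hR : MeasurePreserving R (α.prod γ) α) :
    MeasurePreserving (fun q : (A × B) × C => (R (q.1.1, q.2), q.1.2)) ((α.prod β).prod γ)
      (α.prod β) := by
  have h1 := measurePreserving_prodAssoc α β γ
  have h2 : MeasurePreserving (Prod.map (id : A → A) (Prod.swap : B × C → C × B))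
      (α.prod (β.prod γ)) (α.prod (γ.prod β)) :=
    (MeasurePreserving.id α).prod Measure.measurePreserving_swap
  have h3 := (measurePreserving_prodAssoc α γ β).symm MeasurableEquiv.prodAssoc
  have h4 : MeasurePreserving (Prod.map R (id : B → B)) ((α.prod γ).prod β) (α.prod β) :=
    hR.prod (MeasurePreserving.id β)
  exact h4.comp (h3.comp (h2.comp h1))

lemma measurePreserving_liftRight {R : B × C → B} (hR : MeasurePreserving R (β.prod γ) β) :
    MeasurePreserving (fun q : (A × B) × C => (q.1.1, R (q.1.2, q.2))) ((α.prod β).prod γ)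
      (α.prod β) :=
  ((MeasurePreserving.id α).prod hR).comp (measurePreserving_prodAssoc α β γ)

/-- A coordinate that can be resampled without affecting `F` is independent of `F`. -/
lemma map_prodMk_of_resample {D : Type*} [MeasurableSpace D] {R : A × C → A}
    (hR : MeasurePreserving R (α.prod γ) α) {F : A → D} (hF : Measurable F) {G : A → C}
    (hG : Measurable G) (hFR : ∀ q, F (R q) = F q.1) (hGR : ∀ q, G (R q) = q.2) :
    α.map (fun a => (F a, G a)) = (α.map F).prod γ := by
  have : ((α.prod γ).map R).map (fun a => (F a, G a)) = (α.map F).prod (γ.map id) := by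
    rw [Measure.map_map (hF.prodMk hG) hR.measurable, Measure.map_prod_map _ _ hF measurable_id]
    congr 1
    funext q
    exact Prod.ext (hFR q) (hGR q)
  rwa [hR.map_eq, Measure.map_id] at this

end Preserving

/-- One use of the system: `((x₀, u₁), (z₁, u₂))`. -/
abbrev Letter : Type := (ℝ × ℝ) × (ℝ × ℝ)

namespace Letter

/-- The channel output. -/
def out (ξ : Letter) : ℝ := ξ.1.1 + ξ.1.2 + ξ.2.1

/-- The channel output together with the estimate. -/
def rx (ξ : Letter) : ℝ × ℝ := (ξ.out, ξ.2.2)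

@[fun_prop] lemma continuous_out : Continuous out := by unfold out; fun_prop
@[fun_prop] lemma continuous_rx : Continuous rx := by unfold rx; fun_prop
@[fun_prop] lemma measurable_out : Measurable out := by unfold out; fun_prop
@[fun_prop] lemma measurable_rx : Measurable rx := by unfold rx; fun_prop

end Letter

namespace FBNCDesign

variable {n : ℕ} (c : FBNCDesign n)

lemma Y1_congr {x x' z z' v w w' : Path n} (t : Fin n) (hx : ∀ s ≤ t, x s = x' s)
    (hz : ∀ s ≤ t, z s = z' s) : c.Y1 (x, z, v, w) t = c.Y1 (x', z', v, w') t := by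
  induction t using WellFoundedLT.induction with
  | ind t ih =>
    change x t + c.U1 (x, z, v, w) t + z t = x' t + c.U1 (x', z', v, w') t + z' t
    rw [c.U1_eq, c.U1_eq, hx t le_rfl, hz t le_rfl]
    congr 2
    exact c.enc_causal t _ _ _ _ _ hx fun s hs =>
      ih s hs (fun r hr => hx r (hr.trans hs.le)) fun r hr => hz r (hr.trans hs.le)

/-- The letter used at time `t`. -/
def letter (t : Fin n) (ω : Sample n) : Letter :=
  ((ω.1 t, c.U1 ω t), (ω.2.1 t, c.U2 ω t))

@[fun_prop]
lemma measurable_letter (t : Fin n) : Measurable (c.letter t) := by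
  unfold letter
  have h1 := (measurable_pi_apply t).comp c.measurable_U1
  have h2 := (measurable_pi_apply t).comp c.measurable_U2
  exact Measurable.prodMk (Measurable.prodMk (by fun_prop) h1)
    (Measurable.prodMk (by fun_prop) h2)

/-- Resample the source and the noise from time `t` on. -/
def regen (t : Fin n) (ω : Sample n) (e : Path n × Path n) : Sample n :=
  (fun i => if i < t then ω.1 i else e.1 i, fun i => if i < t then ω.2.1 i else e.2 i, ω.2.2)

@[fun_prop]
lemma measurable_regen (t : Fin n) :
    Measurable fun q : Sample n × (Path n × Path n) => regen t q.1 q.2 := by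
  unfold regen
  refine Measurable.prodMk (measurable_pi_iff.2 fun i => ?_)
    (Measurable.prodMk (measurable_pi_iff.2 fun i => ?_) (by fun_prop))
  all_goals by_cases h : i < t
  all_goals simp only [h, if_true, if_false]; fun_prop

lemma regen_regen (t : Fin n) (ω : Sample n) (e e' : Path n × Path n) :
    regen t (regen t ω e) e' = regen t ω e' := by
  unfold regen
  refine Prod.ext ?_ (Prod.ext ?_ rfl) <;> funext i <;> by_cases h : i < t <;> simp [h]

/-- The base randomness together with infinitely many fresh copies of source and noise. -/
def extBase (n : ℕ) (Q N : ℝ≥0) : Measure (Sample n × (ℕ → Path n × Path n)) :=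
  (base n Q N).prod (Measure.infinitePi fun _ => (iidGaussian n Q).prod (iidGaussian n N))

instance (Q N : ℝ≥0) : IsProbabilityMeasure (extBase n Q N) := by
  unfold extBase; infer_instance

/-- Letters at time `t` whose present and future have been resampled independently. -/
def freshLetters (t : Fin n) (p : Sample n × (ℕ → Path n × Path n)) : ℕ → Letter :=
  fun i => c.letter t (regen t p.1 (p.2 i))

/-- The actual letter at time `t` followed by resampled ones. -/
def allLetters (t : Fin n) (p : Sample n × (ℕ → Path n × Path n)) : ℕ → Letter :=
  seqCons (c.letter t p.1) (c.freshLetters t p)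

@[fun_prop]
lemma measurable_freshLetters (t : Fin n) : Measurable (c.freshLetters t) := by
  refine measurable_pi_iff.2 fun i => (c.measurable_letter t).comp ?_
  exact (measurable_regen t).comp
    (f := fun p : Sample n × (ℕ → Path n × Path n) => (p.1, p.2 i)) (by fun_prop)

@[fun_prop]
lemma measurable_allLetters (t : Fin n) : Measurable (c.allLetters t) := by
  unfold allLetters; fun_prop

variable (Q N : ℝ≥0)

/-- The exchangeable law of the letters at time `t`. -/
def timeLaw (t : Fin n) : Measure (ℕ → Letter) := (extBase n Q N).map (c.freshLetters t)

instance (t : Fin n) : IsProbabilityMeasure (c.timeLaw Q N t) :=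
  Measure.isProbabilityMeasure_map (c.measurable_freshLetters t).aemeasurable

lemma measurePreserving_glue' (v : ℝ≥0) (t : Fin n) :
    MeasurePreserving (fun q : Path n × Path n => fun i => if i < t then q.1 i else q.2 i)
      ((iidGaussian n v).prod (iidGaussian n v)) (iidGaussian n v) :=
  measurePreserving_glue (fun _ : Fin n => gaussianReal 0 v) (fun i => i < t)

lemma measurePreserving_regen (t : Fin n) :
    MeasurePreserving (fun q : Sample n × (Path n × Path n) => regen t q.1 q.2)
      ((base n Q N).prod ((iidGaussian n Q).prod (iidGaussian n N))) (base n Q N) := by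
  have hx : MeasurePreserving (fun q : Sample n × Path n =>
      ((fun i => if i < t then q.1.1 i else q.2 i, q.1.2) : Sample n))
      ((base n Q N).prod (iidGaussian n Q)) (base n Q N) :=
    measurePreserving_liftLeft (measurePreserving_glue' Q t)
  have hz : MeasurePreserving (fun q : Sample n × Path n =>
      ((q.1.1, fun i => if i < t then q.1.2.1 i else q.2 i, q.1.2.2) : Sample n))
      ((base n Q N).prod (iidGaussian n N)) (base n Q N) :=
    measurePreserving_liftRight (measurePreserving_liftLeft (measurePreserving_glue' N t))
  have h1 := (measurePreserving_prodAssoc (base n Q N) (iidGaussian n Q) (iidGaussian n N)).symm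
    MeasurableEquiv.prodAssoc
  exact hz.comp ((hx.prod (MeasurePreserving.id (iidGaussian n N))).comp h1)

lemma map_allLetters (t : Fin n) :
    (extBase n Q N).map (c.allLetters t) = c.timeLaw Q N t := by
  set π := (iidGaussian n Q).prod (iidGaussian n N)
  have h1 : MeasurePreserving (Prod.map (id : Sample n → Sample n)
      (fun f : ℕ → Path n × Path n => (f 0, seqTail f))) (extBase n Q N)
      ((base n Q N).prod (π.prod (Measure.infinitePi fun _ => π))) :=
    (MeasurePreserving.id _).prod (measurePreserving_seqUncons π)
  have h2 := (measurePreserving_prodAssoc (base n Q N) π (Measure.infinitePi fun _ : ℕ => π)).symm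
    MeasurableEquiv.prodAssoc
  have h3 := (measurePreserving_regen Q N t).prod
    (MeasurePreserving.id (Measure.infinitePi fun _ : ℕ => π))
  have hT : MeasurePreserving (fun p : Sample n × (ℕ → Path n × Path n) =>
      (regen t p.1 (p.2 0), seqTail p.2)) (extBase n Q N) (extBase n Q N) :=
    h3.comp (h2.comp h1)
  conv_lhs => rw [← hT.map_eq]
  rw [Measure.map_map (c.measurable_allLetters t) hT.measurable, timeLaw]
  congr 1
  funext p
  change seqCons _ _ = _
  rw [← seqCons_seqTail (c.freshLetters t p)]
  congr 1
  funext i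
  change c.letter t (regen t (regen t p.1 (p.2 0)) (p.2 (i + 1))) = _
  rw [regen_regen]
  rfl

lemma timeLaw_reindex (t : Fin n) (e : ℕ → ℕ) (he : Function.Injective e) :
    (c.timeLaw Q N t).map (fun ξ i => ξ (e i)) = c.timeLaw Q N t := by
  have h : MeasurePreserving (Prod.map (id : Sample n → Sample n)
      (fun (f : ℕ → Path n × Path n) i => f (e i))) (extBase n Q N) (extBase n Q N) :=
    (MeasurePreserving.id _).prod ⟨by fun_prop, map_infinitePi_reindex _ e he⟩
  rw [timeLaw, Measure.map_map (by fun_prop) (c.measurable_freshLetters t)]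
  conv_rhs => rw [← h.map_eq]
  rw [Measure.map_map (c.measurable_freshLetters t) h.measurable]
  rfl

lemma letter_regen_congr (t : Fin n) {ω ω' : Sample n} (e : Path n × Path n)
    (hx : ∀ s < t, ω.1 s = ω'.1 s) (hz : ∀ s < t, ω.2.1 s = ω'.2.1 s) (hs : ω.2.2 = ω'.2.2) :
    c.letter t (regen t ω e) = c.letter t (regen t ω' e) := by
  congr 1
  unfold regen
  refine Prod.ext ?_ (Prod.ext ?_ hs) <;> funext i <;> by_cases h : i < t <;> simp [h]
  · exact hx i h
  · exact hz i h

lemma timeLaw_source (t : Fin n) :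
    (c.timeLaw Q N t).map (fun ξ => (seqTail ξ, (ξ 0).1.1))
      = (c.timeLaw Q N t).prod (gaussianReal 0 Q) := by
  have hR : MeasurePreserving (fun q : (Sample n × (ℕ → Path n × Path n)) × ℝ =>
      (((Function.update q.1.1.1 t q.2, q.1.1.2), q.1.2) : Sample n × (ℕ → Path n × Path n)))
      ((extBase n Q N).prod (gaussianReal 0 Q)) (extBase n Q N) :=
    measurePreserving_liftLeft (measurePreserving_liftLeft
      (measurePreserving_update (fun _ : Fin n => gaussianReal 0 Q) t))
  rw [← c.map_allLetters, Measure.map_map (by fun_prop) (c.measurable_allLetters t)]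
  have := map_prodMk_of_resample hR (F := fun p => seqTail (c.allLetters t p))
    (G := fun p => (c.allLetters t p 0).1.1) (by fun_prop) (by fun_prop) (fun q => ?_)
    (fun q => ?_)
  · refine this.trans ?_
    rw [map_allLetters]
    rfl
  · funext i
    refine c.letter_regen_congr t _ (fun s hs => ?_) (fun s _ => rfl) rfl
    exact Function.update_of_ne hs.ne _ _
  · exact Function.update_self _ _ _

lemma timeLaw_noise (t : Fin n) :
    (c.timeLaw Q N t).map (fun ξ => (((ξ 0).1, seqTail ξ), (ξ 0).2.1))
      = ((c.timeLaw Q N t).map fun ξ => ((ξ 0).1, seqTail ξ)).prod (gaussianReal 0 N) := by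
  have hR : MeasurePreserving (fun q : (Sample n × (ℕ → Path n × Path n)) × ℝ =>
      (((q.1.1.1, Function.update q.1.1.2.1 t q.2, q.1.1.2.2), q.1.2) :
        Sample n × (ℕ → Path n × Path n)))
      ((extBase n Q N).prod (gaussianReal 0 N)) (extBase n Q N) :=
    measurePreserving_liftLeft (measurePreserving_liftRight (measurePreserving_liftLeft
      (measurePreserving_update (fun _ : Fin n => gaussianReal 0 N) t)))
  rw [← c.map_allLetters, Measure.map_map (by fun_prop) (c.measurable_allLetters t),
    Measure.map_map (by fun_prop) (c.measurable_allLetters t)]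
  refine map_prodMk_of_resample hR (F := fun p => ((c.allLetters t p 0).1,
    seqTail (c.allLetters t p))) (G := fun p => (c.allLetters t p 0).2.1) (by fun_prop)
    (by fun_prop) (fun q => ?_) (fun q => ?_)
  · refine Prod.ext (Prod.ext rfl ?_) ?_
    · change c.U1 (q.1.1.1, Function.update q.1.1.2.1 t q.2, q.1.1.2.2) t = c.U1 q.1.1 t
      rw [c.U1_eq, c.U1_eq]
      refine c.enc_causal t _ _ _ _ _ (fun _ _ => rfl) fun s hs => ?_
      refine c.Y1_congr s (fun _ _ => rfl) fun r hr => ?_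
      exact Function.update_of_ne (hr.trans_lt hs).ne _ _
    · funext i
      refine c.letter_regen_congr t _ (fun s _ => rfl) (fun s hs => ?_) rfl
      exact Function.update_of_ne hs.ne _ _
  · exact Function.update_self _ _ _

end FBNCDesign

/-- Admissible logarithms of reference output (sub)densities. -/
structure NiceLog (ψ : ℝ → ℝ) : Prop where
  cont : Continuous ψ
  growth : ∃ C, ∀ y, |ψ y| ≤ C * (1 + |y|)
  mass : ∫⁻ y, ENNReal.ofReal (Real.exp (ψ y)) ≤ 1

/-- Input and output of the same letter, with the remaining letters as side information. -/
def ownPair (ξ : ℕ → Letter) : ((ℝ × ℝ) × (ℝ × ℝ)) × (ℕ → Letter) :=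
  (((ξ 0).1, (ξ 0).rx), seqTail (seqTail ξ))

/-- Input of one letter and output of another, with the remaining letters as side information. -/
def crossPair (ξ : ℕ → Letter) : ((ℝ × ℝ) × (ℝ × ℝ)) × (ℕ → Letter) :=
  (((ξ 0).1, (ξ 1).rx), seqTail (seqTail ξ))

@[fun_prop] lemma measurable_ownPair : Measurable ownPair := by unfold ownPair; fun_prop
@[fun_prop] lemma measurable_crossPair : Measurable crossPair := by unfold crossPair; fun_prop

@[fun_prop]
lemma continuous_seqTail {E : Type*} [TopologicalSpace E] :
    Continuous (seqTail : (ℕ → E) → ℕ → E) := by unfold seqTail; fun_prop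
@[fun_prop] lemma continuous_ownPair : Continuous ownPair := by unfold ownPair; fun_prop
@[fun_prop] lemma continuous_crossPair : Continuous crossPair := by unfold crossPair; fun_prop

namespace FBNCDesign

variable {n : ℕ} (c : FBNCDesign n)

section Info

open BoundedContinuousFunction

/-- Parameters of the converse bound: seeds and fresh copies. -/
abbrev Par (n : ℕ) : Type := (Path n × Path n) × (ℕ → Path n × Path n)

/-- The noise recovered from source and output. -/
def recon (x y v : Path n) : Path n := fun s => y s - x s - c.enc s x y (v s)

lemma recon_Y1 (x z v w : Path n) : c.recon x (c.Y1 (x, z, v, w)) v = z := by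
  funext s
  have h := c.U1_eq (x, z, v, w) s
  change x s + c.U1 (x, z, v, w) s + z s - x s - c.enc s x (c.Y1 (x, z, v, w)) (v s) = z s
  rw [h]
  change x s + c.enc s x (c.Y1 (x, z, v, w)) (v s) + z s - x s - _ = z s
  ring

@[fun_prop]
lemma measurable_enc' {A : Type*} [MeasurableSpace A] (t : Fin n) {f g : A → Path n} {h : A → ℝ}
    (hf : Measurable f) (hg : Measurable g) (hh : Measurable h) :
    Measurable fun a => c.enc t (f a) (g a) (h a) :=
  (c.enc_meas t).comp (f := fun a => ((f a, g a), h a)) (by fun_prop)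

/-- The test function's argument at time `t`, in terms of source, output and parameters. -/
def pairing (t : Fin n) (q : Path n × Path n × Par n) :
    ((ℝ × ℝ) × (ℝ × ℝ)) × (ℕ → Letter) :=
  (((q.1 t, c.enc t q.1 q.2.1 (q.2.2.1.1 t)), (q.2.1 t, c.dec q.2.1 q.2.2.1.2 t)),
    fun i => c.letter t (regen t (q.1, c.recon q.1 q.2.1 q.2.2.1.1, q.2.2.1) (q.2.2.2 (i + 1))))

@[fun_prop]
lemma measurable_pairing (t : Fin n) : Measurable (c.pairing t) := by
  unfold pairing
  have hr : Measurable fun q : Path n × Path n × Par n => c.recon q.1 q.2.1 q.2.2.1.1 := by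
    refine measurable_pi_iff.2 fun s => ?_
    unfold recon
    fun_prop
  have hd : Measurable fun q : Path n × Path n × Par n => c.dec q.2.1 q.2.2.1.2 t :=
    (measurable_pi_apply t).comp
      (c.dec_meas.comp (f := fun q : Path n × Path n × Par n => (q.2.1, q.2.2.1.2)) (by fun_prop))
  refine Measurable.prodMk (Measurable.prodMk (by fun_prop) (by fun_prop))
    (measurable_pi_iff.2 fun i => (c.measurable_letter t).comp ?_)
  exact (measurable_regen t).comp (f := fun q : Path n × Path n × Par n =>
    ((q.1, c.recon q.1 q.2.1 q.2.2.1.1, q.2.2.1), q.2.2.2 (i + 1))) (by fun_prop)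

lemma pairing_congr (t : Fin n) {x x' : Path n} (y : Path n) (θ : Par n)
    (h : ∀ s ≤ t, x s = x' s) : c.pairing t (x, y, θ) = c.pairing t (x', y, θ) := by
  refine Prod.ext (Prod.ext (Prod.ext (h t le_rfl) ?_) rfl) ?_
  · exact c.enc_causal t _ _ _ _ _ h fun _ _ => rfl
  · funext i
    refine c.letter_regen_congr t _ (fun s hs => h s hs.le) (fun s hs => ?_) rfl
    change y s - x s - _ = y s - x' s - _
    rw [h s hs.le]
    congr 1
    exact c.enc_causal s _ _ _ _ _ (fun r hr => h r (hr.trans hs.le)) fun _ _ => rfl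

lemma pairing_own (t : Fin n) (p : Sample n × (ℕ → Path n × Path n)) :
    c.pairing t (p.1.1, c.Y1 p.1, (p.1.2.2, p.2)) = ownPair (c.allLetters t p) := by
  refine Prod.ext (Prod.ext (Prod.ext rfl ?_) rfl) ?_
  · exact (c.U1_eq p.1 t).symm
  · funext i
    refine c.letter_regen_congr t _ (fun s _ => rfl) (fun s _ => ?_) rfl
    exact congrFun (c.recon_Y1 p.1.1 p.1.2.1 p.1.2.2.1 p.1.2.2.2) s

lemma pairing_cross (t : Fin n) (p : Sample n × (ℕ → Path n × Path n)) :
    c.pairing t (Function.update p.1.1 t ((p.2 0).1 t), c.Y1 p.1, (p.1.2.2, p.2))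
      = crossPair (fun i => c.allLetters t p (Equiv.swap 0 1 i)) := by
  have hx : ∀ s ≤ t, Function.update p.1.1 t ((p.2 0).1 t) s = (regen t p.1 (p.2 0)).1 s := by
    intro s hs
    rcases hs.lt_or_eq with h | h
    · rw [Function.update_of_ne h.ne]
      simp [regen, h]
    · subst h
      simp [regen]
  refine Prod.ext (Prod.ext (Prod.ext ?_ ?_) ?_) ?_
  · exact hx t le_rfl
  · refine Eq.trans ?_ (c.U1_eq (regen t p.1 (p.2 0)) t).symm
    refine c.enc_causal t _ _ _ _ _ hx fun s hs => ?_
    refine c.Y1_congr s (fun r hr => ?_) fun r hr => ?_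
    · simp [hr.trans_lt hs]
    · simp [hr.trans_lt hs]
  · rfl
  · funext i
    have e : Equiv.swap (0 : ℕ) 1 (i + 1 + 1) = i + 1 + 1 :=
      Equiv.swap_apply_of_ne_of_ne (by omega) (by omega)
    change _ = c.allLetters t p (Equiv.swap 0 1 (i + 1 + 1))
    rw [e]
    refine c.letter_regen_congr t _ (fun s hs => ?_) (fun s hs => ?_) rfl
    · exact Function.update_of_ne hs.ne _ _
    · have := c.recon_Y1 p.1.1 p.1.2.1 p.1.2.2.1 p.1.2.2.2
      refine Eq.trans ?_ (congrFun this s)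
      change c.Y1 p.1 s - Function.update p.1.1 t _ s - _ = c.Y1 p.1 s - p.1.1 s - _
      rw [Function.update_of_ne hs.ne]
      congr 1
      refine c.enc_causal s _ _ _ _ _ (fun r hr => ?_) fun _ _ => rfl
      exact Function.update_of_ne (hr.trans_lt hs).ne _ _

variable {Q N : ℝ≥0}

lemma measurePreserving_assemble :
    MeasurePreserving (fun q : Path n × Path n × Par n =>
      (((q.1, q.2.1, q.2.2.1), q.2.2.2) : Sample n × (ℕ → Path n × Path n)))
      ((iidGaussian n Q).prod ((iidGaussian n N).prod
        (((iidGaussian n 1).prod (iidGaussian n 1)).prod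
          (Measure.infinitePi fun _ => (iidGaussian n Q).prod (iidGaussian n N)))))
      (extBase n Q N) := by
  set σ' := (iidGaussian n 1).prod (iidGaussian n 1)
  set I := Measure.infinitePi fun _ : ℕ => (iidGaussian n Q).prod (iidGaussian n N)
  have h1 := (MeasurePreserving.id (iidGaussian n Q)).prod
    ((measurePreserving_prodAssoc (iidGaussian n N) σ' I).symm MeasurableEquiv.prodAssoc)
  have h2 := (measurePreserving_prodAssoc (iidGaussian n Q) ((iidGaussian n N).prod σ') I).symm
    MeasurableEquiv.prodAssoc
  exact h2.comp h1

lemma measurePreserving_refresh (t : Fin n) :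
    MeasurePreserving (fun q : (Sample n × (ℕ → Path n × Path n)) × ℝ =>
      ((q.1.1, seqCons (Function.update (q.1.2 0).1 t q.2, (q.1.2 0).2) (seqTail q.1.2)) :
        Sample n × (ℕ → Path n × Path n)))
      ((extBase n Q N).prod (gaussianReal 0 Q)) (extBase n Q N) := by
  refine measurePreserving_liftRight (R := fun q : (ℕ → Path n × Path n) × ℝ =>
    seqCons (Function.update (q.1 0).1 t q.2, (q.1 0).2) (seqTail q.1)) ?_
  set π := (iidGaussian n Q).prod (iidGaussian n N)
  have h1 := (measurePreserving_seqUncons π).prod (MeasurePreserving.id (gaussianReal 0 Q))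
  have h2 : MeasurePreserving (fun q : ((Path n × Path n) × (ℕ → Path n × Path n)) × ℝ =>
      (((Function.update q.1.1.1 t q.2, q.1.1.2), q.1.2) :
        (Path n × Path n) × (ℕ → Path n × Path n)))
      ((π.prod (Measure.infinitePi fun _ => π)).prod (gaussianReal 0 Q))
      (π.prod (Measure.infinitePi fun _ => π)) :=
    measurePreserving_liftLeft (measurePreserving_liftLeft
      (measurePreserving_update (fun _ : Fin n => gaussianReal 0 Q) t))
  exact (measurePreserving_seqCons π).comp (h2.comp h1)

lemma integral_cross (t : Fin n) {f : ((ℝ × ℝ) × (ℝ × ℝ)) × (ℕ → Letter) → ℝ}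
    (hf : Measurable f) {M : ℝ} (hM : ∀ q, |f q| ≤ M) :
    ∫ ξ, f (crossPair ξ) ∂(c.timeLaw Q N t)
      = ∫ p, ∫ a, f (c.pairing t (Function.update p.1.1 t a, c.Y1 p.1, (p.1.2.2, p.2)))
          ∂(gaussianReal 0 Q) ∂(extBase n Q N) := by
  have e1 : c.timeLaw Q N t = (extBase n Q N).map
      (fun p i => c.allLetters t p (Equiv.swap 0 1 i)) := by
    conv_lhs => rw [← c.timeLaw_reindex Q N t (Equiv.swap 0 1) (Equiv.injective _),
      ← c.map_allLetters, Measure.map_map (by fun_prop) (c.measurable_allLetters t)]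
    rfl
  have hfc : Measurable fun ξ => f (crossPair ξ) := hf.comp measurable_crossPair
  rw [e1, integral_map (by fun_prop) hfc.aestronglyMeasurable]
  have hR := measurePreserving_refresh (Q := Q) (N := N) t
  have hS : Measurable fun p : Sample n × (ℕ → Path n × Path n) =>
      f (crossPair fun i => c.allLetters t p (Equiv.swap 0 1 i)) :=
    hf.comp (measurable_crossPair.comp (by fun_prop))
  rw [← hR.map_eq, integral_map hR.measurable.aemeasurable hS.aestronglyMeasurable, hR.map_eq]
  rw [integral_prod (fun q : (Sample n × (ℕ → Path n × Path n)) × ℝ => f (crossPair fun i => c.allLetters t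
    (q.1.1, seqCons (Function.update (q.1.2 0).1 t q.2, (q.1.2 0).2) (seqTail q.1.2))
    (Equiv.swap 0 1 i)))
    (Integrable.of_bound (hS.comp hR.measurable).aestronglyMeasurable M
      (Filter.Eventually.of_forall fun q => hM _))]
  refine integral_congr_ae (Filter.Eventually.of_forall fun p => ?_)
  refine integral_congr_ae (Filter.Eventually.of_forall fun a => ?_)
  change f _ = f _
  rw [← pairing_cross]
  congr 1
  refine Eq.trans (b := c.pairing t (Function.update p.1.1 t a, c.Y1 p.1, (p.1.2.2,
    seqCons (Function.update (p.2 0).1 t a, (p.2 0).2) (seqTail p.2)))) ?_ rfl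
  congr 1
  simp [seqCons]

end Info

end FBNCDesign

namespace FBNCDesign

variable {n : ℕ} (c : FBNCDesign n) {Q N : ℝ≥0}

lemma info_sum (hN : N ≠ 0) {ψ : ℝ → ℝ} (hψ : Measurable ψ)
    (hψ1 : ∫⁻ y, ENNReal.ofReal (Real.exp (ψ y)) ≤ 1)
    (hψi : ∀ t, Integrable (fun ω => ψ (c.Y1 ω t)) (base n Q N))
    {g : ((ℝ × ℝ) × (ℝ × ℝ)) × (ℕ → Letter) → ℝ} (hg : Measurable g) {M : ℝ}
    (hM : ∀ q, |g q| ≤ M) :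
    ∑ t, (∫ ξ, g (ownPair ξ) ∂(c.timeLaw Q N t) + 1
        - ∫ ξ, Real.exp (g (crossPair ξ)) ∂(c.timeLaw Q N t))
      + ∑ t, ∫ ω, ψ (c.Y1 ω t) ∂(base n Q N)
      ≤ n * ∫ z, Real.log (gaussianPDFReal 0 N z) ∂(gaussianReal 0 N) := by
  set γ := gaussianReal 0 Q
  have hM0 : 0 ≤ M := (abs_nonneg _).trans (hM (((0, 0), (0, 0)), fun _ => ((0, 0), (0, 0))))
  have hupd : ∀ t : Fin n, Measurable fun q : (Path n × Path n × Par n) × ℝ =>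
      (Function.update q.1.1 t q.2, q.1.2) := fun t => by
    refine Measurable.prodMk (measurable_pi_iff.2 fun i => ?_) (by fun_prop)
    by_cases h : i = t
    · subst h; simp only [Function.update_self]; fun_prop
    · simp only [Function.update_of_ne h]; fun_prop
  set f : Fin n → Path n × Path n × Par n → ℝ := fun t q => g (c.pairing t q) with hf
  have hfm : ∀ t, Measurable (f t) := fun t => hg.comp (c.measurable_pairing t)
  have hem : ∀ t : Fin n, Measurable fun q : (Path n × Path n × Par n) × ℝ =>
      Real.exp (f t (Function.update q.1.1 t q.2, q.1.2)) := fun t =>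
    Real.measurable_exp.comp ((hfm t).comp (hupd t))
  set J : Fin n → Path n × Path n × Par n → ℝ := fun t q =>
    ∫ a, Real.exp (f t (Function.update q.1 t a, q.2)) ∂γ with hJ
  have hJm : ∀ t, Measurable (J t) := fun t =>
    ((hem t).stronglyMeasurable.integral_prod_right' (ν := γ)).measurable
  have hlo : ∀ t q, Real.exp (-M) ≤ Real.exp (f t q) := fun t q =>
    Real.exp_le_exp.2 (neg_le_of_abs_le (hM _))
  have hhi : ∀ t q, Real.exp (f t q) ≤ Real.exp M := fun t q =>
    Real.exp_le_exp.2 (le_of_abs_le (hM _))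
  have hei : ∀ t (q : Path n × Path n × Par n), Integrable (fun a => Real.exp (f t (Function.update q.1 t a, q.2))) γ :=
    fun t q => Integrable.of_bound
      ((hem t).comp (measurable_prodMk_left (x := q))).aestronglyMeasurable (Real.exp M)
      (Filter.Eventually.of_forall fun a => by
        rw [Real.norm_eq_abs, abs_of_pos (Real.exp_pos _)]; exact hhi _ _)
  have hJlo : ∀ t q, Real.exp (-M) ≤ J t q := fun t q => by
    have := integral_mono (integrable_const (Real.exp (-M))) (hei t q) fun a => hlo t _
    simpa using this
  have hJhi : ∀ t q, J t q ≤ Real.exp M := fun t q => by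
    have := integral_mono (hei t q) (integrable_const (Real.exp M)) fun a => hhi t _
    simpa using this
  have hJpos : ∀ t q, 0 < J t q := fun t q => (Real.exp_pos _).trans_le (hJlo t q)
  have hlogJ : ∀ t q, |Real.log (J t q)| ≤ M := fun t q => by
    refine abs_le.2 ⟨?_, ?_⟩
    · rw [Real.le_log_iff_exp_le (hJpos t q)]; exact hJlo t q
    · rw [Real.log_le_iff_le_exp (hJpos t q)]; exact hJhi t q
  set H : Fin n → Path n × Path n × Par n → ℝ := fun t q => f t q - Real.log (J t q) with hH
  have hHm : ∀ t, Measurable (H t) := fun t => (hfm t).sub (hJm t).log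
  have hJupd : ∀ t x y θ a, J t (Function.update x t a, y, θ) = J t (x, y, θ) := fun t x y θ a => by
    simp only [hJ, Function.update_idem]
  have hcausal : ∀ y θ t x x', (∀ s, s ≤ t → x s = x' s) → H t (x, y, θ) = H t (x', y, θ) := by
    intro y θ t x x' h
    simp only [hH, hf, hJ]
    rw [c.pairing_congr t y θ h]
    congr 2
    refine integral_congr_ae (Filter.Eventually.of_forall fun a => ?_)
    change Real.exp (g _) = Real.exp (g _)
    rw [c.pairing_congr t y θ (x := Function.update x t a) (x' := Function.update x' t a)]
    intro s hs
    by_cases hst : s = t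
    · subst hst; rw [Function.update_self, Function.update_self]
    · rw [Function.update_of_ne hst, Function.update_of_ne hst, h s hs]
  have hone : ∀ y θ t x,
      ∫⁻ a, ENNReal.ofReal (Real.exp (H t (Function.update x t a, y, θ))) ∂γ ≤ 1 := by
    intro y θ t x
    have e : ∀ a, Real.exp (H t (Function.update x t a, y, θ))
        = Real.exp (f t (Function.update x t a, y, θ)) / J t (x, y, θ) := fun a => by
      simp only [hH]
      rw [Real.exp_sub, hJupd, Real.exp_log (hJpos _ _)]
    simp only [e]
    rw [← ofReal_integral_eq_lintegral_ofReal ((hei t (x, y, θ)).div_const _)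
      (Filter.Eventually.of_forall fun a => div_nonneg (Real.exp_pos _).le (hJpos _ _).le),
      integral_div]
    change ENNReal.ofReal (J t (x, y, θ) / J t (x, y, θ)) ≤ 1
    rw [div_self (hJpos _ _).ne']
    simp
  set I := Measure.infinitePi fun _ : ℕ => (iidGaussian n Q).prod (iidGaussian n N)
  set τ := ((iidGaussian n 1).prod (iidGaussian n 1)).prod I
  have hA := measurePreserving_assemble (n := n) (Q := Q) (N := N)
  set Λ := (iidGaussian n Q).prod ((iidGaussian n N).prod τ)
  set Y : Path n × Path n × Par n → Path n := fun q => c.Y1 (q.1, q.2.1, q.2.2.1) with hY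
  have hYm : Measurable Y := c.measurable_Y1.comp (by fun_prop)
  have hB : MeasurePreserving (fun q : Path n × Path n × Par n =>
      ((q.1, q.2.1, q.2.2.1) : Sample n)) Λ (base n Q N) := measurePreserving_fst.comp hA
  have hψi' : ∀ t, Integrable (fun p => ψ (Y p t)) Λ := fun t =>
    hB.integrable_comp_of_integrable (hψi t)
  have hψe : ∀ t, ∫ p, ψ (Y p t) ∂Λ = ∫ ω, ψ (c.Y1 ω t) ∂(base n Q N) := fun t => by
    rw [← hB.map_eq, integral_map hB.measurable.aemeasurable]
    exact (hψ.comp ((measurable_pi_apply t).comp c.measurable_Y1)).aestronglyMeasurable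
  have hHb : ∀ t q, |H t q| ≤ M + M := fun t q =>
    (abs_sub _ _).trans (add_le_add (hM _) (hlogJ t q))
  have hYq : Measurable fun q : Path n × Path n × Par n => (q.1, Y q, q.2.2) := by fun_prop
  have main := converse_bound hN (iidGaussian n Q) τ hYm
    (fun x θ => c.measurePreserving_Y1 x θ.1.1 θ.1.2) (H := fun q => ∑ t, H t q)
    (Finset.measurable_sum _ fun t _ => hHm t) (C := n * (M + M))
    (fun q => (Finset.abs_sum_le_sum_abs _ _).trans
      ((Finset.sum_le_sum fun t _ => hHb t q).trans (by simp [mul_add])))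
    (fun y θ => lintegral_exp_sum_le_one γ (fun t x => H t (x, y, θ))
      (fun t => (hHm t).comp (by fun_prop)) (hcausal y θ) (fun t x => hone y θ t x))
    hψ hψ1 hψi'
  rw [Finset.sum_congr rfl fun t _ => (hψe t).symm]
  refine le_trans (add_le_add_left ?_ _) main
  have hHi : ∀ t, Integrable (fun q => H t (q.1, Y q, q.2.2)) Λ := fun t =>
    Integrable.of_bound ((hHm t).comp hYq).aestronglyMeasurable (M + M)
      (Filter.Eventually.of_forall fun q => hHb t _)
  rw [integral_finsetSum _ fun t _ => hHi t]
  refine Finset.sum_le_sum fun t _ => ?_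
  have hfi : Integrable (fun q => f t (q.1, Y q, q.2.2)) Λ :=
    Integrable.of_bound ((hfm t).comp hYq).aestronglyMeasurable M
      (Filter.Eventually.of_forall fun q => hM _)
  have hli : Integrable (fun q => Real.log (J t (q.1, Y q, q.2.2))) Λ :=
    Integrable.of_bound ((hJm t).log.comp hYq).aestronglyMeasurable M
      (Filter.Eventually.of_forall fun q => hlogJ t _)
  have hJi : Integrable (fun q => J t (q.1, Y q, q.2.2)) Λ :=
    Integrable.of_bound ((hJm t).comp hYq).aestronglyMeasurable (Real.exp M)
      (Filter.Eventually.of_forall fun q => by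
        rw [Real.norm_eq_abs, abs_of_pos (hJpos _ _)]; exact hJhi t _)
  have h1 : ∫ q, H t (q.1, Y q, q.2.2) ∂Λ
      = ∫ q, f t (q.1, Y q, q.2.2) ∂Λ - ∫ q, Real.log (J t (q.1, Y q, q.2.2)) ∂Λ :=
    integral_sub hfi hli
  have h2 : ∫ q, Real.log (J t (q.1, Y q, q.2.2)) ∂Λ ≤ ∫ q, J t (q.1, Y q, q.2.2) ∂Λ - 1 := by
    have := integral_mono hli (hJi.sub (integrable_const (1 : ℝ)))
      fun q => Real.log_le_sub_one_of_pos (hJpos t _)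
    refine this.trans (le_of_eq ?_)
    rw [integral_sub' hJi (integrable_const _)]
    simp
  have h3 : ∫ ξ, g (ownPair ξ) ∂(c.timeLaw Q N t) = ∫ q, f t (q.1, Y q, q.2.2) ∂Λ := by
    have hm1 : Measurable fun ξ => g (ownPair ξ) := hg.comp measurable_ownPair
    have hm2 : Measurable fun p => g (ownPair (c.allLetters t p)) :=
      hm1.comp (c.measurable_allLetters t)
    rw [← c.map_allLetters, integral_map (c.measurable_allLetters t).aemeasurable
      hm1.aestronglyMeasurable, ← hA.map_eq, integral_map hA.measurable.aemeasurable
      hm2.aestronglyMeasurable]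
    refine integral_congr_ae (Filter.Eventually.of_forall fun q => ?_)
    change g _ = g _
    rw [← pairing_own]
  have h4 : ∫ ξ, Real.exp (g (crossPair ξ)) ∂(c.timeLaw Q N t)
      = ∫ q, J t (q.1, Y q, q.2.2) ∂Λ := by
    rw [c.integral_cross t (f := fun q => Real.exp (g q)) (Real.measurable_exp.comp hg)
      (M := Real.exp M) (fun q => by
        rw [abs_of_pos (Real.exp_pos _)]; exact Real.exp_le_exp.2 (le_of_abs_le (hM _)))]
    have hm : Measurable fun p : Sample n × (ℕ → Path n × Path n) =>
        J t (p.1.1, c.Y1 p.1, (p.1.2.2, p.2)) := (hJm t).comp (by fun_prop)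
    change ∫ p, J t (p.1.1, c.Y1 p.1, (p.1.2.2, p.2)) ∂(extBase n Q N) = _
    rw [← hA.map_eq, integral_map hA.measurable.aemeasurable hm.aestronglyMeasurable]
  rw [h3, h4, h1]
  linarith

end FBNCDesign

open BoundedContinuousFunction in
/-- Properties shared by the letter laws of all designs, tested against bounded continuous
functions; they are preserved by mixtures and by weak limits with bounded power. -/
structure LetterLaw (Q N : ℝ≥0) (μ : Measure (ℕ → Letter)) : Prop where
  reindex : ∀ e : ℕ → ℕ, Function.Injective e → ∀ f : (ℕ → Letter) →ᵇ ℝ,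
    ∫ ξ, f (fun i => ξ (e i)) ∂μ = ∫ ξ, f ξ ∂μ
  source : ∀ (f : (ℕ → Letter) →ᵇ ℝ) (h : ℝ →ᵇ ℝ),
    ∫ ξ, f (seqTail ξ) * h (ξ 0).1.1 ∂μ = (∫ ξ, f ξ ∂μ) * ∫ x, h x ∂(gaussianReal 0 Q)
  noise : ∀ (f : ((ℝ × ℝ) × (ℕ → Letter)) →ᵇ ℝ) (h : ℝ →ᵇ ℝ),
    ∫ ξ, f ((ξ 0).1, seqTail ξ) * h (ξ 0).2.1 ∂μ
      = (∫ ξ, f ((ξ 0).1, seqTail ξ) ∂μ) * ∫ x, h x ∂(gaussianReal 0 N)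
  info : ∀ ψ, NiceLog ψ → ∀ g : (((ℝ × ℝ) × (ℝ × ℝ)) × (ℕ → Letter)) →ᵇ ℝ,
    ∫ ξ, g (ownPair ξ) ∂μ + 1 - ∫ ξ, Real.exp (g (crossPair ξ)) ∂μ + ∫ ξ, ψ (ξ 0).out ∂μ
      ≤ ∫ z, Real.log (gaussianPDFReal 0 N z) ∂(gaussianReal 0 N)

/-- The power of a letter law. -/
def powerMoment (μ : Measure (ℕ → Letter)) : ℝ≥0∞ :=
  ∫⁻ ξ, ENNReal.ofReal ((ξ 0).1.2 ^ 2) ∂μ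

/-- The estimation error of a letter law. -/
def errorMoment (μ : Measure (ℕ → Letter)) : ℝ≥0∞ :=
  ∫⁻ ξ, ENNReal.ofReal (((ξ 0).1.1 + (ξ 0).1.2 - (ξ 0).2.2) ^ 2) ∂μ

lemma lintegral_sq_gaussianReal_lt_top (v : ℝ≥0) :
    ∫⁻ x, ENNReal.ofReal (x ^ 2) ∂(gaussianReal 0 v) < ∞ := by
  have h := (memLp_id_gaussianReal (μ := 0) (v := v) 2).integrable_sq
  have := h.lintegral_lt_top
  simpa using this

lemma lintegral_out_sq_le {μ : Measure (ℕ → Letter)} {Q N : ℝ≥0}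
    (hx : μ.map (fun ξ => (ξ 0).1.1) = gaussianReal 0 Q)
    (hz : μ.map (fun ξ => (ξ 0).2.1) = gaussianReal 0 N) :
    ∫⁻ ξ, ENNReal.ofReal ((ξ 0).out ^ 2) ∂μ
      ≤ 3 * (∫⁻ x, ENNReal.ofReal (x ^ 2) ∂(gaussianReal 0 Q) + powerMoment μ
        + ∫⁻ x, ENNReal.ofReal (x ^ 2) ∂(gaussianReal 0 N)) := by
  rw [← hx, ← hz, lintegral_map (by fun_prop) (by fun_prop),
    lintegral_map (by fun_prop) (by fun_prop), powerMoment,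
    ← lintegral_add_left (by fun_prop), ← lintegral_add_left (by fun_prop),
    ← lintegral_const_mul _ (by fun_prop)]
  refine lintegral_mono fun ξ => ?_
  rw [← ENNReal.ofReal_add (by positivity) (by positivity),
    ← ENNReal.ofReal_add (by positivity) (by positivity),
    show (3 : ℝ≥0∞) = ENNReal.ofReal 3 by norm_num, ← ENNReal.ofReal_mul (by norm_num)]
  refine ENNReal.ofReal_le_ofReal ?_
  simp only [Letter.out]
  nlinarith [sq_nonneg ((ξ 0).1.1 - (ξ 0).1.2), sq_nonneg ((ξ 0).1.1 - (ξ 0).2.1),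
    sq_nonneg ((ξ 0).1.2 - (ξ 0).2.1)]

lemma NiceLog.integrable {Ω : Type*} [MeasurableSpace Ω] {μ : Measure Ω} [IsFiniteMeasure μ]
    {ψ : ℝ → ℝ} (hψ : NiceLog ψ) {Y : Ω → ℝ} (hY : Measurable Y)
    (h : ∫⁻ ω, ENNReal.ofReal (Y ω ^ 2) ∂μ < ∞) : Integrable (fun ω => ψ (Y ω)) μ := by
  obtain ⟨C, hC⟩ := hψ.growth
  have hsq : Integrable (fun ω => Y ω ^ 2) μ :=
    (lintegral_ofReal_ne_top_iff_integrable (by fun_prop)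
      (Filter.Eventually.of_forall fun ω => sq_nonneg _)).1 h.ne
  refine Integrable.mono' (((integrable_const (1 : ℝ)).add ((integrable_const (1 : ℝ)).add
    hsq)).const_mul |C|) (hψ.cont.measurable.comp hY).aestronglyMeasurable
    (Filter.Eventually.of_forall fun ω => ?_)
  refine (hC _).trans ?_
  have h1 : |Y ω| ≤ 1 + Y ω ^ 2 := by nlinarith [sq_abs (Y ω), sq_nonneg (|Y ω| - 1), abs_nonneg (Y ω)]
  have h2 : C ≤ |C| := le_abs_self _
  have h3 : 0 ≤ |Y ω| := abs_nonneg _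
  change C * (1 + |Y ω|) ≤ |C| * (1 + (1 + Y ω ^ 2))
  calc C * (1 + |Y ω|) ≤ |C| * (1 + |Y ω|) := by gcongr
    _ ≤ _ := by gcongr

lemma integrable_bcf_comp {A B : Type*} [MeasurableSpace A] [TopologicalSpace B]
    [MeasurableSpace B] [OpensMeasurableSpace B] {μ : Measure A} [IsFiniteMeasure μ]
    (f : BoundedContinuousFunction B ℝ) {T : A → B} (hT : Measurable T) :
    Integrable (fun a => f (T a)) μ :=
  Integrable.of_bound (f.continuous.measurable.comp hT).aestronglyMeasurable ‖f‖
    (Filter.Eventually.of_forall fun _ => f.norm_coe_le_norm _)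

namespace FBNCDesign

variable {n : ℕ} (c : FBNCDesign n) (Q N : ℝ≥0)

lemma map_timeLaw_zero (t : Fin n) :
    (c.timeLaw Q N t).map (fun ξ => ξ 0) = (base n Q N).map (c.letter t) := by
  rw [← c.map_allLetters, Measure.map_map (by fun_prop) (c.measurable_allLetters t)]
  have : (fun ξ : ℕ → Letter => ξ 0) ∘ c.allLetters t = c.letter t ∘ Prod.fst := rfl
  rw [this, ← Measure.map_map (c.measurable_letter t) measurable_fst]
  congr 1
  exact measurePreserving_fst.map_eq

lemma lintegral_timeLaw_zero (t : Fin n) {F : Letter → ℝ≥0∞} (hF : Measurable F) :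
    ∫⁻ ξ, F (ξ 0) ∂(c.timeLaw Q N t) = ∫⁻ ω, F (c.letter t ω) ∂(base n Q N) := by
  rw [← lintegral_map hF (measurable_pi_apply 0), map_timeLaw_zero,
    lintegral_map hF (c.measurable_letter t)]

lemma integral_timeLaw_zero (t : Fin n) {F : Letter → ℝ} (hF : Measurable F) :
    ∫ ξ, F (ξ 0) ∂(c.timeLaw Q N t) = ∫ ω, F (c.letter t ω) ∂(base n Q N) := by
  rw [← integral_map (φ := fun ξ : ℕ → Letter => ξ 0) (measurable_pi_apply 0).aemeasurable
    hF.aestronglyMeasurable, map_timeLaw_zero,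
    integral_map (c.measurable_letter t).aemeasurable hF.aestronglyMeasurable]

lemma map_timeLaw_source (t : Fin n) :
    (c.timeLaw Q N t).map (fun ξ => (ξ 0).1.1) = gaussianReal 0 Q := by
  have h := congrArg (Measure.map Prod.snd) (c.timeLaw_source Q N t)
  rw [Measure.map_map (by fun_prop) (by fun_prop)] at h
  exact h.trans measurePreserving_snd.map_eq

lemma map_timeLaw_noise (t : Fin n) :
    (c.timeLaw Q N t).map (fun ξ => (ξ 0).2.1) = gaussianReal 0 N := by
  have h := congrArg (Measure.map Prod.snd) (c.timeLaw_noise Q N t)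
  rw [Measure.map_map (by fun_prop) (by fun_prop)] at h
  have : IsProbabilityMeasure ((c.timeLaw Q N t).map fun ξ => ((ξ 0).1, seqTail ξ)) :=
    Measure.isProbabilityMeasure_map (by fun_prop)
  exact h.trans measurePreserving_snd.map_eq

/-- The letter law at a uniformly chosen time. -/
def avgLaw : Measure (ℕ → Letter) := (n : ℝ≥0∞)⁻¹ • ∑ t, c.timeLaw Q N t

lemma isProbabilityMeasure_avgLaw (hn : n ≠ 0) : IsProbabilityMeasure (c.avgLaw Q N) := by
  constructor
  simp [avgLaw, Measure.finsetSum_apply]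
  exact ENNReal.inv_mul_cancel (by exact_mod_cast hn) (by simp)

lemma lintegral_avgLaw (F : (ℕ → Letter) → ℝ≥0∞) :
    ∫⁻ ξ, F ξ ∂(c.avgLaw Q N) = (n : ℝ≥0∞)⁻¹ * ∑ t, ∫⁻ ξ, F ξ ∂(c.timeLaw Q N t) := by
  rw [avgLaw, lintegral_smul_measure, lintegral_finsetSum_measure]
  rfl

lemma integral_avgLaw {F : (ℕ → Letter) → ℝ} (hF : ∀ t, Integrable F (c.timeLaw Q N t)) :
    ∫ ξ, F ξ ∂(c.avgLaw Q N) = (n : ℝ)⁻¹ * ∑ t, ∫ ξ, F ξ ∂(c.timeLaw Q N t) := by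
  rw [avgLaw, integral_smul_measure, integral_finsetSum_measure fun t _ => hF t]
  simp

lemma powerMoment_avgLaw :
    powerMoment (c.avgLaw Q N) = ∫⁻ ω, ENNReal.ofReal (costP (c.U1 ω)) ∂(base n Q N) := by
  have hm : ∀ t, Measurable fun ω => ENNReal.ofReal (c.U1 ω t ^ 2) := fun t => by
    have := c.measurable_U1; fun_prop
  rw [powerMoment, lintegral_avgLaw]
  simp_rw [c.lintegral_timeLaw_zero Q N _ (F := fun l : Letter => ENNReal.ofReal (l.1.2 ^ 2))
    (by fun_prop)]
  change _ * ∑ t, ∫⁻ ω, ENNReal.ofReal (c.U1 ω t ^ 2) ∂(base n Q N) = _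
  rw [← lintegral_finsetSum _ fun t _ => hm t, ← lintegral_const_mul _
    (Finset.measurable_sum _ fun t _ => hm t)]
  refine lintegral_congr fun ω => ?_
  rw [costP, ENNReal.ofReal_mul (by positivity), ENNReal.ofReal_sum_of_nonneg
    fun t _ => sq_nonneg _]
  rcases eq_or_ne n 0 with rfl | hn
  · simp
  · rw [one_div, ENNReal.ofReal_inv_of_pos (by positivity), ENNReal.ofReal_natCast]

lemma errorMoment_avgLaw :
    errorMoment (c.avgLaw Q N)
      = ∫⁻ ω, ENNReal.ofReal (costS (c.X1 ω) (c.U2 ω)) ∂(base n Q N) := by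
  have hm : ∀ t, Measurable fun ω => ENNReal.ofReal ((c.X1 ω t - c.U2 ω t) ^ 2) := fun t => by
    have h : Measurable fun l : Letter => ENNReal.ofReal ((l.1.1 + l.1.2 - l.2.2) ^ 2) := by
      fun_prop
    exact h.comp (c.measurable_letter t)
  rw [errorMoment, lintegral_avgLaw]
  simp_rw [c.lintegral_timeLaw_zero Q N _
    (F := fun l : Letter => ENNReal.ofReal ((l.1.1 + l.1.2 - l.2.2) ^ 2)) (by fun_prop)]
  change _ * ∑ t, ∫⁻ ω, ENNReal.ofReal ((c.X1 ω t - c.U2 ω t) ^ 2) ∂(base n Q N) = _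
  rw [← lintegral_finsetSum _ fun t _ => hm t, ← lintegral_const_mul _
    (Finset.measurable_sum _ fun t _ => hm t)]
  refine lintegral_congr fun ω => ?_
  rw [costS, ENNReal.ofReal_mul (by positivity), ENNReal.ofReal_sum_of_nonneg
    fun t _ => sq_nonneg _]
  rcases eq_or_ne n 0 with rfl | hn
  · simp
  · rw [one_div, ENNReal.ofReal_inv_of_pos (by positivity), ENNReal.ofReal_natCast]

lemma letterLaw_avgLaw (hn : n ≠ 0) (hN : N ≠ 0) (hP : powerMoment (c.avgLaw Q N) < ∞) :
    LetterLaw Q N (c.avgLaw Q N) := by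
  have hn0 : (0 : ℝ) < n := by positivity
  have hpow : ∀ t, powerMoment (c.timeLaw Q N t) < ∞ := fun t => by
    rw [powerMoment, lintegral_avgLaw] at hP
    have h1 : ∑ t, ∫⁻ ξ, ENNReal.ofReal ((ξ 0).1.2 ^ 2) ∂(c.timeLaw Q N t) < ∞ := by
      by_contra h
      rw [not_lt, top_le_iff] at h
      rw [h, ENNReal.mul_top (by simp)] at hP
      exact lt_irrefl _ hP
    exact (ENNReal.sum_lt_top.1 h1) t (Finset.mem_univ _)
  refine ⟨fun e he f => ?_, fun f h => ?_, fun f h => ?_, fun ψ hψ g => ?_⟩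
  · have hfi : ∀ t, Integrable (fun ξ => f ξ) (c.timeLaw Q N t) := fun t =>
      integrable_bcf_comp f measurable_id
    have hT : Measurable fun (ξ : ℕ → Letter) i => ξ (e i) := by fun_prop
    rw [c.integral_avgLaw Q N fun t => integrable_bcf_comp f hT,
      c.integral_avgLaw Q N hfi]
    congr 1
    refine Finset.sum_congr rfl fun t _ => ?_
    rw [← integral_map (φ := fun (ξ : ℕ → Letter) i => ξ (e i)) hT.aemeasurable
      f.continuous.measurable.aestronglyMeasurable, c.timeLaw_reindex Q N t e he]
  · have hfi : ∀ t, Integrable (fun ξ => f ξ) (c.timeLaw Q N t) := fun t =>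
      integrable_bcf_comp f measurable_id
    have hi : ∀ t, Integrable (fun ξ : ℕ → Letter => f (seqTail ξ) * h (ξ 0).1.1)
        (c.timeLaw Q N t) := fun t =>
      (integrable_bcf_comp h (by fun_prop)).bdd_mul (c := ‖f‖) (by
        exact (f.continuous.measurable.comp measurable_seqTail).aestronglyMeasurable)
        (Filter.Eventually.of_forall fun _ => f.norm_coe_le_norm _)
    rw [c.integral_avgLaw Q N hi, c.integral_avgLaw Q N hfi, mul_assoc, Finset.sum_mul]
    congr 1
    refine Finset.sum_congr rfl fun t _ => ?_
    have hm : Measurable fun q : (ℕ → Letter) × ℝ => f q.1 * h q.2 :=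
      (f.continuous.measurable.comp measurable_fst).mul
        (h.continuous.measurable.comp measurable_snd)
    have := integral_map (μ := c.timeLaw Q N t)
      (φ := fun ξ : ℕ → Letter => (seqTail ξ, (ξ 0).1.1)) (by fun_prop)
      hm.aestronglyMeasurable
    rw [← this, c.timeLaw_source, integral_prod_mul]
  · have hi : ∀ t, Integrable (fun ξ : ℕ → Letter => f ((ξ 0).1, seqTail ξ) * h (ξ 0).2.1)
        (c.timeLaw Q N t) := fun t =>
      (integrable_bcf_comp h (by fun_prop)).bdd_mul (c := ‖f‖) (by
        exact (f.continuous.measurable.comp (by fun_prop)).aestronglyMeasurable)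
        (Filter.Eventually.of_forall fun _ => f.norm_coe_le_norm _)
    rw [c.integral_avgLaw Q N hi, c.integral_avgLaw Q N fun t => integrable_bcf_comp f
      (by fun_prop), mul_assoc, Finset.sum_mul]
    congr 1
    refine Finset.sum_congr rfl fun t _ => ?_
    have hm : Measurable fun q : ((ℝ × ℝ) × (ℕ → Letter)) × ℝ => f q.1 * h q.2 :=
      (f.continuous.measurable.comp measurable_fst).mul
        (h.continuous.measurable.comp measurable_snd)
    have := integral_map (μ := c.timeLaw Q N t)
      (φ := fun ξ : ℕ → Letter => (((ξ 0).1, seqTail ξ), (ξ 0).2.1)) (by fun_prop)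
      hm.aestronglyMeasurable
    rw [← this, c.timeLaw_noise, integral_prod_mul, integral_map (by fun_prop)
      f.continuous.measurable.aestronglyMeasurable]
  · have hout : ∀ t, ∫⁻ ξ, ENNReal.ofReal ((ξ 0).out ^ 2) ∂(c.timeLaw Q N t) < ∞ := fun t =>
      (lintegral_out_sq_le (c.map_timeLaw_source Q N t) (c.map_timeLaw_noise Q N t)).trans_lt
        (ENNReal.mul_lt_top (by simp) (ENNReal.add_lt_top.2 ⟨ENNReal.add_lt_top.2
          ⟨lintegral_sq_gaussianReal_lt_top Q, hpow t⟩, lintegral_sq_gaussianReal_lt_top N⟩))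
    have hψt : ∀ t, Integrable (fun ξ : ℕ → Letter => ψ (ξ 0).out) (c.timeLaw Q N t) := fun t =>
      hψ.integrable (by fun_prop) (hout t)
    have hψi : ∀ t, Integrable (fun ω => ψ (c.Y1 ω t)) (base n Q N) := fun t => by
      refine hψ.integrable (by fun_prop) ?_
      have := c.lintegral_timeLaw_zero Q N t (F := fun l => ENNReal.ofReal (l.out ^ 2))
        (by fun_prop)
      exact (this.symm.trans_lt (hout t))
    have hexp : ∀ t, Integrable (fun ξ => Real.exp (g (crossPair ξ))) (c.timeLaw Q N t) :=
      fun t => Integrable.of_bound (Real.measurable_exp.comp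
        (g.continuous.measurable.comp measurable_crossPair)).aestronglyMeasurable (Real.exp ‖g‖)
        (Filter.Eventually.of_forall fun ξ => by
          rw [Real.norm_eq_abs, abs_of_pos (Real.exp_pos _)]
          exact Real.exp_le_exp.2 ((le_abs_self _).trans (g.norm_coe_le_norm _)))
    have key := c.info_sum (Q := Q) hN hψ.cont.measurable hψ.mass hψi g.continuous.measurable
      (M := ‖g‖) fun q => g.norm_coe_le_norm q
    rw [c.integral_avgLaw Q N hexp, c.integral_avgLaw Q N hψt,
      c.integral_avgLaw Q N fun t => integrable_bcf_comp g measurable_ownPair]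
    have e : ∀ t, ∫ ξ, ψ (ξ 0).out ∂(c.timeLaw Q N t) = ∫ ω, ψ (c.Y1 ω t) ∂(base n Q N) :=
      fun t => c.integral_timeLaw_zero Q N t (F := fun l => ψ l.out)
        (hψ.cont.measurable.comp Letter.measurable_out)
    simp only [e]
    rw [Finset.sum_sub_distrib, Finset.sum_add_distrib] at key
    simp only [Finset.sum_const, Finset.card_univ, Fintype.card_fin, nsmul_eq_mul, mul_one]
      at key
    refine le_of_mul_le_mul_left ?_ hn0
    refine le_trans (le_of_eq ?_) key
    field_simp

end FBNCDesign

section Basic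

variable {Q N : ℝ≥0} {μ : Measure (ℕ → Letter)} [IsProbabilityMeasure μ]

namespace LetterLaw

lemma map_reindex (h : LetterLaw Q N μ) {e : ℕ → ℕ} (he : Function.Injective e) :
    μ.map (fun ξ i => ξ (e i)) = μ := by
  have hm : Measurable fun (ξ : ℕ → Letter) i => ξ (e i) := by fun_prop
  have := Measure.isProbabilityMeasure_map (μ := μ) hm.aemeasurable
  refine ext_of_forall_integral_eq_of_IsFiniteMeasure fun f => ?_
  rw [integral_map hm.aemeasurable f.continuous.measurable.aestronglyMeasurable]
  exact h.reindex e he f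

lemma map_source (h : LetterLaw Q N μ) :
    μ.map (fun ξ => (seqTail ξ, (ξ 0).1.1)) = μ.prod (gaussianReal 0 Q) := by
  have hm : Measurable fun ξ : ℕ → Letter => (seqTail ξ, (ξ 0).1.1) := by fun_prop
  have := Measure.isProbabilityMeasure_map (μ := μ) hm.aemeasurable
  refine Measure.eq_prod_of_integral_mul_boundedContinuousFunction fun f k => ?_
  have hfk : Measurable fun q : (ℕ → Letter) × ℝ => f q.1 * k q.2 :=
    (f.continuous.measurable.comp measurable_fst).mul
      (k.continuous.measurable.comp measurable_snd)
  rw [integral_map hm.aemeasurable hfk.aestronglyMeasurable]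
  exact h.source f k

lemma map_noise (h : LetterLaw Q N μ) :
    μ.map (fun ξ => (((ξ 0).1, seqTail ξ), (ξ 0).2.1))
      = (μ.map fun ξ => ((ξ 0).1, seqTail ξ)).prod (gaussianReal 0 N) := by
  have hm : Measurable fun ξ : ℕ → Letter => (((ξ 0).1, seqTail ξ), (ξ 0).2.1) := by fun_prop
  have hm' : Measurable fun ξ : ℕ → Letter => ((ξ 0).1, seqTail ξ) := by fun_prop
  have := Measure.isProbabilityMeasure_map (μ := μ) hm.aemeasurable
  have := Measure.isProbabilityMeasure_map (μ := μ) hm'.aemeasurable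
  refine Measure.eq_prod_of_integral_mul_boundedContinuousFunction fun f k => ?_
  have hfk : Measurable fun q : ((ℝ × ℝ) × (ℕ → Letter)) × ℝ => f q.1 * k q.2 :=
    (f.continuous.measurable.comp measurable_fst).mul
      (k.continuous.measurable.comp measurable_snd)
  rw [integral_map hm.aemeasurable hfk.aestronglyMeasurable,
    integral_map hm'.aemeasurable f.continuous.measurable.aestronglyMeasurable]
  exact h.noise f k

lemma map_x (h : LetterLaw Q N μ) : μ.map (fun ξ => (ξ 0).1.1) = gaussianReal 0 Q := by
  have h := congrArg (Measure.map Prod.snd) h.map_source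
  rw [Measure.map_map (by fun_prop) (by fun_prop)] at h
  exact h.trans measurePreserving_snd.map_eq

lemma map_z (h : LetterLaw Q N μ) : μ.map (fun ξ => (ξ 0).2.1) = gaussianReal 0 N := by
  have h := congrArg (Measure.map Prod.snd) h.map_noise
  rw [Measure.map_map (by fun_prop) (by fun_prop)] at h
  have : IsProbabilityMeasure (μ.map fun ξ => ((ξ 0).1, seqTail ξ)) :=
    Measure.isProbabilityMeasure_map (by fun_prop)
  exact h.trans measurePreserving_snd.map_eq

lemma map_coord (h : LetterLaw Q N μ) (i : ℕ) :
    μ.map (fun ξ => ξ i) = μ.map (fun ξ => ξ 0) := by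
  conv_rhs => rw [← h.map_reindex (e := fun j => j + i) (add_left_injective i)]
  rw [Measure.map_map (by fun_prop) (by fun_prop)]
  simp [Function.comp_def]

lemma lintegral_out_sq_le (h : LetterLaw Q N μ) :
    ∫⁻ ξ, ENNReal.ofReal ((ξ 0).out ^ 2) ∂μ
      ≤ 3 * (∫⁻ x, ENNReal.ofReal (x ^ 2) ∂(gaussianReal 0 Q) + powerMoment μ
        + ∫⁻ x, ENNReal.ofReal (x ^ 2) ∂(gaussianReal 0 N)) :=
  Witsenhausen.lintegral_out_sq_le h.map_x h.map_z

lemma lintegral_norm_sq_le (h : LetterLaw Q N μ) (i : ℕ) :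
    ∫⁻ ξ, ENNReal.ofReal (‖ξ i‖ ^ 2) ∂μ
      ≤ 4 * (∫⁻ x, ENNReal.ofReal (x ^ 2) ∂(gaussianReal 0 Q) + powerMoment μ
        + ∫⁻ x, ENNReal.ofReal (x ^ 2) ∂(gaussianReal 0 N) + errorMoment μ) := by
  have hm : Measurable fun l : Letter => ENNReal.ofReal (‖l‖ ^ 2) := by fun_prop
  rw [← lintegral_map (g := fun ξ : ℕ → Letter => ξ i) hm (by fun_prop), h.map_coord,
    lintegral_map hm (by fun_prop), ← h.map_x, ← h.map_z,
    lintegral_map (by fun_prop) (by fun_prop), lintegral_map (by fun_prop) (by fun_prop),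
    powerMoment, errorMoment, ← lintegral_add_left (by fun_prop),
    ← lintegral_add_left (by fun_prop), ← lintegral_add_left (by fun_prop),
    ← lintegral_const_mul _ (by fun_prop)]
  refine lintegral_mono fun ξ => ?_
  rw [← ENNReal.ofReal_add (by positivity) (by positivity),
    ← ENNReal.ofReal_add (by positivity) (by positivity),
    ← ENNReal.ofReal_add (by positivity) (by positivity),
    show (4 : ℝ≥0∞) = ENNReal.ofReal 4 by norm_num, ← ENNReal.ofReal_mul (by norm_num)]
  refine ENNReal.ofReal_le_ofReal ?_
  obtain ⟨⟨x, u⟩, ⟨z, v⟩⟩ := ξ 0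
  simp only [Prod.norm_def, Real.norm_eq_abs]
  have hv : v ^ 2 ≤ 4 * (x ^ 2 + u ^ 2 + z ^ 2 + (x + u - v) ^ 2) := by
    nlinarith [sq_nonneg (x - u), sq_nonneg (x + (x + u - v)), sq_nonneg (u + (x + u - v)),
      sq_nonneg z]
  have hx := sq_nonneg x
  have hu := sq_nonneg u
  have hz := sq_nonneg z
  have he := sq_nonneg (x + u - v)
  rcases max_cases (max |x| |u|) (max |z| |v|) with ⟨h1, _⟩ | ⟨h1, _⟩ <;> rw [h1]
  · rcases max_cases |x| |u| with ⟨h2, _⟩ | ⟨h2, _⟩ <;> rw [h2, sq_abs] <;> linarith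
  · rcases max_cases |z| |v| with ⟨h2, _⟩ | ⟨h2, _⟩ <;> rw [h2, sq_abs] <;> linarith

end LetterLaw

lemma exists_isCompact_letterLaw {B : ℝ≥0∞} (hB : B ≠ ∞) {ε : ℝ≥0} (hε : 0 < ε) :
    ∃ K : Set (ℕ → Letter), IsCompact K ∧ ∀ ν : Measure (ℕ → Letter),
      (∀ i, ∫⁻ ξ, ENNReal.ofReal (‖ξ i‖ ^ 2) ∂ν ≤ B) → ν Kᶜ ≤ ε := by
  obtain ⟨δ, hδ, hsum⟩ := ENNReal.exists_pos_sum_of_countable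
    (ε := (ε : ℝ≥0∞)) (by exact_mod_cast hε.ne') ℕ
  set r : ℕ → ℝ := fun i => √(B.toReal / δ i) + 1 with hr
  have hr0 : ∀ i, 0 < r i := fun i => by positivity
  refine ⟨Set.univ.pi fun i => Metric.closedBall 0 (r i),
    isCompact_univ_pi fun i => isCompact_closedBall _ _, fun ν hν => ?_⟩
  have hcompl : (Set.univ.pi fun i => Metric.closedBall (0 : Letter) (r i))ᶜ
      ⊆ ⋃ i, {ξ : ℕ → Letter | ENNReal.ofReal (r i ^ 2) ≤ ENNReal.ofReal (‖ξ i‖ ^ 2)} := by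
    intro ξ hξ
    simp only [Set.mem_compl_iff, Set.mem_pi, Set.mem_univ, true_implies, not_forall,
      Metric.mem_closedBall, dist_zero_right, not_le] at hξ
    obtain ⟨i, hi⟩ := hξ
    refine Set.mem_iUnion.2 ⟨i, ?_⟩
    rw [Set.mem_ofPred_eq]
    have := hr0 i
    exact ENNReal.ofReal_le_ofReal (by gcongr)
  refine (measure_mono hcompl).trans ((measure_iUnion_le _).trans
    ((ENNReal.tsum_le_tsum fun i => ?_).trans hsum.le))
  have hm : Measurable fun ξ : ℕ → Letter => ENNReal.ofReal (‖ξ i‖ ^ 2) := by fun_prop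
  have hmk := mul_meas_ge_le_lintegral (μ := ν) hm (ENNReal.ofReal (r i ^ 2))
  have hr2 : B.toReal ≤ δ i * r i ^ 2 := by
    have h1 : B.toReal / δ i ≤ r i ^ 2 := by
      have h2 : (0 : ℝ) ≤ B.toReal / δ i := by positivity
      simp only [hr]
      nlinarith [Real.sq_sqrt h2, Real.sqrt_nonneg (B.toReal / δ i)]
    have h3 : (0 : ℝ) < δ i := hδ i
    rw [div_le_iff₀ h3] at h1
    linarith
  have hB' : B ≤ ENNReal.ofReal (r i ^ 2) * δ i := by
    rw [← ENNReal.ofReal_toReal hB, ← ENNReal.ofReal_coe_nnreal (p := δ i),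
      ← ENNReal.ofReal_mul (by positivity)]
    exact ENNReal.ofReal_le_ofReal (by linarith)
  refine (ENNReal.mul_le_mul_iff_right (a := ENNReal.ofReal (r i ^ 2)) ?_ ENNReal.ofReal_ne_top).1
    (hmk.trans ((hν i).trans hB'))
  have := hr0 i
  simpa using this.ne'

end Basic

section Limit

open Filter Topology BoundedContinuousFunction

/-- The truncation of a real number to `[-M, M]`. -/
def clip (M y : ℝ) : ℝ := max (-M) (min M y)

@[fun_prop] lemma continuous_clip (M : ℝ) : Continuous (clip M) := by unfold clip; fun_prop

lemma abs_clip_le {M : ℝ} (hM : 0 ≤ M) (y : ℝ) : |clip M y| ≤ M :=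
  abs_le.2 ⟨le_max_left _ _, max_le (by linarith) (min_le_left _ _)⟩

lemma abs_sub_clip_le {M : ℝ} (hM : 0 < M) (y : ℝ) : |y - clip M y| ≤ y ^ 2 / M := by
  rw [le_div_iff₀ hM]
  unfold clip
  rcases le_total M y with h | h
  · rw [min_eq_left h, max_eq_right (by linarith), abs_of_nonneg (by linarith)]
    nlinarith
  · rw [min_eq_right h]
    rcases le_total (-M) y with h' | h'
    · rw [max_eq_right h']; simp; positivity
    · rw [max_eq_left h', abs_of_nonpos (by linarith)]
      nlinarith

/-- Truncation of a continuous function. -/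
def clipBCF {E : Type*} [TopologicalSpace E] (M : ℝ) (hM : 0 ≤ M) (f : E → ℝ)
    (hf : Continuous f) : E →ᵇ ℝ :=
  BoundedContinuousFunction.ofNormedAddCommGroup (fun x => clip M (f x)) (by fun_prop) M
    fun _ => abs_clip_le hM _

variable {F : Filter ℕ} {μs : ℕ → ProbabilityMeasure (ℕ → Letter)}
  {μ : ProbabilityMeasure (ℕ → Letter)}

lemma tendsto_integral_bcf {E : Type*} [TopologicalSpace E] (h : Tendsto μs F (𝓝 μ))
    (f : E →ᵇ ℝ) {T : (ℕ → Letter) → E} (hT : Continuous T) :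
    Tendsto (fun k => ∫ ξ, f (T ξ) ∂(μs k : Measure (ℕ → Letter))) F
      (𝓝 (∫ ξ, f (T ξ) ∂(μ : Measure (ℕ → Letter)))) :=
  (ProbabilityMeasure.tendsto_iff_forall_integral_tendsto.1 h)
    (f.compContinuous ⟨T, hT⟩)

lemma lintegral_le_of_tendsto [NeBot F] (h : Tendsto μs F (𝓝 μ)) {q : (ℕ → Letter) → ℝ}
    (hq : Continuous q) (hq0 : ∀ ξ, 0 ≤ q ξ) {b : ℕ → ℝ≥0∞} {b₀ : ℝ≥0∞}
    (hb : Tendsto b F (𝓝 b₀))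
    (hle : ∀ k, ∫⁻ ξ, ENNReal.ofReal (q ξ) ∂(μs k : Measure (ℕ → Letter)) ≤ b k) :
    ∫⁻ ξ, ENNReal.ofReal (q ξ) ∂(μ : Measure (ℕ → Letter)) ≤ b₀ := by
  have hclip : ∀ (M : ℕ) ξ, clip M (q ξ) = min (M : ℝ) (q ξ) := fun M ξ =>
    max_eq_right (le_min (by linarith [(Nat.cast_nonneg M : (0 : ℝ) ≤ M)])
      (by linarith [hq0 ξ, (Nat.cast_nonneg M : (0 : ℝ) ≤ M)]))
  have key : ∀ (M : ℕ) (ν : ProbabilityMeasure (ℕ → Letter)),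
      ENNReal.ofReal (∫ ξ, clip M (q ξ) ∂(ν : Measure (ℕ → Letter)))
        = ∫⁻ ξ, ENNReal.ofReal (clip M (q ξ)) ∂(ν : Measure (ℕ → Letter)) := fun M ν => by
    refine ofReal_integral_eq_lintegral_ofReal ?_ (Eventually.of_forall fun ξ => ?_)
    · exact integrable_bcf_comp (clipBCF (M : ℝ) (by positivity) q hq) measurable_id
    · change (0 : ℝ) ≤ clip M (q ξ)
      rw [hclip]; exact le_min (by positivity) (hq0 ξ)
  have hM : ∀ M : ℕ, ∫⁻ ξ, ENNReal.ofReal (clip M (q ξ)) ∂(μ : Measure (ℕ → Letter)) ≤ b₀ := by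
    intro M
    have ht := (ENNReal.continuous_ofReal.tendsto _).comp
      (tendsto_integral_bcf h (clipBCF (M : ℝ) (by positivity) q hq) continuous_id)
    have e := key M μ
    change _ ≤ _
    rw [← e]
    refine le_of_tendsto_of_tendsto' ht hb fun k => ?_
    refine ((key M (μs k)).le.trans (lintegral_mono fun ξ => ?_)).trans (hle k)
    refine ENNReal.ofReal_le_ofReal ?_
    rw [hclip]; exact min_le_right _ _
  have hlim : Tendsto (fun M : ℕ => ∫⁻ ξ, ENNReal.ofReal (clip M (q ξ))
      ∂(μ : Measure (ℕ → Letter))) atTop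
      (𝓝 (∫⁻ ξ, ENNReal.ofReal (q ξ) ∂(μ : Measure (ℕ → Letter)))) := by
    refine lintegral_tendsto_of_tendsto_of_monotone (fun M => ?_)
      (Eventually.of_forall fun ξ M M' hMM' => ?_) (Eventually.of_forall fun ξ => ?_)
    · have : Continuous fun ξ => ENNReal.ofReal (clip M (q ξ)) :=
        ENNReal.continuous_ofReal.comp (by fun_prop)
      exact this.measurable.aemeasurable
    · simp only [hclip]
      exact ENNReal.ofReal_le_ofReal (min_le_min_right _ (by exact_mod_cast hMM'))
    · refine tendsto_const_nhds.congr' ?_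
      obtain ⟨M₀, hM₀⟩ := exists_nat_ge (q ξ)
      filter_upwards [eventually_ge_atTop M₀] with M hM
      rw [hclip, min_eq_right (hM₀.trans (by exact_mod_cast hM))]
  exact le_of_tendsto' hlim hM

lemma NiceLog.abs_integral_sub_clip_le {Ω : Type*} [MeasurableSpace Ω] {ν : Measure Ω}
    [IsProbabilityMeasure ν] {ψ : ℝ → ℝ} (hψ : NiceLog ψ) {C : ℝ}
    (hC : ∀ y, |ψ y| ≤ C * (1 + |y|)) {Y : Ω → ℝ} (hY : Measurable Y) {B : ℝ} (hB : 0 ≤ B)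
    (hYB : ∫⁻ ω, ENNReal.ofReal (Y ω ^ 2) ∂ν ≤ ENNReal.ofReal B) {M : ℝ} (hM : 0 < M) :
    |∫ ω, ψ (Y ω) ∂ν - ∫ ω, clip M (ψ (Y ω)) ∂ν| ≤ 2 * C ^ 2 * (1 + B) / M := by
  have hψi := hψ.integrable (μ := ν) hY (hYB.trans_lt ENNReal.ofReal_lt_top)
  have hψm : Measurable fun ω => ψ (Y ω) := hψ.cont.measurable.comp hY
  have hci : Integrable (fun ω => clip M (ψ (Y ω))) ν :=
    Integrable.of_bound ((continuous_clip M).measurable.comp hψm).aestronglyMeasurable M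
      (Eventually.of_forall fun ω => abs_clip_le hM.le _)
  have hsq : Integrable (fun ω => Y ω ^ 2) ν :=
    (lintegral_ofReal_ne_top_iff_integrable (by fun_prop)
      (Eventually.of_forall fun ω => sq_nonneg _)).1 (hYB.trans_lt ENNReal.ofReal_lt_top).ne
  have hsqB : ∫ ω, Y ω ^ 2 ∂ν ≤ B := by
    rw [← ENNReal.ofReal_le_ofReal_iff hB, ofReal_integral_eq_lintegral_ofReal hsq
      (Eventually.of_forall fun ω => sq_nonneg _)]
    exact hYB
  rw [← integral_sub hψi hci]
  refine (abs_integral_le_integral_abs).trans ?_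
  have hbd : ∀ ω, |ψ (Y ω) - clip M (ψ (Y ω))| ≤ 2 * C ^ 2 / M * (1 + Y ω ^ 2) := fun ω => by
    refine (abs_sub_clip_le hM _).trans ?_
    rw [div_mul_eq_mul_div]
    refine div_le_div_of_nonneg_right ?_ hM.le
    have h1 : ψ (Y ω) ^ 2 ≤ (C * (1 + |Y ω|)) ^ 2 := by
      rw [← sq_abs]
      exact pow_le_pow_left₀ (abs_nonneg _) (hC _) 2
    have h2 : (1 + |Y ω|) ^ 2 ≤ 2 * (1 + Y ω ^ 2) := by
      nlinarith [sq_abs (Y ω), sq_nonneg (1 - |Y ω|)]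
    nlinarith [sq_nonneg C]
  refine (integral_mono (hψi.sub hci).abs (((integrable_const (1 : ℝ)).add hsq).const_mul _)
    hbd).trans ?_
  rw [integral_const_mul, integral_add' (integrable_const _) hsq]
  simp only [integral_const, probReal_univ, smul_eq_mul, mul_one]
  rw [div_mul_eq_mul_div]
  gcongr

lemma letterLaw_of_tendsto [NeBot F] {Q N : ℝ≥0} (h : Tendsto μs F (𝓝 μ))
    (hμs : ∀ k, LetterLaw Q N (μs k : Measure (ℕ → Letter))) {p : ℝ≥0∞} (hp : p ≠ ∞)
    (hpow : ∀ k, powerMoment (μs k : Measure (ℕ → Letter)) ≤ p) :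
    LetterLaw Q N (μ : Measure (ℕ → Letter)) := by
  refine ⟨fun e he f => ?_, fun f k => ?_, fun f k => ?_, fun ψ hψ g => ?_⟩
  · refine tendsto_nhds_unique (tendsto_integral_bcf h f
      (T := fun ξ i => ξ (e i)) (by fun_prop)) ?_
    simp only [(hμs _).reindex e he f]
    exact tendsto_integral_bcf h f continuous_id
  · have h1 := tendsto_integral_bcf h ((f.compContinuous ⟨Prod.fst, continuous_fst⟩) *
      (k.compContinuous ⟨Prod.snd, continuous_snd⟩) : (ℕ → Letter) × ℝ →ᵇ ℝ)
      (T := fun ξ => (seqTail ξ, (ξ 0).1.1)) (by fun_prop)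
    have h2 := (tendsto_integral_bcf h f continuous_id).mul_const
      (∫ x, k x ∂(gaussianReal 0 Q))
    refine tendsto_nhds_unique h1 (h2.congr fun j => ?_)
    exact ((hμs j).source f k).symm
  · have h1 := tendsto_integral_bcf h ((f.compContinuous ⟨Prod.fst, continuous_fst⟩) *
      (k.compContinuous ⟨Prod.snd, continuous_snd⟩) : ((ℝ × ℝ) × (ℕ → Letter)) × ℝ →ᵇ ℝ)
      (T := fun ξ => (((ξ 0).1, seqTail ξ), (ξ 0).2.1)) (by fun_prop)
    have h2 := (tendsto_integral_bcf h f (T := fun ξ => ((ξ 0).1, seqTail ξ))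
      (by fun_prop)).mul_const (∫ x, k x ∂(gaussianReal 0 N))
    refine tendsto_nhds_unique h1 (h2.congr fun j => ?_)
    exact ((hμs j).noise f k).symm
  · obtain ⟨C, hC⟩ := hψ.growth
    set b : ℝ≥0∞ := 3 * (∫⁻ x, ENNReal.ofReal (x ^ 2) ∂(gaussianReal 0 Q) + p
      + ∫⁻ x, ENNReal.ofReal (x ^ 2) ∂(gaussianReal 0 N)) with hb
    have hbt : b ≠ ∞ := (ENNReal.mul_lt_top (by simp) (ENNReal.add_lt_top.2
      ⟨ENNReal.add_lt_top.2 ⟨lintegral_sq_gaussianReal_lt_top Q, hp.lt_top⟩,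
        lintegral_sq_gaussianReal_lt_top N⟩)).ne
    have hbr : ENNReal.ofReal b.toReal = b := ENNReal.ofReal_toReal hbt
    have hout : ∀ k, ∫⁻ ξ, ENNReal.ofReal ((ξ 0).out ^ 2) ∂(μs k : Measure (ℕ → Letter))
        ≤ ENNReal.ofReal b.toReal := fun k => by
      rw [hbr]
      refine (hμs k).lintegral_out_sq_le.trans ?_
      rw [hb]
      gcongr
      exact hpow k
    have hout' : ∫⁻ ξ, ENNReal.ofReal ((ξ 0).out ^ 2) ∂(μ : Measure (ℕ → Letter))
        ≤ ENNReal.ofReal b.toReal :=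
      lintegral_le_of_tendsto h (by fun_prop) (fun _ => sq_nonneg _) tendsto_const_nhds hout
    have hmeas : Measurable fun ξ : ℕ → Letter => (ξ 0).out := by fun_prop
    set L := ∫ z, Real.log (gaussianPDFReal 0 N z) ∂(gaussianReal 0 N)
    set D := 2 * C ^ 2 * (1 + b.toReal) with hD
    have hexpc : Continuous fun q => Real.exp (g q) := by fun_prop
    set eg : (((ℝ × ℝ) × (ℝ × ℝ)) × (ℕ → Letter)) →ᵇ ℝ :=
      BoundedContinuousFunction.ofNormedAddCommGroup (fun q => Real.exp (g q)) hexpc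
        (Real.exp ‖g‖) (fun q => by
          rw [Real.norm_eq_abs, abs_of_pos (Real.exp_pos _)]
          exact Real.exp_le_exp.2 ((le_abs_self _).trans (g.norm_coe_le_norm _)))
    have hMbound : ∀ M : ℝ, 0 < M →
        ∫ ξ, g (ownPair ξ) ∂(μ : Measure (ℕ → Letter)) + 1
          - ∫ ξ, Real.exp (g (crossPair ξ)) ∂(μ : Measure (ℕ → Letter))
          + ∫ ξ, ψ (ξ 0).out ∂(μ : Measure (ℕ → Letter)) ≤ L + 2 * (D / M) := by
      intro M hM
      have h1 := tendsto_integral_bcf h g continuous_ownPair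
      have h2 := tendsto_integral_bcf h eg continuous_crossPair
      have h3 := tendsto_integral_bcf h (clipBCF M hM.le ψ hψ.cont)
        (T := fun ξ => (ξ 0).out) (by fun_prop)
      have h4 := le_of_tendsto (b := L + D / M) (((h1.add_const 1).sub h2).add h3)
        (Eventually.of_forall fun k => ?_)
      · have h5 := (abs_le.1 (hψ.abs_integral_sub_clip_le hC hmeas ENNReal.toReal_nonneg
          hout' hM)).2
        change ∫ ξ, g (ownPair ξ) ∂(μ : Measure (ℕ → Letter)) + 1
          - ∫ ξ, Real.exp (g (crossPair ξ)) ∂(μ : Measure (ℕ → Letter))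
          + ∫ ξ, clip M (ψ (ξ 0).out) ∂(μ : Measure (ℕ → Letter)) ≤ _ at h4
        linarith
      · have h5 := (abs_le.1 (hψ.abs_integral_sub_clip_le hC hmeas ENNReal.toReal_nonneg
          (hout k) hM)).1
        have h6 := (hμs k).info ψ hψ g
        change ∫ ξ, g (ownPair ξ) ∂(μs k : Measure (ℕ → Letter)) + 1
          - ∫ ξ, Real.exp (g (crossPair ξ)) ∂(μs k : Measure (ℕ → Letter))
          + ∫ ξ, clip M (ψ (ξ 0).out) ∂(μs k : Measure (ℕ → Letter)) ≤ _
        linarith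
    have hlim : Tendsto (fun M : ℝ => L + 2 * (D / M)) atTop (𝓝 (L + 2 * 0)) :=
      (((tendsto_const_nhds (x := D)).div_atTop tendsto_id).const_mul 2).const_add L
    rw [mul_zero, add_zero] at hlim
    refine ge_of_tendsto hlim ?_
    filter_upwards [eventually_gt_atTop 0] with M hM using hMbound M hM

end Limit

section Existence

open Filter Topology

variable {Q N : ℝ≥0} {P S : ℝ}

lemma nonneg_of_achievable (h : achievableFBNC Q N P S) : 0 ≤ P ∧ 0 ≤ S := by
  have key : ∀ A : ℝ, A < 0 → (∀ n (c : FBNCDesign n) ω,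
      -A ≤ |P - costP (c.U1 ω)| + |S - costS (c.X1 ω) (c.U2 ω)|) → False := by
    intro A hA hle
    obtain ⟨n, hn⟩ := h (-A / 2) (by linarith)
    obtain ⟨c, hc⟩ := hn n le_rfl
    have h1 : ENNReal.ofReal (-A) ≤ ENNReal.ofReal (-A / 2) := by
      refine le_trans ?_ hc
      have : ∫⁻ _, ENNReal.ofReal (-A) ∂(base n Q N) = ENNReal.ofReal (-A) := by simp
      rw [← this]
      exact lintegral_mono fun ω => ENNReal.ofReal_le_ofReal (hle n c ω)
    rw [ENNReal.ofReal_le_ofReal_iff (by linarith)] at h1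
    linarith
  constructor
  · by_contra hP
    push Not at hP
    refine key P hP fun n c ω => ?_
    have h0 : 0 ≤ costP (c.U1 ω) := by unfold costP; positivity
    have := neg_le_abs (P - costP (c.U1 ω))
    have := abs_nonneg (S - costS (c.X1 ω) (c.U2 ω))
    linarith
  · by_contra hS
    push Not at hS
    refine key S hS fun n c ω => ?_
    have h0 : 0 ≤ costS (c.X1 ω) (c.U2 ω) := by unfold costS; positivity
    have := neg_le_abs (S - costS (c.X1 ω) (c.U2 ω))
    have := abs_nonneg (P - costP (c.U1 ω))
    linarith

lemma exists_letterLaw_approx (hN : N ≠ 0) (h : achievableFBNC Q N P S) {ε : ℝ} (hε : 0 < ε) :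
    ∃ μ : ProbabilityMeasure (ℕ → Letter), LetterLaw Q N (μ : Measure (ℕ → Letter)) ∧
      powerMoment (μ : Measure (ℕ → Letter)) ≤ ENNReal.ofReal P + ENNReal.ofReal ε ∧
      errorMoment (μ : Measure (ℕ → Letter)) ≤ ENNReal.ofReal S + ENNReal.ofReal ε := by
  obtain ⟨n₀, hn₀⟩ := h ε hε
  obtain ⟨c, hc⟩ := hn₀ (n₀ + 1) (Nat.le_succ _)
  have hp : powerMoment (c.avgLaw Q N) ≤ ENNReal.ofReal P + ENNReal.ofReal ε := by
    rw [c.powerMoment_avgLaw]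
    have h1 : ∀ ω, ENNReal.ofReal (costP (c.U1 ω)) ≤ ENNReal.ofReal P +
        ENNReal.ofReal (|P - costP (c.U1 ω)| + |S - costS (c.X1 ω) (c.U2 ω)|) := fun ω => by
      refine (ENNReal.ofReal_le_ofReal ?_).trans ENNReal.ofReal_add_le
      have := neg_le_abs (P - costP (c.U1 ω))
      have := abs_nonneg (S - costS (c.X1 ω) (c.U2 ω))
      linarith
    refine (lintegral_mono h1).trans ?_
    rw [lintegral_add_left measurable_const, lintegral_const, measure_univ, mul_one]
    gcongr
  have he : errorMoment (c.avgLaw Q N) ≤ ENNReal.ofReal S + ENNReal.ofReal ε := by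
    rw [c.errorMoment_avgLaw]
    have h1 : ∀ ω, ENNReal.ofReal (costS (c.X1 ω) (c.U2 ω)) ≤ ENNReal.ofReal S +
        ENNReal.ofReal (|P - costP (c.U1 ω)| + |S - costS (c.X1 ω) (c.U2 ω)|) := fun ω => by
      refine (ENNReal.ofReal_le_ofReal ?_).trans ENNReal.ofReal_add_le
      have := neg_le_abs (S - costS (c.X1 ω) (c.U2 ω))
      have := abs_nonneg (P - costP (c.U1 ω))
      linarith
    refine (lintegral_mono h1).trans ?_
    rw [lintegral_add_left measurable_const, lintegral_const, measure_univ, mul_one]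
    gcongr
  have hprob := c.isProbabilityMeasure_avgLaw Q N (Nat.succ_ne_zero _)
  exact ⟨⟨c.avgLaw Q N, hprob⟩, c.letterLaw_avgLaw Q N (Nat.succ_ne_zero _) hN
    (hp.trans_lt (by simp)), hp, he⟩

lemma exists_letterLaw (hN : N ≠ 0) (h : achievableFBNC Q N P S) :
    ∃ μ : Measure (ℕ → Letter), IsProbabilityMeasure μ ∧ LetterLaw Q N μ ∧
      powerMoment μ ≤ ENNReal.ofReal P ∧ errorMoment μ ≤ ENNReal.ofReal S := by
  choose μs hlaw hp he using fun k : ℕ => exists_letterLaw_approx (ε := 1 / ((k : ℝ) + 1)) hN h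
    (by positivity)
  have hε : ∀ k : ℕ, ENNReal.ofReal (1 / ((k : ℝ) + 1)) ≤ 1 := fun k => by
    rw [ENNReal.ofReal_le_one, div_le_one (by positivity)]
    linarith [(Nat.cast_nonneg k : (0 : ℝ) ≤ k)]
  have hp1 : ∀ k, powerMoment (μs k : Measure (ℕ → Letter)) ≤ ENNReal.ofReal P + 1 := fun k =>
    (hp k).trans (add_le_add_right (hε k) _)
  have he1 : ∀ k, errorMoment (μs k : Measure (ℕ → Letter)) ≤ ENNReal.ofReal S + 1 := fun k =>
    (he k).trans (add_le_add_right (hε k) _)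
  set B : ℝ≥0∞ := 4 * (∫⁻ x, ENNReal.ofReal (x ^ 2) ∂(gaussianReal 0 Q) + (ENNReal.ofReal P + 1)
    + ∫⁻ x, ENNReal.ofReal (x ^ 2) ∂(gaussianReal 0 N) + (ENNReal.ofReal S + 1)) with hBdef
  have hB : B ≠ ∞ := by
    have h1 := (lintegral_sq_gaussianReal_lt_top Q).ne
    have h2 := (lintegral_sq_gaussianReal_lt_top N).ne
    refine ENNReal.mul_ne_top (by simp) ?_
    simp [h1, h2]
  have hnorm : ∀ k i, ∫⁻ ξ, ENNReal.ofReal (‖ξ i‖ ^ 2) ∂(μs k : Measure (ℕ → Letter)) ≤ B :=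
    fun k i => by
      refine ((hlaw k).lintegral_norm_sq_le i).trans ?_
      rw [hBdef]
      gcongr
      · exact hp1 k
      · exact he1 k
  have htight : IsTightMeasureSet {((ν : ProbabilityMeasure (ℕ → Letter)) :
      Measure (ℕ → Letter)) | ν ∈ Set.range μs} := by
    rw [isTightMeasureSet_iff_exists_isCompact_measure_compl_le]
    intro ε hε0
    obtain ⟨δ, hδ0, hδ⟩ := ENNReal.lt_iff_exists_nnreal_btwn.1 hε0
    obtain ⟨K, hK, hKle⟩ := exists_isCompact_letterLaw hB (ε := δ) (by exact_mod_cast hδ0)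
    refine ⟨K, hK, ?_⟩
    rintro _ ⟨_, ⟨k, rfl⟩, rfl⟩
    exact (hKle _ (hnorm k)).trans hδ.le
  have hcomp := isCompact_closure_of_isTightMeasureSet htight
  have hmem : (↑((hyperfilter ℕ).map μs) : Filter (ProbabilityMeasure (ℕ → Letter)))
      ≤ 𝓟 (closure (Set.range μs)) := by
    rw [le_principal_iff]
    exact mem_map.2 (univ_mem' fun k => subset_closure ⟨k, rfl⟩)
  obtain ⟨μ, -, hμ⟩ := hcomp.ultrafilter_le_nhds _ hmem
  have hlim : Tendsto μs (hyperfilter ℕ : Filter ℕ) (𝓝 μ) := hμ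
  have hto : Tendsto (fun k : ℕ => ENNReal.ofReal (1 / ((k : ℝ) + 1)))
      (hyperfilter ℕ : Filter ℕ) (𝓝 0) := by
    have := (ENNReal.continuous_ofReal.tendsto 0).comp tendsto_one_div_add_atTop_nhds_zero_nat
    rw [ENNReal.ofReal_zero] at this
    exact this.mono_left Nat.hyperfilter_le_atTop
  refine ⟨μ, inferInstance, letterLaw_of_tendsto hlim hlaw (p := ENNReal.ofReal P + 1) (by simp)
    hp1, ?_, ?_⟩
  · refine lintegral_le_of_tendsto hlim (by fun_prop) (fun _ => sq_nonneg _) ?_ hp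
    simpa using hto.const_add (ENNReal.ofReal P)
  · refine lintegral_le_of_tendsto hlim (by fun_prop) (fun _ => sq_nonneg _) ?_ he
    simpa using hto.const_add (ENNReal.ofReal S)

end Existence

section DonskerVaradhan

open Filter Topology BoundedContinuousFunction

lemma abs_clip_sub_clip_le (M a b : ℝ) : |clip M a - clip M b| ≤ |a - b| := by
  unfold clip
  refine (abs_max_sub_max_le_max _ _ _ _).trans (max_le (by simp) ?_)
  exact (abs_min_sub_min_le_max _ _ _ _).trans (max_le (by simp) le_rfl)

lemma clip_eq_self {M y : ℝ} (h : |y| ≤ M) : clip M y = y := by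
  rw [clip, min_eq_right (abs_le.1 h).2, max_eq_right (abs_le.1 h).1]

lemma integrable_of_abs_le {Ω : Type*} [MeasurableSpace Ω] {ρ : Measure Ω} [IsFiniteMeasure ρ]
    {f : Ω → ℝ} (hf : Measurable f) {M : ℝ} (h : ∀ x, |f x| ≤ M) : Integrable f ρ :=
  Integrable.of_bound hf.aestronglyMeasurable M (Eventually.of_forall h)

lemma integrable_exp_of_abs_le {Ω : Type*} [MeasurableSpace Ω] {ρ : Measure Ω}
    [IsFiniteMeasure ρ] {f : Ω → ℝ} (hf : Measurable f) {M : ℝ} (h : ∀ x, |f x| ≤ M) :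
    Integrable (fun x => Real.exp (f x)) ρ :=
  integrable_of_abs_le (Real.measurable_exp.comp hf) (M := Real.exp M) fun x => by
    rw [abs_of_pos (Real.exp_pos _)]
    exact Real.exp_le_exp.2 (le_of_abs_le (h x))

variable {E : Type*} [TopologicalSpace E] [TopologicalSpace.PseudoMetrizableSpace E]
  [MeasurableSpace E] [BorelSpace E] {μ ν : Measure E} [IsProbabilityMeasure μ]
  [IsProbabilityMeasure ν] {c : ℝ}

lemma variational_of_measurable
    (h : ∀ g : E →ᵇ ℝ, ∫ x, g x ∂μ + 1 - ∫ x, Real.exp (g x) ∂ν ≤ c)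
    {g : E → ℝ} (hg : Measurable g) {M : ℝ} (hM : ∀ x, |g x| ≤ M) :
    ∫ x, g x ∂μ + 1 - ∫ x, Real.exp (g x) ∂ν ≤ c := by
  have hM0 : 0 ≤ M := by
    obtain ⟨x⟩ := nonempty_of_isProbabilityMeasure μ
    exact (abs_nonneg _).trans (hM x)
  let := TopologicalSpace.pseudoMetrizableSpacePseudoMetric E
  have hgi : Integrable g (μ + ν) := integrable_of_abs_le hg hM
  refine le_of_forall_pos_le_add fun ε hε => ?_
  obtain ⟨k, hk, hki⟩ := hgi.exists_boundedContinuous_integral_sub_le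
    (ε := ε / (1 + Real.exp M)) (by positivity)
  have hkm : Measurable k := k.continuous.measurable
  set k' := clipBCF M hM0 k k.continuous with hk'
  have hk'm : Measurable k' := k'.continuous.measurable
  have hk'M : ∀ x, |k' x| ≤ M := fun x => abs_clip_le hM0 _
  have hdi : ∀ ρ : Measure E, [IsFiniteMeasure ρ] → Integrable (fun x => ‖g x - k x‖) ρ :=
    fun ρ _ => ((integrable_of_abs_le hg hM).sub (integrable_bcf_comp k measurable_id)).norm
  have hdist : ∀ x, |g x - k' x| ≤ ‖g x - k x‖ := fun x => by
    have := abs_clip_sub_clip_le M (g x) (k x)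
    rwa [clip_eq_self (hM x)] at this
  have hsum : ∫ x, ‖g x - k x‖ ∂μ + ∫ x, ‖g x - k x‖ ∂ν ≤ ε / (1 + Real.exp M) := by
    rwa [← integral_add_measure (hdi μ) (hdi ν)]
  have h0μ : 0 ≤ ∫ x, ‖g x - k x‖ ∂μ := integral_nonneg fun _ => norm_nonneg _
  have h0ν : 0 ≤ ∫ x, ‖g x - k x‖ ∂ν := integral_nonneg fun _ => norm_nonneg _
  have hεeq : ε / (1 + Real.exp M) * (1 + Real.exp M) = ε :=
    div_mul_cancel₀ _ (by positivity)
  have h1 : ∫ x, g x ∂μ ≤ ∫ x, k' x ∂μ + ∫ x, ‖g x - k x‖ ∂μ := by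
    rw [← integral_add (integrable_of_abs_le hk'm hk'M) (hdi μ)]
    refine integral_mono (integrable_of_abs_le hg hM)
      ((integrable_of_abs_le hk'm hk'M).add (hdi μ)) fun x => ?_
    have := (le_abs_self _).trans (hdist x)
    change g x ≤ k' x + ‖g x - k x‖
    linarith
  have h2 : ∫ x, Real.exp (k' x) ∂ν ≤ ∫ x, Real.exp (g x) ∂ν
      + Real.exp M * ∫ x, ‖g x - k x‖ ∂ν := by
    rw [← integral_const_mul, ← integral_add (integrable_exp_of_abs_le hg hM)
      ((hdi ν).const_mul _)]
    refine integral_mono (integrable_exp_of_abs_le hk'm hk'M)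
      ((integrable_exp_of_abs_le hg hM).add ((hdi ν).const_mul _)) fun x => ?_
    have e1 : Real.exp (k' x) * (1 + (g x - k' x)) ≤ Real.exp (g x) := by
      have := Real.add_one_le_exp (g x - k' x)
      calc Real.exp (k' x) * (1 + (g x - k' x)) ≤ Real.exp (k' x) * Real.exp (g x - k' x) := by
            gcongr; linarith
        _ = Real.exp (g x) := by rw [← Real.exp_add]; congr 1; ring
    have e2 : Real.exp (k' x) * (k' x - g x) ≤ Real.exp M * ‖g x - k x‖ := by
      have h3 : k' x - g x ≤ ‖g x - k x‖ := by
        have := (neg_le_abs _).trans (hdist x); linarith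
      calc Real.exp (k' x) * (k' x - g x) ≤ Real.exp (k' x) * ‖g x - k x‖ := by gcongr
        _ ≤ _ := by
          gcongr
          exact le_of_abs_le (hk'M x)
    change Real.exp (k' x) ≤ Real.exp (g x) + Real.exp M * ‖g x - k x‖
    nlinarith
  have h3 := h k'
  have h4 : Real.exp M * ∫ x, ‖g x - k x‖ ∂ν + ∫ x, ‖g x - k x‖ ∂μ ≤ ε := by
    have hexp := Real.exp_pos M
    nlinarith
  linarith

lemma klDiv_le_of_variational
    (h : ∀ g : E →ᵇ ℝ, ∫ x, g x ∂μ + 1 - ∫ x, Real.exp (g x) ∂ν ≤ c) :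
    InformationTheory.klDiv μ ν ≤ ENNReal.ofReal c := by
  have hac : μ ≪ ν := by
    refine Measure.AbsolutelyContinuous.mk fun A hA hνA => ?_
    by_contra hμA
    have hpos : 0 < μ.real A := by
      rw [measureReal_def]; exact ENNReal.toReal_pos hμA (measure_ne_top _ _)
    obtain ⟨M, hM⟩ := exists_nat_gt (c / μ.real A)
    have hb : ∀ x, |A.indicator (fun _ => (M : ℝ)) x| ≤ M := fun x => by
      by_cases hx : x ∈ A <;> simp [hx]
    have h1 := variational_of_measurable h (measurable_const.indicator hA) hb
    rw [integral_indicator_const _ hA] at h1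
    have h2 : ∫ x, Real.exp (A.indicator (fun _ => (M : ℝ)) x) ∂ν = 1 := by
      have : (fun x => Real.exp (A.indicator (fun _ => (M : ℝ)) x)) =ᵐ[ν] fun _ => 1 := by
        filter_upwards [measure_eq_zero_iff_ae_notMem.1 hνA] with x hx
        simp [hx]
      rw [integral_congr_ae this]; simp
    rw [h2, smul_eq_mul] at h1
    rw [div_lt_iff₀ hpos] at hM
    linarith
  rw [InformationTheory.klDiv_eq_lintegral_klFun_of_ac hac]
  set f : E → ℝ := fun x => (μ.rnDeriv ν x).toReal with hf
  have hfm : Measurable f := (Measure.measurable_rnDeriv μ ν).ennreal_toReal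
  have hf0 : ∀ x, 0 ≤ f x := fun x => ENNReal.toReal_nonneg
  have hfi : Integrable f ν := Measure.integrable_toReal_rnDeriv
  set q : ℕ → E → ℝ := fun j x => max ((j : ℝ) + 1)⁻¹ (min ((j : ℝ) + 1) (f x)) with hq
  have hqm : ∀ j, Measurable (q j) := fun j =>
    measurable_const.max (measurable_const.min hfm)
  have hj : ∀ j : ℕ, ((j : ℝ) + 1)⁻¹ ≤ 1 ∧ 1 ≤ (j : ℝ) + 1 := fun j =>
    ⟨inv_le_one_of_one_le₀ (by linarith [(Nat.cast_nonneg j : (0 : ℝ) ≤ j)]),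
      by linarith [(Nat.cast_nonneg j : (0 : ℝ) ≤ j)]⟩
  have hqlo : ∀ (j : ℕ) x, ((j : ℝ) + 1)⁻¹ ≤ q j x := fun j x => le_max_left _ _
  have hqhi : ∀ (j : ℕ) x, q j x ≤ (j : ℝ) + 1 := fun j x =>
    max_le ((hj j).1.trans (hj j).2) (min_le_left _ _)
  have hqpos : ∀ j x, 0 < q j x := fun j x => lt_of_lt_of_le (by positivity) (hqlo j x)
  have hlog : ∀ (j : ℕ) x, |Real.log (q j x)| ≤ Real.log ((j : ℝ) + 1) := fun j x => by
    refine abs_le.2 ⟨?_, Real.log_le_log (hqpos j x) (hqhi j x)⟩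
    rw [← Real.log_inv]
    exact Real.log_le_log (by positivity) (hqlo j x)
  set r : ℕ → E → ℝ := fun j x => f x * Real.log (q j x) + 1 - q j x with hr
  have hrm : ∀ j, Measurable (r j) := fun j =>
    ((hfm.mul (hqm j).log).add_const 1).sub (hqm j)
  have hr0 : ∀ j x, 0 ≤ r j x := fun j x => by
    have h1 : q j x * Real.log (q j x) + 1 - q j x ≤ r j x := by
      have : 0 ≤ (f x - q j x) * Real.log (q j x) := by
        rcases le_total (f x) ((j : ℝ) + 1)⁻¹ with hx | hx
        · have e : q j x = ((j : ℝ) + 1)⁻¹ :=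
            max_eq_left ((min_le_right _ _).trans hx)
          rw [e]
          refine mul_nonneg_of_nonpos_of_nonpos (by linarith)
            (Real.log_nonpos (by positivity) (hj j).1)
        · rcases le_total ((j : ℝ) + 1) (f x) with hx' | hx'
          · have e : q j x = (j : ℝ) + 1 := by
              simp only [hq]
              rw [min_eq_left hx', max_eq_right ((hj j).1.trans (hj j).2)]
            rw [e]
            exact mul_nonneg (by linarith) (Real.log_nonneg (hj j).2)
          · have e : q j x = f x := by
              simp only [hq]
              rw [min_eq_right hx', max_eq_right hx]
            rw [e]; simp
      simp only [hr]
      nlinarith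
    exact (InformationTheory.klFun_nonneg (hqpos j x).le).trans h1
  have hflog : ∀ j, Integrable (fun x => f x * Real.log (q j x)) ν := fun j =>
    hfi.mul_bdd (c := Real.log ((j : ℝ) + 1)) (hqm j).log.aestronglyMeasurable
      (Eventually.of_forall fun x => hlog j x)
  have hqi : ∀ j, Integrable (q j) ν := fun j => integrable_of_abs_le (hqm j) (M := (j : ℝ) + 1)
    fun x => by rw [abs_of_pos (hqpos j x)]; exact hqhi j x
  have hrle : ∀ j, ∫⁻ x, ENNReal.ofReal (r j x) ∂ν ≤ ENNReal.ofReal c := fun j => by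
    have hri : Integrable (r j) ν := ((hflog j).add (integrable_const 1)).sub (hqi j)
    rw [← ofReal_integral_eq_lintegral_ofReal hri (Eventually.of_forall fun x => hr0 j x)]
    refine ENNReal.ofReal_le_ofReal ?_
    have h1 := variational_of_measurable h (hqm j).log (hlog j)
    have h2 : ∫ x, f x * Real.log (q j x) ∂ν = ∫ x, Real.log (q j x) ∂μ :=
      integral_rnDeriv_smul hac
    have h3 : ∫ x, Real.exp (Real.log (q j x)) ∂ν = ∫ x, q j x ∂ν :=
      integral_congr_ae (Eventually.of_forall fun x => Real.exp_log (hqpos j x))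
    have h4 : ∫ x, r j x ∂ν = ∫ x, f x * Real.log (q j x) ∂ν + 1 - ∫ x, q j x ∂ν := by
      simp only [hr]
      have hadd : Integrable (fun x => f x * Real.log (q j x) + 1) ν :=
        (hflog j).add (integrable_const 1)
      rw [integral_sub hadd (hqi j),
        integral_add (hflog j) (integrable_const 1)]
      simp
    rw [h4, h2, ← h3]
    exact h1
  have hlim : ∀ x, Tendsto (fun j => ENNReal.ofReal (r j x)) atTop
      (𝓝 (ENNReal.ofReal (InformationTheory.klFun (f x)))) := fun x => by
    refine (ENNReal.continuous_ofReal.tendsto _).comp ?_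
    rcases (hf0 x).eq_or_lt with hx | hx
    · have e : ∀ j, r j x = 1 - ((j : ℝ) + 1)⁻¹ := fun j => by
        have : q j x = ((j : ℝ) + 1)⁻¹ := by
          simp only [hq, ← hx]
          rw [min_eq_right (by positivity), max_eq_left (by positivity)]
        simp only [hr]
        rw [this, ← hx]; ring
      simp only [e, ← hx, InformationTheory.klFun_zero]
      have := (tendsto_one_div_add_atTop_nhds_zero_nat (𝕜 := ℝ)).const_sub 1
      simpa using this
    · refine tendsto_const_nhds.congr' ?_
      obtain ⟨j₀, hj₀⟩ := exists_nat_ge (max (f x) (f x)⁻¹)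
      filter_upwards [eventually_ge_atTop j₀] with j hjj
      have h1 : max (f x) (f x)⁻¹ ≤ (j : ℝ) + 1 := by
        have : (j₀ : ℝ) ≤ j := by exact_mod_cast hjj
        linarith
      have : q j x = f x := by
        simp only [hq]
        rw [min_eq_right ((le_max_left _ _).trans h1), max_eq_right]
        exact inv_le_of_inv_le₀ hx ((le_max_right _ _).trans h1)
      simp only [hr]
      rw [this, InformationTheory.klFun]
  calc ∫⁻ x, ENNReal.ofReal (InformationTheory.klFun (f x)) ∂ν
      = ∫⁻ x, liminf (fun j => ENNReal.ofReal (r j x)) atTop ∂ν :=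
        lintegral_congr fun x => (hlim x).liminf_eq.symm
    _ ≤ liminf (fun j => ∫⁻ x, ENNReal.ofReal (r j x) ∂ν) atTop :=
        lintegral_liminf_le fun j => (hrm j).ennreal_ofReal
    _ ≤ liminf (fun _ : ℕ => ENNReal.ofReal c) atTop :=
        liminf_le_liminf (Eventually.of_forall hrle)
    _ = ENNReal.ofReal c := by simp

end DonskerVaradhan

section PairBound

open Filter Topology

lemma lintegral_outDens {N : ℝ≥0} (hN : N ≠ 0) (ν : Measure ℝ) [IsProbabilityMeasure ν] :
    ∫⁻ y, ENNReal.ofReal (outDens N ν y) = 1 := by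
  have h := congrArg (fun ρ : Measure ℝ => ρ Set.univ)
    (map_add_noise_eq_withDensity ν (m := id) measurable_id hN)
  have : IsProbabilityMeasure ((ν.prod (gaussianReal 0 N)).map fun p => id p.1 + p.2) :=
    Measure.isProbabilityMeasure_map (by fun_prop)
  simp only [measure_univ, withDensity_apply _ MeasurableSet.univ, Measure.map_id,
    Measure.restrict_univ] at h
  exact h.symm

lemma lintegral_cauchy : ∫⁻ y : ℝ, ENNReal.ofReal ((Real.pi)⁻¹ * (1 + y ^ 2)⁻¹) = 1 := by
  rw [← ofReal_integral_eq_lintegral_ofReal (integrable_inv_one_add_sq.const_mul _)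
    (Eventually.of_forall fun y => by positivity), integral_const_mul,
    integral_univ_inv_one_add_sq, inv_mul_cancel₀ Real.pi_ne_zero, ENNReal.ofReal_one]

/-- The logarithm of an output density mixed with a heavy-tailed density. -/
def mixLog (N : ℝ≥0) (ν : Measure ℝ) (δ y : ℝ) : ℝ :=
  Real.log ((1 - δ) * outDens N ν y + δ * ((Real.pi)⁻¹ * (1 + y ^ 2)⁻¹))

lemma niceLog_mixLog {N : ℝ≥0} (hN : N ≠ 0) (ν : Measure ℝ) [IsProbabilityMeasure ν] {δ : ℝ}
    (h0 : 0 < δ) (h1 : δ < 1) : NiceLog (mixLog N ν δ) := by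
  have hcau : ∀ y : ℝ, 0 < (Real.pi)⁻¹ * (1 + y ^ 2)⁻¹ := fun y => by
    have := Real.pi_pos; positivity
  have hp : ∀ y, 0 < outDens N ν y := outDens_pos hN ν
  have hpos : ∀ y, 0 < (1 - δ) * outDens N ν y + δ * ((Real.pi)⁻¹ * (1 + y ^ 2)⁻¹) := fun y =>
    add_pos (mul_pos (by linarith) (hp y)) (mul_pos h0 (hcau y))
  have hden : Continuous fun y : ℝ => (1 + y ^ 2)⁻¹ :=
    Continuous.inv₀ (by fun_prop) fun y => by positivity
  have hc := continuous_outDens N ν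
  refine ⟨Continuous.log (by fun_prop) fun y => (hpos y).ne', ?_, ?_⟩
  · set A := (√(2 * Real.pi * N))⁻¹ + 1 with hA
    have hA1 : 1 ≤ A := by
      have : 0 ≤ (√(2 * Real.pi * N))⁻¹ := by positivity
      linarith
    have hpi1 : (Real.pi)⁻¹ ≤ 1 := inv_le_one_of_one_le₀ (by linarith [Real.pi_gt_three])
    refine ⟨|Real.log A| + |Real.log (δ * (Real.pi)⁻¹)| + 2, fun y => ?_⟩
    have hup : mixLog N ν δ y ≤ Real.log A := by
      refine Real.log_le_log (hpos y) ?_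
      have e1 : (1 - δ) * outDens N ν y ≤ 1 * (√(2 * Real.pi * N))⁻¹ :=
        mul_le_mul (by linarith) (outDens_le N ν y) (hp y).le (by norm_num)
      have e2 : (Real.pi)⁻¹ * (1 + y ^ 2)⁻¹ ≤ 1 :=
        mul_le_one₀ hpi1 (by positivity) (inv_le_one_of_one_le₀ (by nlinarith [sq_nonneg y]))
      have e3 : δ * ((Real.pi)⁻¹ * (1 + y ^ 2)⁻¹) ≤ 1 :=
        mul_le_one₀ h1.le (hcau y).le e2
      linarith
    have hlo : Real.log (δ * (Real.pi)⁻¹) - 2 * |y| ≤ mixLog N ν δ y := by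
      have e1 : Real.log (δ * (Real.pi)⁻¹) - Real.log (1 + y ^ 2) ≤ mixLog N ν δ y := by
        rw [← Real.log_div (by have := Real.pi_pos; positivity) (by positivity)]
        refine Real.log_le_log (by have := Real.pi_pos; positivity) ?_
        rw [div_eq_mul_inv, mul_assoc]
        have := mul_pos (sub_pos.2 h1) (hp y)
        linarith
      have e2 : Real.log (1 + y ^ 2) ≤ 2 * |y| := by
        have e3 : 1 + y ^ 2 ≤ Real.exp |y| ^ 2 := by
          have h2 := Real.add_one_le_exp |y|
          have h3 := abs_nonneg y
          nlinarith [sq_abs y]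
        calc Real.log (1 + y ^ 2) ≤ Real.log (Real.exp |y| ^ 2) :=
              Real.log_le_log (by positivity) e3
          _ = 2 * |y| := by rw [Real.log_pow, Real.log_exp]; norm_num
      linarith
    have ha := le_abs_self (Real.log A)
    have hb := neg_abs_le (Real.log (δ * (Real.pi)⁻¹))
    have hy := abs_nonneg y
    have ha' := abs_nonneg (Real.log A)
    have hb' := abs_nonneg (Real.log (δ * (Real.pi)⁻¹))
    refine abs_le.2 ⟨?_, ?_⟩ <;> nlinarith [mul_nonneg ha' hy, mul_nonneg hb' hy]
  · have hm1 : Measurable fun y => ENNReal.ofReal (outDens N ν y) := by fun_prop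
    have hm2 : Measurable fun y : ℝ => ENNReal.ofReal ((Real.pi)⁻¹ * (1 + y ^ 2)⁻¹) := by fun_prop
    have e : ∀ y, ENNReal.ofReal (Real.exp (mixLog N ν δ y))
        = ENNReal.ofReal (1 - δ) * ENNReal.ofReal (outDens N ν y)
          + ENNReal.ofReal δ * ENNReal.ofReal ((Real.pi)⁻¹ * (1 + y ^ 2)⁻¹) := fun y => by
      rw [mixLog, Real.exp_log (hpos y), ENNReal.ofReal_add (mul_nonneg (by linarith) (hp y).le)
        (mul_nonneg h0.le (hcau y).le), ENNReal.ofReal_mul (by linarith),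
        ENNReal.ofReal_mul h0.le]
    simp only [e]
    rw [lintegral_add_left (hm1.const_mul _), lintegral_const_mul _ hm1,
      lintegral_const_mul _ hm2, lintegral_outDens hN, lintegral_cauchy, mul_one, mul_one,
      ← ENNReal.ofReal_add (by linarith) h0.le]
    simp

/-- The law of the interim state. -/
def stateLaw (μ : Measure (ℕ → Letter)) : Measure ℝ := μ.map fun ξ => (ξ 0).1.1 + (ξ 0).1.2

variable {Q N : ℝ≥0} {μ : Measure (ℕ → Letter)} [IsProbabilityMeasure μ]

instance : IsProbabilityMeasure (stateLaw μ) :=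
  Measure.isProbabilityMeasure_map (by fun_prop)

namespace LetterLaw

lemma integrable_u_sq (hpow : powerMoment μ ≠ ∞) :
    Integrable (fun ξ : ℕ → Letter => (ξ 0).1.2 ^ 2) μ :=
  (lintegral_ofReal_ne_top_iff_integrable
    (by fun_prop : Measurable fun ξ : ℕ → Letter => (ξ 0).1.2 ^ 2).aestronglyMeasurable
    (Eventually.of_forall fun _ => sq_nonneg _)).1 hpow

lemma integrable_err_sq (herr : errorMoment μ ≠ ∞) :
    Integrable (fun ξ : ℕ → Letter => ((ξ 0).1.1 + (ξ 0).1.2 - (ξ 0).2.2) ^ 2) μ :=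
  (lintegral_ofReal_ne_top_iff_integrable
    (by fun_prop : Measurable fun ξ : ℕ → Letter =>
      ((ξ 0).1.1 + (ξ 0).1.2 - (ξ 0).2.2) ^ 2).aestronglyMeasurable
    (Eventually.of_forall fun _ => sq_nonneg _)).1 herr

lemma integrable_state_sq (h : LetterLaw Q N μ) (hpow : powerMoment μ ≠ ∞) :
    Integrable (fun ξ : ℕ → Letter => ((ξ 0).1.1 + (ξ 0).1.2) ^ 2) μ := by
  have hx : Integrable (fun ξ : ℕ → Letter => (ξ 0).1.1 ^ 2) μ := by
    have := integrable_sq_gaussianReal Q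
    rw [← h.map_x] at this
    exact this.comp_aemeasurable
      (by fun_prop : Measurable fun ξ : ℕ → Letter => (ξ 0).1.1).aemeasurable
  refine ((hx.add (integrable_u_sq hpow)).const_mul 2).mono'
    (by fun_prop : Measurable fun ξ : ℕ → Letter =>
      ((ξ 0).1.1 + (ξ 0).1.2) ^ 2).aestronglyMeasurable
    (Eventually.of_forall fun ξ => ?_)
  rw [Real.norm_eq_abs, abs_of_nonneg (sq_nonneg _)]
  change _ ≤ 2 * ((ξ 0).1.1 ^ 2 + (ξ 0).1.2 ^ 2)
  nlinarith [sq_nonneg ((ξ 0).1.1 - (ξ 0).1.2)]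

lemma integrable_log_outDens (h : LetterLaw Q N μ) (hN : N ≠ 0) (hpow : powerMoment μ ≠ ∞) :
    Integrable (fun ξ : ℕ → Letter => Real.log (outDens N (stateLaw μ) (ξ 0).out)) μ := by
  have hm' : Measurable fun ξ : ℕ → Letter => ((ξ 0).1, seqTail ξ) := by fun_prop
  have := Measure.isProbabilityMeasure_map (μ := μ) hm'.aemeasurable
  have hm : Measurable fun q : (ℝ × ℝ) × (ℕ → Letter) => q.1.1 + q.1.2 := by fun_prop
  have e : (μ.map fun ξ => ((ξ 0).1, seqTail ξ)).map (fun q => q.1.1 + q.1.2) = stateLaw μ := by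
    rw [Measure.map_map hm hm']; rfl
  have h2 : Integrable (fun q : (ℝ × ℝ) × (ℕ → Letter) => (q.1.1 + q.1.2) ^ 2)
      (μ.map fun ξ => ((ξ 0).1, seqTail ξ)) := by
    rw [integrable_map_measure (by fun_prop) hm'.aemeasurable]
    exact h.integrable_state_sq hpow
  have h3 := Witsenhausen.integrable_log_outDens (μ.map fun ξ => ((ξ 0).1, seqTail ξ)) hm hN h2
  rw [e, ← h.map_noise] at h3
  exact h3.comp_aemeasurable (by fun_prop)

lemma klDiv_pair_le (h : LetterLaw Q N μ) (hN : N ≠ 0) (hpow : powerMoment μ ≠ ∞) :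
    InformationTheory.klDiv (μ.map ownPair) (μ.map crossPair)
      ≤ ENNReal.ofReal ((∫ z, Real.log (gaussianPDFReal 0 N z) ∂(gaussianReal 0 N))
        - ∫ ξ, Real.log (outDens N (stateLaw μ) (ξ 0).out) ∂μ) := by
  set L := ∫ z, Real.log (gaussianPDFReal 0 N z) ∂(gaussianReal 0 N)
  set A := ∫ ξ, Real.log (outDens N (stateLaw μ) (ξ 0).out) ∂μ with hA
  have := Measure.isProbabilityMeasure_map (μ := μ) measurable_ownPair.aemeasurable
  have := Measure.isProbabilityMeasure_map (μ := μ) measurable_crossPair.aemeasurable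
  have hout : ∫⁻ ξ, ENNReal.ofReal ((ξ 0).out ^ 2) ∂μ < ∞ :=
    h.lintegral_out_sq_le.trans_lt (ENNReal.mul_lt_top (by simp) (ENNReal.add_lt_top.2
      ⟨ENNReal.add_lt_top.2 ⟨lintegral_sq_gaussianReal_lt_top Q, hpow.lt_top⟩,
        lintegral_sq_gaussianReal_lt_top N⟩))
  have hδ : ∀ δ : ℝ, 0 < δ → δ < 1 → InformationTheory.klDiv (μ.map ownPair) (μ.map crossPair)
      ≤ ENNReal.ofReal (L - A - Real.log (1 - δ)) := by
    intro δ h0 h1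
    refine klDiv_le_of_variational fun g => ?_
    have hψ := niceLog_mixLog hN (stateLaw μ) h0 h1
    have hi := h.info _ hψ g
    have hm : Measurable fun q => Real.exp (g q) :=
      Real.measurable_exp.comp g.continuous.measurable
    rw [integral_map measurable_ownPair.aemeasurable
      g.continuous.measurable.aestronglyMeasurable,
      integral_map measurable_crossPair.aemeasurable hm.aestronglyMeasurable]
    have hmono : A + Real.log (1 - δ) ≤ ∫ ξ, mixLog N (stateLaw μ) δ (ξ 0).out ∂μ := by
      have e : A + Real.log (1 - δ) = ∫ ξ, (Real.log (outDens N (stateLaw μ) (ξ 0).out)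
          + Real.log (1 - δ)) ∂μ := by
        rw [integral_add (h.integrable_log_outDens hN hpow) (integrable_const _)]
        simp [hA]
      rw [e]
      refine integral_mono ((h.integrable_log_outDens hN hpow).add (integrable_const _))
        (hψ.integrable (by fun_prop) hout) fun ξ => ?_
      change Real.log (outDens N (stateLaw μ) (ξ 0).out) + Real.log (1 - δ) ≤ mixLog _ _ _ _
      have hp := outDens_pos hN (stateLaw μ) (ξ 0).out
      rw [← Real.log_mul hp.ne' (by linarith), mixLog]
      refine Real.log_le_log (mul_pos hp (by linarith)) ?_
      have : 0 ≤ δ * ((Real.pi)⁻¹ * (1 + (ξ 0).out ^ 2)⁻¹) := by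
        have := Real.pi_pos; positivity
      linarith
    linarith
  have hlim : Tendsto (fun δ : ℝ => ENNReal.ofReal (L - A - Real.log (1 - δ))) (𝓝[>] 0)
      (𝓝 (ENNReal.ofReal (L - A))) := by
    have hc : ContinuousAt (fun δ : ℝ => L - A - Real.log (1 - δ)) 0 :=
      continuousAt_const.sub (ContinuousAt.log (by fun_prop) (by norm_num))
    have := (ENNReal.continuous_ofReal.continuousAt.comp hc).tendsto
    simp only [Function.comp_def, sub_zero, Real.log_one] at this
    exact this.mono_left nhdsWithin_le_nhds
  refine ge_of_tendsto hlim ?_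
  filter_upwards [Ioo_mem_nhdsGT (zero_lt_one' ℝ)] with δ hδ'
  exact hδ δ hδ'.1 hδ'.2

end LetterLaw

end PairBound

section Shift

open BoundedContinuousFunction

/-- Shift the control input by `a` and the estimate by `a + b`. -/
def shiftLetter (a b : ℝ) (l : Letter) : Letter :=
  ((l.1.1, l.1.2 + a), (l.2.1, l.2.2 + (a + b)))

@[fun_prop] lemma continuous_shiftLetter (a b : ℝ) : Continuous (shiftLetter a b) := by
  unfold shiftLetter; fun_prop

@[fun_prop] lemma measurable_shiftLetter (a b : ℝ) : Measurable (shiftLetter a b) :=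
  (continuous_shiftLetter a b).measurable

/-- Shift every letter of a sequence. -/
def shiftSeq (a b : ℝ) (ξ : ℕ → Letter) : ℕ → Letter := fun i => shiftLetter a b (ξ i)

@[fun_prop] lemma continuous_shiftSeq (a b : ℝ) : Continuous (shiftSeq a b) := by
  unfold shiftSeq; fun_prop

@[fun_prop] lemma measurable_shiftSeq (a b : ℝ) : Measurable (shiftSeq a b) := by
  unfold shiftSeq; fun_prop

lemma NiceLog.shift {ψ : ℝ → ℝ} (h : NiceLog ψ) (a : ℝ) : NiceLog fun y => ψ (y + a) := by
  obtain ⟨C, hC⟩ := h.growth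
  refine ⟨h.cont.comp (by fun_prop), ⟨|C| * (1 + |a|), fun y => ?_⟩, ?_⟩
  · refine (hC _).trans ?_
    have h1 : |y + a| ≤ |y| + |a| := abs_add_le _ _
    calc C * (1 + |y + a|) ≤ |C| * (1 + |y + a|) := by gcongr; exact le_abs_self C
      _ ≤ |C| * ((1 + |a|) * (1 + |y|)) := by
          gcongr
          nlinarith [abs_nonneg a, abs_nonneg y, mul_nonneg (abs_nonneg a) (abs_nonneg y)]
      _ = _ := by ring
  · rw [lintegral_add_right_eq_self (fun y => ENNReal.ofReal (Real.exp (ψ y)))]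
    exact h.mass

variable {Q N : ℝ≥0} {μ : Measure (ℕ → Letter)}

lemma LetterLaw.shift (h : LetterLaw Q N μ) (a b : ℝ) : LetterLaw Q N (μ.map (shiftSeq a b)) := by
  have key : ∀ f : (ℕ → Letter) → ℝ, Continuous f →
      ∫ ξ, f ξ ∂(μ.map (shiftSeq a b)) = ∫ ξ, f (shiftSeq a b ξ) ∂μ := fun f hf =>
    integral_map (measurable_shiftSeq a b).aemeasurable hf.measurable.aestronglyMeasurable
  have ct : Continuous (seqTail : (ℕ → Letter) → _) := by unfold seqTail; fun_prop
  refine ⟨fun e he f => ?_, fun f k => ?_, fun f k => ?_, fun ψ hψ g => ?_⟩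
  · rw [key _ (by fun_prop), key _ (by fun_prop)]
    exact h.reindex e he (f.compContinuous ⟨_, continuous_shiftSeq a b⟩)
  · rw [key _ (by fun_prop), key _ (by fun_prop)]
    exact h.source (f.compContinuous ⟨_, continuous_shiftSeq a b⟩) k
  · rw [key _ (by fun_prop), key _ (by fun_prop)]
    exact h.noise (f.compContinuous ⟨fun q => ((q.1.1, q.1.2 + a), shiftSeq a b q.2),
      by fun_prop⟩) k
  · have co : Continuous fun ξ : ℕ → Letter => ownPair ξ := by
      unfold ownPair Letter.rx Letter.out; fun_prop
    have cc : Continuous fun ξ : ℕ → Letter => crossPair ξ := by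
      unfold crossPair Letter.rx Letter.out; fun_prop
    have cψ : Continuous fun ξ : ℕ → Letter => ψ (ξ 0).out :=
      hψ.cont.comp (by unfold Letter.out; fun_prop)
    have ce : Continuous fun ξ : ℕ → Letter => Real.exp (g (crossPair ξ)) :=
      Real.continuous_exp.comp (g.continuous.comp cc)
    rw [key _ (by fun_prop), key _ ce, key _ cψ]
    let s : ((ℝ × ℝ) × (ℝ × ℝ)) × (ℕ → Letter) → ((ℝ × ℝ) × (ℝ × ℝ)) × (ℕ → Letter) :=
      fun q => (((q.1.1.1, q.1.1.2 + a), (q.1.2.1 + a, q.1.2.2 + (a + b))), shiftSeq a b q.2)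
    have cs : Continuous s := by simp only [s]; fun_prop
    have hi := h.info _ (hψ.shift a) (g.compContinuous ⟨s, cs⟩)
    have eo : ∀ ξ : ℕ → Letter, (shiftSeq a b ξ 0).out = (ξ 0).out + a := fun ξ => by
      simp only [shiftSeq, shiftLetter, Letter.out]; ring
    have e1 : ∀ ξ : ℕ → Letter, (shiftSeq a b ξ 1).out = (ξ 1).out + a := fun ξ => by
      simp only [shiftSeq, shiftLetter, Letter.out]; ring
    have hown : ∀ ξ, ownPair (shiftSeq a b ξ) = s (ownPair ξ) := fun ξ => by
      simp only [ownPair, Letter.rx, eo]; rfl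
    have hcross : ∀ ξ, crossPair (shiftSeq a b ξ) = s (crossPair ξ) := fun ξ => by
      simp only [crossPair, Letter.rx, e1]; rfl
    simp only [hown, hcross, eo]
    exact hi

lemma exists_integral_add_sq_eq {Ω : Type*} [MeasurableSpace Ω] {ν : Measure Ω}
    [IsProbabilityMeasure ν] {Y : Ω → ℝ} (hY : Measurable Y)
    (h2 : Integrable (fun ω => Y ω ^ 2) ν) {P : ℝ} (hP : ∫ ω, Y ω ^ 2 ∂ν ≤ P) :
    ∃ a, Integrable (fun ω => (Y ω + a) ^ 2) ν ∧ ∫ ω, (Y ω + a) ^ 2 ∂ν = P := by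
  have h1 : Integrable Y ν :=
    ((memLp_two_iff_integrable_sq hY.aestronglyMeasurable).2 h2).integrable (by norm_num)
  set m := ∫ ω, Y ω ∂ν with hm
  set E := ∫ ω, Y ω ^ 2 ∂ν with hE
  obtain ⟨a, ha⟩ : ∃ a, a = -m + √(m ^ 2 + (P - E)) := ⟨_, rfl⟩
  have e : (fun ω => (Y ω + a) ^ 2) = fun ω => Y ω ^ 2 + (2 * a * Y ω + a ^ 2) := by
    funext ω; ring
  refine ⟨a, ?_, ?_⟩
  · rw [e]
    exact h2.add ((h1.const_mul _).add (integrable_const _))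
  · have hi : Integrable (fun ω => 2 * a * Y ω + a ^ 2) ν :=
      (h1.const_mul _).add (integrable_const _)
    rw [e, integral_add h2 hi, integral_add (h1.const_mul _) (integrable_const _),
      integral_const_mul, integral_const, ← hE, ← hm]
    have hs : √(m ^ 2 + (P - E)) ^ 2 = m ^ 2 + (P - E) := Real.sq_sqrt (by nlinarith)
    simp only [probReal_univ, one_smul]
    have : √(m ^ 2 + (P - E)) = a + m := by rw [ha]; ring
    rw [this] at hs
    nlinarith

variable {P S : ℝ}

lemma exists_letterLaw_eq (hN : N ≠ 0) (h : achievableFBNC Q N P S) :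
    ∃ μ : Measure (ℕ → Letter), IsProbabilityMeasure μ ∧ LetterLaw Q N μ ∧
      (Integrable (fun ξ : ℕ → Letter => (ξ 0).1.2 ^ 2) μ ∧ ∫ ξ, (ξ 0).1.2 ^ 2 ∂μ = P) ∧
      Integrable (fun ξ : ℕ → Letter => ((ξ 0).1.1 + (ξ 0).1.2 - (ξ 0).2.2) ^ 2) μ ∧
        ∫ ξ, ((ξ 0).1.1 + (ξ 0).1.2 - (ξ 0).2.2) ^ 2 ∂μ = S := by
  obtain ⟨μ, hμ, hl, hp, hs⟩ := exists_letterLaw hN h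
  obtain ⟨hP, hS⟩ := nonneg_of_achievable h
  have mu : Measurable fun ξ : ℕ → Letter => (ξ 0).1.2 := by fun_prop
  have me : Measurable fun ξ : ℕ → Letter => (ξ 0).1.1 + (ξ 0).1.2 - (ξ 0).2.2 := by fun_prop
  have iu := LetterLaw.integrable_u_sq (ne_top_of_le_ne_top ENNReal.ofReal_ne_top hp)
  have ie := LetterLaw.integrable_err_sq (ne_top_of_le_ne_top ENNReal.ofReal_ne_top hs)
  have hp' : ∫ ξ, (ξ 0).1.2 ^ 2 ∂μ ≤ P := by
    rw [integral_eq_lintegral_of_nonneg_ae (ae_of_all _ fun _ => sq_nonneg _)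
      iu.aestronglyMeasurable]
    exact ENNReal.toReal_le_of_le_ofReal hP hp
  have hs' : ∫ ξ, ((ξ 0).1.1 + (ξ 0).1.2 - (ξ 0).2.2) ^ 2 ∂μ ≤ S := by
    rw [integral_eq_lintegral_of_nonneg_ae (ae_of_all _ fun _ => sq_nonneg _)
      ie.aestronglyMeasurable]
    exact ENNReal.toReal_le_of_le_ofReal hS hs
  obtain ⟨a, ha, ha'⟩ := exists_integral_add_sq_eq mu iu hp'
  obtain ⟨b, hb, hb'⟩ := exists_integral_add_sq_eq me ie hs'
  have ms := measurable_shiftSeq a (-b)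
  have eb : ∀ ξ : ℕ → Letter, (shiftSeq a (-b) ξ 0).1.1 + (shiftSeq a (-b) ξ 0).1.2
      - (shiftSeq a (-b) ξ 0).2.2 = (ξ 0).1.1 + (ξ 0).1.2 - (ξ 0).2.2 + b := fun ξ => by
    simp only [shiftSeq, shiftLetter]; ring
  have mu2 := mu.pow_const 2
  have me2 := me.pow_const 2
  refine ⟨μ.map (shiftSeq a (-b)), Measure.isProbabilityMeasure_map ms.aemeasurable,
    hl.shift a (-b), ⟨?_, ?_⟩, ?_, ?_⟩
  · rw [integrable_map_measure mu2.aestronglyMeasurable ms.aemeasurable]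
    exact ha
  · rw [integral_map ms.aemeasurable mu2.aestronglyMeasurable]
    exact ha'
  · rw [integrable_map_measure me2.aestronglyMeasurable ms.aemeasurable]
    simp only [Function.comp_def, eb]
    exact hb
  · rw [integral_map ms.aemeasurable me2.aestronglyMeasurable]
    simp only [eb]
    exact hb'

end Shift

section Exchangeable

variable {E : Type*} [MeasurableSpace E] [StandardBorelSpace E] [Nonempty E]
  {μ : Measure (ℕ → E)} [IsProbabilityMeasure μ]

/-- The law of the first letter given the following ones. -/
def headKernel (μ : Measure (ℕ → E)) [IsProbabilityMeasure μ] : Kernel (ℕ → E) E :=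
  condDistrib (fun ξ => ξ 0) seqTail μ

instance : IsMarkovKernel (headKernel μ) := by unfold headKernel; infer_instance

lemma map_tail_of_exchangeable
    (hex : ∀ e : ℕ → ℕ, Function.Injective e → μ.map (fun ξ i => ξ (e i)) = μ) :
    μ.map seqTail = μ := hex (fun i => i + 1) (add_left_injective 1)

lemma map_tail_head_of_exchangeable
    (hex : ∀ e : ℕ → ℕ, Function.Injective e → μ.map (fun ξ i => ξ (e i)) = μ) :
    μ.map (fun ξ => (seqTail ξ, ξ 0)) = μ ⊗ₘ headKernel μ := by
  have h := compProd_map_condDistrib (mβ := MeasurableSpace.pi) (μ := μ) (X := seqTail) (Y := fun ξ : ℕ → E => ξ 0)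
    (measurable_pi_apply 0).aemeasurable
  rw [map_tail_of_exchangeable hex] at h
  exact h.symm

lemma map_tail_tail_head_of_exchangeable
    (hex : ∀ e : ℕ → ℕ, Function.Injective e → μ.map (fun ξ i => ξ (e i)) = μ) :
    μ.map (fun ξ => (seqTail (seqTail ξ), ξ 0)) = μ ⊗ₘ headKernel μ := by
  have hinj : Function.Injective fun i : ℕ => if i = 0 then 0 else i + 1 := fun i j h => by
    simp only at h
    split_ifs at h <;> omega
  rw [← map_tail_head_of_exchangeable hex]
  conv_rhs => rw [← hex _ hinj]
  rw [Measure.map_map (by fun_prop) (by fun_prop)]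
  rfl

lemma headKernel_tail_ae
    (hex : ∀ e : ℕ → ℕ, Function.Injective e → μ.map (fun ξ i => ξ (e i)) = μ)
    {s : Set E} (hs : MeasurableSet s) :
    ∀ᵐ r ∂μ, headKernel μ r s = headKernel μ (seqTail r) s := by
  set κ := headKernel μ
  have hF : Measurable fun r => (κ r).real s := (Kernel.measurable_coe κ hs).ennreal_toReal
  have hFt : Measurable fun r => (κ (seqTail r)).real s := hF.comp (by fun_prop)
  have hb : ∀ r, |(κ r).real s| ≤ 1 := fun r => by
    rw [abs_of_nonneg measureReal_nonneg]; exact measureReal_le_one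
  have bdd : ∀ {h : (ℕ → E) → ℝ}, Measurable h → (∀ r, |h r| ≤ 1) → Integrable h μ :=
    fun hm hb => Integrable.of_bound hm.aestronglyMeasurable 1 (ae_of_all _ hb)
  have test : ∀ (T : (ℕ → E) → (ℕ → E)), Measurable T → μ.map (fun ξ => (T ξ, ξ 0)) = μ ⊗ₘ κ →
      ∀ h : (ℕ → E) → ℝ, Measurable h → (∀ r, |h r| ≤ 1) →
      ∫ ξ, h (T ξ) * s.indicator 1 (ξ 0) ∂μ = ∫ r, h r * (κ r).real s ∂μ := by
    intro T hT e h hm hb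
    have hm2 : Measurable fun q : (ℕ → E) × E => h q.1 * s.indicator (1 : E → ℝ) q.2 :=
      (hm.comp measurable_fst).mul ((measurable_one.indicator hs).comp measurable_snd)
    have hTm : Measurable fun ξ : ℕ → E => (T ξ, ξ 0) := by fun_prop
    have hi : Integrable (fun q : (ℕ → E) × E => h q.1 * s.indicator (1 : E → ℝ) q.2)
        (μ ⊗ₘ κ) := by
      refine Integrable.of_bound hm2.aestronglyMeasurable 1 (ae_of_all _ fun q => ?_)
      rw [Real.norm_eq_abs, abs_mul]
      refine mul_le_one₀ (hb _) (abs_nonneg _) ?_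
      by_cases hq : q.2 ∈ s <;> simp [hq]
    calc ∫ ξ, h (T ξ) * s.indicator 1 (ξ 0) ∂μ
        = ∫ q, h q.1 * s.indicator 1 q.2 ∂(μ.map fun ξ => (T ξ, ξ 0)) :=
          (integral_map hTm.aemeasurable hm2.aestronglyMeasurable).symm
      _ = ∫ r, h r * (κ r).real s ∂μ := by
          rw [e, Measure.integral_compProd hi]
          refine integral_congr_ae (ae_of_all _ fun r => ?_)
          simp only
          rw [integral_const_mul, integral_indicator_one hs]
  have hcross : ∫ r, (κ (seqTail r)).real s * (κ r).real s ∂μ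
      = ∫ r, (κ r).real s * (κ r).real s ∂μ := by
    rw [← test seqTail (by fun_prop) (map_tail_head_of_exchangeable hex) _ hFt fun r => hb _,
      ← test (fun ξ => seqTail (seqTail ξ)) (by fun_prop)
        (map_tail_tail_head_of_exchangeable hex) _ hF hb]
  have hsq : ∫ r, (κ (seqTail r)).real s * (κ (seqTail r)).real s ∂μ
      = ∫ r, (κ r).real s * (κ r).real s ∂μ := by
    have hm : Measurable fun r => (κ r).real s * (κ r).real s := hF.mul hF
    have := integral_map (μ := μ) (φ := seqTail) (by fun_prop) hm.aestronglyMeasurable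
    rw [map_tail_of_exchangeable hex] at this
    exact this.symm
  have prod_le : ∀ a b : ℝ, |a| ≤ 1 → |b| ≤ 1 → |a * b| ≤ 1 := fun a b ha hb => by
    rw [abs_mul]; exact mul_le_one₀ ha (abs_nonneg _) hb
  have i1 := bdd (hF.mul hF) fun r => prod_le _ _ (hb r) (hb r)
  have i2 := bdd (hFt.mul hF) fun r => prod_le _ _ (hb _) (hb r)
  have i3 := bdd (hFt.mul hFt) fun r => prod_le _ _ (hb _) (hb _)
  have hzero : ∫ r, ((κ r).real s - (κ (seqTail r)).real s) ^ 2 ∂μ = 0 := by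
    have e : (fun r => ((κ r).real s - (κ (seqTail r)).real s) ^ 2)
        = fun r => ((κ r).real s * (κ r).real s - 2 * ((κ (seqTail r)).real s * (κ r).real s))
          + (κ (seqTail r)).real s * (κ (seqTail r)).real s := by funext r; ring
    have i4 : Integrable (fun r => (κ r).real s * (κ r).real s
        - 2 * ((κ (seqTail r)).real s * (κ r).real s)) μ := i1.sub (i2.const_mul 2)
    have i5 : Integrable (fun r => (κ (seqTail r)).real s * (κ (seqTail r)).real s) μ := i3
    have i6 : Integrable (fun r => (κ r).real s * (κ r).real s) μ := i1
    have i7 : Integrable (fun r => 2 * ((κ (seqTail r)).real s * (κ r).real s)) μ :=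
      i2.const_mul 2
    rw [e, integral_add i4 i5, integral_sub i6 i7, integral_const_mul, hcross, hsq]
    ring
  have hi : Integrable (fun r => ((κ r).real s - (κ (seqTail r)).real s) ^ 2) μ := by
    refine Integrable.of_bound ((hF.sub hFt).pow_const 2).aestronglyMeasurable 1
      (ae_of_all _ fun r => ?_)
    have h1 : (κ r).real s ≤ 1 := measureReal_le_one
    have h2 : (κ (seqTail r)).real s ≤ 1 := measureReal_le_one
    have h3 : 0 ≤ (κ r).real s := measureReal_nonneg
    have h4 : 0 ≤ (κ (seqTail r)).real s := measureReal_nonneg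
    rw [Real.norm_eq_abs, abs_of_nonneg (sq_nonneg _)]
    nlinarith
  rw [integral_eq_zero_iff_of_nonneg (fun r => sq_nonneg _) hi] at hzero
  filter_upwards [hzero] with r hr
  have : (κ r).real s = (κ (seqTail r)).real s := by
    have : ((κ r).real s - (κ (seqTail r)).real s) ^ 2 = 0 := hr
    exact sub_eq_zero.1 (pow_eq_zero_iff (two_ne_zero) |>.1 this)
  exact (ENNReal.toReal_eq_toReal_iff' (measure_ne_top _ _) (measure_ne_top _ _)).1 this

/-- The first two letters are conditionally i.i.d. given the following ones. -/
lemma map_head_pair_of_exchangeable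
    (hex : ∀ e : ℕ → ℕ, Function.Injective e → μ.map (fun ξ i => ξ (e i)) = μ) :
    μ.map (fun ξ => (seqTail (seqTail ξ), (ξ 0, ξ 1)))
      = μ ⊗ₘ (headKernel μ ×ₖ headKernel μ) := by
  have h1 : μ.map (fun ξ => (seqTail ξ, ξ 0))
      = μ ⊗ₘ (headKernel μ).comap seqTail (by fun_prop) := by
    rw [map_tail_head_of_exchangeable hex]
    refine Measure.ext_prod fun {s t} hs ht => ?_
    rw [Measure.compProd_apply_prod hs ht, Measure.compProd_apply_prod hs ht]
    refine setLIntegral_congr_fun_ae hs ?_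
    filter_upwards [headKernel_tail_ae hex ht] with r hr _
    rw [Kernel.comap_apply, hr]
  refine Measure.ext_of_lintegral _ fun f hf => ?_
  have hf' : Measurable fun q : (ℕ → E) × E => f (seqTail q.1, (q.2, q.1 0)) := by fun_prop
  calc ∫⁻ q, f q ∂(μ.map fun ξ => (seqTail (seqTail ξ), (ξ 0, ξ 1)))
      = ∫⁻ q, f (seqTail q.1, (q.2, q.1 0)) ∂(μ.map fun ξ => (seqTail ξ, ξ 0)) := by
        rw [lintegral_map hf (by fun_prop), lintegral_map hf' (by fun_prop)]; rfl
    _ = ∫⁻ r, ∫⁻ t, f (seqTail r, (t, r 0)) ∂(headKernel μ (seqTail r)) ∂μ := by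
        rw [h1, Measure.lintegral_compProd hf']; rfl
    _ = ∫⁻ q, ∫⁻ t, f (q.1, (t, q.2)) ∂(headKernel μ q.1) ∂(μ.map fun ξ => (seqTail ξ, ξ 0)) := by
        have hm : Measurable fun q : (ℕ → E) × E =>
            ∫⁻ t, f (q.1, (t, q.2)) ∂((headKernel μ).comap Prod.fst measurable_fst q) :=
          Measurable.lintegral_kernel_prod_right' (f := fun p : ((ℕ → E) × E) × E =>
            f (p.1.1, (p.2, p.1.2))) (by fun_prop)
        exact (lintegral_map (g := fun ξ : ℕ → E => (seqTail ξ, ξ 0)) hm (by fun_prop)).symm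
    _ = ∫⁻ r, ∫⁻ s, ∫⁻ t, f (r, (t, s)) ∂(headKernel μ r) ∂(headKernel μ r) ∂μ := by
        have hm : Measurable fun q : (ℕ → E) × E =>
            ∫⁻ t, f (q.1, (t, q.2)) ∂((headKernel μ).comap Prod.fst measurable_fst q) :=
          Measurable.lintegral_kernel_prod_right' (f := fun p : ((ℕ → E) × E) × E =>
            f (p.1.1, (p.2, p.1.2))) (by fun_prop)
        rw [map_tail_head_of_exchangeable hex]
        exact Measure.lintegral_compProd hm
    _ = ∫⁻ q, f q ∂(μ ⊗ₘ (headKernel μ ×ₖ headKernel μ)) := by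
        rw [Measure.lintegral_compProd hf]
        refine lintegral_congr fun r => ?_
        have hm : Measurable fun q : E × E => f (r, q) := by fun_prop
        rw [Kernel.prod_apply, lintegral_prod_symm _ hm.aemeasurable]

end Exchangeable

section Compensation

variable {A B C : Type*} [MeasurableSpace A] [MeasurableSpace B] [MeasurableSpace C]

/-- Exchange the last two coordinates. -/
def swapRight : (C × A) × B ≃ᵐ (C × B) × A where
  toFun p := ((p.1.1, p.2), p.1.2)
  invFun p := ((p.1.1, p.2), p.1.2)
  left_inv _ := rfl
  right_inv _ := rfl
  measurable_toFun := by simp only [Equiv.coe_fn_mk]; fun_prop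
  measurable_invFun := by simp only [Equiv.coe_fn_symm_mk]; fun_prop

lemma map_swapRight_compProd (m : Measure C) [SFinite m] (a : Kernel C A) [IsSFiniteKernel a]
    (b : Kernel C B) [IsSFiniteKernel b] :
    ((m ⊗ₘ a) ⊗ₘ b.comap Prod.fst measurable_fst).map swapRight
      = (m ⊗ₘ b) ⊗ₘ a.comap Prod.fst measurable_fst := by
  refine Measure.ext_of_lintegral _ fun f hf => ?_
  have h1 : Measurable fun p : (C × A) × B => f ((p.1.1, p.2), p.1.2) := by fun_prop
  have h2 : Measurable fun q : C × A => ∫⁻ y, f ((q.1, y), q.2)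
      ∂((b.comap Prod.fst measurable_fst : Kernel (C × A) B) q) :=
    Measurable.lintegral_kernel_prod_right' h1
  have h3 : Measurable fun q : C × B => ∫⁻ x, f (q, x)
      ∂((a.comap Prod.fst measurable_fst : Kernel (C × B) A) q) :=
    Measurable.lintegral_kernel_prod_right' hf
  rw [lintegral_map hf swapRight.measurable]
  change ∫⁻ p : (C × A) × B, f ((p.1.1, p.2), p.1.2) ∂_ = _
  rw [Measure.lintegral_compProd h1, Measure.lintegral_compProd h2,
    Measure.lintegral_compProd hf, Measure.lintegral_compProd h3]
  refine lintegral_congr fun c => ?_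
  simp only [Kernel.comap_apply]
  exact lintegral_lintegral_swap (f := fun x y => f ((c, y), x)) (by fun_prop)

/-- Replacing the conditional law by another kernel costs a relative entropy. -/
lemma klDiv_compensation [StandardBorelSpace A] [Nonempty A] (P : Measure ((C × A) × B))
    [IsProbabilityMeasure P] (b η : Kernel C B) [IsMarkovKernel b] [IsMarkovKernel η]
    (hb : P.map (fun q => (q.1.1, q.2)) = (P.map fun q => q.1.1) ⊗ₘ b) :
    InformationTheory.klDiv P (P.map Prod.fst ⊗ₘ η.comap Prod.fst measurable_fst)
      = InformationTheory.klDiv ((P.map fun q => q.1.1) ⊗ₘ b) ((P.map fun q => q.1.1) ⊗ₘ η)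
        + InformationTheory.klDiv P (P.map Prod.fst ⊗ₘ b.comap Prod.fst measurable_fst) := by
  set m := P.map fun q => q.1.1 with hm
  have : IsProbabilityMeasure m := Measure.isProbabilityMeasure_map (by fun_prop)
  set a := condDistrib (fun q : (C × A) × B => q.1.2) (fun q => q.1.1) P with ha
  set K := condDistrib (fun q : (C × A) × B => q.1.2) (fun q => (q.1.1, q.2)) P
  have hP : P.map swapRight = (m ⊗ₘ b) ⊗ₘ K := by
    rw [← hb, compProd_map_condDistrib (by fun_prop)]
    rfl
  have hfst : P.map Prod.fst = m ⊗ₘ a := (compProd_map_condDistrib (by fun_prop)).symm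
  rw [← klDiv_map_measurableEquiv P (P.map Prod.fst ⊗ₘ η.comap _ _) swapRight,
    ← klDiv_map_measurableEquiv P (P.map Prod.fst ⊗ₘ b.comap _ _) swapRight, hfst,
    map_swapRight_compProd, map_swapRight_compProd, hP,
    InformationTheory.klDiv_compProd_eq_add]

end Compensation

section LetterInfo

variable {Q N : ℝ≥0} {μ : Measure (ℕ → Letter)} [IsProbabilityMeasure μ]

/-- The law of source and control input given the other letters. -/
def inKernel (μ : Measure (ℕ → Letter)) [IsProbabilityMeasure μ] : Kernel (ℕ → Letter) (ℝ × ℝ) :=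
  (headKernel μ).map Prod.fst

/-- The law of output and estimate given the other letters. -/
def rxKernel (μ : Measure (ℕ → Letter)) [IsProbabilityMeasure μ] : Kernel (ℕ → Letter) (ℝ × ℝ) :=
  (headKernel μ).map Letter.rx

instance : IsMarkovKernel (inKernel μ) := Kernel.IsMarkovKernel.map _ measurable_fst

instance : IsMarkovKernel (rxKernel μ) := Kernel.IsMarkovKernel.map _ (by fun_prop)

/-- Source, control input and output of the first letter together with the side information. -/
def ownObs (ξ : ℕ → Letter) : ((ℕ → Letter) × (ℝ × ℝ)) × ℝ :=
  ((seqTail (seqTail ξ), (ξ 0).1), (ξ 0).out)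

@[fun_prop] lemma measurable_ownObs : Measurable ownObs := by unfold ownObs; fun_prop

/-- The projection forgetting source and control input. -/
def dropIn (q : ((ℕ → Letter) × (ℝ × ℝ)) × ℝ) : (ℕ → Letter) × ℝ := (q.1.1, q.2)

@[fun_prop] lemma measurable_dropIn : Measurable dropIn := by unfold dropIn; fun_prop

namespace LetterLaw

lemma exchangeable (h : LetterLaw Q N μ) (e : ℕ → ℕ) (he : Function.Injective e) :
    μ.map (fun ξ i => ξ (e i)) = μ := h.map_reindex he

lemma map_side_in (h : LetterLaw Q N μ) :
    μ.map (fun ξ => (seqTail (seqTail ξ), (ξ 0).1)) = μ ⊗ₘ inKernel μ := by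
  rw [inKernel, Measure.compProd_map measurable_fst,
    ← map_tail_tail_head_of_exchangeable h.exchangeable,
    Measure.map_map (by fun_prop) (by fun_prop)]
  rfl

lemma map_side_out (h : LetterLaw Q N μ) :
    μ.map (fun ξ => (seqTail (seqTail ξ), (ξ 0).out)) = μ ⊗ₘ (rxKernel μ).fst := by
  rw [rxKernel, Kernel.fst_eq, Measure.compProd_map measurable_fst,
    Measure.compProd_map (by fun_prop),
    ← map_tail_tail_head_of_exchangeable h.exchangeable,
    Measure.map_map (by fun_prop) (by fun_prop), Measure.map_map (by fun_prop) (by fun_prop)]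
  rfl

lemma map_cross (h : LetterLaw Q N μ) :
    μ.map (fun ξ => (((seqTail (seqTail ξ), (ξ 0).1), (ξ 1).out), (ξ 1).2.2))
      = ((μ ⊗ₘ inKernel μ) ⊗ₘ (rxKernel μ).fst.comap Prod.fst measurable_fst)
        ⊗ₘ (rxKernel μ).condKernel.comap dropIn measurable_dropIn := by
  refine Measure.ext_of_lintegral _ fun f hf => ?_
  have e : μ.map (fun ξ => (((seqTail (seqTail ξ), (ξ 0).1), (ξ 1).out), (ξ 1).2.2))
      = (μ ⊗ₘ (headKernel μ ×ₖ headKernel μ)).map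
        (fun q => (((q.1, q.2.1.1), q.2.2.out), q.2.2.2.2)) := by
    rw [← map_head_pair_of_exchangeable h.exchangeable,
      Measure.map_map (by fun_prop) (by fun_prop)]
    rfl
  have h1 : Measurable fun q : (ℕ → Letter) × (Letter × Letter) =>
      f (((q.1, q.2.1.1), q.2.2.out), q.2.2.2.2) := by fun_prop
  have h2 : Measurable fun q : ((ℕ → Letter) × (ℝ × ℝ)) × ℝ => ∫⁻ v, f (q, v)
      ∂((rxKernel μ).condKernel.comap dropIn measurable_dropIn q) :=
    Measurable.lintegral_kernel_prod_right' hf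
  have h3 : Measurable fun p : (ℕ → Letter) × (ℝ × ℝ) => ∫⁻ y, ∫⁻ v, f ((p, y), v)
      ∂((rxKernel μ).condKernel.comap dropIn measurable_dropIn (p, y))
      ∂((rxKernel μ).fst.comap Prod.fst measurable_fst p) :=
    Measurable.lintegral_kernel_prod_right' h2
  rw [e, lintegral_map hf (by fun_prop), Measure.lintegral_compProd h1,
    Measure.lintegral_compProd hf, Measure.lintegral_compProd h2,
    Measure.lintegral_compProd h3]
  refine lintegral_congr fun r => ?_
  have h4 : Measurable fun q : Letter × Letter => f (((r, q.1.1), q.2.out), q.2.2.2) := by fun_prop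
  have h5 : Measurable fun a : ℝ × ℝ => ∫⁻ y, ∫⁻ v, f (((r, a), y), v)
      ∂((rxKernel μ).condKernel.comap dropIn measurable_dropIn ((r, a), y))
      ∂((rxKernel μ).fst.comap Prod.fst measurable_fst (r, a)) := h3.comp (by fun_prop)
  rw [Kernel.prod_apply, lintegral_prod _ h4.aemeasurable, inKernel,
    Kernel.map_apply _ measurable_fst, lintegral_map h5 measurable_fst]
  refine lintegral_congr fun s => ?_
  have h6 : Measurable fun b : ℝ × ℝ => f (((r, s.1), b.1), b.2) := by fun_prop
  have e2 : ∫⁻ t, f (((r, s.1), t.out), t.2.2) ∂(headKernel μ r)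
      = ∫⁻ b, f (((r, s.1), b.1), b.2) ∂(rxKernel μ r) := by
    rw [rxKernel, Kernel.map_apply _ (by fun_prop), lintegral_map h6 (by fun_prop)]
    rfl
  rw [e2]
  conv_lhs => rw [← (rxKernel μ).disintegrate (rxKernel μ).condKernel]
  rw [Kernel.lintegral_compProd _ _ _ h6]
  rfl

lemma map_side_noise (h : LetterLaw Q N μ) :
    μ.map (fun ξ => ((seqTail (seqTail ξ), (ξ 0).1), (ξ 0).2.1))
      = (μ ⊗ₘ inKernel μ).prod (gaussianReal 0 N) := by
  have hm : Measurable fun q : (ℝ × ℝ) × (ℕ → Letter) => (seqTail q.2, q.1) := by fun_prop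
  have h1 : Measurable fun ξ : ℕ → Letter => ((ξ 0).1, seqTail ξ) := by fun_prop
  have := Measure.isProbabilityMeasure_map (μ := μ) h1.aemeasurable
  have e := congrArg (Measure.map (Prod.map (fun q : (ℝ × ℝ) × (ℕ → Letter) =>
    (seqTail q.2, q.1)) (id : ℝ → ℝ))) h.map_noise
  rw [← Measure.map_prod_map _ _ hm measurable_id, Measure.map_map hm h1, Measure.map_id,
    Measure.map_map (by fun_prop) (by fun_prop)] at e
  rw [← h.map_side_in]
  exact e

lemma map_ownObs (h : LetterLaw Q N μ) :
    μ.map ownObs = ((μ ⊗ₘ inKernel μ).prod (gaussianReal 0 N)).map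
      (fun p => (p.1, (p.1.2.1 + p.1.2.2) + p.2)) := by
  rw [← h.map_side_noise, Measure.map_map (by fun_prop) (by fun_prop)]
  rfl

/-- The law of the estimate given all observations of the letter. -/
lemma exists_kernel_klDiv_le (h : LetterLaw Q N μ) (hN : N ≠ 0)
    (hpow : Integrable (fun ξ : ℕ → Letter => (ξ 0).1.2 ^ 2) μ) :
    ∃ (κ : Kernel (((ℕ → Letter) × (ℝ × ℝ)) × ℝ) ℝ) (η : Kernel ((ℕ → Letter) × ℝ) ℝ),
      IsMarkovKernel κ ∧ IsMarkovKernel η ∧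
      μ.map (fun ξ => (ownObs ξ, (ξ 0).2.2)) = μ.map ownObs ⊗ₘ κ ∧
      InformationTheory.klDiv (μ.map ownObs ⊗ₘ κ)
          (μ.map ownObs ⊗ₘ η.comap dropIn measurable_dropIn)
        ≤ InformationTheory.klDiv (μ.map fun ξ => (seqTail (seqTail ξ), (ξ 0).out))
          (μ.prod (μ.map fun ξ => (ξ 0).out)) := by
  have hpow' : powerMoment μ ≠ ∞ := hpow.lintegral_lt_top.ne
  have hm : Measurable fun q : (ℕ → Letter) × (ℝ × ℝ) => q.2.1 + q.2.2 := by fun_prop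
  set l := μ ⊗ₘ inKernel μ with hl
  set T := μ.map ownObs with hT
  have pT : IsProbabilityMeasure T := Measure.isProbabilityMeasure_map (by fun_prop)
  set pY := μ.map fun ξ => (ξ 0).out with hpY
  have mY : Measurable fun ξ : ℕ → Letter => (ξ 0).out := by fun_prop
  have ppY : IsProbabilityMeasure pY := Measure.isProbabilityMeasure_map mY.aemeasurable
  have hstate : l.map (fun q => q.2.1 + q.2.2) = stateLaw μ := by
    rw [hl, ← h.map_side_in, Measure.map_map hm (by fun_prop)]; rfl
  have h2 : Integrable (fun q : (ℕ → Letter) × (ℝ × ℝ) => (q.2.1 + q.2.2) ^ 2) l := by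
    have hs : Measurable fun ξ : ℕ → Letter => (seqTail (seqTail ξ), (ξ 0).1) := by fun_prop
    rw [hl, ← h.map_side_in, integrable_map_measure (by fun_prop) hs.aemeasurable]
    exact h.integrable_state_sq hpow'
  have hpY' : (l.prod (gaussianReal 0 N)).map (fun p => (p.1.2.1 + p.1.2.2) + p.2) = pY := by
    rw [← h.map_side_noise, Measure.map_map (by fun_prop) (by fun_prop)]; rfl
  have hlog : ∫ p, Real.log (outDens N (stateLaw μ) ((p.1.2.1 + p.1.2.2) + p.2))
      ∂(l.prod (gaussianReal 0 N))
      = ∫ ξ, Real.log (outDens N (stateLaw μ) (ξ 0).out) ∂μ := by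
    have hs : Measurable fun ξ : ℕ → Letter =>
      ((seqTail (seqTail ξ), (ξ 0).1), (ξ 0).2.1) := by fun_prop
    have hd := (continuous_outDens N (stateLaw μ)).measurable
    have hdm : Measurable fun p : ((ℕ → Letter) × (ℝ × ℝ)) × ℝ =>
        Real.log (outDens N (stateLaw μ) ((p.1.2.1 + p.1.2.2) + p.2)) :=
      (hd.comp (by fun_prop)).log
    rw [← h.map_side_noise, integral_map hs.aemeasurable hdm.aestronglyMeasurable]
    rfl
  have hchan := klDiv_channel l (m := fun q => q.2.1 + q.2.2) hm hN h2
  rw [hpY', hstate, hlog, ← h.map_ownObs, ← hT] at hchan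
  have hTfst : T.map Prod.fst = l := by
    rw [hT, Measure.map_map measurable_fst (by fun_prop), hl, ← h.map_side_in]; rfl
  have hTr : T.map (fun q => q.1.1) = μ := by
    have : l.map Prod.fst = μ := Measure.fst_compProd _ _
    rw [← hTfst, Measure.map_map measurable_fst measurable_fst] at this
    exact this
  have hTry : T.map (fun q => (q.1.1, q.2)) = μ ⊗ₘ (rxKernel μ).fst := by
    rw [hT, Measure.map_map (by fun_prop) (by fun_prop), ← h.map_side_out]; rfl
  have hcomp := klDiv_compensation T (rxKernel μ).fst (Kernel.const _ pY) (by rw [hTr, hTry])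
  rw [hTfst, hTr, Measure.compProd_const, ← h.map_side_out] at hcomp
  have hconst : (Kernel.const (ℕ → Letter) pY).comap Prod.fst
      (measurable_fst : Measurable (Prod.fst : (ℕ → Letter) × (ℝ × ℝ) → _))
      = Kernel.const _ pY := rfl
  rw [hconst, Measure.compProd_const, hchan] at hcomp
  refine ⟨condDistrib (fun ξ : ℕ → Letter => (ξ 0).2.2) ownObs μ, (rxKernel μ).condKernel,
    inferInstance, inferInstance, ?_, ?_⟩
  · have hv : Measurable fun ξ : ℕ → Letter => (ξ 0).2.2 := by fun_prop
    exact (compProd_map_condDistrib hv.aemeasurable).symm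
  · set κ := condDistrib (fun ξ : ℕ → Letter => (ξ 0).2.2) ownObs μ with hκ
    have hv : Measurable fun ξ : ℕ → Letter => (ξ 0).2.2 := by fun_prop
    have hown : μ.map (fun ξ => (ownObs ξ, (ξ 0).2.2)) = T ⊗ₘ κ :=
      (compProd_map_condDistrib hv.aemeasurable).symm
    let s : ((ℝ × ℝ) × (ℝ × ℝ)) × (ℕ → Letter) ≃ᵐ (((ℕ → Letter) × (ℝ × ℝ)) × ℝ) × ℝ :=
      { toFun := fun p => (((p.2, p.1.1), p.1.2.1), p.1.2.2)
        invFun := fun p => ((p.1.1.2, (p.1.2, p.2)), p.1.1.1)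
        left_inv := fun p => rfl
        right_inv := fun p => rfl
        measurable_toFun := by simp only [Equiv.coe_fn_mk]; fun_prop
        measurable_invFun := by simp only [Equiv.coe_fn_symm_mk]; fun_prop }
    have hso : (μ.map ownPair).map s = T ⊗ₘ κ := by
      rw [← hown, Measure.map_map s.measurable (by fun_prop)]; rfl
    have hsc : (μ.map crossPair).map s
        = (l ⊗ₘ (rxKernel μ).fst.comap Prod.fst measurable_fst)
          ⊗ₘ (rxKernel μ).condKernel.comap dropIn measurable_dropIn := by
      rw [hl, ← h.map_cross, Measure.map_map s.measurable (by fun_prop)]; rfl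
    have := Measure.isProbabilityMeasure_map (μ := μ) measurable_ownPair.aemeasurable
    have := Measure.isProbabilityMeasure_map (μ := μ) measurable_crossPair.aemeasurable
    have hle := h.klDiv_pair_le hN hpow'
    rw [← klDiv_map_measurableEquiv _ _ s, hso, hsc, InformationTheory.klDiv_compProd_eq_add,
      hcomp, add_comm] at hle
    refine (ENNReal.add_le_add_iff_right ?_).1 hle
    refine ne_top_of_le_ne_top (ENNReal.ofReal_ne_top (r := _)) (le_add_self.trans hcomp.ge)

end LetterLaw

end LetterInfo

section KernelPullback

variable {O T V : Type*} [MeasurableSpace O] [MeasurableSpace T] [MeasurableSpace V]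

lemma map_compProd_comap (L : Measure O) [SFinite L] {Ψ : O → T} (hΨ : Measurable Ψ)
    (κ : Kernel T V) [IsSFiniteKernel κ] :
    (L ⊗ₘ κ.comap Ψ hΨ).map (fun p => (Ψ p.1, p.2)) = L.map Ψ ⊗ₘ κ := by
  refine Measure.ext_of_lintegral _ fun f hf => ?_
  have h1 : Measurable fun p : O × V => f (Ψ p.1, p.2) := by fun_prop
  have h2 : Measurable fun t => ∫⁻ v, f (t, v) ∂(κ t) :=
    Measurable.lintegral_kernel_prod_right' hf
  rw [lintegral_map hf (by fun_prop), Measure.lintegral_compProd h1,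
    Measure.lintegral_compProd hf, lintegral_map h2 hΨ]
  rfl

lemma klDiv_compProd_comap_le [StandardBorelSpace O] [Nonempty O] (L : Measure O)
    [IsProbabilityMeasure L] {Ψ : O → T} (hΨ : Measurable Ψ) (κ η : Kernel T V)
    [IsMarkovKernel κ] [IsMarkovKernel η] :
    InformationTheory.klDiv (L ⊗ₘ κ.comap Ψ hΨ) (L ⊗ₘ η.comap Ψ hΨ)
      ≤ InformationTheory.klDiv (L.map Ψ ⊗ₘ κ) (L.map Ψ ⊗ₘ η) := by
  have := Measure.isProbabilityMeasure_map (μ := L) hΨ.aemeasurable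
  set K := condDistrib id Ψ L
  have hK : L.map Ψ ⊗ₘ K = L.map fun o => (Ψ o, o) := compProd_map_condDistrib (by fun_prop)
  have key : ∀ k : Kernel T V, IsMarkovKernel k →
      ((L.map Ψ ⊗ₘ k) ⊗ₘ K.comap Prod.fst measurable_fst).map (fun p => (p.2, p.1.2))
        = L ⊗ₘ k.comap Ψ hΨ := by
    intro k hk
    rw [← map_swapRight_compProd, hK, Measure.map_map (by fun_prop) swapRight.measurable]
    refine Measure.ext_of_lintegral _ fun f hf => ?_
    have h1 : Measurable fun p : (T × O) × V => f (p.1.2, p.2) := by fun_prop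
    have h2 : Measurable fun q : T × O => ∫⁻ v, f (q.2, v)
        ∂(k.comap Prod.fst measurable_fst q) :=
      Measurable.lintegral_kernel_prod_right' h1
    rw [lintegral_map hf (by fun_prop)]
    change ∫⁻ p : (T × O) × V, f (p.1.2, p.2) ∂_ = _
    rw [Measure.lintegral_compProd h1, lintegral_map h2 (by fun_prop),
      Measure.lintegral_compProd hf]
    rfl
  rw [← key κ inferInstance, ← key η inferInstance]
  refine (InformationTheory.klDiv_map_le _ _ (by fun_prop)).trans ?_
  rw [InformationTheory.klDiv_compProd_left]

end KernelPullback

lemma condMutualInfo_le {Ω α β γ : Type*} [MeasurableSpace Ω]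
    [MeasurableSpace α] [StandardBorelSpace α] [Nonempty α]
    [MeasurableSpace β] [StandardBorelSpace β] [Nonempty β] [MeasurableSpace γ]
    (μ : Measure Ω) [IsProbabilityMeasure μ] {A : Ω → α} {B : Ω → β} {C : Ω → γ}
    (hA : Measurable A) (hB : Measurable B) (hC : Measurable C)
    (η : Kernel γ α) [IsMarkovKernel η] :
    condMutualInfo μ A B C
      ≤ InformationTheory.klDiv (μ.map fun ω => ((C ω, B ω), A ω))
        ((μ.map fun ω => (C ω, B ω)) ⊗ₘ η.comap Prod.fst measurable_fst) := by
  have hm : Measurable fun ω => ((C ω, B ω), A ω) := by fun_prop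
  have := Measure.isProbabilityMeasure_map (μ := μ) hm.aemeasurable
  have h1 : (μ.map fun ω => ((C ω, B ω), A ω)).map (fun q => (q.1.1, q.2))
      = ((μ.map fun ω => ((C ω, B ω), A ω)).map fun q => q.1.1) ⊗ₘ condDistrib A C μ := by
    rw [Measure.map_map (by fun_prop) hm, Measure.map_map (by fun_prop) hm]
    exact (compProd_map_condDistrib hA.aemeasurable).symm
  have h2 := klDiv_compensation _ (condDistrib A C μ) η h1
  rw [Measure.map_map measurable_fst hm] at h2
  rw [condMutualInfo_eq μ hA hB hC]
  exact le_add_self.trans h2.ge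

section Construction

variable {Q N : ℝ≥0} {μ : Measure (ℕ → Letter)} [IsProbabilityMeasure μ]

/-- The side information together with the randomness of the encoder. -/
abbrev Side : Type := (ℕ → Letter) × unitInterval

/-- Side information, source and simulated control input. -/
def simIn (Φ : ℝ × (ℕ → Letter) → unitInterval → ℝ) (a : ℝ × Side) :
    (ℕ → Letter) × (ℝ × ℝ) := (a.2.1, (a.1, Φ (a.1, a.2.1) a.2.2))

lemma LetterLaw.exists_simIn (h : LetterLaw Q N μ) :
    ∃ Φ : ℝ × (ℕ → Letter) → unitInterval → ℝ, Measurable (Function.uncurry Φ) ∧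
      ((gaussianReal 0 Q).prod (μ.prod volume)).map (simIn Φ) = μ ⊗ₘ inKernel μ := by
  have mx : Measurable fun ξ : ℕ → Letter => ((ξ 0).1.1, seqTail (seqTail ξ)) := by fun_prop
  have mu : Measurable fun ξ : ℕ → Letter => (ξ 0).1.2 := by fun_prop
  set k := condDistrib (fun ξ : ℕ → Letter => (ξ 0).1.2)
    (fun ξ => ((ξ 0).1.1, seqTail (seqTail ξ))) μ with hk
  have hxr : μ.map (fun ξ => ((ξ 0).1.1, seqTail (seqTail ξ))) = (gaussianReal 0 Q).prod μ := by
    have e := congrArg (Measure.map (Prod.map seqTail (id : ℝ → ℝ))) h.map_source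
    rw [← Measure.map_prod_map _ _ (by fun_prop) measurable_id, Measure.map_id,
      map_tail_of_exchangeable h.exchangeable, Measure.map_map (by fun_prop) (by fun_prop)] at e
    rw [← Measure.prod_swap, ← e, Measure.map_map measurable_swap (by fun_prop)]
    rfl
  have hjoint : μ.map (fun ξ => (((ξ 0).1.1, seqTail (seqTail ξ)), (ξ 0).1.2))
      = ((gaussianReal 0 Q).prod μ) ⊗ₘ k := by
    rw [← hxr]; exact (compProd_map_condDistrib mu.aemeasurable).symm
  obtain ⟨Φ, hΦ, hmap⟩ := k.exists_measurable_map_eq_unitInterval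
  have ms : Measurable (simIn Φ) := by
    have : Measurable fun a : ℝ × Side => Function.uncurry Φ ((a.1, a.2.1), a.2.2) := by fun_prop
    exact measurable_snd.fst.prodMk (measurable_fst.prodMk this)
  refine ⟨Φ, hΦ, ?_⟩
  have e1 : μ ⊗ₘ inKernel μ = (((gaussianReal 0 Q).prod μ) ⊗ₘ k).map
      (fun q => (q.1.2, (q.1.1, q.2))) := by
    rw [← hjoint, ← h.map_side_in, Measure.map_map (by fun_prop) (by fun_prop)]; rfl
  rw [e1]
  refine Measure.ext_of_lintegral _ fun f hf => ?_
  have h1 : Measurable fun q : (ℝ × (ℕ → Letter)) × ℝ => f (q.1.2, (q.1.1, q.2)) := by fun_prop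
  have h2 : Measurable fun a : ℝ × Side => f (simIn Φ a) := hf.comp ms
  have h3 : Measurable fun q : (ℝ × (ℕ → Letter)) × unitInterval =>
      f (simIn Φ (q.1.1, (q.1.2, q.2))) := h2.comp (by fun_prop)
  have e2 : (gaussianReal 0 Q).prod (μ.prod (volume : Measure unitInterval))
      = (((gaussianReal 0 Q).prod μ).prod volume).map (fun q => (q.1.1, (q.1.2, q.2))) :=
    (Measure.prodAssoc_prod).symm
  rw [lintegral_map hf ms, e2, lintegral_map h2 (by fun_prop),
    lintegral_prod _ h3.aemeasurable, lintegral_map hf (by fun_prop),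
    Measure.lintegral_compProd h1]
  refine lintegral_congr fun a => ?_
  have h4 : Measurable fun u : ℝ => f (a.2, (a.1, u)) := by fun_prop
  have hΦa : Measurable (Φ a) := hΦ.comp measurable_prodMk_left
  rw [← hmap a]
  exact (lintegral_map h4 hΦa).symm

end Construction

section Construction

variable {Q N : ℝ≥0} {μ : Measure (ℕ → Letter)} [IsProbabilityMeasure μ]
  {Φ : ℝ × (ℕ → Letter) → unitInterval → ℝ}

lemma measurable_simIn (hΦ : Measurable (Function.uncurry Φ)) : Measurable (simIn Φ) := by
  have : Measurable fun a : ℝ × Side => Function.uncurry Φ ((a.1, a.2.1), a.2.2) := by fun_prop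
  exact measurable_snd.fst.prodMk (measurable_fst.prodMk this)

/-- The decomposition whose auxiliary variable is the side information together with the
encoder randomness, the decoder being driven by the simulated encoder observation. -/
def simDecomp (Q N : ℝ≥0) (μ : Measure (ℕ → Letter)) [IsProbabilityMeasure μ]
    (hΦ : Measurable (Function.uncurry Φ))
    (κ : Kernel (((ℕ → Letter) × (ℝ × ℝ)) × ℝ) ℝ) [IsMarkovKernel κ] :
    SLDecompFB Q N Side where
  μW := μ.prod volume
  probW := inferInstance
  κ1 := Kernel.deterministic (fun a => (simIn Φ a).2.2) (measurable_simIn hΦ).snd.snd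
  markov1 := inferInstance
  κ2 := κ.comap (Prod.map (simIn Φ) id) ((measurable_simIn hΦ).prodMap measurable_id)
  markov2 := inferInstance

variable (hΦ : Measurable (Function.uncurry Φ))
  (κ : Kernel (((ℕ → Letter) × (ℝ × ℝ)) × ℝ) ℝ) [IsMarkovKernel κ]

lemma inputLaw_simDecomp : (simDecomp Q N μ hΦ κ).inputLaw
    = ((gaussianReal 0 Q).prod (μ.prod volume)).map (fun a => (a, (simIn Φ a).2.2)) :=
  Measure.compProd_deterministic (measurable_simIn hΦ).snd.snd

lemma ae_sU1_simDecomp : ∀ᵐ q ∂(simDecomp Q N μ hΦ κ).measure,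
    SLDecompFB.sU1 q = (simIn Φ (SLDecompFB.sX0 q, SLDecompFB.sW q)).2.2 := by
  set d := simDecomp Q N μ hΦ κ
  have m := (measurable_simIn hΦ).snd.snd
  have e : d.measure.map (fun q => q.1.1) = d.inputLaw := by
    have : d.preLaw.map Prod.fst = d.inputLaw := Measure.fst_prod
    rw [← this, ← d.map_fst_measure, Measure.map_map measurable_fst measurable_fst]; rfl
  have hset : MeasurableSet {p : (ℝ × Side) × ℝ | p.2 = (simIn Φ p.1).2.2} :=
    measurableSet_eq_fun measurable_snd (m.comp measurable_fst)
  have h1 : ∀ᵐ p ∂d.inputLaw, p.2 = (simIn Φ p.1).2.2 := by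
    rw [inputLaw_simDecomp, ae_map_iff (by fun_prop) hset]
    exact ae_of_all _ fun _ => rfl
  rw [← e, ae_map_iff (by fun_prop) hset] at h1
  exact h1

lemma map_obsLaw_simDecomp (h : LetterLaw Q N μ)
    (hsim : ((gaussianReal 0 Q).prod (μ.prod volume)).map (simIn Φ) = μ ⊗ₘ inKernel μ) :
    (simDecomp Q N μ hΦ κ).obsLaw.map (Prod.map (simIn Φ) id) = μ.map ownObs := by
  have ms := measurable_simIn hΦ
  have m1 : Measurable fun a : ℝ × Side => (a, (simIn Φ a).2.2) := by fun_prop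
  have m2 : Measurable (Prod.map (simIn Φ) (id : ℝ → ℝ)) := ms.prodMap measurable_id
  rw [h.map_ownObs, ← hsim, SLDecompFB.obsLaw, SLDecompFB.preLaw, inputLaw_simDecomp]
  have e : ∀ {T : Type} [MeasurableSpace T] (g : ℝ × Side → T) (_ : Measurable g),
      (((gaussianReal 0 Q).prod (μ.prod volume)).map g).prod (gaussianReal 0 N)
        = (((gaussianReal 0 Q).prod (μ.prod volume)).prod (gaussianReal 0 N)).map
            (Prod.map g id) := by
    intro T _ g hg
    rw [← Measure.map_prod_map _ _ hg measurable_id, Measure.map_id]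
  rw [e _ m1, e _ ms, Measure.map_map m2 (by fun_prop), Measure.map_map (by fun_prop)
    (m1.prodMap measurable_id), Measure.map_map (by fun_prop) m2]
  rfl

end Construction

theorem exists_decomposition_of_achievable {Q N : ℝ≥0} (hN : N ≠ 0) {P S : ℝ}
    (hach : achievableFBNC Q N P S) :
    ∃ d : SLDecompFB Q N Side,
      condMutualInfo d.measure SLDecompFB.sU2 SLDecompFB.sX0
          (fun q => (SLDecompFB.sW q, SLDecompFB.sY1 q))
        ≤ mutualInfo d.measure SLDecompFB.sW SLDecompFB.sY1 ∧
      d.realizes P S := by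
  obtain ⟨μ, hμ, h, ⟨hP, hP'⟩, hS, hS'⟩ := exists_letterLaw_eq hN hach
  obtain ⟨Φ, hΦ, hsim⟩ := h.exists_simIn
  obtain ⟨κ, η, hκ, hη, hlaw, hkl⟩ := h.exists_kernel_klDiv_le hN hP
  have ms := measurable_simIn hΦ
  have m2 : Measurable (Prod.map (simIn Φ) (id : ℝ → ℝ)) := ms.prodMap measurable_id
  have hT := map_obsLaw_simDecomp (N := N) hΦ κ h hsim
  have hu := ae_sU1_simDecomp (Q := Q) (N := N) (μ := μ) hΦ κ
  have hd2 : (simDecomp Q N μ hΦ κ).κ2 = κ.comap (Prod.map (simIn Φ) id) m2 := rfl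
  have hdW : (simDecomp Q N μ hΦ κ).μW = μ.prod volume := rfl
  set d := simDecomp Q N μ hΦ κ
  have mo : Measurable (ownObs) := by fun_prop
  have hjoint : d.measure.map
      (fun q => (Prod.map (simIn Φ) id (SLDecompFB.obsMap q.1), q.2))
      = μ.map (fun ξ => (ownObs ξ, (ξ 0).2.2)) := by
    rw [hlaw, ← hT, ← map_compProd_comap _ m2, ← hd2, ← d.map_obs_measure,
      Measure.map_map (by fun_prop) (by fun_prop)]
    rfl
  have mj : Measurable (fun q : SLDecompFB.Space Side =>
      (Prod.map (simIn Φ) id (SLDecompFB.obsMap q.1), q.2)) := by fun_prop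
  have mξ : Measurable (fun ξ : ℕ → Letter => (ownObs ξ, (ξ 0).2.2)) := by fun_prop
  refine ⟨d, ?_, ?_⟩
  · have mr : Measurable fun o : (Side × ℝ) × ℝ => (simIn Φ (o.2, o.1.1), o.1.2) := by fun_prop
    have me : Measurable fun p : (ℝ × Side) × ℝ => ((p.1.2, p.2), p.1.1) := by fun_prop
    have hA : d.measure.map (fun q => ((SLDecompFB.sW q, SLDecompFB.sY1 q), SLDecompFB.sX0 q))
        = d.obsLaw.map fun p => ((p.1.2, p.2), p.1.1) := by
      rw [← d.map_obs, Measure.map_map me (by fun_prop)]; rfl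
    have hB : d.measure.map (fun q =>
          (((SLDecompFB.sW q, SLDecompFB.sY1 q), SLDecompFB.sX0 q), SLDecompFB.sU2 q))
        = (d.obsLaw.map fun p => ((p.1.2, p.2), p.1.1)) ⊗ₘ κ.comap _ mr := by
      rw [← map_compProd_comap _ me]
      change _ = (d.obsLaw ⊗ₘ d.κ2).map _
      rw [← d.map_obs_measure, Measure.map_map (by fun_prop) (by fun_prop)]
      rfl
    have hL : (d.obsLaw.map fun p => ((p.1.2, p.2), p.1.1)).map
        (fun o => (simIn Φ (o.2, o.1.1), o.1.2)) = μ.map ownObs := by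
      rw [← hT, Measure.map_map mr me]; rfl
    have mη : Measurable fun p : Side × ℝ => (p.1.1, p.2) := by fun_prop
    have := Measure.isProbabilityMeasure_map (μ := d.obsLaw) me.aemeasurable
    refine (condMutualInfo_le d.measure (by fun_prop) (by fun_prop) (by fun_prop)
      (η.comap _ mη)).trans ?_
    rw [hA, hB]
    change InformationTheory.klDiv _ (_ ⊗ₘ (η.comap dropIn measurable_dropIn).comap _ mr) ≤ _
    have : StandardBorelSpace unitInterval := measurableSet_Icc.standardBorel
    have : StandardBorelSpace (ℕ → Letter) := inferInstance
    have : StandardBorelSpace Side := inferInstance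
    have : StandardBorelSpace ((Side × ℝ) × ℝ) := inferInstance
    refine (klDiv_compProd_comap_le _ mr κ (η.comap dropIn measurable_dropIn)).trans ?_
    rw [hL]
    refine hkl.trans ?_
    rw [d.mutualInfo_eq, hdW]
    have mp : Measurable (Prod.map Prod.fst id : Side × ℝ → (ℕ → Letter) × ℝ) := by fun_prop
    have hY : d.obsLaw.map Prod.snd = μ.map (fun ξ => (ξ 0).out) := by
      have e := congrArg (Measure.map Prod.snd) hT
      rw [Measure.map_map measurable_snd m2, Measure.map_map measurable_snd mo] at e
      exact e
    have hWY : d.auxLaw.map (Prod.map Prod.fst id)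
        = μ.map (fun ξ => (seqTail (seqTail ξ), (ξ 0).out)) := by
      have e := congrArg (Measure.map (fun q => (q.1.1, q.2))) hT
      rw [Measure.map_map (by fun_prop) m2, Measure.map_map (by fun_prop) mo] at e
      rw [SLDecompFB.auxLaw, Measure.map_map mp (by fun_prop)]
      exact e
    have hprod : ((μ.prod (volume : Measure unitInterval)).prod d.outLaw).map
        (Prod.map Prod.fst id) = μ.prod (μ.map (fun ξ => (ξ 0).out)) := by
      have e : (μ.prod (volume : Measure unitInterval)).map Prod.fst = μ := Measure.fst_prod
      rw [← Measure.map_prod_map _ _ measurable_fst measurable_id, Measure.map_id, e,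
        SLDecompFB.outLaw, hY]
    rw [← hWY, ← hprod]
    exact InformationTheory.klDiv_map_le _ _ mp
  · have transfer : ∀ (F : ((((ℕ → Letter) × (ℝ × ℝ)) × ℝ) × ℝ) → ℝ), Measurable F →
        ∀ G : SLDecompFB.Space Side → ℝ, (∀ᵐ q ∂d.measure,
          G q = F (Prod.map (simIn Φ) id (SLDecompFB.obsMap q.1), q.2)) →
        (Integrable (fun ξ => F (ownObs ξ, (ξ 0).2.2)) μ → Integrable G d.measure) ∧
          ∫ q, G q ∂d.measure = ∫ ξ, F (ownObs ξ, (ξ 0).2.2) ∂μ := by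
      intro F hF G hG
      constructor
      · intro hi
        refine Integrable.congr ?_ (hG.mono fun _ hq => hq.symm)
        have hi' : Integrable F (μ.map fun ξ => (ownObs ξ, (ξ 0).2.2)) :=
          (integrable_map_measure hF.aestronglyMeasurable mξ.aemeasurable).2 hi
        rw [← hjoint] at hi'
        exact (integrable_map_measure hF.aestronglyMeasurable mj.aemeasurable).1 hi'
      · rw [integral_congr_ae hG, ← integral_map mξ.aemeasurable hF.aestronglyMeasurable,
          ← hjoint, integral_map mj.aemeasurable hF.aestronglyMeasurable]
    have t1 := transfer (fun q => q.1.1.2.2 ^ 2) (by fun_prop) (fun q => (SLDecompFB.sU1 q) ^ 2)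
      (hu.mono fun q hq => by simp only [hq]; rfl)
    have t2 := transfer (fun q => (q.1.1.2.1 + q.1.1.2.2 - q.2) ^ 2) (by fun_prop)
      (fun q => (SLDecompFB.sX1 q - SLDecompFB.sU2 q) ^ 2)
      (hu.mono fun q hq => by simp only [SLDecompFB.sX1, hq]; rfl)
    exact ⟨t1.1 hP, t2.1 hS, (t1.2.trans hP').symm, (t2.2.trans hS').symm⟩

/-- **Theorem 3** (causal encoding and noncausal decoding with channel feedback): the pair of
Witsenhausen costs `(P, S)` is achievable if and only if there exists a joint distribution
of `(X₀, W₁, U₁, X₁, Y₁, U₂)` decomposing according to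
`P_{X₀} P_{W₁} P_{U₁|X₀,W₁} P_{X₁,Y₁|X₀,U₁} P_{U₂|X₀,W₁,Y₁}` such that the information
constraint `I(W₁; Y₁) - I(U₂; X₀ | W₁, Y₁) ≥ 0` holds, `P = E[U₁²]` and
`S = E[(X₁ - U₂)²]`. -/
theorem achievable_iff_exists_decomposition_fb_noncausal
    (Q N : ℝ≥0) (hQ : 0 < Q) (hN : 0 < N) (P S : ℝ) :
    achievableFBNC Q N P S ↔
      ∃ (W : Type) (mW : MeasurableSpace W) (d : SLDecompFB Q N W),
        condMutualInfo d.measure SLDecompFB.sU2 SLDecompFB.sX0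
            (fun q => (SLDecompFB.sW q, SLDecompFB.sY1 q))
          ≤ mutualInfo d.measure SLDecompFB.sW SLDecompFB.sY1 ∧
        d.realizes P S := by
  refine ⟨fun h => ⟨Side, inferInstance, exists_decomposition_of_achievable hN.ne' h⟩, ?_⟩
  rintro ⟨W, mW, d, hI, hd⟩
  exact d.achievable_of_realizes hN hd hI

end

end Witsenhausen
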